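/- Let n ≥ 2, p > 1, and let Ω ⊂ ℝⁿ be a strongly convex bounded open set with boundary of class C². Then for every δ > 0 there exist ε₀ > 0, C > 0 and β ∈ (0,1), all independent of ε, such that for every ε ∈ (0, ε₀) and every normalized minimizer u_ε of the ε-regularized problem: u_ε is C^∞ on Ω_δ, and on cl(Ω_{2δ}) one has sup |u_ε| + sup ‖∇u_ε‖ ≤ C together with ‖∇u_ε(x) − ∇u_ε(y)‖ ≤ C ‖x − y‖^β for all x, y ∈ cl(Ω_{2δ}). -/

import Mathlib

open MeasureTheory Real Set Metric Bornology
open scoped RealInnerProductSpace Pointwise NNReal Topology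

noncomputable def gaussianMeasure (n : ℕ) : Measure (EuclideanSpace ℝ (Fin n)) :=
  (volume : Measure (EuclideanSpace ℝ (Fin n))).withDensity
    (fun x => ENNReal.ofReal ((2 * π) ^ (-(n : ℝ) / 2) * Real.exp (-‖x‖ ^ 2 / 2)))

/-- `φ` is a smooth compactly supported test function on `Ω`. -/
def IsTestFun (n : ℕ) (Ω : Set (EuclideanSpace ℝ (Fin n)))
    (φ : EuclideanSpace ℝ (Fin n) → ℝ) : Prop :=
  ContDiff ℝ (⊤ : ℕ∞) φ ∧ HasCompactSupport φ ∧ tsupport φ ⊆ Ω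

/-- The first eigenvalue of the Gaussian-weighted `p`-Laplacian on `Ω`. -/
noncomputable def lambdaPGamma (n : ℕ) (p : ℝ) (Ω : Set (EuclideanSpace ℝ (Fin n))) : ℝ :=
  sInf { r : ℝ | ∃ v : EuclideanSpace ℝ (Fin n) → ℝ, IsTestFun n Ω v ∧ v ≠ 0 ∧
    r = (∫ x in Ω, ‖gradient v x‖ ^ p ∂(gaussianMeasure n)) /
        (∫ x in Ω, |v x| ^ p ∂(gaussianMeasure n)) }

/-- `Ω` has boundary of class `C²`. -/
def HasC2Boundary (n : ℕ) (Ω : Set (EuclideanSpace ℝ (Fin n))) : Prop :=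
  ∀ x ∈ frontier Ω, ∃ (U : Set (EuclideanSpace ℝ (Fin n))) (f : EuclideanSpace ℝ (Fin n) → ℝ),
    IsOpen U ∧ x ∈ U ∧ ContDiff ℝ 2 f ∧ (∀ y ∈ U, (y ∈ Ω ↔ f y < 0)) ∧
    (∀ y ∈ U, y ∈ frontier Ω → fderiv ℝ f y ≠ 0)

/-- The regularized functional `J_ε(v) = ∫_Ω (ε v² + ‖∇v‖²)^{p/2} dγ`. -/
noncomputable def Jeps (n : ℕ) (p ε : ℝ) (Ω : Set (EuclideanSpace ℝ (Fin n)))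
    (v : EuclideanSpace ℝ (Fin n) → ℝ) : ℝ :=
  ∫ x in Ω, (ε * v x ^ 2 + ‖gradient v x‖ ^ 2) ^ (p / 2) ∂(gaussianMeasure n)

/-- The infimum of the regularized functional over normalized test functions. -/
noncomputable def lambdaEps (n : ℕ) (p ε : ℝ) (Ω : Set (EuclideanSpace ℝ (Fin n))) : ℝ :=
  sInf { r : ℝ | ∃ v : EuclideanSpace ℝ (Fin n) → ℝ, IsTestFun n Ω v ∧
    (∫ x in Ω, |v x| ^ p ∂(gaussianMeasure n)) = 1 ∧ r = Jeps n p ε Ω v }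

/-- A normalized minimizer of the `ε`-regularized problem. -/
def IsNormalizedMinimizer (n : ℕ) (p ε : ℝ) (Ω : Set (EuclideanSpace ℝ (Fin n)))
    (uε : EuclideanSpace ℝ (Fin n) → ℝ) : Prop :=
  ContinuousOn uε (closure Ω) ∧ ContDiffOn ℝ 1 uε Ω ∧
  (∀ x ∈ closure Ω, 0 ≤ uε x) ∧ (∀ x ∈ frontier Ω, uε x = 0) ∧
  (∫ x in Ω, uε x ^ p ∂(gaussianMeasure n)) = 1 ∧
  Jeps n p ε Ω uε = lambdaEps n p ε Ω

set_option linter.unusedSectionVars false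
set_option linter.unusedSimpArgs false

alias mll := mul_le_mul_of_nonneg_left
alias mlr := mul_le_mul_of_nonneg_right
alias sie := setIntegral_eq_integral_of_forall_compl_eq_zero
alias cpi := continuous_parametric_integral_of_continuous
alias eof := Filter.Eventually.of_forall
alias hcsub := HasCompactSupport.of_support_subset_isCompact
alias ime := image_eq_zero_of_notMem_tsupport
alias riq := real_inner_self_eq_norm_sq
alias nnn := Real.norm_of_nonneg
alias icb := isCompact_closedBall
alias bscb := ball_subset_closedBall
alias icm := integral_const_mul
alias hgfd := hasGradientAt_iff_hasFDerivAt
alias mrau := measureReal_restrict_apply_univ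
alias mcz := mem_closedBall_zero_iff
alias mlo := mul_le_of_le_one_left
alias ascl := add_sub_cancel_left
alias cbsb := closedBall_subset_ball
alias cdsucc := contDiffOn_succ_iff_fderiv_of_isOpen
alias smar := self_mem_ae_restrict
alias nmt := notMem_tsupport_iff_eventuallyEq
alias inm := indicator_of_notMem
alias lop := ContinuousLinearMap.le_opNorm
alias tpz := tendsto_pow_atTop_nhds_zero_of_lt_one
alias iisub := intervalIntegral.integral_eq_sub_of_hasDerivAt
alias smo := setIntegral_mono_on
alias nsl := norm_sub_le_norm_sub_add_norm_sub
alias bsb := ball_subset_ball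
alias isml := inner_smul_left
alias nea := Real.norm_eq_abs
alias den := dist_eq_norm
alias cbcb := closedBall_subset_closedBall
alias mb_ := measurableSet_ball
alias nwn := nhdsWithin_le_nhds
alias scf := setIntegral_congr_fun
alias cjr := RCLike.conj_to_real
alias ail := abs_real_inner_le_norm
notation "pz" => (by positivity)
notation "lz" => (by linarith)
notation "fz" => (by fun_prop)
notation "sz" => (by simp)
notation "nz" => (by norm_num)
notation "hlf" => (1 / 2 : ℝ)
notation "fd" => fderiv ℝ
notation "nnz" => (norm_nonneg _)
alias Continuous.ics := Continuous.integrable_of_hasCompactSupport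
notation "tD" => InnerProductSpace.toDual ℝ

theorem posPow_hasDerivAt (k : ℕ) (s : ℝ) :
    HasDerivAt (fun s : ℝ => (max s 0) ^ (k + 2)) ((k + 2) * (max s 0) ^ (k + 1)) s := by
  rcases lt_trichotomy s 0 with h | h | h
  · have : (fun s : ℝ => (max s 0) ^ (k + 2)) =ᶠ[𝓝 s] fun _ => 0 := by
      filter_upwards [gt_mem_nhds h] with t ht
      rw [max_eq_right (le_of_lt ht)]; simp
    rw [max_eq_right h.le]
    simpa using (hasDerivAt_const s (0 : ℝ)).congr_of_eventuallyEq this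
  · subst h
    simp only [max_self, ne_eq, Nat.add_eq_zero_iff, one_ne_zero, and_false, not_false_eq_true, zero_pow, mul_zero]
    rw [hasDerivAt_iff_isLittleO_nhds_zero]
    simp only [zero_add, max_self, ne_eq, Nat.add_eq_zero_iff, OfNat.ofNat_ne_zero, and_false, not_false_eq_true, zero_pow, sub_zero, smul_zero]
    have h1 : (fun h : ℝ => (max h 0) ^ (k + 2)) =O[𝓝 0] fun h : ℝ => h ^ (k + 2) := by
      apply Asymptotics.IsBigO.of_bound 1
      filter_upwards with h
      rw [one_mul, norm_pow, norm_pow]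
      apply pow_le_pow_left₀ nnz
      rw [nea, nea, abs_of_nonneg (le_max_right _ _)]
      exact max_le (le_abs_self _) (abs_nonneg _)
    refine h1.trans_isLittleO ?_
    simpa using Asymptotics.isLittleO_pow_id (𝕜 := ℝ) (n := k + 2) (by omega)
  · have : (fun s : ℝ => (max s 0) ^ (k + 2)) =ᶠ[𝓝 s] fun s => s ^ (k + 2) := by
      filter_upwards [lt_mem_nhds h] with t ht
      rw [max_eq_left (le_of_lt ht)]
    rw [max_eq_left h.le]
    simpa using (hasDerivAt_pow (k + 2) s).congr_of_eventuallyEq this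

theorem posPow_contDiff (k : ℕ) : ContDiff ℝ 1 (fun s : ℝ => (max s 0) ^ (k + 2)) := by
  rw [contDiff_one_iff_deriv]
  refine ⟨fun s => (posPow_hasDerivAt k s).differentiableAt, ?_⟩
  rw [show deriv (fun s : ℝ => (max s 0) ^ (k + 2)) = fun s : ℝ => ((k : ℝ) + 2) * (max s 0) ^ (k + 1) from
    funext fun s => (posPow_hasDerivAt k s).deriv]
  fun_prop

theorem sq_integral_le {α : Type*} [MeasurableSpace α] {μ : Measure α} [IsFiniteMeasure μ] {f : α → ℝ}
    (hf : Integrable f μ) (hf2 : Integrable (fun x => f x ^ 2) μ) :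
    (∫ x, f x ∂μ) ^ 2 ≤ μ.real univ * ∫ x, f x ^ 2 ∂μ := by
  have key : ∀ t : ℝ, 0 ≤ (∫ x, f x ^ 2 ∂μ) - 2 * t * (∫ x, f x ∂μ) + t ^ 2 * μ.real univ := by
    intro t
    have h0 : 0 ≤ ∫ x, (f x - t) ^ 2 ∂μ := integral_nonneg fun x => sq_nonneg _
    have : ∫ x, (f x - t) ^ 2 ∂μ = (∫ x, f x ^ 2 ∂μ) - 2 * t * (∫ x, f x ∂μ) + t ^ 2 * μ.real univ := by
      have e : ∀ x, (f x - t) ^ 2 = f x ^ 2 - 2 * t * f x + t ^ 2 := fun x => by ring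
      simp_rw [e]
      have i1 : Integrable (fun x => 2 * t * f x) μ := hf.const_mul _
      have i2 : Integrable (fun x => f x ^ 2 - 2 * t * f x) μ := hf2.sub i1
      rw [integral_add i2 (integrable_const _), integral_sub hf2 i1, icm, integral_const]
      simp [mul_comm]
    linarith
  set I := ∫ x, f x ∂μ
  set M := μ.real univ
  have hM : 0 ≤ M := measureReal_nonneg
  rcases hM.eq_or_lt with h | h
  · have hμ : μ = 0 := by
      rw [← Measure.measure_univ_eq_zero]
      exact (measureReal_eq_zero_iff (measure_ne_top _ _)).1 h.symm
    have : I = 0 := by simp [I, hμ]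
    rw [this, ← h]; simp
  · have := key (I / M)
    have e : I / M * M = I := div_mul_cancel₀ _ h.ne'
    have h2 : 0 ≤ M * ((∫ x, f x ^ 2 ∂μ) - 2 * (I / M) * I + (I / M) ^ 2 * M) := mul_nonneg h.le this
    have : M * ((∫ x, f x ^ 2 ∂μ) - 2 * (I / M) * I + (I / M) ^ 2 * M) = M * (∫ x, f x ^ 2 ∂μ) - I ^ 2 := by
      have : M ≠ 0 := h.ne'
      field_simp; ring
    linarith

section
variable {E : Type} [NormedAddCommGroup E] [InnerProductSpace ℝ E] [FiniteDimensional ℝ E]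
  [MeasurableSpace E] [BorelSpace E]

/-- weak equation: div V + g = 0 tested with C¹ functions. -/
def Weak (U : Set E) (V : E → E) (g : E → ℝ) : Prop :=
  ∀ φ : E → ℝ, ContDiff ℝ 1 φ → HasCompactSupport φ → tsupport φ ⊆ U →
    ∫ x, fd φ x (V x) = ∫ x, g x * φ x

/-- symmetric coercive operator. -/
def SPD (S : E →L[ℝ] E) : Prop :=
  (∀ x y, ⟪S x, y⟫ = ⟪x, S y⟫) ∧ ∃ c : ℝ, 0 < c ∧ ∀ x, c * ‖x‖ ^ 2 ≤ ⟪S x, x⟫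

theorem SPD.inv {S : E →L[ℝ] E} (hS : SPD S) : ∃ Si : E →L[ℝ] E, (∀ y, S (Si y) = y) ∧
    ∃ c : ℝ, 0 < c ∧ ∀ y, c * ‖y‖ ^ 2 ≤ ⟪Si y, y⟫ := by
  obtain ⟨hs, c, hc, hco⟩ := hS
  have inj : Function.Injective S.toLinearMap := by
    rw [injective_iff_map_eq_zero]
    intro x hx
    have h1 := hco x
    have h2 : S x = 0 := hx
    rw [h2, inner_zero_left] at h1
    have : ‖x‖ ^ 2 ≤ 0 := by nlinarith [sq_nonneg ‖x‖]
    have : ‖x‖ = 0 := by nlinarith [norm_nonneg x]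
    exact norm_eq_zero.1 this
  let e := LinearEquiv.ofInjectiveEndo S.toLinearMap inj
  have he : ∀ x, e x = S x := fun x => by simp [e]
  refine ⟨LinearMap.toContinuousLinearMap e.symm.toLinearMap, fun y => ?_, ?_⟩
  · rw [← he]; simp
  have hSi : ∀ y, S (LinearMap.toContinuousLinearMap e.symm.toLinearMap y) = y := by
    intro y; rw [← he]; simp
  set Si := LinearMap.toContinuousLinearMap e.symm.toLinearMap
  refine ⟨c / (‖S‖ + 1) ^ 2, pz, fun y => ?_⟩
  have h1 := hco (Si y)
  rw [hSi, real_inner_comm] at h1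
  have h2 : ‖y‖ ≤ (‖S‖ + 1) * ‖Si y‖ := by
    calc ‖y‖ = ‖S (Si y)‖ := by rw [hSi]
      _ ≤ ‖S‖ * ‖Si y‖ := S.le_opNorm _
      _ ≤ _ := by gcongr; linarith
  have h3 : ‖y‖ ^ 2 ≤ (‖S‖ + 1) ^ 2 * ‖Si y‖ ^ 2 := by
    rw [← mul_pow]; gcongr
  calc c / (‖S‖ + 1) ^ 2 * ‖y‖ ^ 2 ≤ c / (‖S‖ + 1) ^ 2 * ((‖S‖ + 1) ^ 2 * ‖Si y‖ ^ 2) := by gcongr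
    _ = c * ‖Si y‖ ^ 2 := by field_simp
    _ ≤ _ := h1

theorem exists_kernel {S : E →L[ℝ] E} (hS : SPD S) : ∃ Ψ ρ : E → ℝ, ContDiff ℝ 1 Ψ ∧ ContDiff ℝ 1 ρ ∧
    (∀ y, Ψ y ≠ 0 → ‖y‖ ≤ 1 / 2) ∧ (∀ y, ρ y ≠ 0 → ‖y‖ ≤ 1 / 2) ∧ (∀ y, 0 ≤ ρ y) ∧ ∫ y, ρ y = 1 ∧
    ∀ y η, fd Ψ y (S η) = - ρ y * ⟪y, η⟫ := by
  obtain ⟨Si, hSi, c, hc, hco⟩ := hS.inv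
  obtain ⟨hs, -⟩ := hS
  have hsym : ∀ x y, ⟪Si x, y⟫ = ⟪x, Si y⟫ := by
    intro x y
    conv_lhs => rw [← hSi y]
    rw [← hs, hSi]
  let q : E → ℝ := fun y => c / 4 - ⟪Si y, y⟫
  have hq : ContDiff ℝ 1 q := by
    apply contDiff_const.sub
    exact (Si.contDiff).inner ℝ contDiff_id
  have hqd : ∀ y, HasFDerivAt q (-(2 : ℝ) • (innerSL ℝ (Si y))) y := by
    intro y
    have := (Si.hasFDerivAt (x := y)).inner ℝ (hasFDerivAt_id y)
    have := (hasFDerivAt_const (c / 4) y).sub this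
    refine HasFDerivAt.congr_fderiv (f' := _) this ?_
    refine ContinuousLinearMap.ext fun η => ?_
    have e1 := hsym η y
    have e2 := real_inner_comm (Si y) η
    simp at *
    linarith
  have hsupp : ∀ y, max (q y) 0 ≠ 0 → ‖y‖ ≤ 1 / 2 := by
    intro y hy
    by_contra hcon
    push Not at hcon
    apply hy
    apply max_eq_right
    have := hco y
    have h2 : hlf ^ 2 ≤ ‖y‖ ^ 2 := by gcongr
    simp only [q]
    nlinarith
  let I : ℝ := ∫ y, 6 * (max (q y) 0) ^ 2
  have hρc : Continuous fun y => 6 * (max (q y) 0) ^ 2 := by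
    have := hq.continuous
    fun_prop
  have hI : 0 < I := by
    have hcs : HasCompactSupport fun y => 6 * (max (q y) 0) ^ 2 := by
      apply hcsub (icb (0 : E) (1 / 2))
      intro y hy
      rw [mcz]
      apply hsupp
      intro h
      apply hy
      simp [h]
    apply hρc.integral_pos_of_hasCompactSupport_nonneg_nonzero (x := 0) hcs
    · intro y; positivity
    · simp only [q]
      simp [max_eq_left (show (0 : ℝ) ≤ c / 4 by positivity)]
      exact hc.ne'
  refine ⟨fun y => I⁻¹ * (max (q y) 0) ^ 3, fun y => I⁻¹ * (6 * (max (q y) 0) ^ 2),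
    contDiff_const.mul ((posPow_contDiff 1).comp hq), contDiff_const.mul (contDiff_const.mul ((posPow_contDiff 0).comp hq)),
    fun y hy => hsupp y fun h => hy (by simp [h]), fun y hy => hsupp y fun h => hy (by simp [h]),
    fun y => pz, ?_, ?_⟩
  · rw [icm]; exact inv_mul_cancel₀ hI.ne'
  · intro y η
    have h1 := ((posPow_hasDerivAt 1 (q y)).comp_hasFDerivAt y (hqd y)).const_mul I⁻¹
    have h2 : HasFDerivAt (fun y => I⁻¹ * (max (q y) 0) ^ 3) _ y := h1
    rw [h2.fderiv]
    simp
    rw [← hs, hSi]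
    ring

theorem grad_fderiv {z : E → ℝ} {Z x : E} (h : HasGradientAt z Z x) (ξ : E) : fd z x ξ = ⟪Z, ξ⟫ := by
  rw [h.hasFDerivAt.fderiv]; simp

theorem contDiff_of_grad {z : E → ℝ} {Z : E → E} (h : ∀ x, HasGradientAt z (Z x) x) (hZ : Continuous Z) :
    ContDiff ℝ 1 z := by
  rw [contDiff_one_iff_fderiv]
  refine ⟨fun x => (h x).differentiableAt, ?_⟩
  rw [show fd z = fun x => tD E (Z x) from funext fun x => (h x).hasFDerivAt.fderiv]
  exact (tD E).continuous.comp hZ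

theorem continuous_fderiv_ap {φ : E → ℝ} {V : E → E} (hφ : ContDiff ℝ 1 φ) (hV : Continuous V) :
    Continuous fun x => fd φ x (V x) :=
  (hφ.continuous_fderiv sz).clm_apply hV

theorem hcs_fderiv_ap {φ : E → ℝ} (V : E → E) (hφ : HasCompactSupport φ) :
    HasCompactSupport fun x => fd φ x (V x) := by
  refine (hφ.fderiv (𝕜 := ℝ)).mono ?_
  intro x hx h
  apply hx
  simp [h]

theorem integral_fderiv_const {φ : E → ℝ} (hφ : ContDiff ℝ 1 φ) (hc : HasCompactSupport φ) (v : E) :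
    ∫ x, fd φ x v = 0 := by
  have := integral_mul_fderiv_eq_neg_fderiv_mul_of_integrable (μ := (volume : Measure E)) (f := fun _ => (1 : ℝ)) (g := φ) (v := v)
    sz (by simpa using (continuous_fderiv_ap hφ continuous_const).ics (hcs_fderiv_ap (fun _ => v) hc))
    (by simpa using hφ.continuous.ics hc)
    (fun x _ => fz) (fun x _ => hφ.differentiable sz x)
  simpa using this

theorem caccioppoli {S : E →L[ℝ] E} (hS : SPD S) : ∃ C : ℝ, 0 < C ∧ ∀ (U : Set E) (z : E → ℝ) (Z H : E → E) (g ζ : E → ℝ),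
    (∀ x, HasGradientAt z (Z x) x) → Continuous Z → Continuous H → Continuous g → ContDiff ℝ 1 ζ →
    HasCompactSupport ζ → tsupport ζ ⊆ U → Weak U (fun x => S (Z x) - H x) g →
    ∫ x, ζ x ^ 2 * ‖Z x‖ ^ 2 ≤ C * ∫ x, (‖fd ζ x‖ ^ 2 * z x ^ 2 + ζ x ^ 2 * ‖H x‖ ^ 2 + |g x| * ζ x ^ 2 * |z x|) := by
  obtain ⟨hs, c, hc, hco⟩ := hS
  set L := ‖S‖
  have hL : 0 ≤ L := norm_nonneg _
  let A : ℝ := 2 / c + 8 / c * L ^ 2 + 1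
  refine ⟨2 / c * A, pz, ?_⟩
  intro U z Z H g ζ hz hZ hH hg hζ hζc hζU hw
  have hzC := contDiff_of_grad hz hZ
  have zc := hzC.continuous
  have ζc := hζ.continuous
  have hφ : ContDiff ℝ 1 (fun x => ζ x ^ 2 * z x) := (hζ.pow 2).mul hzC
  have hsub : Function.support (fun x => ζ x ^ 2 * z x) ⊆ Function.support ζ := by
    intro x hx h
    apply hx
    simp [h]
  have hφc : HasCompactSupport (fun x => ζ x ^ 2 * z x) := hζc.mono hsub
  have := hw _ hφ hφc ((closure_mono hsub).trans hζU)
  have hD : ∀ x ξ, fd (fun x => ζ x ^ 2 * z x) x ξ = 2 * ζ x * z x * fd ζ x ξ + ζ x ^ 2 * ⟪Z x, ξ⟫ := by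
    intro x ξ
    have h1 := ((hζ.differentiable sz x).hasFDerivAt.pow 2).mul (hz x).hasFDerivAt
    have h2 : HasFDerivAt (fun x => ζ x ^ 2 * z x) _ x := h1
    rw [h2.fderiv]
    simp
    ring
  have hint1 : Integrable fun x => fd (fun x => ζ x ^ 2 * z x) x (S (Z x) - H x) :=
    (continuous_fderiv_ap hφ fz).ics (hcs_fderiv_ap _ hφc)
  have hint2 : Integrable fun x => g x * (ζ x ^ 2 * z x) :=
    (by fun_prop : Continuous fun x => g x * (ζ x ^ 2 * z x)).ics hφc.mul_left
  have hcsζ : ∀ f : E → ℝ, HasCompactSupport fun x => ζ x ^ 2 * f x := by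
    intro f
    refine hζc.mono fun x hx h => hx (by simp [h])
  have hint3 : Integrable fun x => ζ x ^ 2 * ‖Z x‖ ^ 2 :=
    (by fun_prop : Continuous fun x => ζ x ^ 2 * ‖Z x‖ ^ 2).ics (hcsζ _)
  have hfc : Continuous (fd ζ) := hζ.continuous_fderiv sz
  have hint4 : Integrable fun x => (‖fd ζ x‖ ^ 2 * z x ^ 2 + ζ x ^ 2 * ‖H x‖ ^ 2 + |g x| * ζ x ^ 2 * |z x|) := by
    refine Continuous.ics fz ?_
    refine hcsub hζc (fun x hx => ?_)
    by_contra hcon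
    apply hx
    have h0 : ζ x = 0 := ime hcon
    have h1 : fd ζ x = 0 := by
      by_contra h
      exact hcon (support_fderiv_subset ℝ h)
    simp [h0, h1]
  have hpt : ∀ x, c / 2 * (ζ x ^ 2 * ‖Z x‖ ^ 2) ≤ (fd (fun x => ζ x ^ 2 * z x) x (S (Z x) - H x) - g x * (ζ x ^ 2 * z x))
      + A * (‖fd ζ x‖ ^ 2 * z x ^ 2 + ζ x ^ 2 * ‖H x‖ ^ 2 + |g x| * ζ x ^ 2 * |z x|) := by
    intro x
    rw [hD]
    simp only [map_sub, inner_sub_right]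
    set d := fd ζ x
    have a1 : c * ‖Z x‖ ^ 2 ≤ ⟪Z x, S (Z x)⟫ := by rw [← hs]; exact hco _
    have a2 : ⟪Z x, H x⟫ ≤ ‖Z x‖ * ‖H x‖ := real_inner_le_norm _ _
    have a3 : |d (S (Z x))| ≤ ‖d‖ * (L * ‖Z x‖) := by
      refine (d.le_opNorm _).trans ?_
      gcongr
      exact S.le_opNorm _
    have a4 : |d (H x)| ≤ ‖d‖ * ‖H x‖ := d.le_opNorm _
    have b2 : ⟪Z x, H x⟫ ≤ c / 4 * ‖Z x‖ ^ 2 + 1 / c * ‖H x‖ ^ 2 := by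
      have : 0 ≤ (c / 2 * ‖Z x‖ - ‖H x‖) ^ 2 / c := pz
      have e : (c / 2 * ‖Z x‖ - ‖H x‖) ^ 2 / c = c / 4 * ‖Z x‖ ^ 2 - ‖Z x‖ * ‖H x‖ + 1 / c * ‖H x‖ ^ 2 := by
        field_simp; ring
      linarith
    have b3 : -(2 * ζ x * z x * d (S (Z x))) ≤ c / 4 * (ζ x ^ 2 * ‖Z x‖ ^ 2) + 4 / c * L ^ 2 * (‖d‖ ^ 2 * z x ^ 2) := by
      have h1 : -(2 * ζ x * z x * d (S (Z x))) ≤ 2 * |ζ x| * |z x| * (‖d‖ * (L * ‖Z x‖)) := by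
        refine (neg_le_abs _).trans ?_
        rw [abs_mul, abs_mul, abs_mul, abs_two]
        gcongr
      have : 0 ≤ (c / 2 * (|ζ x| * ‖Z x‖) - 2 * (|z x| * ‖d‖ * L)) ^ 2 / c := pz
      have e : (c / 2 * (|ζ x| * ‖Z x‖) - 2 * (|z x| * ‖d‖ * L)) ^ 2 / c = c / 4 * (|ζ x| ^ 2 * ‖Z x‖ ^ 2) - 2 * |ζ x| * |z x| * (‖d‖ * (L * ‖Z x‖)) + 4 / c * L ^ 2 * (‖d‖ ^ 2 * |z x| ^ 2) := by
        field_simp; ring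
      rw [sq_abs, sq_abs] at e
      linarith
    have b4 : (2 * ζ x * z x * d (H x)) ≤ ‖d‖ ^ 2 * z x ^ 2 + ζ x ^ 2 * ‖H x‖ ^ 2 := by
      have h1 : (2 * ζ x * z x * d (H x)) ≤ 2 * |ζ x| * |z x| * (‖d‖ * ‖H x‖) := by
        refine (le_abs_self _).trans ?_
        rw [abs_mul, abs_mul, abs_mul, abs_two]
        gcongr
      have := sq_nonneg (‖d‖ * |z x| - |ζ x| * ‖H x‖)
      have e : (‖d‖ * |z x| - |ζ x| * ‖H x‖) ^ 2 = ‖d‖ ^ 2 * |z x| ^ 2 - 2 * |ζ x| * |z x| * (‖d‖ * ‖H x‖) + |ζ x| ^ 2 * ‖H x‖ ^ 2 := by ring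
      rw [sq_abs, sq_abs] at e
      linarith
    have b5 : g x * (ζ x ^ 2 * z x) ≤ |g x| * ζ x ^ 2 * |z x| := by
      refine (le_abs_self _).trans (le_of_eq ?_)
      rw [abs_mul, abs_mul, abs_of_nonneg (sq_nonneg (ζ x))]; ring
    have p1 : 0 ≤ ‖d‖ ^ 2 * z x ^ 2 := pz
    have p2 : 0 ≤ ζ x ^ 2 * ‖H x‖ ^ 2 := pz
    have p3 : 0 ≤ |g x| * ζ x ^ 2 * |z x| := pz
    have hA1 : 4 / c * L ^ 2 + 1 ≤ A := by
      have e : 8 / c * L ^ 2 = 2 * (4 / c * L ^ 2) := by ring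
      have : 0 ≤ 4 / c * L ^ 2 := pz
      have : 0 ≤ 2 / c := pz
      simp only [A]
      linarith
    have hA2 : 1 / c + 1 ≤ A := by
      have e : 2 / c = 2 * (1 / c) := by ring
      have : 0 ≤ 8 / c * L ^ 2 := pz
      have : 0 ≤ 1 / c := pz
      simp only [A]
      linarith
    have hA3 : 1 ≤ A := le_trans (by have : 0 ≤ 1 / c := pz
                                     linarith) hA2
    have q1 := mlr hA1 p1
    have q2 := mlr hA2 p2
    have q3 := mlr hA3 p3
    have r1 := mll a1 (sq_nonneg (ζ x))
    have r2 := mll b2 (sq_nonneg (ζ x))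
    nlinarith only [q1, q2, q3, r1, r2, b3, b4, b5, p1, p2, p3]
  have hI := integral_mono (hint3.const_mul (c / 2)) ((hint1.sub hint2).add (hint4.const_mul A)) hpt
  rw [icm, integral_add' (hint1.sub hint2) (hint4.const_mul A), integral_sub' hint1 hint2, this, sub_self, zero_add, icm] at hI
  have : (2 / c) * (c / 2 * ∫ x, ζ x ^ 2 * ‖Z x‖ ^ 2) ≤ 2 / c * (A * ∫ x, (‖fd ζ x‖ ^ 2 * z x ^ 2 + ζ x ^ 2 * ‖H x‖ ^ 2 + |g x| * ζ x ^ 2 * |z x|)) := by gcongr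
  rw [← mul_assoc, ← mul_assoc, show 2 / c * (c / 2) = 1 by field_simp, one_mul] at this
  exact this

theorem hasFDerivAt_setIntegral_compact {X Y G : Type*} [NormedAddCommGroup X] [NormedSpace ℝ X] [ProperSpace X]
    [TopologicalSpace Y] [MeasurableSpace Y] [OpensMeasurableSpace Y] [T2Space Y]
    [SecondCountableTopology Y]
    [NormedAddCommGroup G] [NormedSpace ℝ G] [CompleteSpace G]
    {μ : Measure Y} [IsFiniteMeasureOnCompacts μ] {K : Set Y} (hK : IsCompact K) {F : X → Y → G} {F' : X → Y → X →L[ℝ] G}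
    (hF : Continuous (Function.uncurry F)) (hF' : Continuous (Function.uncurry F'))
    (h : ∀ x y, HasFDerivAt (F · y) (F' x y) x) (x : X) :
    HasFDerivAt (fun x => ∫ y in K, F x y ∂μ) (∫ y in K, F' x y ∂μ) x := by
  obtain ⟨M, hM⟩ := ((icb x 1).prod hK).exists_bound_of_continuousOn hF'.norm.continuousOn
  have c1 : ∀ x, Continuous (F x) := fun x => hF.comp (by fun_prop : Continuous fun y => (x, y))
  have c2 : ∀ x, Continuous (F' x) := fun x => hF'.comp (by fun_prop : Continuous fun y => (x, y))
  have : IsFiniteMeasure (μ.restrict K) := ⟨by simpa using hK.measure_lt_top⟩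
  refine hasFDerivAt_integral_of_dominated_of_fderiv_le (bound := fun _ => M) (s := closedBall x 1) (closedBall_mem_nhds x one_pos)
    (eof fun x => ((c1 x).continuousOn.aestronglyMeasurable_of_isCompact hK hK.measurableSet)) ((c1 x).continuousOn.integrableOn_compact hK)
    ((c2 x).continuousOn.aestronglyMeasurable_of_isCompact hK hK.measurableSet) ?_ (integrable_const _) (eof fun a x _ => h x a)
  refine (ae_restrict_iff' hK.measurableSet).2 (eof fun y hy x' hx' => ?_)
  simpa using hM (x', y) ⟨hx', hy⟩

theorem integral_affine {F : Type*} [NormedAddCommGroup F] [NormedSpace ℝ F] (f : E → F) (x : E) {s : ℝ} (hs : 0 < s) :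
    ∫ y, f (x + s • y) = (s ^ Module.finrank ℝ E)⁻¹ • ∫ y, f y := by
  have := Measure.integral_comp_smul_of_nonneg (volume : Measure E) (fun y => f (x + y)) s (hR := hs.le)
  rw [this, integral_add_left_eq_self (fun y => f y) x]

theorem setIntegral_affine {F : Type*} [NormedAddCommGroup F] [NormedSpace ℝ F] (f : E → F) (x : E) {s : ℝ} (hs : 0 < s) (t : ℝ) :
    ∫ y in ball 0 t, f (x + s • y) = (s ^ Module.finrank ℝ E)⁻¹ • ∫ y in ball x (s * t), f y := by
  rw [← integral_indicator mb_, ← integral_indicator mb_, ← integral_affine _ x hs]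
  congr 1
  ext y
  have : y ∈ ball (0 : E) t ↔ x + s • y ∈ ball x (s * t) := by
    rw [mem_ball_zero_iff, mem_ball, den, ascl, norm_smul, nea, abs_of_pos hs, mul_lt_mul_iff_right₀ hs]
  by_cases h : y ∈ ball (0 : E) t
  · rw [indicator_of_mem h, indicator_of_mem (this.1 h)]
  · rw [inm h, inm (fun h' => h (this.2 h'))]

theorem weak_rescale {U : Set E} {V : E → E} {g φ : E → ℝ} (hw : Weak U V g) (x : E) {s r : ℝ} (hs : 0 < s)
    (hφ : ContDiff ℝ 1 φ) (hsu : tsupport φ ⊆ closedBall 0 r) (hU : closedBall x (s * r) ⊆ U) :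
    ∫ y, fd φ y (V (x + s • y)) = ∫ y, s * g (x + s • y) * φ y := by
  let a : E → E := fun y => s⁻¹ • (y - x)
  have haC : ContDiff ℝ 1 a := fz
  have hsup : ∀ y, φ (a y) ≠ 0 → y ∈ closedBall x (s * r) := by
    intro y hy
    have h1 : a y ∈ closedBall 0 r := hsu (subset_tsupport _ hy)
    rw [mcz, norm_smul, norm_inv, nea, abs_of_pos hs, inv_mul_le_iff₀ hs] at h1
    rwa [mem_closedBall, den]
  have hc : HasCompactSupport (fun y => φ (a y)) :=
    hcsub (icb x (s * r)) hsup
  have hts : tsupport (fun y => φ (a y)) ⊆ U := (closure_minimal hsup isClosed_closedBall).trans hU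
  have h := hw _ (hφ.comp haC) hc hts
  have hd : ∀ y v, fd (fun y => φ (a y)) y v = s⁻¹ * fd φ (a y) v := by
    intro y v
    have h1 : HasFDerivAt a (s⁻¹ • ContinuousLinearMap.id ℝ E) y := ((hasFDerivAt_id y).sub_const x).const_smul s⁻¹
    have h2 : HasFDerivAt (fun y => φ (a y)) _ y := (hφ.differentiable sz (a y)).hasFDerivAt.comp y h1
    rw [h2.fderiv]
    simp
  have h3 : ∫ y, fd (fun y => φ (a y)) y (V y) = ∫ y, g y * φ (a y) := h
  simp_rw [hd] at h3
  have e : ∀ y, a (x + s • y) = y := by intro y; simp [a, smul_smul, hs.ne']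
  have h4 := integral_affine (fun y => s⁻¹ * fd φ (a y) (V y)) x hs
  have h5 := integral_affine (fun y => g y * φ (a y)) x hs
  rw [h3, ← h5] at h4
  simp only [e] at h4
  rw [icm] at h4
  rw [inv_mul_eq_iff_eq_mul₀ hs.ne', ← icm] at h4
  rw [h4]
  congr 1; ext y; ring

theorem kern_id {S : E →L[ℝ] E} {Ψ ρ : E → ℝ} (hΨ : ContDiff ℝ 1 Ψ) (hρ : Continuous ρ)
    (hΨs : ∀ y, Ψ y ≠ 0 → ‖y‖ ≤ 1 / 2) (hρs : ∀ y, ρ y ≠ 0 → ‖y‖ ≤ 1 / 2) (hSΨ : ∀ y η, fd Ψ y (S η) = - ρ y * ⟪y, η⟫)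
    {U : Set E} {Z W : E → E} {g : E → ℝ} (hZ : Continuous Z) (hW : Continuous W) (hg : Continuous g)
    (hw : Weak U (fun x => S (Z x) - W x) g) (x : E) {s : ℝ} (hs : 0 < s) (hU : closedBall x (s / 2) ⊆ U) :
    ∫ y in closedBall 0 (1 / 2), ρ y * ⟪Z (x + s • y), y⟫ =
      - ∫ y in closedBall 0 (1 / 2), (fd Ψ y (W (x + s • y)) + s * g (x + s • y) * Ψ y) := by
  have hb : Function.support Ψ ⊆ closedBall 0 (1 / 2) := fun y hy => mcz.2 (hΨs y hy)
  have hts : tsupport Ψ ⊆ closedBall 0 (1 / 2) := closure_minimal hb isClosed_closedBall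
  have hc : HasCompactSupport Ψ := hcsub (icb 0 (1 / 2)) hb
  have h := weak_rescale hw x hs hΨ hts (by rwa [mul_one_div])
  have z0 : ∀ y, y ∉ closedBall (0 : E) (1 / 2) → Ψ y = 0 := fun y hy => by_contra fun h => hy (hb h)
  have z1 : ∀ y, y ∉ closedBall (0 : E) (1 / 2) → fd Ψ y = 0 :=
    fun y hy => by_contra fun h => hy (hts (support_fderiv_subset ℝ h))
  simp only [map_sub, hSΨ] at h
  have i1 : Integrable fun y => -ρ y * ⟪y, Z (x + s • y)⟫ := by
    refine Continuous.ics fz ?_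
    refine hcsub (icb 0 (1 / 2)) fun y hy => ?_
    exact mcz.2 (hρs y fun h => hy (by simp [h]))
  have i2 : Integrable fun y => fd Ψ y (W (x + s • y)) :=
    (continuous_fderiv_ap hΨ fz).ics (hcs_fderiv_ap _ hc)
  rw [integral_sub i1 i2] at h
  rw [sie, sie]
  rotate_left
  · intro y hy; simp [z0 y hy, z1 y hy]
  · intro y hy
    have : ρ y = 0 := by_contra fun h => hy (mcz.2 (hρs y h))
    simp [this]
  have i3 : Integrable fun y => s * g (x + s • y) * Ψ y :=
    (by have := hΨ.continuous; fun_prop : Continuous fun y => s * g (x + s • y) * Ψ y).ics hc.mul_left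
  rw [integral_add i2 i3, ← h]
  simp_rw [neg_mul, integral_neg, real_inner_comm]
  ring

theorem swap_cont {X Y : Type*} [MeasurableSpace X] [TopologicalSpace X] [OpensMeasurableSpace X] [MeasurableSpace Y] [TopologicalSpace Y] [OpensMeasurableSpace Y]
    [SecondCountableTopologyEither X Y] [SecondCountableTopology X] [SecondCountableTopology Y] [T2Space X] [T2Space Y]
    {μ : Measure X} {ν : Measure Y} [SFinite μ] [SFinite ν] [IsLocallyFiniteMeasure μ] [IsLocallyFiniteMeasure ν] {s K : Set X} {t L : Set Y}
    (hK : IsCompact K) (hL : IsCompact L) (hs : s ⊆ K) (ht : t ⊆ L) {f : X → Y → ℝ} (hf : Continuous (Function.uncurry f)) :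
    ∫ x in s, ∫ y in t, f x y ∂ν ∂μ = ∫ y in t, ∫ x in s, f x y ∂μ ∂ν := by
  apply integral_integral_swap
  rw [Measure.prod_restrict]
  have : IntegrableOn (Function.uncurry f) (K ×ˢ L) (μ.prod ν) := hf.continuousOn.integrableOn_compact (hK.prod hL)
  exact this.mono_set (prod_mono hs ht)

theorem translate_le {h : E → ℝ} (hc : Continuous h) (h0 : ∀ x, 0 ≤ h x) {v : E} {a b : ℝ} (hv : a + ‖v‖ < b) :
    ∫ x in closedBall 0 a, h (x + v) ≤ ∫ x in ball 0 b, h x := by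
  rw [← integral_indicator measurableSet_closedBall, ← integral_indicator mb_,
    ← integral_add_right_eq_self (fun x => (ball (0 : E) b).indicator h x) v]
  have hi : Integrable (fun x => (ball (0 : E) b).indicator h x) := by
    rw [integrable_indicator_iff mb_]
    exact (hc.continuousOn.integrableOn_compact (icb 0 b)).mono_set bscb
  refine integral_mono_of_nonneg (eof fun x => indicator_nonneg (fun x _ => h0 _) _) (hi.comp_add_right v) (eof fun x => ?_)
  by_cases hx : x ∈ closedBall (0 : E) a
  · rw [mcz] at hx
    have : x + v ∈ ball (0 : E) b := by
      rw [mem_ball_zero_iff]; exact (norm_add_le _ _).trans_lt lz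
    simp [indicator_of_mem this, indicator_of_mem, hx]
  · simp only [inm hx]
    exact indicator_nonneg (fun x _ => h0 _) _

theorem moll_hasDeriv {ρ : E → ℝ} (hρ : Continuous ρ) {z : E → ℝ} {Z : E → E} (hz : ∀ x, HasGradientAt z (Z x) x) (hZ : Continuous Z) (r : ℝ)
    (x : E) (s : ℝ) : HasDerivAt (fun s : ℝ => ∫ y in closedBall 0 r, ρ y * z (x + s • y)) (∫ y in closedBall 0 r, ρ y * ⟪Z (x + s • y), y⟫) s := by
  have zc := (contDiff_of_grad hz hZ).continuous
  have hB : IsCompact (closedBall (0 : E) r) := icb 0 r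
  have hcF' : Continuous fun q : ℝ × E => (ρ q.2 * ⟪Z (x + q.1 • q.2), q.2⟫) • (ContinuousLinearMap.id ℝ ℝ) := fz
  have := hasFDerivAt_setIntegral_compact (μ := (volume : Measure E)) hB (F := fun (s : ℝ) y => ρ y * z (x + s • y))
    (F' := fun s y => (ρ y * ⟪Z (x + s • y), y⟫) • (ContinuousLinearMap.id ℝ ℝ)) (by unfold Function.uncurry; fun_prop)
    hcF' (fun s y => ?_) s
  · have h2 := this.hasDerivAt
    rw [ContinuousLinearMap.integral_apply] at h2
    · simpa using h2
    · exact (hcF'.comp (by fun_prop : Continuous fun y : E => (s, y))).continuousOn.integrableOn_compact hB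
  · have h1 : HasDerivAt (fun s : ℝ => x + s • y) y s := by
      simpa using ((hasDerivAt_id s).smul_const y).const_add x
    have h2 := ((hz (x + s • y)).hasFDerivAt.comp_hasDerivAt s h1).const_mul (ρ y)
    have h3 := h2.hasFDerivAt
    refine h3.congr_fderiv ?_
    ext; simp

theorem moll_hasGrad {ρ : E → ℝ} (hρ : Continuous ρ) {z : E → ℝ} {Z : E → E} (hz : ∀ x, HasGradientAt z (Z x) x) (hZ : Continuous Z) (r s : ℝ)
    (x : E) : HasGradientAt (fun x : E => ∫ y in closedBall 0 r, ρ y * z (x + s • y)) (∫ y in closedBall 0 r, ρ y • Z (x + s • y)) x := by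
  have zc := (contDiff_of_grad hz hZ).continuous
  have hB : IsCompact (closedBall (0 : E) r) := icb 0 r
  have hcF' : Continuous fun q : E × E => tD E (ρ q.2 • Z (q.1 + s • q.2)) :=
    (tD E).continuous.comp fz
  have := hasFDerivAt_setIntegral_compact (μ := (volume : Measure E)) hB (F := fun (x : E) y => ρ y * z (x + s • y))
    (F' := fun x y => tD E (ρ y • Z (x + s • y))) (by unfold Function.uncurry; fun_prop)
    hcF' (fun x y => ?_) x
  · rw [hgfd]
    refine this.congr_fderiv ?_
    have hi : IntegrableOn (fun y => ρ y • Z (x + s • y)) (closedBall 0 r) :=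
      (by fun_prop : Continuous fun y => ρ y • Z (x + s • y)).continuousOn.integrableOn_compact hB
    exact ((tD E).toContinuousLinearEquiv.toContinuousLinearMap.integral_comp_comm hi)
  · have h1 : HasFDerivAt (fun x : E => x + s • y) (ContinuousLinearMap.id ℝ E) x := (hasFDerivAt_id x).add_const _
    have h2 := ((hz (x + s • y)).hasFDerivAt.comp x h1).const_mul (ρ y)
    refine h2.congr_fderiv ?_
    ext; simp

theorem moll_L2 {S : E →L[ℝ] E} {Ψ ρ : E → ℝ} (hΨ : ContDiff ℝ 1 Ψ) (hρ : Continuous ρ)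
    (hΨs : ∀ y, Ψ y ≠ 0 → ‖y‖ ≤ 1 / 2) (hρs : ∀ y, ρ y ≠ 0 → ‖y‖ ≤ 1 / 2) (hρ1 : ∫ y in closedBall 0 (1 / 2), ρ y = 1)
    (hSΨ : ∀ y η, fd Ψ y (S η) = - ρ y * ⟪y, η⟫) :
    ∃ C : ℝ, 0 < C ∧ ∀ (z : E → ℝ) (Z W : E → E) (g : E → ℝ) (K : ℝ), (∀ x, HasGradientAt z (Z x) x) → Continuous Z → Continuous W → Continuous g →
      Weak (ball 0 1) (fun x => S (Z x) - W x) g → (∀ x ∈ ball 0 1, |g x| ≤ K) →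
      ∫ x in closedBall 0 (1 / 2), ((∫ y in closedBall 0 (1 / 2), ρ y * z (x + hlf • y)) - z x) ^ 2 ≤ C * ((∫ x in ball 0 1, ‖W x‖ ^ 2) + K ^ 2) := by
  set B : Set E := closedBall 0 (1 / 2) with hBdef
  have hB : IsCompact B := icb 0 (1 / 2)
  have hBm : MeasurableSet B := measurableSet_closedBall
  set ω := volume.real B
  have hω : 0 ≤ ω := measureReal_nonneg
  obtain ⟨c1, hc1⟩ := hB.exists_bound_of_continuousOn (hΨ.continuous_fderiv sz).continuousOn
  obtain ⟨c2, hc2⟩ := hB.exists_bound_of_continuousOn hΨ.continuous.continuousOn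
  set c := |c1| + |c2|
  have hc : 0 ≤ c := pz
  have hfin : IsFiniteMeasure ((volume : Measure E).restrict B) := ⟨by simpa using hB.measure_lt_top⟩
  refine ⟨1 / 4 * (ω * (2 * c ^ 2 * (ω + ω ^ 2))) + 1, pz, ?_⟩
  intro z Z W g K hz hZ hW hg hw hK
  have hK0 : 0 ≤ K := (abs_nonneg _).trans (hK 0 sz)
  set Q := ∫ x in ball (0 : E) 1, ‖W x‖ ^ 2
  have hQ : 0 ≤ Q := integral_nonneg fun x => pz
  have zc := (contDiff_of_grad hz hZ).continuous
  set D : E → ℝ → ℝ := fun x s => ∫ y in B, ρ y * ⟪Z (x + s • y), y⟫ with hD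
  have hDc : Continuous (Function.uncurry D) := by
    have := cpi (μ := (volume : Measure E)) (f := fun (q : E × ℝ) y => ρ y * ⟪Z (q.1 + q.2 • y), y⟫) (by unfold Function.uncurry; fun_prop) hB
    exact this
  have hFTC : ∀ x, (∫ y in B, ρ y * z (x + hlf • y)) - z x = ∫ s in Ioc (0 : ℝ) (1 / 2), D x s := by
    intro x
    rw [← intervalIntegral.integral_of_le nz]
    rw [iisub (fun s _ => moll_hasDeriv hρ hz hZ (1 / 2) x s)]
    · simp only [zero_smul, add_zero]
      rw [integral_mul_const, hρ1, one_mul]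
    · exact (hDc.comp (by fun_prop : Continuous fun s : ℝ => (x, s))).intervalIntegrable _ _
  have hDx : ∀ x, Continuous (D x) := fun x => hDc.comp (by fun_prop : Continuous fun s : ℝ => (x, s))
  have h1 : ∀ x, ((∫ y in B, ρ y * z (x + hlf • y)) - z x) ^ 2 ≤ 1 / 2 * ∫ s in Ioc (0 : ℝ) (1 / 2), D x s ^ 2 := by
    intro x
    rw [hFTC]
    refine (sq_integral_le (hDx x).integrableOn_Ioc ((hDx x).pow 2).integrableOn_Ioc).trans (le_of_eq ?_)
    congr 1
    simp
  have h2 : ∀ x ∈ B, ∀ s ∈ Ioc (0 : ℝ) (1 / 2), D x s ^ 2 ≤ 2 * c ^ 2 * ω * ((∫ y in B, ‖W (x + s • y)‖ ^ 2) + K ^ 2 * ω) := by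
    intro x hx s hs
    rw [hBdef, mcz] at hx
    have hin : ∀ y ∈ B, x + s • y ∈ ball (0 : E) 1 := by
      intro y hy
      rw [hBdef, mcz] at hy
      rw [mem_ball_zero_iff]
      calc ‖x + s • y‖ ≤ ‖x‖ + ‖s • y‖ := norm_add_le _ _
        _ = ‖x‖ + s * ‖y‖ := by rw [norm_smul, nea, abs_of_pos hs.1]
        _ ≤ 1 / 2 + 1 / 2 * (1 / 2) := by gcongr; exact hs.2
        _ < 1 := nz
    have hkid := kern_id hΨ hρ hΨs hρs hSΨ hZ hW hg hw x hs.1 (by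
      intro y hy
      rw [mem_closedBall, den] at hy
      rw [mem_ball_zero_iff]
      have : ‖y‖ ≤ ‖y - x‖ + ‖x‖ := by simpa using norm_add_le (y - x) x
      linarith [hs.2])
    have hDe : D x s = - ∫ y in B, (fd Ψ y (W (x + s • y)) + s * g (x + s • y) * Ψ y) := hkid
    have cW : Continuous fun y => fd Ψ y (W (x + s • y)) := continuous_fderiv_ap hΨ fz
    have cg : Continuous fun y => fd Ψ y (W (x + s • y)) + s * g (x + s • y) * Ψ y := by
      have := hΨ.continuous
      fun_prop
    rw [hDe, neg_sq]
    refine (sq_integral_le (cg.continuousOn.integrableOn_compact hB) ((cg.pow 2).continuousOn.integrableOn_compact hB)).trans ?_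
    have : ((volume : Measure E).restrict B).real univ = ω := by simp [ω, Measure.real]
    rw [this]
    have iW : IntegrableOn (fun y => ‖W (x + s • y)‖ ^ 2) B := (by fun_prop : Continuous fun y => ‖W (x + s • y)‖ ^ 2).continuousOn.integrableOn_compact hB
    have : ∫ y in B, (fd Ψ y (W (x + s • y)) + s * g (x + s • y) * Ψ y) ^ 2 ≤ ∫ y in B, 2 * c ^ 2 * (‖W (x + s • y)‖ ^ 2 + K ^ 2) := by
      refine smo ((cg.pow 2).continuousOn.integrableOn_compact hB) ((iW.add (integrable_const _)).const_mul _) hBm fun y hy => ?_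
      have a1 : |fd Ψ y (W (x + s • y))| ≤ c * ‖W (x + s • y)‖ := by
        refine ((fd Ψ y).le_opNorm _).trans ?_
        gcongr
        refine (hc1 y hy).trans ((le_abs_self _).trans ?_)
        simp [c]
      have a2 : |s * g (x + s • y) * Ψ y| ≤ c * K := by
        rw [abs_mul, abs_mul, abs_of_pos hs.1]
        have b1 := hK _ (hin y hy)
        have b2 : |Ψ y| ≤ c := (hc2 y hy).trans ((le_abs_self _).trans (by simp [c]))
        calc s * |g (x + s • y)| * |Ψ y| ≤ 1 * K * c := by
              gcongr
              linarith [hs.2]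
          _ = c * K := by ring
      rw [← sq_abs]
      calc |fd Ψ y (W (x + s • y)) + s * g (x + s • y) * Ψ y| ^ 2 ≤ (c * ‖W (x + s • y)‖ + c * K) ^ 2 := by
            gcongr
            exact (abs_add_le _ _).trans (add_le_add a1 a2)
        _ ≤ _ := by nlinarith [sq_nonneg (c * ‖W (x + s • y)‖ - c * K)]
    rw [icm, integral_add iW (integrable_const _)] at this
    simp only [integral_const, smul_eq_mul, mrau] at this
    refine (mll this hω).trans (le_of_eq ?_)
    ring
  have h3 : ∀ s ∈ Ioc (0 : ℝ) (1 / 2), ∫ x in B, D x s ^ 2 ≤ 2 * c ^ 2 * ω * (ω * Q + K ^ 2 * ω ^ 2) := by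
    intro s hs
    have cN : Continuous (Function.uncurry fun (x y : E) => ‖W (x + s • y)‖ ^ 2) := by unfold Function.uncurry; fun_prop
    have cN2 : Continuous fun x => ∫ y in B, ‖W (x + s • y)‖ ^ 2 := cpi (μ := (volume : Measure E)) cN hB
    have iN := cN2.continuousOn.integrableOn_compact (μ := volume) hB
    have cDs : Continuous fun x => D x s ^ 2 := (hDc.comp (by fun_prop : Continuous fun x : E => (x, s))).pow 2
    have e1 : ∫ x in B, D x s ^ 2 ≤ ∫ x in B, 2 * c ^ 2 * ω * ((∫ y in B, ‖W (x + s • y)‖ ^ 2) + K ^ 2 * ω) :=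
      smo (cDs.continuousOn.integrableOn_compact hB) ((iN.add (integrable_const _)).const_mul _) hBm fun x hx => h2 x hx s hs
    rw [icm, integral_add iN (integrable_const _), swap_cont hB hB subset_rfl subset_rfl cN] at e1
    simp only [integral_const, smul_eq_mul, mrau] at e1
    have e2 : ∫ y in B, ∫ x in B, ‖W (x + s • y)‖ ^ 2 ≤ ∫ y in B, Q := by
      refine smo ?_ (integrable_const _) hBm fun y hy => ?_
      · have : Continuous fun y => ∫ x in B, ‖W (x + s • y)‖ ^ 2 := cpi (μ := (volume : Measure E)) (by unfold Function.uncurry; fun_prop) hB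
        exact this.continuousOn.integrableOn_compact hB
      · refine translate_le (h := fun x => ‖W x‖ ^ 2) fz (fun x => pz) ?_
        rw [hBdef, mcz] at hy
        rw [norm_smul, nea, abs_of_pos hs.1]
        have : s * ‖y‖ ≤ 1 / 2 * (1 / 2) := by gcongr; exact hs.2
        linarith
    simp only [integral_const, smul_eq_mul, mrau] at e2
    calc _ ≤ _ := e1
      _ ≤ 2 * c ^ 2 * ω * (ω * Q + ω * (K ^ 2 * ω)) := by gcongr
      _ = _ := by ring
  have cD2 : Continuous (Function.uncurry fun x s => D x s ^ 2) := hDc.pow 2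
  have c5 : Continuous fun x => ∫ s in Ioc (0 : ℝ) (1 / 2), D x s ^ 2 := by
    have := cpi (μ := (volume : Measure ℝ)) cD2 (isCompact_Icc (a := (0 : ℝ)) (b := 1 / 2))
    simpa only [integral_Icc_eq_integral_Ioc] using this
  have c6 : Continuous fun s => ∫ x in B, D x s ^ 2 :=
    cpi (μ := (volume : Measure E)) (f := fun s x => D x s ^ 2) (cD2.comp continuous_swap) hB
  have c7 : Continuous fun x => ((∫ y in B, ρ y * z (x + hlf • y)) - z x) ^ 2 := by
    have : Continuous fun x => ∫ y in B, ρ y * z (x + hlf • y) := cpi (μ := (volume : Measure E)) (by unfold Function.uncurry; fun_prop) hB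
    fun_prop
  have f1 : ∫ x in B, ((∫ y in B, ρ y * z (x + hlf • y)) - z x) ^ 2 ≤ ∫ x in B, 1 / 2 * ∫ s in Ioc (0 : ℝ) (1 / 2), D x s ^ 2 :=
    smo (c7.continuousOn.integrableOn_compact hB) ((c5.continuousOn.integrableOn_compact hB).const_mul _) hBm fun x _ => h1 x
  rw [icm, swap_cont hB (isCompact_Icc (a := (0 : ℝ)) (b := 1 / 2)) subset_rfl Ioc_subset_Icc_self cD2] at f1
  have f2 : ∫ s in Ioc (0 : ℝ) (1 / 2), ∫ x in B, D x s ^ 2 ≤ ∫ s in Ioc (0 : ℝ) (1 / 2), 2 * c ^ 2 * ω * (ω * Q + K ^ 2 * ω ^ 2) :=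
    smo c6.integrableOn_Ioc (integrableOn_const sz) measurableSet_Ioc h3
  have f3 : ∫ s in Ioc (0 : ℝ) (1 / 2), 2 * c ^ 2 * ω * (ω * Q + K ^ 2 * ω ^ 2) = 1 / 2 * (2 * c ^ 2 * ω * (ω * Q + K ^ 2 * ω ^ 2)) := by
    simp
  rw [f3] at f2
  calc _ ≤ _ := f1
    _ ≤ 1 / 2 * (1 / 2 * (2 * c ^ 2 * ω * (ω * Q + K ^ 2 * ω ^ 2))) := by gcongr
    _ ≤ _ := by
      have g1 : 0 ≤ 1 / 4 * (ω * (2 * c ^ 2 * (ω ^ 2))) * Q := pz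
      have g2 : 0 ≤ 1 / 4 * (ω * (2 * c ^ 2 * ω)) * K ^ 2 := pz
      have g3 : 0 ≤ K ^ 2 := pz
      nlinarith

theorem intOn_ball {f : E → ℝ} (hf : Continuous f) (x : E) (r : ℝ) : IntegrableOn f (ball x r) :=
  (hf.continuousOn.integrableOn_compact (icb x r)).mono_set bscb

theorem finBall (x : E) (r : ℝ) : IsFiniteMeasure ((volume : Measure E).restrict (ball x r)) :=
  ⟨by simpa using measure_ball_lt_top⟩

theorem real_ball (x : E) {r : ℝ} (hr : 0 < r) : volume.real (ball x r) = r ^ Module.finrank ℝ E * volume.real (ball (0 : E) 1) := by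
  rw [Measure.real, Measure.addHaar_ball_of_pos _ _ hr, ENNReal.toReal_mul, ENNReal.toReal_ofReal pz]
  rfl

theorem ker_le {Z : E → E} (hZ : Continuous Z) {k : E → ℝ} {M : ℝ} (hk : ∀ y, |k y| ≤ M) :
    ‖∫ y in ball (0 : E) 1, k y • Z y‖ ^ 2 ≤ M ^ 2 * volume.real (ball (0 : E) 1) * ∫ y in ball (0 : E) 1, ‖Z y‖ ^ 2 := by
  have hM : 0 ≤ M := (abs_nonneg _).trans (hk 0)
  have := finBall (0 : E) 1
  have h1 : ‖∫ y in ball (0 : E) 1, k y • Z y‖ ≤ ∫ y in ball (0 : E) 1, M * ‖Z y‖ := by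
    refine norm_integral_le_of_norm_le (intOn_ball fz 0 1) (eof fun y => ?_)
    rw [norm_smul]
    exact mlr (hk y) nnz
  have h2 := sq_integral_le (intOn_ball hZ.norm (0 : E) 1) (intOn_ball (hZ.norm.pow 2) 0 1)
  rw [icm] at h1
  rw [mrau] at h2
  calc _ ≤ (M * ∫ y in ball (0 : E) 1, ‖Z y‖) ^ 2 := by gcongr
    _ = M ^ 2 * (∫ y in ball (0 : E) 1, ‖Z y‖) ^ 2 := by ring
    _ ≤ M ^ 2 * _ := mll h2 (sq_nonneg M)
    _ = _ := by ring

theorem moll_ker {ρ : E → ℝ} (hρs : ∀ y, ρ y ≠ 0 → ‖y‖ ≤ 1 / 2) (Z : E → E) {x : E} (hx : ‖x‖ ≤ 1 / 4) :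
    ∫ y in closedBall 0 (1 / 2), ρ y • Z (x + hlf • y) = (2 : ℝ) ^ Module.finrank ℝ E • ∫ y in ball (0 : E) 1, ρ ((2 : ℝ) • (y - x)) • Z y := by
  have h := integral_affine (fun y => ρ ((2 : ℝ) • (y - x)) • Z y) x (s := 1 / 2) nz
  simp only [ascl, smul_smul] at h
  rw [show (2 : ℝ) * (1 / 2) = 1 by norm_num] at h
  simp only [one_smul] at h
  rw [sie, sie]
  · rw [h, one_div, inv_pow, inv_inv]
  · intro y hy
    have : ρ ((2 : ℝ) • (y - x)) = 0 := by
      by_contra h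
      have h1 := hρs _ h
      apply hy
      rw [norm_smul] at h1
      norm_num at h1
      rw [mem_ball_zero_iff]
      have : ‖y‖ ≤ ‖y - x‖ + ‖x‖ := by simpa using norm_add_le (y - x) x
      linarith
    simp [this]
  · intro y hy
    have : ρ y = 0 := by
      by_contra h
      exact hy (mcz.2 (hρs _ h))
    simp [this]

set_option maxHeartbeats 1000000 in
theorem unit_decay {S : E →L[ℝ] E} (hS : SPD S) : ∃ ρ : E → ℝ, Continuous ρ ∧ (∀ y, 0 ≤ ρ y) ∧ ∫ y in closedBall 0 (1 / 2), ρ y = 1 ∧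
    ∃ C : ℝ, 0 < C ∧ ∀ σ : ℝ, 0 < σ → σ ≤ 1 / 8 → ∃ Cσ : ℝ, 0 < Cσ ∧
      ∀ (z : E → ℝ) (Z W : E → E) (g : E → ℝ) (K : ℝ), (∀ x, HasGradientAt z (Z x) x) → Continuous Z → Continuous W → Continuous g →
      Weak (ball 0 1) (fun x => S (Z x) - W x) g → (∀ x ∈ ball 0 1, |g x| ≤ K) →
      ‖∫ y in closedBall 0 (1 / 2), ρ y • Z (hlf • y)‖ ^ 2 ≤ C * ∫ x in ball 0 1, ‖Z x‖ ^ 2 ∧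
      ∫ x in ball 0 σ, ‖Z x - ∫ y in closedBall 0 (1 / 2), ρ y • Z (hlf • y)‖ ^ 2 ≤
        C * σ ^ (Module.finrank ℝ E + 2) * (∫ x in ball 0 1, ‖Z x‖ ^ 2) + Cσ * ((∫ x in ball 0 1, ‖W x‖ ^ 2) + K ^ 2) := by
  obtain ⟨Ψ, ρ, hΨ, hρ, hΨs, hρs, hρ0, hρ1, hSΨ⟩ := exists_kernel hS
  set n := Module.finrank ℝ E
  have hρ1' : ∫ y in closedBall 0 (1 / 2), ρ y = 1 := by
    rw [sie, hρ1]
    intro y hy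
    by_contra h
    exact hy (mcz.2 (hρs _ h))
  have hρcs : HasCompactSupport ρ := hcsub (icb 0 (1 / 2))
    fun y hy => mcz.2 (hρs y hy)
  obtain ⟨Lp, hLp⟩ := hρ.lipschitzWith_of_hasCompactSupport hρcs sz
  obtain ⟨M0, hM0⟩ := hρ.continuous.bounded_above_of_compact_support hρcs
  obtain ⟨C1, hC1, hmol⟩ := moll_L2 hΨ hρ.continuous hΨs hρs hρ1' hSΨ
  obtain ⟨C2, hC2, hcac⟩ := caccioppoli hS
  set ω := volume.real (ball (0 : E) 1)
  have hω : 0 ≤ ω := measureReal_nonneg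
  set Λ := ‖S‖
  set CL : ℝ := ((2 : ℝ) ^ n) ^ 2 * ((2 * Lp) ^ 2 * ω)
  have hCL : 0 ≤ CL := pz
  set CM : ℝ := ((2 : ℝ) ^ n) ^ 2 * (M0 ^ 2 * ω)
  refine ⟨ρ, hρ.continuous, hρ0, hρ1', CM + 4 * C2 * (Λ ^ 2 * (CL * 4 * ((2 : ℝ) ^ n * ω))) + 2 * CL * ω + 1, pz, ?_⟩
  intro σ hσ hσ8
  have hb1 : IsCompact (closedBall (0 : E) (1 / 2)) := icb _ _
  let ζ : ContDiffBump (0 : E) := ⟨σ, 2 * σ, hσ, lz⟩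
  have hζ : ContDiff ℝ 1 ζ := ζ.contDiff
  obtain ⟨M, hM⟩ := (hζ.continuous_fderiv sz).bounded_above_of_compact_support (ζ.hasCompactSupport.fderiv (𝕜 := ℝ))
  set ω2 := volume.real (closedBall (0 : E) (1 / 2))
  have hω2 : 0 ≤ ω2 := measureReal_nonneg
  refine ⟨2 * C2 * ((M ^ 2 + 1) * C1 + 2 + ω2) + 1, pz, ?_⟩
  intro z Z W g K hz hZ hW hg hw hK
  set B : Set E := closedBall 0 (1 / 2)
  set z1 : E → ℝ := fun x => ∫ y in B, ρ y * z (x + hlf • y) with hz1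
  set Z1 : E → E := fun x => ∫ y in B, ρ y • Z (x + hlf • y) with hZ1
  set q : E := ∫ y in B, ρ y • Z (hlf • y) with hq
  have hq' : Z1 0 = q := by simp [hZ1, hq]
  set Q := ∫ x in ball (0 : E) 1, ‖Z x‖ ^ 2
  have hQ : 0 ≤ Q := integral_nonneg fun x => pz
  set Qw := ∫ x in ball (0 : E) 1, ‖W x‖ ^ 2
  have hQw : 0 ≤ Qw := integral_nonneg fun x => pz
  have hZ1c : Continuous Z1 := cpi (μ := (volume : Measure E)) (by unfold Function.uncurry; have := hρ.continuous; fun_prop) hb1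
  have hgrad1 : ∀ x, HasGradientAt z1 (Z1 x) x := fun x => moll_hasGrad hρ.continuous hz hZ (1 / 2) (1 / 2) x
  have hlip : ∀ x, ‖x‖ ≤ 1 / 4 → ‖Z1 x - q‖ ^ 2 ≤ CL * ‖x‖ ^ 2 * Q := by
    intro x hx
    rw [← hq', hZ1]
    simp only
    rw [moll_ker hρs Z hx, moll_ker hρs Z (x := 0) sz, ← smul_sub, ← integral_sub]
    · simp_rw [← sub_smul]
      have := ker_le hZ (k := fun y => ρ ((2 : ℝ) • (y - x)) - ρ ((2 : ℝ) • (y - 0))) (M := 2 * Lp * ‖x‖) (fun y => by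
        have := hLp.dist_le_mul ((2 : ℝ) • (y - x)) ((2 : ℝ) • (y - 0))
        rw [Real.dist_eq, den, ← smul_sub, norm_smul] at this
        refine this.trans (le_of_eq ?_)
        simp
        ring)
      rw [norm_smul, mul_pow, norm_pow]
      norm_num only [Real.norm_ofNat]
      calc _ ≤ ((2 : ℝ) ^ n) ^ 2 * _ := mll this pz
        _ = _ := by simp only [CL, ω, Q]; ring
    · exact ((by have := hρ.continuous; fun_prop : Continuous fun y => ρ ((2 : ℝ) • (y - x)) • Z y).continuousOn.integrableOn_compact (icb 0 1)).mono_set bscb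
    · exact ((by have := hρ.continuous; fun_prop : Continuous fun y => ρ ((2 : ℝ) • (y - 0)) • Z y).continuousOn.integrableOn_compact (icb 0 1)).mono_set bscb
  have hqb : ‖q‖ ^ 2 ≤ CM * Q := by
    rw [← hq', hZ1]
    simp only
    rw [moll_ker hρs Z (x := 0) sz]
    have := ker_le hZ (k := fun y => ρ ((2 : ℝ) • (y - 0))) (M := M0) (fun y => hM0 _)
    rw [norm_smul, mul_pow, norm_pow]
    norm_num only [Real.norm_ofNat]
    calc _ ≤ ((2 : ℝ) ^ n) ^ 2 * _ := mll this pz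
      _ = _ := by simp only [CM, ω, Q]; ring
  have hCM : 0 ≤ CM := pz
  refine ⟨hqb.trans (mlr ?_ hQ), ?_⟩
  · have : 0 ≤ 4 * C2 * (Λ ^ 2 * (CL * 4 * ((2 : ℝ) ^ n * ω))) + 2 * CL * ω := pz
    linarith
  set v : E → ℝ := fun x => z x - z1 x with hv
  have hgv : ∀ x, HasGradientAt v (Z x - Z1 x) x := by
    intro x
    rw [hgfd, map_sub]
    exact (hz x).hasFDerivAt.sub (hgrad1 x).hasFDerivAt
  set H : E → E := fun x => W x - S (Z1 x - q)
  have hHc : Continuous H := fz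
  have hweak : Weak (ball 0 1) (fun x => S (Z x - Z1 x) - H x) g := by
    intro φ h1 h2 h3
    rw [← hw φ h1 h2 h3]
    have e : ∀ x, fd φ x (S (Z x - Z1 x) - H x) = fd φ x (S (Z x) - W x) - fd φ x (S q) := by
      intro x; simp only [H, map_sub]; ring
    simp_rw [e]
    rw [integral_sub, integral_fderiv_const h1 h2, sub_zero]
    · exact (continuous_fderiv_ap h1 fz).ics (hcs_fderiv_ap _ h2)
    · exact (continuous_fderiv_ap h1 fz).ics (hcs_fderiv_ap _ h2)
  have hts : tsupport ζ = closedBall (0 : E) (2 * σ) := ζ.tsupport_eq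
  set B2 : Set E := closedBall (0 : E) (2 * σ)
  have hB2 : IsCompact B2 := icb _ _
  have hB2s : B2 ⊆ ball 0 1 := cbsb lz
  have hB2B : B2 ⊆ B := cbcb lz
  have hca := hcac (ball 0 1) v (fun x => Z x - Z1 x) H g ζ hgv fz hHc hg hζ ζ.hasCompactSupport (hts ▸ hB2s) hweak
  have vc : Continuous v := (contDiff_of_grad hgv fz).continuous
  have hvL : ∫ x in B, v x ^ 2 ≤ C1 * (Qw + K ^ 2) := by
    refine le_trans (le_of_eq ?_) (hmol z Z W g K hz hZ hW hg hw hK)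
    congr 1; ext x; simp only [v]; ring
  have hK0 : 0 ≤ K := (abs_nonneg _).trans (hK 0 sz)
  have intB : ∀ f : E → ℝ, Continuous f → IntegrableOn f B := fun f hf => hf.continuousOn.integrableOn_compact hb1
  have intB2 : ∀ f : E → ℝ, Continuous f → IntegrableOn f B2 := fun f hf => hf.continuousOn.integrableOn_compact hB2
  have hvol2 : volume.real B2 = (2 * σ) ^ n * ω := by
    rw [Measure.addHaar_real_closedBall _ _ pz]
  have hR : ∫ x, (‖fd ζ x‖ ^ 2 * v x ^ 2 + ζ x ^ 2 * ‖H x‖ ^ 2 + |g x| * ζ x ^ 2 * |v x|) ≤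
      (M ^ 2 + 1) * (C1 * (Qw + K ^ 2)) + 2 * Qw + 2 * (Λ ^ 2 * (CL * (2 * σ) ^ 2 * Q) * ((2 * σ) ^ n * ω)) + K ^ 2 * ω2 := by
    rw [← sie (s := B2)]
    rotate_left
    · intro x hx
      have h0 : ζ x = 0 := ime (by rwa [hts])
      have h1 : fd ζ x = 0 := by
        by_contra h
        exact hx (hts ▸ support_fderiv_subset ℝ h)
      simp [h0, h1]
    have hfc := hζ.continuous_fderiv sz
    have hζc := hζ.continuous
    have s1 : ∫ x in B2, (‖fd ζ x‖ ^ 2 * v x ^ 2 + ζ x ^ 2 * ‖H x‖ ^ 2 + |g x| * ζ x ^ 2 * |v x|) ≤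
        ∫ x in B2, (((M ^ 2 + 1) * v x ^ 2 + 2 * ‖W x‖ ^ 2) + (2 * (Λ ^ 2 * (CL * (2 * σ) ^ 2 * Q)) + K ^ 2)) := by
      refine smo (intB2 _ fz) (intB2 _ fz) measurableSet_closedBall fun x hx => ?_
      have hx2 : ‖x‖ ≤ 2 * σ := mcz.1 hx
      have a1 : ‖fd ζ x‖ ^ 2 * v x ^ 2 ≤ M ^ 2 * v x ^ 2 := by gcongr; exact hM x
      have z0 : 0 ≤ ζ x := ζ.nonneg
      have z1 : ζ x ≤ 1 := ζ.le_one
      have z2 : ζ x ^ 2 ≤ 1 := pow_le_one₀ z0 z1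
      have a2 : ‖H x‖ ^ 2 ≤ 2 * ‖W x‖ ^ 2 + 2 * (Λ ^ 2 * (CL * (2 * σ) ^ 2 * Q)) := by
        have b1 : ‖S (Z1 x - q)‖ ^ 2 ≤ Λ ^ 2 * (CL * (2 * σ) ^ 2 * Q) := by
          calc ‖S (Z1 x - q)‖ ^ 2 ≤ (Λ * ‖Z1 x - q‖) ^ 2 := by gcongr; exact S.le_opNorm _
            _ = Λ ^ 2 * ‖Z1 x - q‖ ^ 2 := by ring
            _ ≤ Λ ^ 2 * (CL * ‖x‖ ^ 2 * Q) := by gcongr; exact hlip x lz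
            _ ≤ _ := by gcongr
        have b2 : ‖H x‖ ≤ ‖W x‖ + ‖S (Z1 x - q)‖ := norm_sub_le _ _
        have b3 : ‖H x‖ ^ 2 ≤ (‖W x‖ + ‖S (Z1 x - q)‖) ^ 2 := by gcongr
        nlinarith only [b1, b3, sq_nonneg (‖W x‖ - ‖S (Z1 x - q)‖)]
      have a3 : ζ x ^ 2 * ‖H x‖ ^ 2 ≤ ‖H x‖ ^ 2 := mlo pz z2
      have a4 : |g x| * ζ x ^ 2 * |v x| ≤ K ^ 2 + v x ^ 2 := by
        calc |g x| * ζ x ^ 2 * |v x| ≤ K * 1 * |v x| := by gcongr; exact hK x (hB2s hx)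
          _ ≤ K ^ 2 + |v x| ^ 2 := by nlinarith only [sq_nonneg (K - |v x|), sq_nonneg K, sq_nonneg (|v x|)]
          _ = _ := by rw [sq_abs]
      linarith
    refine s1.trans ?_
    have : IsFiniteMeasure ((volume : Measure E).restrict B2) := ⟨by simpa using hB2.measure_lt_top⟩
    rw [integral_add (intB2 _ fz) (integrable_const _), integral_add (intB2 _ fz) (intB2 _ fz), icm, icm, integral_const, mrau, smul_eq_mul]
    have t1 : ∫ x in B2, v x ^ 2 ≤ C1 * (Qw + K ^ 2) :=
      (setIntegral_mono_set (intB _ fz) (eof fun x => sq_nonneg _) hB2B.eventuallyLE).trans hvL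
    have t2 : ∫ x in B2, ‖W x‖ ^ 2 ≤ Qw :=
      setIntegral_mono_set (intOn_ball fz 0 1) (eof fun x => pz) hB2s.eventuallyLE
    have t3 : volume.real B2 ≤ ω2 := measureReal_mono hB2B hb1.measure_lt_top.ne
    have t4 : volume.real B2 * (2 * (Λ ^ 2 * (CL * (2 * σ) ^ 2 * Q)) + K ^ 2) ≤ 2 * (Λ ^ 2 * (CL * (2 * σ) ^ 2 * Q) * ((2 * σ) ^ n * ω)) + K ^ 2 * ω2 := by
      have := mlr t3 (sq_nonneg K)
      rw [mul_add, hvol2] at *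
      linarith
    have t5 := mll t1 (show 0 ≤ M ^ 2 + 1 by positivity)
    linarith
  have hA : ∫ x in ball 0 σ, ‖Z x - q‖ ^ 2 ≤ 2 * (∫ x, ζ x ^ 2 * ‖Z x - Z1 x‖ ^ 2) + 2 * (CL * σ ^ 2 * Q) * (σ ^ n * ω) := by
    have hζc := hζ.continuous
    have := finBall (0 : E) σ
    have s1 : ∫ x in ball 0 σ, ‖Z x - q‖ ^ 2 ≤ ∫ x in ball 0 σ, (2 * (ζ x ^ 2 * ‖Z x - Z1 x‖ ^ 2) + 2 * (CL * σ ^ 2 * Q)) := by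
      refine smo (intOn_ball fz 0 σ) (intOn_ball fz 0 σ) mb_ fun x hx => ?_
      have hx1 : ‖x‖ < σ := mem_ball_zero_iff.1 hx
      have : ζ x = 1 := ζ.one_of_mem_closedBall (bscb hx)
      rw [this]
      have b0 : ‖Z1 x - q‖ ^ 2 ≤ CL * σ ^ 2 * Q := (hlip x lz).trans (by gcongr)
      have b2 : ‖Z x - q‖ ≤ ‖Z x - Z1 x‖ + ‖Z1 x - q‖ := nsl _ _ _
      have b3 : ‖Z x - q‖ ^ 2 ≤ (‖Z x - Z1 x‖ + ‖Z1 x - q‖) ^ 2 := by gcongr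
      nlinarith only [b0, b3, sq_nonneg (‖Z x - Z1 x‖ - ‖Z1 x - q‖)]
    refine s1.trans ?_
    rw [integral_add (intOn_ball fz 0 σ) (integrable_const _), icm, integral_const, mrau, smul_eq_mul, real_ball _ hσ]
    have hint : Integrable fun x => ζ x ^ 2 * ‖Z x - Z1 x‖ ^ 2 :=
      (by fun_prop : Continuous fun x => ζ x ^ 2 * ‖Z x - Z1 x‖ ^ 2).ics (ζ.hasCompactSupport.mono fun x hx h => hx (by simp [h]))
    have : ∫ x in ball 0 σ, ζ x ^ 2 * ‖Z x - Z1 x‖ ^ 2 ≤ ∫ x, ζ x ^ 2 * ‖Z x - Z1 x‖ ^ 2 :=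
      setIntegral_le_integral hint (eof fun x => pz)
    linarith
  have hca2 := hca.trans (mll hR hC2.le)
  refine hA.trans ?_
  have hfin := mll hca2 (show (0:ℝ) ≤ 2 by norm_num)
  have e1 : (2 * σ) ^ 2 * (2 * σ) ^ n = 4 * 2 ^ n * σ ^ (n + 2) := by rw [mul_pow, mul_pow]; ring
  have hs2 : 0 ≤ σ ^ (n + 2) := pz
  have e2 : 2 * (C2 * (2 * (Λ ^ 2 * (CL * (2 * σ) ^ 2 * Q) * ((2 * σ) ^ n * ω)))) = 4 * C2 * (Λ ^ 2 * (CL * 4 * ((2 : ℝ) ^ n * ω))) * σ ^ (n + 2) * Q := by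
    have : 2 * (C2 * (2 * (Λ ^ 2 * (CL * (2 * σ) ^ 2 * Q) * ((2 * σ) ^ n * ω)))) = 4 * C2 * Λ ^ 2 * CL * Q * ω * ((2 * σ) ^ 2 * (2 * σ) ^ n) := by ring
    rw [this, e1]; ring
  have e3 : 2 * (CL * σ ^ 2 * Q) * (σ ^ n * ω) = 2 * CL * ω * σ ^ (n + 2) * Q := by ring
  have p1 : 0 ≤ (CM + 1) * σ ^ (n + 2) * Q := pz
  have p2 : 0 ≤ C2 * K ^ 2 := pz
  have p3 : 0 ≤ C2 * ω2 * Qw := pz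
  have p4 : 0 ≤ K ^ 2 := pz
  nlinarith only [hfin, e2, e3, p1, p2, p3, p4, hQw]

/-- scaled excess -/
noncomputable def En (Z : E → E) (x : E) (r : ℝ) (q : E) : ℝ := ∫ y in ball (0 : E) 1, ‖Z (x + r • y) - q‖ ^ 2

theorem avg_mem {Q : Set E} (hQc : IsClosed Q) (hQ : Convex ℝ Q) {ρ : E → ℝ} (hρ : Continuous ρ) (h0 : ∀ y, 0 ≤ ρ y)
    (h1 : ∫ y in closedBall (0 : E) (1 / 2), ρ y = 1) {f : E → E} (hf : Continuous f) (hm : ∀ y ∈ closedBall (0 : E) (1 / 2), f y ∈ Q) :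
    ∫ y in closedBall (0 : E) (1 / 2), ρ y • f y ∈ Q := by
  by_contra hn
  obtain ⟨l, u, hl, hu⟩ := geometric_hahn_banach_closed_point hQ hQc hn
  have hI : ∀ {F : Type} [NormedAddCommGroup F] {g : E → F}, Continuous g → IntegrableOn g (closedBall (0 : E) (1 / 2)) :=
    fun hg => hg.continuousOn.integrableOn_compact (icb 0 (1 / 2))
  rw [← ContinuousLinearMap.integral_comp_comm l (hI fz)] at hu
  have : ∫ y in closedBall (0 : E) (1 / 2), l (ρ y • f y) ≤ ∫ y in closedBall (0 : E) (1 / 2), ρ y * u := by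
    refine smo (hI fz) (hI fz) measurableSet_closedBall fun y hy => ?_
    rw [map_smul, smul_eq_mul]
    exact mll (hl _ (hm y hy)).le (h0 y)
  rw [integral_mul_const, h1, one_mul] at this
  linarith

theorem decay_step {S : E →L[ℝ] E} (hS : SPD S) {β : ℝ} (hβ : 0 < β) (hβ1 : β < 1) :
    ∃ σ θ C : ℝ, 0 < σ ∧ σ ≤ 1 / 8 ∧ 0 < θ ∧ 0 < C ∧ ∀ (U Q : Set E) (z : E → ℝ) (Z V : E → E) (g : E → ℝ) (x q c : E) (r κ K : ℝ),
      (∀ x, HasGradientAt z (Z x) x) → Continuous Z → Continuous V → Continuous g → Weak U V g →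
      0 < r → closedBall x r ⊆ U → IsClosed Q → Convex ℝ Q → (∀ y ∈ closedBall x r, Z y ∈ Q) →
      (∀ y ∈ closedBall x r, ‖V y - S (Z y) - c‖ ≤ θ * ‖Z y - q‖ + κ) → (∀ y ∈ closedBall x r, |g y| ≤ K) →
      ∃ q' ∈ Q, En Z x (σ * r) q' ≤ 1 / 2 * (σ ^ β) ^ 2 * En Z x r q + C * (κ ^ 2 + (r * K) ^ 2) ∧
        ‖q' - q‖ ^ 2 ≤ C * En Z x r q := by
  obtain ⟨ρ, hρ, hρ0, hρ1, C, hC, H⟩ := unit_decay hS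
  obtain ⟨σ, hσ, hσ8, hσC⟩ : ∃ σ : ℝ, 0 < σ ∧ σ ≤ 1 / 8 ∧ C * σ ^ 2 ≤ 1 / 4 * (σ ^ β) ^ 2 := by
    refine ⟨min (1 / 8) ((4 * C)⁻¹ ^ (1 / (2 - 2 * β))), pz, min_le_left _ _, ?_⟩
    set σ := min (1 / 8 : ℝ) ((4 * C)⁻¹ ^ (1 / (2 - 2 * β)))
    have hσ : 0 < σ := pz
    have h1 : σ ^ (2 - 2 * β) ≤ (4 * C)⁻¹ := by
      calc σ ^ (2 - 2 * β) ≤ ((4 * C)⁻¹ ^ (1 / (2 - 2 * β))) ^ (2 - 2 * β) :=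
            Real.rpow_le_rpow hσ.le (min_le_right _ _) lz
        _ = _ := by rw [← Real.rpow_mul pz, one_div_mul_cancel lz, Real.rpow_one]
    have h2 : σ ^ 2 = σ ^ (2 - 2 * β) * (σ ^ β) ^ 2 := by
      rw [← Real.rpow_natCast (σ ^ β), ← Real.rpow_mul hσ.le, ← Real.rpow_add hσ, ← Real.rpow_natCast]
      congr 1; push_cast; ring
    rw [h2]
    calc C * (σ ^ (2 - 2 * β) * (σ ^ β) ^ 2) ≤ C * ((4 * C)⁻¹ * (σ ^ β) ^ 2) := by gcongr
      _ = _ := by field_simp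
  obtain ⟨D, hD, H⟩ := H σ hσ hσ8
  set n := Module.finrank ℝ E
  set ω := volume.real (ball (0 : E) 1)
  set B := D * (σ ^ n)⁻¹
  have hB : 0 < B := pz
  have hω : 0 ≤ ω := pz
  refine ⟨σ, √((σ ^ β) ^ 2 / (8 * B)), C + B * (1 + 2 * ω), hσ, hσ8, pz, pz, ?_⟩
  set θ := √((σ ^ β) ^ 2 / (8 * B))
  have hθ : 2 * B * θ ^ 2 = 1 / 4 * (σ ^ β) ^ 2 := by
    rw [Real.sq_sqrt pz]; field_simp; norm_num
  intro U Q z Z V g x q c r κ K hz hZ hV hg hw hr hU hQc hQ hZQ hVS hgK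
  have hmem : ∀ y ∈ closedBall (0 : E) 1, x + r • y ∈ closedBall x r := by
    intro y hy
    rw [mcz] at hy
    rw [mem_closedBall, den, ascl, norm_smul, nea, abs_of_pos hr]
    exact mul_le_of_le_one_right hr.le hy
  have a1 : ∀ y, HasGradientAt (fun y => r⁻¹ * z (x + r • y) - ⟪q, y⟫) (Z (x + r • y) - q) y := by
    intro y
    have h1 : HasFDerivAt (fun y : E => x + r • y) (r • ContinuousLinearMap.id ℝ E) y := ((hasFDerivAt_id y).const_smul r).const_add x
    have h2 := ((hz (x + r • y)).hasFDerivAt.comp y h1).const_mul r⁻¹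
    have h3 := (innerSL ℝ q).hasFDerivAt (x := y)
    refine (h2.sub h3).congr_fderiv ?_
    ext v
    simp [inner_sub_left, hr.ne', inner_smul_right]
  have a2 : Weak (ball 0 1) (fun y => S (Z (x + r • y) - q) - (S (Z (x + r • y) - q) - (V (x + r • y) - (c + S q)))) (fun y => r * g (x + r • y)) := by
    intro φ hφ hφc hs
    have h := weak_rescale (r := 1) hw x hr hφ (hs.trans bscb) (by rwa [mul_one])
    rw [← h]
    have e : ∀ y, fd φ y (S (Z (x + r • y) - q) - (S (Z (x + r • y) - q) - (V (x + r • y) - (c + S q)))) = fd φ y (V (x + r • y)) - fd φ y (c + S q) := by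
      intro y; rw [sub_sub_cancel, map_sub]
    simp only [e]
    rw [integral_sub, integral_fderiv_const hφ hφc, sub_zero]
    · exact (continuous_fderiv_ap hφ fz).ics (hcs_fderiv_ap _ hφc)
    · exact (continuous_fderiv_ap hφ continuous_const).ics (hcs_fderiv_ap _ hφc)
  have a3 : ∀ y ∈ ball (0 : E) 1, |r * g (x + r • y)| ≤ r * K := by
    intro y hy
    rw [abs_mul, abs_of_pos hr]
    exact mll (hgK _ (hmem y (bscb hy))) hr.le
  obtain ⟨h1, h2⟩ := H _ _ _ _ (r * K) a1 fz fz fz a2 a3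
  set q' := ∫ y in closedBall (0 : E) (1 / 2), ρ y • Z (x + r • (hlf • y))
  have hI : ∀ {F : Type} [NormedAddCommGroup F] {g : E → F}, Continuous g → IntegrableOn g (closedBall (0 : E) (1 / 2)) :=
    fun hg => hg.continuousOn.integrableOn_compact (icb 0 (1 / 2))
  have e1 : ∫ y in closedBall (0 : E) (1 / 2), ρ y • (Z (x + r • (hlf • y)) - q) = q' - q := by
    simp only [smul_sub]
    rw [integral_sub (hI fz) (hI fz), integral_smul_const, hρ1, one_smul]
  rw [e1] at h1 h2
  have hW : ∫ y in ball (0 : E) 1, ‖S (Z (x + r • y) - q) - (V (x + r • y) - (c + S q))‖ ^ 2 ≤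
      2 * θ ^ 2 * En Z x r q + 2 * κ ^ 2 * ω := by
    have : ∫ y in ball (0 : E) 1, ‖S (Z (x + r • y) - q) - (V (x + r • y) - (c + S q))‖ ^ 2 ≤
        ∫ y in ball (0 : E) 1, (2 * θ ^ 2 * ‖Z (x + r • y) - q‖ ^ 2 + 2 * κ ^ 2) := by
      refine smo (intOn_ball fz _ _) (intOn_ball fz _ _) mb_ fun y hy => ?_
      have h := hVS _ (hmem y (bscb hy))
      have e : S (Z (x + r • y) - q) - (V (x + r • y) - (c + S q)) = -(V (x + r • y) - S (Z (x + r • y)) - c) := by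
        rw [map_sub]; abel
      rw [e, norm_neg]
      calc _ ≤ (θ * ‖Z (x + r • y) - q‖ + κ) ^ 2 := by gcongr
        _ ≤ _ := by nlinarith only [sq_nonneg (θ * ‖Z (x + r • y) - q‖ - κ)]
    have hfb := finBall (0 : E) 1
    rw [integral_add (intOn_ball fz _ _) (integrable_const _), icm, integral_const, mrau, smul_eq_mul] at this
    unfold En; linarith
  have hE : 0 ≤ En Z x r q := integral_nonneg fun _ => pz
  refine ⟨q', avg_mem hQc hQ hρ hρ0 hρ1 fz fun y hy => hZQ _ (hmem _ ?_), ?_, ?_⟩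
  · rw [mcz] at hy ⊢
    rw [norm_smul, nea, abs_of_pos nz]; linarith
  · have e2 : En Z x (σ * r) q' = (σ ^ n)⁻¹ * ∫ y in ball (0 : E) σ, ‖Z (x + r • y) - q - (q' - q)‖ ^ 2 := by
      have := setIntegral_affine (fun y : E => ‖Z (x + r • y) - q - (q' - q)‖ ^ 2) 0 hσ 1
      simp only [zero_add, mul_one, smul_eq_mul] at this
      rw [← this]
      unfold En
      congr 1; ext y
      rw [smul_smul, mul_comm r σ]; congr 2; abel
    rw [e2]
    have h3 : (σ ^ n)⁻¹ * (∫ y in ball (0 : E) σ, ‖Z (x + r • y) - q - (q' - q)‖ ^ 2) ≤ (σ ^ n)⁻¹ * (C * σ ^ (n + 2) * En Z x r q +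
        D * (2 * θ ^ 2 * En Z x r q + 2 * κ ^ 2 * ω + (r * K) ^ 2)) := by
      refine mll (h2.trans ?_) pz
      exact add_le_add le_rfl (mll lz hD.le)
    refine h3.trans ?_
    have e3 : (σ ^ n)⁻¹ * (C * σ ^ (n + 2) * En Z x r q +
        D * (2 * θ ^ 2 * En Z x r q + 2 * κ ^ 2 * ω + (r * K) ^ 2)) = C * σ ^ 2 * En Z x r q + 2 * B * θ ^ 2 * En Z x r q + B * (2 * κ ^ 2 * ω + (r * K) ^ 2) := by
      simp only [B]; field_simp; ring
    rw [e3, hθ]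
    have h4 := mlr hσC hE
    have h5 : B * (2 * κ ^ 2 * ω + (r * K) ^ 2) ≤ (C + B * (1 + 2 * ω)) * (κ ^ 2 + (r * K) ^ 2) := by
      have : (C + B * (1 + 2 * ω)) * (κ ^ 2 + (r * K) ^ 2) - B * (2 * κ ^ 2 * ω + (r * K) ^ 2) = C * (κ ^ 2 + (r * K) ^ 2) + B * (κ ^ 2 + 2 * ω * (r * K) ^ 2) := by ring
      have : 0 ≤ C * (κ ^ 2 + (r * K) ^ 2) + B * (κ ^ 2 + 2 * ω * (r * K) ^ 2) := pz
      linarith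
    linarith
  · refine h1.trans ?_
    have : 0 ≤ B * (1 + 2 * ω) * En Z x r q := pz
    change C * En Z x r q ≤ _
    linarith

theorem En_eq (Z : E → E) (x : E) {r : ℝ} (hr : 0 < r) (q : E) :
    ∫ y in ball x r, ‖Z y - q‖ ^ 2 = r ^ Module.finrank ℝ E * En Z x r q := by
  have := setIntegral_affine (fun y : E => ‖Z y - q‖ ^ 2) x hr 1
  unfold En
  rw [this, mul_one, smul_eq_mul, mul_inv_cancel_left₀ pz]

theorem En_compare {Z : E → E} (hZ : Continuous Z) {x y q q' : E} {r : ℝ} (hr : 0 < r) (hxy : ‖x - y‖ ≤ r / 2) :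
    ‖q - q'‖ ^ 2 * volume.real (ball (0 : E) 1) ≤ 2 * 2 ^ Module.finrank ℝ E * (En Z x r q + En Z y r q') := by
  set n := Module.finrank ℝ E
  have hi : ∀ {a b : E}, ball y (r / 2) ⊆ ball a r → ∫ w in ball y (r / 2), ‖Z w - b‖ ^ 2 ≤ r ^ n * En Z a r b := by
    intro a b h
    rw [← En_eq Z a hr b]
    exact setIntegral_mono_set (intOn_ball fz _ _) (eof fun _ => pz) (eof h)
  have h1 := hi (a := x) (b := q) (fun w hw => by
    rw [mem_ball] at hw ⊢
    have := dist_triangle w y x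
    rw [dist_comm y x, den x y] at this; linarith)
  have h2 := hi (a := y) (b := q') (bsb lz)
  have h3 : ∫ w in ball y (r / 2), ‖q - q'‖ ^ 2 ≤ ∫ w in ball y (r / 2), (2 * ‖Z w - q‖ ^ 2 + 2 * ‖Z w - q'‖ ^ 2) := by
    refine smo (intOn_ball fz _ _) (intOn_ball fz _ _) mb_ fun w _ => ?_
    have : ‖q - q'‖ ≤ ‖Z w - q‖ + ‖Z w - q'‖ := by
      rw [norm_sub_rev (Z w) q]; simpa using nsl q (Z w) q'
    calc _ ≤ (‖Z w - q‖ + ‖Z w - q'‖) ^ 2 := by gcongr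
      _ ≤ _ := by nlinarith [sq_nonneg (‖Z w - q‖ - ‖Z w - q'‖)]
  rw [integral_add (intOn_ball fz _ _) (intOn_ball fz _ _), icm, icm,
    setIntegral_const, real_ball _ pz, smul_eq_mul] at h3
  have h4 : (r / 2) ^ n * volume.real (ball (0 : E) 1) * ‖q - q'‖ ^ 2 ≤ 2 * (r ^ n * (En Z x r q + En Z y r q')) := lz
  rw [div_pow] at h4
  have hrn : 0 < r ^ n := pz
  rw [← mul_le_mul_iff_right₀ hrn]
  have h5 := mll h4 (show (0 : ℝ) ≤ 2 ^ n by positivity)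
  calc _ = 2 ^ n * (r ^ n / 2 ^ n * volume.real (ball (0 : E) 1) * ‖q - q'‖ ^ 2) := by field_simp
    _ ≤ _ := h5
    _ = _ := by ring

theorem camp_point {Z : E → E} (hZ : Continuous Z) {x : E} {Q : Set E} {σ C A D r0 : ℝ} (hσ : 0 < σ) (hσ1 : σ < 1) (hD : 0 < D) (hD1 : D < 1) (hC : 0 ≤ C)
    (hA : 0 ≤ A) {q0 : E} (hq0 : q0 ∈ Q) (hb : 1 + ‖q0‖ ≤ A) (hb' : En Z x r0 q0 ≤ A ^ 2)
    (step : ∀ k q, q ∈ Q → En Z x (σ ^ k * r0) q ≤ A ^ 2 * (D ^ k) ^ 2 → 1 + ‖q‖ ≤ A * (1 + C / (1 - D)) →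
      ∃ q' ∈ Q, En Z x (σ ^ (k + 1) * r0) q' ≤ A ^ 2 * (D ^ (k + 1)) ^ 2 ∧ ‖q' - q‖ ≤ C * A * D ^ k) (k : ℕ) :
    ∃ q, En Z x (σ ^ k * r0) q ≤ A ^ 2 * (D ^ k) ^ 2 ∧ ‖Z x - q‖ ≤ C * A * D ^ k / (1 - D) ∧ ‖q‖ ≤ A * (1 + C / (1 - D)) := by
  let P : ℕ → E → Prop := fun k q => q ∈ Q ∧ En Z x (σ ^ k * r0) q ≤ A ^ 2 * (D ^ k) ^ 2 ∧ 1 + ‖q‖ ≤ A + C * A * ((1 - D ^ k) / (1 - D))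
  have hP1 : ∀ k q, P k q → 1 + ‖q‖ ≤ A * (1 + C / (1 - D)) := by
    intro k q h
    have h1 : 0 < 1 - D := lz
    have : (1 - D ^ k) / (1 - D) ≤ 1 / (1 - D) := by
      gcongr; linarith [pow_pos hD k]
    calc _ ≤ A + C * A * ((1 - D ^ k) / (1 - D)) := h.2.2
      _ ≤ A + C * A * (1 / (1 - D)) := by gcongr
      _ = _ := by ring
  have st : ∀ k q, P k q → ∃ q', P (k + 1) q' ∧ ‖q' - q‖ ≤ C * A * D ^ k := by
    intro k q h
    obtain ⟨q', h1, h2, h3⟩ := step k q h.1 h.2.1 (hP1 k q h)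
    refine ⟨q', ⟨h1, h2, ?_⟩, h3⟩
    have h4 : ‖q'‖ ≤ ‖q' - q‖ + ‖q‖ := by simpa using norm_add_le (q' - q) q
    have h5 : (1 - D ^ (k + 1)) / (1 - D) = (1 - D ^ k) / (1 - D) + D ^ k := by
      have : 1 - D ≠ 0 := lz
      field_simp; ring
    rw [h5]
    linarith [h.2.2]
  choose! nxt hn using st
  let s : ℕ → E := fun k => Nat.rec q0 (fun k q => nxt k q) k
  have hs : ∀ k, P k (s k) := by
    intro k
    induction k with
    | zero => exact ⟨hq0, by simpa [s] using hb', by simpa [s] using hb⟩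
    | succ k ih => exact (hn k _ ih).1
  have hd : ∀ k, dist (s k) (s (k + 1)) ≤ C * A * D ^ k := fun k => by
    rw [dist_comm, den]; exact (hn k _ (hs k)).2
  obtain ⟨L, hL⟩ := cauchySeq_tendsto_of_complete (cauchySeq_of_le_geometric D _ hD1 hd)
  have hLZ : Z x = L := by
    have hc : Continuous fun q : ℝ × E => ∫ y in closedBall (0 : E) (1 / 2), ‖Z (x + q.1 • y) - q.2‖ ^ 2 := by
      refine cpi (μ := (volume : Measure E)) (f := fun (q : ℝ × E) y => ‖Z (x + q.1 • y) - q.2‖ ^ 2) ?_ (icb 0 (1 / 2))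
      unfold Function.uncurry; fun_prop
    have h1 : Filter.Tendsto (fun k => (σ ^ k * r0, s k)) Filter.atTop (𝓝 (0, L)) := by
      refine Filter.Tendsto.prodMk_nhds ?_ hL
      simpa using (tpz hσ.le hσ1).mul_const r0
    have h2 := (hc.tendsto _).comp h1
    have h3 : Filter.Tendsto (fun k => A ^ 2 * (D ^ k) ^ 2) Filter.atTop (𝓝 0) := by
      simpa using ((tpz hD.le hD1).pow 2).const_mul (A ^ 2)
    have h4 := le_of_tendsto_of_tendsto h2 h3 (eof fun k => (?_ : _ ≤ _))
    · simp only [zero_smul, add_zero, setIntegral_const, smul_eq_mul] at h4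
      have h5 : 0 < volume.real (closedBall (0 : E) (1 / 2)) :=
        ENNReal.toReal_pos (measure_closedBall_pos _ _ nz).ne' measure_closedBall_lt_top.ne
      have h6 : ‖Z x - L‖ ^ 2 ≤ 0 := by
        by_contra h; push Not at h; have := mul_pos h5 h; linarith
      have : ‖Z x - L‖ = 0 := by nlinarith [norm_nonneg (Z x - L)]
      exact sub_eq_zero.1 (norm_eq_zero.1 this)
    · refine le_trans ?_ (hs k).2.1
      exact setIntegral_mono_set (intOn_ball fz _ _) (eof fun _ => pz)
        (eof (cbsb nz))
  refine ⟨s k, (hs k).2.1, ?_, ?_⟩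
  · rw [hLZ, ← den, dist_comm]
    exact dist_le_of_le_geometric_of_tendsto D _ hD1 hd hL k
  · linarith [hP1 k _ (hs k)]

/-- Main interior Hölder estimate. -/
theorem holder_est {S : E →L[ℝ] E} (hS : SPD S) {β : ℝ} (hβ : 0 < β) (hβ1 : β < 1) :
    ∃ θ : ℝ, 0 < θ ∧ ∀ K R M : ℝ, 0 < K → 0 < R → ∃ C : ℝ, 0 < C ∧
      ∀ (U Q : Set E) (z : E → ℝ) (Z V : E → E) (g : E → ℝ) (x0 q0 : E),
      (∀ x, HasGradientAt z (Z x) x) → Continuous Z → Continuous V → Continuous g → Weak U V g →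
      closedBall x0 (2 * R) ⊆ U → IsClosed Q → Convex ℝ Q → (∀ y ∈ closedBall x0 (2 * R), Z y ∈ Q) →
      q0 ∈ Q → ‖q0‖ ≤ M → ∫ y in ball x0 (2 * R), ‖Z y - q0‖ ^ 2 ≤ M →
      (∀ x ∈ closedBall x0 R, ∀ r, 0 < r → r ≤ R → ∀ q ∈ Q, ∃ c, ∀ y ∈ closedBall x r,
        ‖V y - S (Z y) - c‖ ≤ θ * ‖Z y - q‖ + K * r ^ β * (1 + ‖q‖)) → (∀ y ∈ closedBall x0 (2 * R), |g y| ≤ K) →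
      ∀ x ∈ closedBall x0 R, ‖Z x‖ ≤ C ∧ ∀ y ∈ closedBall x0 R, ‖Z x - Z y‖ ≤ C * ‖x - y‖ ^ β := by
  obtain ⟨σ, θ, C, hσ, hσ8, hθ, hC, H⟩ := decay_step hS hβ hβ1
  refine ⟨θ, hθ, fun K R M hK hR => ?_⟩
  set D := σ ^ β
  have hD : 0 < D := pz
  have hσ1 : σ < 1 := lz
  have hD1 : D < 1 := Real.rpow_lt_one hσ.le hσ1 hβ
  have hD1' : 0 < 1 - D := lz
  set C4 := 1 + √C / (1 - D)
  have hC4 : 1 ≤ C4 := le_add_of_nonneg_right pz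
  obtain ⟨r0, hr0, hr01, hr0R, hr0K⟩ : ∃ r0 : ℝ, 0 < r0 ∧ r0 ≤ 1 ∧ r0 ≤ R ∧ 2 * C * K ^ 2 * (r0 ^ β) ^ 2 * C4 ^ 2 ≤ 1 / 2 * D ^ 2 := by
    have hc : Filter.Tendsto (fun r : ℝ => 2 * C * K ^ 2 * (r ^ β) ^ 2 * C4 ^ 2) (𝓝[>] 0) (𝓝 (2 * C * K ^ 2 * ((0 : ℝ) ^ β) ^ 2 * C4 ^ 2)) := by
      refine Filter.Tendsto.mono_left ?_ nwn
      have : ContinuousAt (fun r : ℝ => r ^ β) 0 := Real.continuousAt_rpow_const _ _ (Or.inr hβ.le)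
      exact ((this.pow 2).const_mul _).mul_const _
    rw [Real.zero_rpow hβ.ne'] at hc
    have h1 := hc.eventually (gt_mem_nhds (show 2 * C * K ^ 2 * (0 : ℝ) ^ 2 * C4 ^ 2 < 1 / 2 * D ^ 2 by simp; positivity))
    have h2 : ∀ᶠ r : ℝ in 𝓝[>] 0, r ∈ Ioc 0 (min 1 R) := Ioc_mem_nhdsGT pz
    obtain ⟨r, h3, h4⟩ := (h1.and h2).exists
    exact ⟨r, h4.1, h4.2.trans (min_le_left _ _), h4.2.trans (min_le_right _ _), h3.le⟩
  set n := Module.finrank ℝ E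
  set A := 1 + |M| + √((r0 ^ n)⁻¹ * |M|)
  set ω := volume.real (ball (0 : E) 1)
  have hω : 0 < ω := ENNReal.toReal_pos (measure_ball_pos _ _ nz).ne' measure_ball_lt_top.ne
  set C5 := √C * A / (1 - D)
  set C6 := 2 * C5 + √(4 * 2 ^ n / ω) * A
  have hA : 1 ≤ A := by
    have : 0 ≤ √((r0 ^ n)⁻¹ * |M|) := pz
    have := abs_nonneg M; simp only [A]; linarith
  have hC5 : 0 ≤ C5 := pz
  set C7 := A * C4 + C5
  have hC7 : 0 < C7 := pz
  refine ⟨C7 + C6 * (2 / (σ * r0)) ^ β + 2 * C7 * (2 / r0) ^ β, pz, ?_⟩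
  intro U Q z Z V g x0 q0 hz hZ hV hg hw hU hQc hQ hZQ hq0 hq0M hM hVS hgK
  have key : ∀ x ∈ closedBall x0 R, ∀ k : ℕ, ∃ q, En Z x (σ ^ k * r0) q ≤ A ^ 2 * (D ^ k) ^ 2 ∧ ‖Z x - q‖ ≤ √C * A * D ^ k / (1 - D) ∧ ‖q‖ ≤ A * C4 := by
    intro x hx k
    have hsub : ∀ r ≤ R, closedBall x r ⊆ closedBall x0 (2 * R) := by
      intro r hr y hy
      rw [mem_closedBall] at *
      linarith [dist_triangle y x x0]
    refine camp_point (Q := Q) hZ hσ hσ1 hD hD1 pz pz hq0 ?_ ?_ ?_ k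
    · have : 0 ≤ √((r0 ^ n)⁻¹ * |M|) := pz
      simp only [A]; linarith [le_abs_self M]
    · have h1 : r0 ^ n * En Z x r0 q0 ≤ |M| := by
        rw [← En_eq Z x hr0 q0]
        refine le_trans (setIntegral_mono_set (intOn_ball fz _ _) (eof fun _ => pz)
          (eof ?_)) (hM.trans (le_abs_self M))
        intro y hy
        change y ∈ ball _ _ at hy
        rw [mem_ball] at *; rw [mem_closedBall] at hx
        change dist y x0 < 2 * R
        linarith [dist_triangle y x x0]
      have h2 : En Z x r0 q0 ≤ (r0 ^ n)⁻¹ * |M| := by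
        rw [le_inv_mul_iff₀ pz]; exact h1
      refine h2.trans ?_
      conv_lhs => rw [← Real.sq_sqrt (show 0 ≤ (r0 ^ n)⁻¹ * |M| by positivity)]
      gcongr
      simp only [A]; linarith [abs_nonneg M]
    · intro k q hq h1 h2
      set r := σ ^ k * r0
      have hr : 0 < r := pz
      have hrr : r ≤ r0 := mlo hr0.le (pow_le_one₀ hσ.le hσ1.le)
      have hrβ : r ^ β = D ^ k * r0 ^ β := by
        rw [Real.mul_rpow pz hr0.le, ← Real.rpow_natCast, ← Real.rpow_natCast, ← Real.rpow_mul hσ.le, ← Real.rpow_mul hσ.le, mul_comm (k : ℝ)]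
      obtain ⟨c, hc⟩ := hVS x hx r hr (hrr.trans hr0R) q hq
      obtain ⟨q', hq', h3, h4⟩ := H U Q z Z V g x q c r _ K hz hZ hV hg hw hr ((hsub r (hrr.trans hr0R)).trans hU) hQc hQ
        (fun y hy => hZQ y (hsub r (hrr.trans hr0R) hy)) hc (fun y hy => hgK y (hsub r (hrr.trans hr0R) hy))
      refine ⟨q', hq', ?_, ?_⟩
      · rw [show σ ^ (k + 1) * r0 = σ * r by simp only [r]; ring]
        refine h3.trans ?_
        have h5 : r ≤ r ^ β := by
          conv_lhs => rw [← Real.rpow_one r]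
          exact Real.rpow_le_rpow_of_exponent_ge hr (hrr.trans hr01) hβ1.le
        have h6 : K * r ^ β * (1 + ‖q‖) ≤ K * (D ^ k * r0 ^ β) * (A * C4) := by rw [hrβ]; gcongr
        have h7 : r * K ≤ K * (D ^ k * r0 ^ β) * (A * C4) := by
          calc r * K ≤ K * (D ^ k * r0 ^ β) * 1 := by rw [← hrβ, mul_one, mul_comm]; gcongr
            _ ≤ _ := by gcongr; nlinarith only [hA, hC4]
        have h8 : (K * r ^ β * (1 + ‖q‖)) ^ 2 + (r * K) ^ 2 ≤ 2 * (K * (D ^ k * r0 ^ β) * (A * C4)) ^ 2 := by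
          have := pow_le_pow_left₀ pz h6 2
          have := pow_le_pow_left₀ pz h7 2
          linarith
        have h9 : C * (2 * (K * (D ^ k * r0 ^ β) * (A * C4)) ^ 2) ≤ 1 / 2 * D ^ 2 * (A ^ 2 * (D ^ k) ^ 2) := by
          calc _ = (2 * C * K ^ 2 * (r0 ^ β) ^ 2 * C4 ^ 2) * (A ^ 2 * (D ^ k) ^ 2) := by ring
            _ ≤ _ := by gcongr
        have h10 := mll h8 hC.le
        have h11 := mll h1 (show 0 ≤ 1 / 2 * D ^ 2 by positivity)
        calc _ ≤ 1 / 2 * D ^ 2 * (A ^ 2 * (D ^ k) ^ 2) + 1 / 2 * D ^ 2 * (A ^ 2 * (D ^ k) ^ 2) := add_le_add h11 (h10.trans h9)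
          _ = _ := by ring
      · have h5 : ‖q' - q‖ ^ 2 ≤ (√C * A * D ^ k) ^ 2 := by
          refine h4.trans ((mll h1 hC.le).trans_eq ?_)
          rw [mul_pow, mul_pow, Real.sq_sqrt hC.le]; ring
        exact (pow_le_pow_iff_left₀ nnz pz two_ne_zero).1 h5
  have bd : ∀ x ∈ closedBall x0 R, ‖Z x‖ ≤ C7 := by
    intro x hx
    obtain ⟨q, -, h2, h3⟩ := key x hx 0
    have h4 : ‖Z x‖ ≤ ‖Z x - q‖ + ‖q‖ := by simpa using norm_add_le (Z x - q) q
    rw [pow_zero, mul_one] at h2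
    simp only [C7]; linarith
  intro x hx
  have p1 : 0 ≤ C6 * (2 / (σ * r0)) ^ β := pz
  have p2 : 0 ≤ 2 * C7 * (2 / r0) ^ β := pz
  refine ⟨by linarith [bd x hx], fun y hy => ?_⟩
  rcases eq_or_ne x y with rfl | hne
  · simp [Real.zero_rpow hβ.ne']
  have hd : 0 < ‖x - y‖ := norm_pos_iff.2 (sub_ne_zero.2 hne)
  rcases le_or_gt ‖x - y‖ (r0 / 2) with hle | hgt
  · obtain ⟨k, hk1, hk2⟩ := exists_nat_pow_near_of_lt_one (x := 2 * ‖x - y‖ / r0) (y := σ) pz (by rw [div_le_one hr0]; linarith) hσ hσ1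
    have hr : 0 < σ ^ k * r0 := pz
    rw [div_le_iff₀ hr0] at hk2
    obtain ⟨q, e1, e2, -⟩ := key x hx k
    obtain ⟨q', e3, e4, -⟩ := key y hy k
    have e5 := En_compare (q := q) (q' := q') hZ hr (show ‖x - y‖ ≤ σ ^ k * r0 / 2 by linarith)
    have e6 : ‖q - q'‖ ≤ √(4 * 2 ^ n / ω) * A * D ^ k := by
      refine (pow_le_pow_iff_left₀ nnz pz two_ne_zero).1 ?_
      rw [mul_pow, mul_pow, Real.sq_sqrt pz]
      rw [← mul_le_mul_iff_left₀ hω]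
      calc _ ≤ _ := e5
        _ ≤ 2 * 2 ^ n * (A ^ 2 * (D ^ k) ^ 2 + A ^ 2 * (D ^ k) ^ 2) := by gcongr
        _ = _ := by field_simp; ring
    have e7 : D ^ k ≤ (2 / (σ * r0)) ^ β * ‖x - y‖ ^ β := by
      rw [← Real.mul_rpow pz hd.le]
      have : D ^ k = (σ ^ k) ^ β := by
        rw [← Real.rpow_natCast, ← Real.rpow_natCast, ← Real.rpow_mul hσ.le, ← Real.rpow_mul hσ.le, mul_comm (k : ℝ)]
      rw [this]
      refine Real.rpow_le_rpow pz ?_ hβ.le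
      rw [pow_succ, lt_div_iff₀ hr0] at hk1
      rw [div_mul_eq_mul_div, le_div_iff₀ pz]
      linarith
    have e8 : ‖Z x - Z y‖ ≤ ‖Z x - q‖ + ‖q - q'‖ + ‖Z y - q'‖ := by
      have h1 := nsl (Z x) q (Z y)
      have h2 := nsl q q' (Z y)
      rw [norm_sub_rev q' (Z y)] at h2; linarith
    calc ‖Z x - Z y‖ ≤ C6 * D ^ k := by
          refine e8.trans ((add_le_add (add_le_add e2 e6) e4).trans_eq ?_)
          simp only [C6, C5]; ring
      _ ≤ C6 * ((2 / (σ * r0)) ^ β * ‖x - y‖ ^ β) := by gcongr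
      _ = (C6 * (2 / (σ * r0)) ^ β) * ‖x - y‖ ^ β := by ring
      _ ≤ _ := by gcongr; linarith
  · have h1 : 1 ≤ (2 / r0 * ‖x - y‖) ^ β := Real.one_le_rpow (by rw [div_mul_eq_mul_div, le_div_iff₀ hr0]; linarith) hβ.le
    rw [Real.mul_rpow pz hd.le] at h1
    calc ‖Z x - Z y‖ ≤ 2 * C7 * 1 := by linarith [norm_sub_le (Z x) (Z y), bd x hx, bd y hy]
      _ ≤ 2 * C7 * ((2 / r0) ^ β * ‖x - y‖ ^ β) := by gcongr
      _ = (2 * C7 * (2 / r0) ^ β) * ‖x - y‖ ^ β := by ring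
      _ ≤ _ := by gcongr; linarith

theorem fderiv_zero_off {φ : E → ℝ} {x : E} (h : x ∉ tsupport φ) : fd φ x = 0 := by
  by_contra h'
  exact h (support_fderiv_subset ℝ h')

theorem Weak.congr {U : Set E} {V V' : E → E} {g g' : E → ℝ} (hw : Weak U V g) (h : ∀ x ∈ U, V' x = V x ∧ g' x = g x) : Weak U V' g' := by
  intro φ hφ hc hs
  have e1 : ∀ x, fd φ x (V' x) = fd φ x (V x) := fun x => by
    by_cases hx : x ∈ tsupport φ
    · rw [(h x (hs hx)).1]
    · simp [fderiv_zero_off hx]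
  have e2 : ∀ x, g' x * φ x = g x * φ x := fun x => by
    by_cases hx : x ∈ tsupport φ
    · rw [(h x (hs hx)).2]
    · simp [ime hx]
  simp only [e1, e2]; exact hw φ hφ hc hs

theorem Weak.mono {U U' : Set E} {V : E → E} {g : E → ℝ} (hw : Weak U V g) (h : U' ⊆ U) : Weak U' V g :=
  fun φ hφ hc hs => hw φ hφ hc (hs.trans h)

theorem globalize {U : Set E} (hU : IsOpen U) {z : E → ℝ} {Z V : E → E} {g : E → ℝ} (hz : ContDiffOn ℝ 1 z U) (hZ : ∀ x ∈ U, HasGradientAt z (Z x) x)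
    (hV : ContinuousOn V U) (hg : ContinuousOn g U) (hw : Weak U V g) {x0 : E} {R : ℝ} (hR : 0 < R) (hs : closedBall x0 (3 * R) ⊆ U) :
    ∃ (z' : E → ℝ) (Z' V' : E → E) (g' : E → ℝ), (∀ x, HasGradientAt z' (Z' x) x) ∧ Continuous Z' ∧ Continuous V' ∧ Continuous g' ∧
      Weak (ball x0 (5 / 2 * R)) V' g' ∧ ∀ x ∈ ball x0 (5 / 2 * R), z' x = z x ∧ Z' x = Z x ∧ V' x = V x ∧ g' x = g x := by
  let χ : ContDiffBump x0 := ⟨5 / 2 * R, 3 * R, pz, lz⟩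
  have hχ : ContDiff ℝ 1 χ := χ.contDiff
  have hχs : tsupport χ ⊆ U := by rw [χ.tsupport_eq]; exact hs
  have h1 : ∀ x ∈ ball x0 (5 / 2 * R), χ x = 1 := fun x hx => χ.one_of_mem_closedBall (bscb hx)
  have hz' : ContDiff ℝ 1 (fun x => χ x • z x) := by
    refine contDiff_iff_contDiffAt.2 fun x => ?_
    by_cases hx : x ∈ tsupport χ
    · exact hχ.contDiffAt.smul (hz.contDiffAt (hU.mem_nhds (hχs hx)))
    · refine (contDiffAt_const (c := (0 : ℝ))).congr_of_eventuallyEq ?_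
      filter_upwards [nmt.1 hx] with y hy
      simp [hy]
  have hcont : ∀ {F : Type} [NormedAddCommGroup F] [NormedSpace ℝ F] {f : E → F}, ContinuousOn f U → Continuous fun x => χ x • f x := by
    intro F _ _ f hf
    refine continuous_of_tsupport fun x hx => ?_
    have hxU := hχs (tsupport_smul_subset_left _ _ hx)
    exact hχ.continuous.continuousAt.smul (hf.continuousAt (hU.mem_nhds hxU))
  have hb : ∀ x ∈ ball x0 (5 / 2 * R), x ∈ U := fun x hx => hs (bscb (bsb lz hx))
  refine ⟨_, gradient (fun x => χ x • z x), fun x => χ x • V x, fun x => χ x • g x,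
    fun x => (hz'.differentiable sz x).hasGradientAt, ?_, hcont hV, hcont hg, ?_, ?_⟩
  · exact (tD E).symm.continuous.comp (hz'.continuous_fderiv sz)
  · exact (hw.mono hb).congr fun x hx => by simp [h1 x hx]
  · intro x hx
    refine ⟨by simp [h1 x hx], ?_, by simp [h1 x hx], by simp [h1 x hx]⟩
    refine HasGradientAt.gradient ((hZ x (hb x hx)).congr_of_eventuallyEq ?_)
    filter_upwards [isOpen_ball.mem_nhds hx] with y hy
    simp [h1 y hy]

theorem holder_loc {S : E →L[ℝ] E} (hS : SPD S) {β : ℝ} (hβ : 0 < β) (hβ1 : β < 1) :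
    ∃ θ : ℝ, 0 < θ ∧ ∀ K R M : ℝ, 0 < K → 0 < R → ∃ C : ℝ, 0 < C ∧
      ∀ (U Q : Set E) (z : E → ℝ) (Z V : E → E) (g : E → ℝ) (x0 q0 : E), IsOpen U →
      ContDiffOn ℝ 1 z U → (∀ x ∈ U, HasGradientAt z (Z x) x) → ContinuousOn V U → ContinuousOn g U → Weak U V g →
      closedBall x0 (3 * R) ⊆ U → IsClosed Q → Convex ℝ Q → (∀ y ∈ closedBall x0 (2 * R), Z y ∈ Q) →
      q0 ∈ Q → ‖q0‖ ≤ M → ∫ y in ball x0 (2 * R), ‖Z y - q0‖ ^ 2 ≤ M →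
      (∀ x ∈ closedBall x0 R, ∀ r, 0 < r → r ≤ R → ∀ q ∈ Q, ∃ c, ∀ y ∈ closedBall x r,
        ‖V y - S (Z y) - c‖ ≤ θ * ‖Z y - q‖ + K * r ^ β * (1 + ‖q‖)) → (∀ y ∈ closedBall x0 (2 * R), |g y| ≤ K) →
      ∀ x ∈ closedBall x0 R, ‖Z x‖ ≤ C ∧ ∀ y ∈ closedBall x0 R, ‖Z x - Z y‖ ≤ C * ‖x - y‖ ^ β := by
  obtain ⟨θ, hθ, H⟩ := holder_est hS hβ hβ1
  refine ⟨θ, hθ, fun K R M hK hR => ?_⟩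
  obtain ⟨C, hC, H⟩ := H K R M hK hR
  refine ⟨C, hC, ?_⟩
  intro U Q z Z V g x0 q0 hU hz hZ hV hg hw hs hQc hQ hZQ hq0 hq0M hM hVS hgK
  obtain ⟨z', Z', V', g', a1, a2, a3, a4, a5, a6⟩ := globalize hU hz hZ hV hg hw hR hs
  have hb : closedBall x0 (2 * R) ⊆ ball x0 (5 / 2 * R) := cbsb lz
  have hb1 : closedBall x0 R ⊆ ball x0 (5 / 2 * R) := cbsb lz
  have := H _ Q z' Z' V' g' x0 q0 a1 a2 a3 a4 a5 hb hQc hQ (fun y hy => by rw [(a6 y (hb hy)).2.1]; exact hZQ y hy) hq0 hq0M ?_ ?_ ?_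
  · intro x hx
    have h1 := this x hx
    rw [(a6 x (hb1 hx)).2.1] at h1
    refine ⟨h1.1, fun y hy => ?_⟩
    have h2 := h1.2 y hy
    rwa [(a6 y (hb1 hy)).2.1] at h2
  · refine le_of_eq_of_le (scf mb_ fun y hy => ?_) hM
    simp only [(a6 y (hb (bscb hy))).2.1]
  · intro x hx r hr hrR q hq
    obtain ⟨c, hc⟩ := hVS x hx r hr hrR q hq
    refine ⟨c, fun y hy => ?_⟩
    have hy' : y ∈ ball x0 (5 / 2 * R) := hb (by
      rw [mem_closedBall] at *; linarith [dist_triangle y x x0])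
    rw [(a6 y hy').2.1, (a6 y hy').2.2.1]; exact hc y hy
  · intro y hy
    rw [(a6 y (hb hy)).2.2.2]; exact hgK y hy

/-- equi-Hölder difference quotients give a Hölder derivative. -/
theorem dq_diff {F : Type} [NormedAddCommGroup F] [NormedSpace ℝ F] [CompleteSpace F] {f : E → F} {x0 : E} {R C β : ℝ} (hR : 0 < R) (hC : 0 ≤ C) (hβ : 0 < β)
    (hf : ContinuousOn f (closedBall x0 R)) (H : ∀ v : E, v ≠ 0 → ‖v‖ ≤ R → ∀ x ∈ closedBall x0 R, ∀ y ∈ closedBall x0 R, ‖(f (x + v) - f x) - (f (y + v) - f y)‖ ≤ C * ‖v‖ * ‖x - y‖ ^ β) :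
    ∀ x ∈ ball x0 R, DifferentiableAt ℝ f x ∧ ∀ y ∈ ball x0 R, ‖fd f x - fd f y‖ ≤ C * ‖x - y‖ ^ β := by
  have H : ∀ v : E, ‖v‖ ≤ R → ∀ x ∈ closedBall x0 R, ∀ y ∈ closedBall x0 R, ‖(f (x + v) - f x) - (f (y + v) - f y)‖ ≤ C * ‖v‖ * ‖x - y‖ ^ β := by
    intro v hv x hx y hy
    rcases eq_or_ne v 0 with rfl | h
    · simp
    · exact H v h hv x hx y hy
  set τ : ℝ := hlf ^ β
  have hτ : 0 < τ := pz
  have hτ1 : τ < 1 := Real.rpow_lt_one nz nz hβ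
  have hτ1' : 0 < 1 - τ := lz
  have hτk : ∀ k : ℕ, (hlf ^ k) ^ β = τ ^ k := fun k => by
    rw [← Real.rpow_natCast, ← Real.rpow_natCast, ← Real.rpow_mul nz, ← Real.rpow_mul nz, mul_comm]
  let a : E → ℕ → E → F := fun x k v => (2 : ℝ) ^ k • (f (x + hlf ^ k • v) - f x)
  have nrm : ∀ (k : ℕ) (v : E), ‖hlf ^ k • v‖ = (1 / 2) ^ k * ‖v‖ := fun k v => by
    rw [norm_smul, nnn pz]
  have two : ∀ k : ℕ, (2 : ℝ) ^ k * (1 / 2) ^ k = 1 := fun k => by rw [← mul_pow]; norm_num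
  have memx : ∀ x ∈ ball x0 R, ∃ s > 0, s ≤ R ∧ ∀ v, ‖v‖ ≤ s → x + v ∈ closedBall x0 R := by
    intro x hx
    rw [mem_ball] at hx
    refine ⟨R - dist x x0, lz, by linarith [dist_nonneg (x := x) (y := x0)], fun v hv => ?_⟩
    rw [mem_closedBall]
    have := dist_triangle (x + v) x x0
    rw [den (x + v) x, ascl] at this; linarith
  have small : ∀ s > 0, ∀ v : E, ∃ k0 : ℕ, ∀ k ≥ k0, hlf ^ k * ‖v‖ ≤ s := by
    intro s hs v
    have : Filter.Tendsto (fun k : ℕ => hlf ^ k * ‖v‖) Filter.atTop (𝓝 (0 * ‖v‖)) :=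
      (tpz nz nz).mul_const _
    rw [zero_mul] at this
    exact Filter.eventually_atTop.1 ((this.eventually (gt_mem_nhds hs)).mono fun k hk => hk.le)
  have one : ∀ x ∈ ball x0 R, ∀ v, ‖v‖ ≤ R → x + v ∈ closedBall x0 R → ∀ k, x + hlf ^ (k + 1) • v ∈ closedBall x0 R →
      dist (a x k v) (a x (k + 1) v) ≤ (C * ‖v‖ * ‖v‖ ^ β) * τ ^ k := by
    intro x hx v hv _ k hxv
    have h1 := H (hlf ^ (k + 1) • v) (by
      rw [nrm]; exact (mlo nnz (pow_le_one₀ nz nz)).trans hv) (x + hlf ^ (k + 1) • v) hxv x (bscb hx)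
    have e : a x k v - a x (k + 1) v = (2 : ℝ) ^ k • ((f (x + hlf ^ (k + 1) • v + hlf ^ (k + 1) • v) - f (x + hlf ^ (k + 1) • v)) - (f (x + hlf ^ (k + 1) • v) - f x)) := by
      have : x + hlf ^ (k + 1) • v + hlf ^ (k + 1) • v = x + hlf ^ k • v := by
        rw [add_assoc, ← add_smul, pow_succ]; congr 2; ring
      rw [this]
      simp only [a, pow_succ (2 : ℝ)]
      module
    rw [den, e, norm_smul, nnn pz]
    refine (mll h1 pz).trans ?_
    rw [ascl, nrm, Real.mul_rpow pz nnz, hτk]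
    have h2 : (2 : ℝ) ^ k * (C * ((1 / 2) ^ (k + 1) * ‖v‖) * (τ ^ (k + 1) * ‖v‖ ^ β)) = (C * ‖v‖ * ‖v‖ ^ β * τ ^ k) * (τ / 2) := by
      rw [show (2 : ℝ) ^ k * (C * ((1 / 2) ^ (k + 1) * ‖v‖) * (τ ^ (k + 1) * ‖v‖ ^ β)) = ((2 : ℝ) ^ k * (1 / 2) ^ k) * (C * (1 / 2 * ‖v‖) * (τ ^ (k + 1) * ‖v‖ ^ β)) by ring, two]; ring
    rw [h2]
    exact mul_le_of_le_one_right pz lz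
  have conv : ∀ x ∈ ball x0 R, ∀ v, ∃ L, Filter.Tendsto (fun k => a x k v) Filter.atTop (𝓝 L) := by
    intro x hx v
    obtain ⟨s, hs, hsR, hsm⟩ := memx x hx
    obtain ⟨k0, hk0⟩ := small s hs v
    set v' := hlf ^ k0 • v
    have hv' : ‖v'‖ ≤ s := by rw [nrm]; exact hk0 k0 le_rfl
    have hle : ∀ k : ℕ, ‖hlf ^ k • v'‖ ≤ s := fun k => by
      rw [nrm]; exact (mlo nnz (pow_le_one₀ nz nz)).trans hv'
    obtain ⟨L, hL⟩ := cauchySeq_tendsto_of_complete (cauchySeq_of_le_geometric τ _ hτ1 (fun k => one x hx v' (hv'.trans hsR) (hsm _ hv') k (hsm _ (hle _))))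
    refine ⟨(2 : ℝ) ^ k0 • L, (Filter.tendsto_add_atTop_iff_nat k0).1 ((hL.const_smul ((2 : ℝ) ^ k0)).congr fun k => ?_)⟩
    simp only [a, v', smul_smul, pow_add]
    congr 1; ring
  choose! A hA using conv
  have bound : ∀ x ∈ ball x0 R, ∃ s > 0, ∀ v, ‖v‖ ≤ s → ‖f (x + v) - f x - A x v‖ ≤ C / (1 - τ) * (‖v‖ * ‖v‖ ^ β) := by
    intro x hx
    obtain ⟨s, hs, hsR, hsm⟩ := memx x hx
    refine ⟨s, hs, fun v hv => ?_⟩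
    have hle : ∀ k : ℕ, ‖hlf ^ k • v‖ ≤ s := fun k => by
      rw [nrm]; exact (mlo nnz (pow_le_one₀ nz nz)).trans hv
    have := dist_le_of_le_geometric_of_tendsto₀ τ _ hτ1 (fun k => one x hx v (hv.trans hsR) (hsm _ hv) k (hsm _ (hle _))) (hA x hx v)
    rw [den] at this
    simp only [a, pow_zero, one_smul] at this
    refine this.trans_eq (by ring)
  have add : ∀ x ∈ ball x0 R, ∀ v w, A x (v + w) = A x v + A x w := by
    intro x hx v w
    obtain ⟨s, hs, hsR, hsm⟩ := memx x hx
    obtain ⟨k1, hk1⟩ := small s hs v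
    obtain ⟨k2, hk2⟩ := small s hs w
    have h1 := ((hA x hx (v + w)).sub (hA x hx v)).sub (hA x hx w)
    have h2 : Filter.Tendsto (fun k : ℕ => C * ‖w‖ * ‖v‖ ^ β * τ ^ k) Filter.atTop (𝓝 0) := by
      simpa using (tpz hτ.le hτ1).const_mul (C * ‖w‖ * ‖v‖ ^ β)
    have h3 := le_of_tendsto_of_tendsto h1.norm h2 (Filter.eventually_atTop.2 ⟨max k1 k2, fun k hk => ?_⟩)
    · rw [← sub_eq_zero, ← sub_sub, ← norm_le_zero_iff]; exact h3
    · have h4 := H (hlf ^ k • w) (by rw [nrm]; exact (hk2 k (le_of_max_le_right hk)).trans hsR) (x + hlf ^ k • v)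
        (hsm _ (by rw [nrm]; exact hk1 k (le_of_max_le_left hk))) x (bscb hx)
      have e : a x k (v + w) - a x k v - a x k w = (2 : ℝ) ^ k • ((f (x + hlf ^ k • v + hlf ^ k • w) - f (x + hlf ^ k • v)) - (f (x + hlf ^ k • w) - f x)) := by
        simp only [a, smul_add, add_assoc]; module
      change ‖a x k (v + w) - a x k v - a x k w‖ ≤ _
      rw [e, norm_smul, nnn pz]
      refine (mll h4 pz).trans_eq ?_
      rw [ascl, nrm, nrm, Real.mul_rpow pz nnz, hτk]
      rw [show (2 : ℝ) ^ k * (C * ((1 / 2) ^ k * ‖w‖) * (τ ^ k * ‖v‖ ^ β)) = ((2 : ℝ) ^ k * (1 / 2) ^ k) * (C * ‖w‖ * ‖v‖ ^ β * τ ^ k) by ring, two, one_mul]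
  have lin : ∀ x ∈ ball x0 R, ∃ L : E →L[ℝ] F, HasFDerivAt f L x ∧ ∀ v, L v = A x v := by
    intro x hx
    obtain ⟨s, hs, hb⟩ := bound x hx
    let g : E →+ F := AddMonoidHom.mk' (A x) (add x hx)
    have g0 : A x 0 = 0 := g.map_zero
    have nb : Filter.Tendsto (fun v : E => ‖v‖ * ‖v‖ ^ β) (𝓝 0) (𝓝 0) := by
      have h : Filter.Tendsto (fun v : E => ‖v‖) (𝓝 0) (𝓝 0) := by simpa using (continuous_norm (E := E)).tendsto 0
      have h' := h.rpow_const (p := β) (Or.inr hβ.le)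
      rw [Real.zero_rpow hβ.ne'] at h'
      simpa using h.mul h'
    have gc : Continuous g := by
      refine continuous_of_continuousAt_zero g ?_
      unfold ContinuousAt
      have fx : ContinuousAt f x := hf.continuousAt (Filter.mem_of_superset (isOpen_ball.mem_nhds hx) bscb)
      have h1 : Filter.Tendsto (fun v => f (x + v) - f x) (𝓝 0) (𝓝 0) := by
        have h2 : Filter.Tendsto (fun v : E => x + v) (𝓝 0) (𝓝 x) := by
          have : Continuous fun v : E => x + v := fz
          simpa using this.tendsto 0
        have := (fx.tendsto.comp h2).sub_const (f x)
        simpa using this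
      have h2 : Filter.Tendsto (fun v => f (x + v) - f x - A x v) (𝓝 0) (𝓝 0) := by
        refine squeeze_zero_norm' ?_ (by simpa using nb.const_mul (C / (1 - τ)))
        filter_upwards [closedBall_mem_nhds (0 : E) hs] with v hv
        exact hb v (mcz.1 hv)
      have h3 := h1.sub h2
      rw [sub_zero] at h3
      rw [map_zero]
      exact h3.congr fun v => by change _ = A x v; abel
    refine ⟨g.toRealLinearMap gc, ?_, fun v => rfl⟩
    rw [hasFDerivAt_iff_isLittleO_nhds_zero, Asymptotics.isLittleO_iff]
    intro c hc
    have h : Filter.Tendsto (fun v : E => C / (1 - τ) * ‖v‖ ^ β) (𝓝 0) (𝓝 0) := by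
      have h : Filter.Tendsto (fun v : E => ‖v‖) (𝓝 0) (𝓝 0) := by simpa using (continuous_norm (E := E)).tendsto 0
      have h' := h.rpow_const (p := β) (Or.inr hβ.le)
      rw [Real.zero_rpow hβ.ne'] at h'
      simpa using h'.const_mul (C / (1 - τ))
    filter_upwards [closedBall_mem_nhds (0 : E) hs, h.eventually (gt_mem_nhds hc)] with v hv hv2
    refine (hb v (mcz.1 hv)).trans ?_
    calc C / (1 - τ) * (‖v‖ * ‖v‖ ^ β) = (C / (1 - τ) * ‖v‖ ^ β) * ‖v‖ := by ring
      _ ≤ _ := by gcongr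
  intro x hx
  obtain ⟨L, hL, hLA⟩ := lin x hx
  refine ⟨hL.differentiableAt, fun y hy => ?_⟩
  obtain ⟨L', hL', hLA'⟩ := lin y hy
  rw [hL.fderiv, hL'.fderiv]
  refine ContinuousLinearMap.opNorm_le_bound _ pz fun v => ?_
  rw [_root_.sub_apply, hLA, hLA']
  obtain ⟨k0, hk0⟩ := small R hR v
  refine le_of_tendsto ((hA x hx v).sub (hA y hy v)).norm (Filter.eventually_atTop.2 ⟨k0, fun k hk => ?_⟩)
  have h4 := H (hlf ^ k • v) (by rw [nrm]; exact hk0 k hk) x (bscb hx) y (bscb hy)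
  simp only [a]
  rw [← smul_sub, norm_smul, nnn pz]
  refine (mll h4 pz).trans_eq ?_
  rw [nrm, show (2 : ℝ) ^ k * (C * ((1 / 2) ^ k * ‖v‖) * ‖x - y‖ ^ β) = ((2 : ℝ) ^ k * (1 / 2) ^ k) * (C * ‖x - y‖ ^ β * ‖v‖) by ring, two, one_mul]

theorem weak_dq {V : E → E} {g : E → ℝ} (hV : Continuous V) (hg : Continuous g) {x0 v : E} {R : ℝ} (hv : ‖v‖ ≤ R) (hw : Weak (ball x0 (5 * R)) V g) (h : ℝ) :
    Weak (ball x0 (4 * R)) (fun x => h • (V (x + v) - V x + (∫ t in Icc (0 : ℝ) 1, g (x + t • v)) • v)) (fun _ => 0) := by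
  intro φ hφ hφc hs
  have hR : 0 ≤ R := (norm_nonneg v).trans hv
  have φc := hφ.continuous
  have hfd : ∀ w : E, Continuous fun x => fd φ x w := fun w => continuous_fderiv_ap hφ continuous_const
  have hφ0 : ∀ x, x ∉ ball x0 (4 * R) → φ x = 0 := fun x hx => ime fun h => hx (hs h)
  have hφ0' : ∀ x, x ∉ ball x0 (4 * R) → fd φ x = 0 := fun x hx => fderiv_zero_off fun h => hx (hs h)
  set B := closedBall x0 (5 * R)
  have hB : IsCompact B := icb _ _
  have hmem : ∀ (t : ℝ) (x : E), t ∈ Icc (0 : ℝ) 1 → x ∉ B → x - t • v ∉ ball x0 (4 * R) := by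
    intro t x ht hx hx'
    apply hx
    rw [mem_ball, den] at hx'
    rw [mem_closedBall, den]
    have h1 : ‖t • v‖ ≤ R := by
      rw [norm_smul, nnn ht.1]
      exact (mlo nnz ht.2).trans hv
    calc ‖x - x0‖ = ‖(x - t • v - x0) + t • v‖ := by congr 1; abel
      _ ≤ _ := norm_add_le _ _
      _ ≤ _ := lz
  have T1 : ∫ x, fd φ x (V (x + v)) = ∫ x, g x * φ (x - v) := by
    have e : ∀ x, fd (fun y => φ (y - v)) x = fd φ (x - v) := fun x => by
      simp only [sub_eq_add_neg]; rw [fderiv_comp_add_right]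
    have hc : HasCompactSupport fun y => φ (y - v) := by
      refine hcsub hB fun x hx => ?_
      by_contra h
      exact hx (hφ0 _ (by simpa using hmem 1 x sz h))
    have := hw (fun y => φ (y - v)) (hφ.comp fz) hc ?_
    · rw [← this, ← integral_add_right_eq_self (fun x => fd (fun y => φ (y - v)) x (V x)) v]
      simp only [e, add_sub_cancel_right]
    · have h2 : tsupport φ ⊆ ball x0 (4 * R) := hs
      intro x hx
      have h3 : x - v ∈ tsupport φ := by
        have := tsupport_comp_subset_preimage φ (f := fun y => y - v) fz hx
        exact this
      have := hs h3
      rw [mem_ball, den] at this ⊢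
      calc ‖x - x0‖ = ‖(x - v - x0) + v‖ := by congr 1; abel
        _ ≤ _ := norm_add_le _ _
        _ < _ := lz
  have T2 : ∫ x, fd φ x (V x) = ∫ x, g x * φ x := hw φ hφ hφc (hs.trans (bsb lz))
  have T3 : ∫ x, (∫ t in Icc (0 : ℝ) 1, g (x + t • v)) * fd φ x v = ∫ x, g x * (φ x - φ (x - v)) := by
    rw [← sie (s := B) (f := fun x => (∫ t in Icc (0 : ℝ) 1, g (x + t • v)) * fd φ x v), ← sie (s := B) (f := fun x => g x * (φ x - φ (x - v)))]
    · have e1 : ∀ x, (∫ t in Icc (0 : ℝ) 1, g (x + t • v)) * fd φ x v = ∫ t in Icc (0 : ℝ) 1, g (x + t • v) * fd φ x v :=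
        fun x => (integral_mul_const _ _).symm
      have e2 : ∀ x, g x * (φ x - φ (x - v)) = ∫ t in Icc (0 : ℝ) 1, g x * fd φ (x - t • v) v := by
        intro x
        rw [icm, integral_Icc_eq_integral_Ioc, ← intervalIntegral.integral_of_le zero_le_one]
        have hd : ∀ t : ℝ, HasDerivAt (fun t : ℝ => -φ (x - t • v)) (fd φ (x - t • v) v) t := by
          intro t
          have h1 : HasDerivAt (fun t : ℝ => x - t • v) (-v) t := by
            simpa using ((hasDerivAt_id t).smul_const v).const_sub x
          have h2 := ((hφ.differentiable sz (x - t • v)).hasFDerivAt.comp_hasDerivAt t h1).neg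
          refine h2.congr_deriv ?_
          simp
        rw [iisub (fun t _ => hd t)]
        · simp [sub_eq_add_neg, add_comm]
        · exact (Continuous.intervalIntegrable (by exact (hfd v).comp fz) _ _)
      simp only [e1, e2]
      rw [swap_cont (K := B) (L := Icc (0 : ℝ) 1) hB isCompact_Icc subset_rfl subset_rfl, swap_cont (K := B) (L := Icc (0 : ℝ) 1) hB isCompact_Icc subset_rfl subset_rfl]
      · refine scf measurableSet_Icc fun t ht => ?_
        rw [sie, sie,
          ← integral_add_right_eq_self (fun x => g x * fd φ (x - t • v) v) (t • v)]
        · simp only [add_sub_cancel_right]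
        · intro x hx; simp [hφ0' _ (hmem t x ht hx)]
        · intro x hx; have := hmem 0 x sz hx; rw [zero_smul, sub_zero] at this; simp [hφ0' _ this]
      · unfold Function.uncurry; exact (hg.comp continuous_fst).mul ((hfd v).comp fz)
      · unfold Function.uncurry; exact (hg.comp fz).mul ((hfd v).comp fz)
    · intro x hx
      have h1 := hmem 0 x sz hx
      have h2 := hmem 1 x sz hx
      rw [zero_smul, sub_zero] at h1; rw [one_smul] at h2
      simp [hφ0 _ h1, hφ0 _ h2]
    · intro x hx; have := hmem 0 x sz hx; rw [zero_smul, sub_zero] at this; simp [hφ0' _ this]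
  have hGc : Continuous fun x => ∫ t in Icc (0 : ℝ) 1, g (x + t • v) := by
    refine cpi (μ := (volume : Measure ℝ)) (f := fun (x : E) (t : ℝ) => g (x + t • v)) ?_ isCompact_Icc
    unfold Function.uncurry; fun_prop
  have hI : ∀ W : E → E, Continuous W → Integrable fun x => fd φ x (W x) := fun W hW =>
    (continuous_fderiv_ap hφ hW).ics (hcs_fderiv_ap _ hφc)
  have hg1 : Integrable fun x => g x * φ x := (hg.mul φc).ics hφc.mul_left
  have hg2 : Integrable fun x => g x * φ (x - v) := by
    refine (hg.mul (φc.comp fz)).ics (hcsub hB fun x hx => ?_)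
    by_contra h'
    have h1 := hmem 1 x sz h'
    rw [one_smul] at h1
    exact hx (by simp [hφ0 _ h1])
  have e : ∀ x, fd φ x (h • (V (x + v) - V x + (∫ t in Icc (0 : ℝ) 1, g (x + t • v)) • v)) =
      h * (fd φ x (V (x + v)) - fd φ x (V x) + (∫ t in Icc (0 : ℝ) 1, g (x + t • v)) * fd φ x v) := by
    intro x; simp [mul_add]
  simp only [e, zero_mul, integral_zero]
  have hI3 : Integrable fun x => (∫ t in Icc (0 : ℝ) 1, g (x + t • v)) * fd φ x v :=
    (hI (fun x => (∫ t in Icc (0 : ℝ) 1, g (x + t • v)) • v) fz).congr (eof fun x => sz)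
  have hI4 : Integrable fun x => fd φ x (V (x + v)) - fd φ x (V x) := (hI (fun x => V (x + v)) fz).sub (hI V hV)
  rw [icm, integral_add hI4 hI3, integral_sub (hI (fun x => V (x + v)) fz) (hI V hV), T1, T2, T3]
  simp only [mul_sub]
  rw [integral_sub hg1 hg2]; ring

theorem dq_est {S : E →L[ℝ] E} (hS : SPD S) : ∃ θ : ℝ, 0 < θ ∧ ∀ (z : E → ℝ) (Z V : E → E) (g : E → ℝ) (x0 : E) (R K : ℝ),
    (∀ x, HasGradientAt z (Z x) x) → Continuous Z → Continuous V → Continuous g → Weak (ball x0 (5 * R)) V g → 0 < R → 0 < K →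
    (∀ x ∈ ball x0 (5 * R), ‖Z x‖ ≤ K) → (∀ x ∈ ball x0 (5 * R), ∀ y ∈ ball x0 (5 * R), |g x - g y| ≤ K * ‖x - y‖ ^ hlf) →
    (∀ x ∈ ball x0 (5 * R), |g x| ≤ K) →
    (∀ v : E, v ≠ 0 → ‖v‖ ≤ R → ∃ (a : E → E →L[ℝ] E) (f : E → E), ∀ x ∈ ball x0 (4 * R), V (x + v) - V x = a x (Z (x + v) - Z x) + ‖v‖ • f x ∧
      ‖a x - S‖ ≤ θ ∧ ‖f x‖ ≤ K ∧ ∀ y ∈ ball x0 (4 * R), ‖a x - a y‖ ≤ K * ‖x - y‖ ^ hlf ∧ ‖f x - f y‖ ≤ K * ‖x - y‖ ^ hlf) →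
    ∃ C : ℝ, 0 ≤ C ∧ ∀ v : E, v ≠ 0 → ‖v‖ ≤ R → ∀ x ∈ closedBall x0 R, ∀ y ∈ closedBall x0 R,
      ‖(Z (x + v) - Z x) - (Z (y + v) - Z y)‖ ≤ C * ‖v‖ * ‖x - y‖ ^ hlf := by
  obtain ⟨θ1, hθ1, Hh⟩ := holder_est hS (β := 1 / 2) nz nz
  obtain ⟨Cc, hCc, Hc⟩ := caccioppoli hS
  set θ := min θ1 (√(1 / (4 * Cc)))
  have hθ : 0 < θ := pz
  have hθ2 : Cc * (2 * θ ^ 2) ≤ 1 / 2 := by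
    have : θ ^ 2 ≤ 1 / (4 * Cc) := by
      rw [← Real.sq_sqrt (show 0 ≤ 1 / (4 * Cc) by positivity)]; gcongr; exact min_le_right _ _
    calc _ ≤ Cc * (2 * (1 / (4 * Cc))) := by gcongr
      _ = _ := by field_simp; norm_num
  refine ⟨θ, hθ, ?_⟩
  intro z Z V g x0 R K hz hZ hV hg hw hR hK hZK hgH hgK hst
  let ζ : ContDiffBump x0 := ⟨2 * R, 3 * R, pz, lz⟩
  have hζ : ContDiff ℝ 1 ζ := ζ.contDiff
  have hζc := ζ.hasCompactSupport
  have hζt : tsupport ζ = closedBall x0 (3 * R) := ζ.tsupport_eq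
  set M := 2 * Cc * ∫ x, (‖fd ζ x‖ ^ 2 * K ^ 2 + ζ x ^ 2 * (8 * K ^ 2))
  obtain ⟨C, hC, Hh⟩ := Hh (2 * K) R M pz hR
  refine ⟨C, hC.le, fun v hv0 hv => ?_⟩
  set h := ‖v‖
  have hh : 0 < h := norm_pos_iff.2 hv0
  obtain ⟨a, f, haf⟩ := hst v hv0 hv
  have hw' := weak_dq hV hg hv hw h⁻¹
  set G : E → ℝ := fun x => ∫ t in Icc (0 : ℝ) 1, g (x + t • v) with hG
  have hGc : Continuous G := by
    refine cpi (μ := (volume : Measure ℝ)) (f := fun (x : E) (t : ℝ) => g (x + t • v)) ?_ isCompact_Icc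
    unfold Function.uncurry; fun_prop
  let Y : E → E := fun x => h⁻¹ • (Z (x + v) - Z x)
  let y : E → ℝ := fun x => h⁻¹ * (z (x + v) - z x)
  let W : E → E := fun x => h⁻¹ • (V (x + v) - V x + G x • v)
  have hYc : Continuous Y := fz
  have hWc : Continuous W := fz
  have hy : ∀ x, HasGradientAt y (Y x) x := by
    intro x
    have h1 : HasFDerivAt (fun x => z (x + v)) (tD E (Z (x + v))) x := by
      exact ((hz (x + v)).hasFDerivAt.comp x ((hasFDerivAt_id x).add_const v)).congr_fderiv sz
    refine ((h1.sub (hz x).hasFDerivAt).const_mul h⁻¹).congr_fderiv ?_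
    ext w; simp [Y, isml, inner_sub_left]
  have hmv : ∀ x ∈ ball x0 (4 * R), ∀ t ∈ Icc (0 : ℝ) 1, x + t • v ∈ ball x0 (5 * R) := by
    intro x hx t ht
    have h1 : ‖t • v‖ ≤ R := by
      rw [norm_smul, nnn ht.1]
      exact (mlo nnz ht.2).trans hv
    rw [mem_ball, den] at *
    calc ‖x + t • v - x0‖ = ‖(x - x0) + t • v‖ := by congr 1; abel
      _ ≤ _ := norm_add_le _ _
      _ < _ := lz
  have hyK : ∀ x ∈ ball x0 (4 * R), |y x| ≤ K := by
    intro x hx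
    have h1 := Convex.norm_image_sub_le_of_norm_hasFDerivWithin_le (f := z) (C := K) (s := ball x0 (5 * R)) (fun x _ => (hz x).hasFDerivAt.hasFDerivWithinAt)
      (fun x hx => by simpa using hZK x hx) (convex_ball _ _) (by simpa using hmv x hx 0 sz) (by simpa using hmv x hx 1 sz)
    rw [nea, ascl] at h1
    simp only [y]
    rw [abs_mul, abs_of_pos pz, inv_mul_le_iff₀ hh]; linarith
  have hG1 : ∀ x ∈ ball x0 (4 * R), |G x| ≤ K := by
    intro x hx
    have := norm_setIntegral_le_of_norm_le_const (μ := (volume : Measure ℝ)) (s := Icc 0 1) (f := fun t : ℝ => g (x + t • v)) (C := K) sz (fun t ht => hgK _ (hmv x hx t ht))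
    simpa using this
  have hG2 : ∀ x ∈ ball x0 (4 * R), ∀ y ∈ ball x0 (4 * R), |G x - G y| ≤ K * ‖x - y‖ ^ hlf := by
    intro x hx y hy
    have e : G x - G y = ∫ t in Icc (0 : ℝ) 1, (g (x + t • v) - g (y + t • v)) := by
      rw [integral_sub]
      all_goals exact (Continuous.continuousOn fz).integrableOn_compact isCompact_Icc
    rw [e]
    have := norm_setIntegral_le_of_norm_le_const (μ := (volume : Measure ℝ)) (s := Icc 0 1) (f := fun t : ℝ => g (x + t • v) - g (y + t • v)) (C := K * ‖x - y‖ ^ hlf) sz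
      (fun t ht => by simpa using hgH _ (hmv x hx t ht) _ (hmv y hy t ht))
    simpa using this
  have hW : ∀ x ∈ ball x0 (4 * R), W x = a x (Y x) + f x + G x • (h⁻¹ • v) := by
    intro x hx
    simp only [W, Y, (haf x hx).1, map_smul, smul_add, smul_smul, inv_mul_cancel₀ hh.ne', one_smul, mul_comm (G x)]
    rw [show h⁻¹ * ‖v‖ = 1 from inv_mul_cancel₀ hh.ne', one_smul]
  have hvn : ‖h⁻¹ • v‖ = 1 := by rw [norm_smul, norm_inv, norm_norm, inv_mul_cancel₀ hh.ne']
  have b32 : closedBall x0 (3 * R) ⊆ ball x0 (4 * R) := cbsb lz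
  have hL2 : ∫ x in ball x0 (2 * R), ‖Y x - 0‖ ^ 2 ≤ M := by
    have h1 := Hc (ball x0 (4 * R)) y Y (fun x => S (Y x) - W x) (fun _ => 0) ζ hy hYc fz continuous_const hζ hζc (hζt ▸ b32) (by
      simpa only [sub_sub_cancel] using hw')
    have hyc := (contDiff_of_grad hy hYc).continuous
    have ζc := hζ.continuous
    have hfc : Continuous fun x => ‖fd ζ x‖ := (hζ.continuous_fderiv sz).norm
    have i1 : Integrable fun x => ζ x ^ 2 * ‖Y x‖ ^ 2 := by
      refine Continuous.ics fz (hζc.mono fun x hx hz => hx ?_)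
      simp [hz]
    have i2 : Integrable fun x => (‖fd ζ x‖ ^ 2 * K ^ 2 + ζ x ^ 2 * (8 * K ^ 2)) := by
      refine Continuous.ics fz (HasCompactSupport.intro hζc fun x hx => ?_)
      simp [fderiv_zero_off hx, ime hx]
    have h2 : ∫ x, (‖fd ζ x‖ ^ 2 * y x ^ 2 + ζ x ^ 2 * ‖S (Y x) - W x‖ ^ 2 + |(0 : ℝ)| * ζ x ^ 2 * |y x|) ≤
        ∫ x, (2 * θ ^ 2 * (ζ x ^ 2 * ‖Y x‖ ^ 2) + (‖fd ζ x‖ ^ 2 * K ^ 2 + ζ x ^ 2 * (8 * K ^ 2))) := by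
      refine integral_mono ?_ ((i1.const_mul _).add i2) fun x => ?_
      · refine Continuous.ics fz (HasCompactSupport.intro hζc fun x hx => ?_)
        simp [fderiv_zero_off hx, ime hx]
      · simp only [abs_zero, zero_mul, add_zero]
        by_cases hx : x ∈ tsupport ζ
        · have hx4 := b32 (hζt ▸ hx)
          have e1 : y x ^ 2 ≤ K ^ 2 := sq_le_sq' (by linarith [abs_le.1 (hyK x hx4)]) (abs_le.1 (hyK x hx4)).2
          have e2 : ‖S (Y x) - W x‖ ≤ θ * ‖Y x‖ + 2 * K := by
            rw [hW x hx4]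
            have : S (Y x) - (a x (Y x) + f x + G x • (h⁻¹ • v)) = -((a x - S) (Y x)) - f x - G x • (h⁻¹ • v) := by
              rw [_root_.sub_apply]; abel
            rw [this]
            have n1 : ‖(a x - S) (Y x)‖ ≤ θ * ‖Y x‖ := (lop _ _).trans (by gcongr; exact (haf x hx4).2.1)
            have n2 : ‖G x • (h⁻¹ • v)‖ ≤ K := by rw [norm_smul, hvn, mul_one]; exact hG1 x hx4
            have := norm_sub_le (-((a x - S) (Y x)) - f x) (G x • (h⁻¹ • v))
            have := norm_sub_le (-((a x - S) (Y x))) (f x)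
            rw [norm_neg] at this
            linarith [(haf x hx4).2.2.1]
          have e3 : ‖S (Y x) - W x‖ ^ 2 ≤ 2 * θ ^ 2 * ‖Y x‖ ^ 2 + 8 * K ^ 2 := by
            calc _ ≤ (θ * ‖Y x‖ + 2 * K) ^ 2 := by gcongr
              _ ≤ _ := by nlinarith [sq_nonneg (θ * ‖Y x‖ - 2 * K)]
          have e4 := mll e3 (sq_nonneg (ζ x))
          have e5 := mll e1 (sq_nonneg ‖fd ζ x‖)
          linarith
        · simp [fderiv_zero_off hx, ime hx]
    rw [integral_add (i1.const_mul _) i2, icm] at h2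
    have h3 := h1.trans (mll h2 hCc.le)
    have h4 : 0 ≤ ∫ x, ζ x ^ 2 * ‖Y x‖ ^ 2 := integral_nonneg fun _ => pz
    have h5 := mlr hθ2 h4
    have h6 : ∫ x, ζ x ^ 2 * ‖Y x‖ ^ 2 ≤ M := by
      simp only [M]; nlinarith
    refine le_trans ?_ h6
    rw [← integral_indicator mb_]
    refine integral_mono ((intOn_ball fz _ _).integrable_indicator mb_) i1 fun x => ?_
    by_cases hx : x ∈ ball x0 (2 * R)
    · rw [indicator_of_mem hx]
      have : ζ x = 1 := ζ.one_of_mem_closedBall (bscb hx)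
      simp [this]
    · rw [inm hx]; positivity
  have fin := Hh (ball x0 (4 * R)) univ y Y W (fun _ => 0) x0 0 hy hYc hWc continuous_const hw' (cbsb lz) isClosed_univ convex_univ
    (fun _ _ => mem_univ _) (mem_univ _) (by rw [norm_zero]; exact (setIntegral_nonneg mb_ fun _ _ => pz).trans hL2) hL2 ?_ (fun _ _ => by simp; positivity)
  · intro x hx y hy
    have h1 := (fin x hx).2 y hy
    have e : (Z (x + v) - Z x) - (Z (y + v) - Z y) = h • (Y x - Y y) := by
      simp only [Y]; rw [← smul_sub, smul_inv_smul₀ hh.ne']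
    rw [e, norm_smul, nnn hh.le]
    calc _ ≤ h * (C * ‖x - y‖ ^ hlf) := by gcongr
      _ = _ := by ring
  · intro x hx r hr hrR q _
    refine ⟨a x q - S q + f x + G x • (h⁻¹ • v), fun w hw1 => ?_⟩
    have hx4 : x ∈ ball x0 (4 * R) := cbsb lz hx
    have hw4 : w ∈ ball x0 (4 * R) := by
      rw [mem_closedBall] at hx hw1; rw [mem_ball]; linarith [dist_triangle w x x0]
    have hwr : ‖w - x‖ ^ hlf ≤ r ^ hlf := by
      rw [mem_closedBall, den] at hw1
      exact Real.rpow_le_rpow nnz hw1 nz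
    rw [hW w hw4]
    have e : a w (Y w) + f w + G w • (h⁻¹ • v) - S (Y w) - (a x q - S q + f x + G x • (h⁻¹ • v)) =
        (a w - S) (Y w - q) + (a w - a x) q + (f w - f x) + (G w - G x) • (h⁻¹ • v) := by
      simp only [_root_.sub_apply, map_sub, sub_smul]; abel
    rw [e]
    obtain ⟨-, a2, -, a3⟩ := haf w hw4
    have n1 : ‖(a w - S) (Y w - q)‖ ≤ θ1 * ‖Y w - q‖ := (lop _ _).trans (by gcongr; exact a2.trans (min_le_left _ _))
    have n2 : ‖(a w - a x) q‖ ≤ K * r ^ hlf * ‖q‖ := (lop _ _).trans (by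
      gcongr; exact (a3 x hx4).1.trans (by gcongr))
    have n3 : ‖f w - f x‖ ≤ K * r ^ hlf := (a3 x hx4).2.trans (by gcongr)
    have n4 : ‖(G w - G x) • (h⁻¹ • v)‖ ≤ K * r ^ hlf := by
      rw [norm_smul, hvn, mul_one]; exact (hG2 w hw4 x hx4).trans (by gcongr)
    have n5 : 0 ≤ K * r ^ hlf * ‖q‖ := pz
    refine (norm_add₄_le).trans ?_
    linarith

def LH {F : Type} [NormedAddCommGroup F] (f : E → F) (x : E) : Prop :=
  (fun q : E × E => f q.1 - f q.2) =O[𝓝 (x, x)] fun q => ‖q.1 - q.2‖ ^ hlf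

def HC (U : Set E) : ℕ → ∀ {F : Type} [NormedAddCommGroup F] [NormedSpace ℝ F], (E → F) → Prop
  | 0, _, _, _, f => ∀ x ∈ U, LH f x
  | m + 1, _, _, _, f => ContDiffOn ℝ 1 f U ∧ HC U m (fd f)

section
variable {F G H : Type} [NormedAddCommGroup F] [NormedSpace ℝ F] [NormedAddCommGroup G] [NormedSpace ℝ G] [NormedAddCommGroup H] [NormedSpace ℝ H]

theorem LH.exists {f : E → F} {x : E} (h : LH f x) : ∃ K > 0, ∃ ρ > 0, ∀ y ∈ ball x ρ, ∀ z ∈ ball x ρ, ‖f y - f z‖ ≤ K * ‖y - z‖ ^ hlf := by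
  obtain ⟨K, hK, h⟩ := Asymptotics.IsBigO.exists_pos h
  obtain ⟨ρ, hρ, h⟩ := Metric.eventually_nhds_iff_ball.1 h.bound
  refine ⟨K, hK, ρ, hρ, fun y hy z hz => ?_⟩
  have := h (y, z) (by rw [← ball_prod_same]; exact ⟨hy, hz⟩)
  rwa [nnn pz] at this

theorem LH.mk {f : E → F} {x : E} {K ρ : ℝ} (hρ : 0 < ρ) (h : ∀ y ∈ ball x ρ, ∀ z ∈ ball x ρ, ‖f y - f z‖ ≤ K * ‖y - z‖ ^ hlf) : LH f x := by
  refine Asymptotics.IsBigO.of_bound K (Metric.eventually_nhds_iff_ball.2 ⟨ρ, hρ, fun q hq => ?_⟩)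
  rw [← ball_prod_same] at hq
  rw [nnn pz]
  exact h _ hq.1 _ hq.2

theorem LH.cont {f : E → F} {x : E} (h : LH f x) : ContinuousAt f x := by
  obtain ⟨K, hK, ρ, hρ, h⟩ := h.exists
  rw [ContinuousAt, tendsto_iff_norm_sub_tendsto_zero]
  have h0 : Filter.Tendsto (fun y => K * ‖y - x‖ ^ hlf) (𝓝 x) (𝓝 0) := by
    have : ContinuousAt (fun y => K * ‖y - x‖ ^ hlf) x := by
      refine ContinuousAt.mul continuousAt_const (ContinuousAt.rpow_const fz (Or.inr nz))
    simpa [ContinuousAt] using this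
  refine squeeze_zero' (eof fun _ => norm_nonneg _) ?_ h0
  filter_upwards [ball_mem_nhds x hρ] with y hy using h y hy x (mem_ball_self hρ)

theorem LH.of_contDiffAt {f : E → F} {x : E} (h : ContDiffAt ℝ 1 f x) : LH f x := by
  obtain ⟨K, s, hs, h⟩ := h.exists_lipschitzOnWith
  obtain ⟨r, hr, hrs⟩ := Metric.mem_nhds_iff.1 hs
  refine LH.mk (K := K) (ρ := min r (1 / 2)) pz fun y hy z hz => ?_
  have h1 := h.norm_sub_le (hrs (bsb (min_le_left _ _) hy)) (hrs (bsb (min_le_left _ _) hz))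
  refine h1.trans ?_
  gcongr
  have h2 : ‖y - z‖ ≤ 1 := by
    have h3 := bsb (min_le_right r (1 / 2)) hy
    have h4 := bsb (min_le_right r (1 / 2)) hz
    rw [mem_ball] at h3 h4
    rw [← den]; linarith [dist_triangle_right y z x]
  simpa using Real.rpow_le_rpow_of_exponent_ge' nnz h2 nz (show hlf ≤ 1 by norm_num)

theorem LH.congr {f g : E → F} {x : E} (h : LH f x) (e : g =ᶠ[𝓝 x] f) : LH g x := by
  refine Asymptotics.IsBigO.congr' h ?_ Filter.EventuallyEq.rfl
  have h1 : ∀ᶠ q : E × E in 𝓝 (x, x), g q.1 = f q.1 := (continuous_fst.tendsto (x, x)).eventually e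
  have h2 : ∀ᶠ q : E × E in 𝓝 (x, x), g q.2 = f q.2 := (continuous_snd.tendsto (x, x)).eventually e
  filter_upwards [h1, h2] with q a b
  rw [a, b]

theorem LH.bilin (B : F →L[ℝ] G →L[ℝ] H) {f : E → F} {g : E → G} {x : E} (hf : LH f x) (hg : LH g x) : LH (fun y => B (f y) (g y)) x := by
  have c1 : (fun q : E × E => f q.2) =O[𝓝 (x, x)] fun _ => (1 : ℝ) := (ContinuousAt.comp (f := Prod.snd) hf.cont continuousAt_snd).isBigO_one ℝ
  have c2 : (fun q : E × E => g q.1) =O[𝓝 (x, x)] fun _ => (1 : ℝ) := (ContinuousAt.comp (f := Prod.fst) hg.cont continuousAt_fst).isBigO_one ℝ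
  have hB : ∀ {φ : E × E → F} {ψ : E × E → G}, (fun q => B (φ q) (ψ q)) =O[𝓝 (x, x)] fun q => ‖φ q‖ * ‖ψ q‖ := fun {φ ψ} =>
    Asymptotics.IsBigO.of_bound ‖B‖ (eof fun q => by simpa [mul_assoc] using B.le_opNorm₂ (φ q) (ψ q))
  have t1 := (hB (φ := fun q => f q.1 - f q.2) (ψ := fun q => g q.1)).trans (hf.norm_left.mul c2.norm_left)
  have t2 := (hB (φ := fun q => f q.2) (ψ := fun q => g q.1 - g q.2)).trans (c1.norm_left.mul hg.norm_left)
  simp only [mul_one, one_mul] at t1 t2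
  refine (t1.add t2).congr_left fun q => ?_
  simp

theorem LH.comp {Φ : F → G} {f : E → F} {x : E} (hf : LH f x) (hΦ : ContDiffAt ℝ 1 Φ (f x)) : LH (fun y => Φ (f y)) x := by
  have h1 := (hΦ.hasStrictFDerivAt sz).isBigO_sub
  have h2 : Filter.Tendsto (fun q : E × E => (f q.1, f q.2)) (𝓝 (x, x)) (𝓝 (f x, f x)) :=
    ((ContinuousAt.comp (f := Prod.fst) hf.cont continuousAt_fst).prodMk (ContinuousAt.comp (f := Prod.snd) hf.cont continuousAt_snd) : ContinuousAt _ (x, x))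
  exact (h1.comp_tendsto h2).trans hf

theorem HC.congr {U : Set E} (hU : IsOpen U) (m : ℕ) : ∀ {F : Type} [NormedAddCommGroup F] [NormedSpace ℝ F] {f g : E → F}, HC U m f → (∀ x ∈ U, g x = f x) → HC U m g := by
  induction m with
  | zero => exact fun hf h x hx => LH.congr (hf x hx) (Filter.eventuallyEq_of_mem (hU.mem_nhds hx) h)
  | succ m ih => exact fun hf h => ⟨hf.1.congr h, ih hf.2 fun x hx => Filter.EventuallyEq.fderiv_eq (Filter.eventuallyEq_of_mem (hU.mem_nhds hx) h)⟩

theorem HC.pred {U : Set E} (hU : IsOpen U) (m : ℕ) : ∀ {F : Type} [NormedAddCommGroup F] [NormedSpace ℝ F] {f : E → F}, HC U (m + 1) f → HC U m f := by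
  induction m with
  | zero => exact fun hf x hx => LH.of_contDiffAt (hf.1.contDiffAt (hU.mem_nhds hx))
  | succ m ih => exact fun hf => ⟨hf.1, ih hf.2⟩

theorem HC.local {U : Set E} (m : ℕ) : ∀ {F : Type} [NormedAddCommGroup F] [NormedSpace ℝ F] {f : E → F}, (∀ x ∈ U, ∃ r > 0, HC (ball x r) m f) → HC U m f := by
  induction m with
  | zero => exact fun h x hx => by obtain ⟨r, hr, h⟩ := h x hx; exact h x (mem_ball_self hr)
  | succ m ih =>
    refine fun h => ⟨fun x hx => ?_, ih fun x hx => ?_⟩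
    · obtain ⟨r, hr, h⟩ := h x hx
      exact (h.1.contDiffAt (ball_mem_nhds x hr)).contDiffWithinAt
    · obtain ⟨r, hr, h⟩ := h x hx
      exact ⟨r, hr, h.2⟩

theorem HC.mono {U U' : Set E} (h : U' ⊆ U) (m : ℕ) : ∀ {F : Type} [NormedAddCommGroup F] [NormedSpace ℝ F] {f : E → F}, HC U m f → HC U' m f := by
  induction m with
  | zero => exact fun hf x hx => hf x (h hx)
  | succ m ih => exact fun hf => ⟨hf.1.mono h, ih hf.2⟩

theorem HC.contDiffOn {U : Set E} (hU : IsOpen U) (m : ℕ) : ∀ {F : Type} [NormedAddCommGroup F] [NormedSpace ℝ F] {f : E → F}, HC U m f → ContDiffOn ℝ m f U := by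
  induction m with
  | zero => exact fun hf => by rw [Nat.cast_zero, contDiffOn_zero]; exact fun x hx => (LH.cont (hf x hx)).continuousWithinAt
  | succ m ih =>
    intro F _ _ f hf
    push_cast
    rw [cdsucc hU]
    exact ⟨hf.1.differentiableOn sz, sz, ih hf.2⟩

theorem HC.add {U : Set E} (hU : IsOpen U) (m : ℕ) : ∀ {F : Type} [NormedAddCommGroup F] [NormedSpace ℝ F] {f g : E → F}, HC U m f → HC U m g → HC U m (fun x => f x + g x) := by
  induction m with
  | zero => exact fun hf hg x hx => (Asymptotics.IsBigO.add (hf x hx) (hg x hx)).congr_left fun q => by simp only; abel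
  | succ m ih =>
    refine fun hf hg => ⟨hf.1.add hg.1, HC.congr hU m (ih hf.2 hg.2) fun x hx => ?_⟩
    exact fderiv_add ((hf.1.contDiffAt (hU.mem_nhds hx)).differentiableAt sz) ((hg.1.contDiffAt (hU.mem_nhds hx)).differentiableAt sz)

theorem HC.bilin {U : Set E} (hU : IsOpen U) (m : ℕ) : ∀ {F G H : Type} [NormedAddCommGroup F] [NormedSpace ℝ F] [NormedAddCommGroup G] [NormedSpace ℝ G] [NormedAddCommGroup H] [NormedSpace ℝ H]
    (B : F →L[ℝ] G →L[ℝ] H) {f : E → F} {g : E → G}, HC U m f → HC U m g → HC U m (fun x => B (f x) (g x)) := by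
  induction m with
  | zero => exact fun B f g hf hg x hx => LH.bilin B (hf x hx) (hg x hx)
  | succ m ih =>
    intro F G H _ _ _ _ _ _ B f g hf hg
    refine ⟨(ContDiffOn.clm_apply (B.contDiff.comp_contDiffOn hf.1) hg.1),
      HC.congr hU m (HC.add hU m (ih (B.precompR E) (HC.pred hU m hf) hg.2) (ih (B.precompL E) hf.2 (HC.pred hU m hg))) fun x hx => ?_⟩
    exact B.fderiv_of_bilinear ((hf.1.contDiffAt (hU.mem_nhds hx)).differentiableAt sz) ((hg.1.contDiffAt (hU.mem_nhds hx)).differentiableAt sz)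

theorem HC.const {U : Set E} (m : ℕ) : ∀ {F : Type} [NormedAddCommGroup F] [NormedSpace ℝ F] (c : F), HC U m (fun _ : E => c) := by
  induction m with
  | zero => exact fun c x _ => LH.of_contDiffAt contDiffAt_const
  | succ m ih => exact fun c => ⟨contDiffOn_const, by rw [show (fd fun _ : E => c) = fun _ => 0 from fderiv_fun_const c]; exact ih 0⟩

theorem HC.clm {U : Set E} (hU : IsOpen U) (m : ℕ) (L : F →L[ℝ] G) {f : E → F} (hf : HC U m f) : HC U m (fun x => L (f x)) :=
  HC.bilin hU m (ContinuousLinearMap.id ℝ (F →L[ℝ] G)) (HC.const m L) hf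

theorem HC.comp {U : Set E} (hU : IsOpen U) (m : ℕ) : ∀ {F G : Type} [NormedAddCommGroup F] [NormedSpace ℝ F] [NormedAddCommGroup G] [NormedSpace ℝ G]
    {Φ : F → G} {f : E → F}, ContDiff ℝ (m + 1) Φ → HC U m f → HC U m (fun x => Φ (f x)) := by
  induction m with
  | zero => exact fun hΦ hf x hx => LH.comp (hf x hx) (by simpa using hΦ.contDiffAt)
  | succ m ih =>
    intro F G _ _ _ _ Φ f hΦ hf
    have h1 : ContDiff ℝ 1 Φ := hΦ.of_le sz
    refine ⟨h1.comp_contDiffOn hf.1,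
      HC.congr hU m (HC.bilin hU m (ContinuousLinearMap.compL ℝ E F G) (ih (hΦ.fderiv_right (m := m + 1) sz) (HC.pred hU m hf)) hf.2) fun x hx => ?_⟩
    exact fderiv_comp x (h1.differentiable sz _) ((hf.1.contDiffAt (hU.mem_nhds hx)).differentiableAt sz)
end

section

structure Sol (U : Set E) (z : E → ℝ) (Z V : E → E) (g : E → ℝ) : Prop where
  hU : IsOpen U
  hz : ContDiffOn ℝ 1 z U
  hZ : ∀ x ∈ U, HasGradientAt z (Z x) x
  hV : ContinuousOn V U
  hg : ContinuousOn g U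
  hw : Weak U V g

variable {U : Set E} {z : E → ℝ} {Z V : E → E} {g : E → ℝ} {x0 : E} {S : E →L[ℝ] E}

theorem Sol.cZ (h : Sol U z Z V g) : ContinuousOn Z U := by
  have h1 := (tD E).symm.continuous.comp_continuousOn (h.hz.continuousOn_fderiv_of_isOpen h.hU sz)
  refine h1.congr fun x hx => ?_
  simp [(h.hZ x hx).hasFDerivAt.fderiv]

theorem ball_small {P : E → Prop} (h : ∀ᶠ x in 𝓝 x0, P x) {k : ℝ} (hk : 0 < k) : ∃ R > 0, ∀ x ∈ ball x0 (k * R), P x := by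
  obtain ⟨r, hr, h⟩ := Metric.eventually_nhds_iff_ball.1 h
  exact ⟨r / k, pz, by rwa [mul_div_cancel₀ _ hk.ne']⟩

theorem ContinuousAt.bdd {F : Type} [NormedAddCommGroup F] {f : E → F} (h : ContinuousAt f x0) : ∀ᶠ x in 𝓝 x0, ‖f x‖ ≤ ‖f x0‖ + 1 := by
  filter_upwards [h.norm.eventually (gt_mem_nhds (lt_add_one ‖f x0‖))] with x hx using le_of_lt hx

theorem holder_pt (h : Sol U z Z V g) (hS : SPD S) (hx0 : x0 ∈ U) (H : ∀ θ : ℝ, 0 < θ → ∃ ρ > 0, ∃ K > 0, ∃ Q : Set E, IsClosed Q ∧ Convex ℝ Q ∧ (∀ y ∈ ball x0 ρ, Z y ∈ Q) ∧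
    ∀ q ∈ Q, ∀ x ∈ ball x0 ρ, ∃ c, ∀ y ∈ ball x0 ρ, ‖V y - S (Z y) - c‖ ≤ θ * ‖Z y - q‖ + K * ‖y - x‖ ^ hlf * (1 + ‖q‖)) : LH Z x0 := by
  obtain ⟨θ, hθ, H1⟩ := holder_loc hS (β := 1 / 2) nz nz
  obtain ⟨ρ, hρ, K, hK, Q, Qc, Qx, hQ, H⟩ := H θ hθ
  have hU := h.hU.mem_nhds hx0
  obtain ⟨R, hR, h1⟩ := ball_small (k := 4) (((isOpen_ball.eventually_mem (mem_ball_self hρ)).and (h.hU.eventually_mem hx0)).and (ContinuousAt.bdd (h.hg.continuousAt hU))) nz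
  have s : ∀ {k : ℝ}, k < 4 → closedBall x0 (k * R) ⊆ ball x0 (4 * R) := fun hk => cbsb (by nlinarith)
  obtain ⟨C, -, H1⟩ := H1 (K + ‖g x0‖ + 1) R (‖Z x0‖ + ∫ y in ball x0 (2 * R), ‖Z y - Z x0‖ ^ 2) pz hR
  have h0 : 0 ≤ ∫ y in ball x0 (2 * R), ‖Z y - Z x0‖ ^ 2 := setIntegral_nonneg mb_ fun _ _ => pz
  have H2 := H1 U Q z Z V g x0 (Z x0) h.hU h.hz h.hZ h.hV h.hg h.hw (fun x hx => (h1 x (s nz hx)).1.2) Qc Qx (fun y hy => hQ y (h1 y (s nz hy)).1.1)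
    (hQ _ (mem_ball_self hρ)) lz (by linarith [norm_nonneg (Z x0)]) ?_ (fun y hy => ((h1 y (s nz hy)).2).trans lz)
  · exact LH.mk (K := C) hR fun y hy x hx => (H2 y (bscb hy)).2 x (bscb hx)
  · intro x hx r hr hrR q hq
    have hb : ∀ y ∈ closedBall x r, y ∈ ball x0 ρ := fun y hy => (h1 y (by
      rw [mem_closedBall] at *; rw [mem_ball]; linarith [dist_triangle y x x0])).1.1
    obtain ⟨c, hc⟩ := H q hq x (hb x (mem_closedBall_self hr.le))
    refine ⟨c, fun y hy => (hc y (hb y hy)).trans ?_⟩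
    rw [mem_closedBall, den] at hy
    have := norm_nonneg (g x0)
    gcongr
    linarith

theorem dq_pt (h : Sol U z Z V g) (hS : SPD S) (hx0 : x0 ∈ U) (hgL : LH g x0) (H : ∀ θ : ℝ, 0 < θ → ∃ ρ > 0, ∃ K > 0, ∀ v : E, v ≠ 0 → ‖v‖ ≤ ρ → ∃ (a : E → E →L[ℝ] E) (f : E → E), ∀ x ∈ ball x0 ρ, V (x + v) - V x = a x (Z (x + v) - Z x) + ‖v‖ • f x ∧
      ‖a x - S‖ ≤ θ ∧ ‖f x‖ ≤ K ∧ ∀ y ∈ ball x0 ρ, ‖a x - a y‖ ≤ K * ‖x - y‖ ^ hlf ∧ ‖f x - f y‖ ≤ K * ‖x - y‖ ^ hlf) :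
    LH (fd Z) x0 ∧ ∀ᶠ x in 𝓝 x0, DifferentiableAt ℝ Z x := by
  obtain ⟨θ, hθ, H1⟩ := dq_est hS
  obtain ⟨ρ, hρ, K, hK, H⟩ := H θ hθ
  obtain ⟨K', hK', ρ', hρ', hgL⟩ := hgL.exists
  have hU := h.hU.mem_nhds hx0
  obtain ⟨R, hR, h1⟩ := ball_small (k := 7) ((((isOpen_ball.eventually_mem (mem_ball_self hρ)).and (h.hU.eventually_mem hx0)).and (ContinuousAt.bdd (h.hg.continuousAt hU))).and ((ContinuousAt.bdd (h.cZ.continuousAt hU)).and (isOpen_ball.eventually_mem (mem_ball_self hρ')))) nz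
  have s : ∀ {k : ℝ}, k ≤ 7 → ball x0 (k * R) ⊆ ball x0 (7 * R) := fun hk => bsb (by nlinarith)
  obtain ⟨z', Z', V', g', a1, a2, a3, a4, a5, a6⟩ := globalize h.hU h.hz h.hZ h.hV h.hg h.hw (R := 2 * R) (x0 := x0) pz (fun x hx => (h1 x (cbsb lz hx)).1.1.2)
  rw [show 5 / 2 * (2 * R) = 5 * R by ring] at a5 a6
  have hRρ : 6 * R < ρ ∨ Subsingleton E := by
    rcases subsingleton_or_nontrivial E with h | h
    · exact Or.inr h
    · left
      obtain ⟨v, hv⟩ := exists_norm_eq E (show 0 ≤ 6 * R by positivity)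
      have := (h1 (x0 + v) (by rw [mem_ball, den, ascl]; linarith)).1.1.1
      rwa [mem_ball, den, ascl, hv] at this
  have H2 := H1 z' Z' V' g' x0 R (K + K' + (‖g x0‖ + 1) + (‖Z x0‖ + 1)) a1 a2 a3 a4 a5 hR pz ?_ ?_ ?_ ?_
  · obtain ⟨C, hC, H2⟩ := H2
    have H3 := dq_diff hR hC nz a2.continuousOn H2
    have e : ∀ x ∈ ball x0 R, Z =ᶠ[𝓝 x] Z' := fun x hx => by
      filter_upwards [isOpen_ball.mem_nhds (bsb (show R ≤ 5 * R by linarith) hx)] with y hy using (a6 y hy).2.1.symm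
    refine ⟨LH.mk (K := C) hR fun y hy x hx => ?_, ?_⟩
    · rw [(e y hy).fderiv_eq, (e x hx).fderiv_eq]; exact (H3 y hy).2 x hx
    · filter_upwards [ball_mem_nhds x0 hR] with x hx using ((e x hx).differentiableAt_iff).2 (H3 x hx).1
  · intro x hx
    rw [(a6 x hx).2.1]
    linarith [(h1 x (s nz hx)).2.1, norm_nonneg (g x0)]
  · intro x hx y hy
    rw [(a6 x hx).2.2.2, (a6 y hy).2.2.2]
    refine (hgL x (h1 x (s nz hx)).2.2 y (h1 y (s nz hy)).2.2).trans ?_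
    gcongr
    linarith [norm_nonneg (g x0), norm_nonneg (Z x0)]
  · intro x hx
    rw [(a6 x hx).2.2.2]
    have := (h1 x (s nz hx)).1.2
    rw [nea, nea] at this
    linarith [norm_nonneg (Z x0), nea (g x0)]
  · intro v hv0 hv
    have hR6 : 6 * R < ρ := hRρ.resolve_right fun hs => hv0 (Subsingleton.elim _ _)
    obtain ⟨a, f, haf⟩ := H v hv0 lz
    refine ⟨a, f, fun x hx => ?_⟩
    have hx5 : x ∈ ball x0 (5 * R) := bsb lz hx
    have hxv : x + v ∈ ball x0 (5 * R) := by
      rw [mem_ball, den] at *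
      calc ‖x + v - x0‖ = ‖(x - x0) + v‖ := by congr 1; abel
        _ ≤ _ := norm_add_le _ _
        _ < _ := lz
    have sρ : ∀ {y}, y ∈ ball x0 (4 * R) → y ∈ ball x0 ρ := fun hy => bsb lz hy
    obtain ⟨b1, b2, b3, b4⟩ := haf x (sρ hx)
    have hKK : K ≤ K + K' + (‖g x0‖ + 1) + (‖Z x0‖ + 1) := by linarith [norm_nonneg (g x0), norm_nonneg (Z x0)]
    refine ⟨?_, b2, b3.trans hKK, fun y hy => ⟨(b4 y (sρ hy)).1.trans (by gcongr), (b4 y (sρ hy)).2.trans (by gcongr)⟩⟩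
    rw [(a6 x hx5).2.1, (a6 _ hxv).2.1, (a6 x hx5).2.2.1, (a6 _ hxv).2.2.1, b1]

theorem hc_one (h : Sol U z Z V g) (H : ∀ x ∈ U, LH (fd Z) x ∧ ∀ᶠ x in 𝓝 x, DifferentiableAt ℝ Z x) : HC U 1 Z := by
  refine ⟨?_, fun x hx => (H x hx).1⟩
  rw [show (1 : WithTop ℕ∞) = 0 + 1 by simp, cdsucc h.hU]
  exact ⟨fun x hx => (H x hx).2.self_of_nhds.differentiableWithinAt, sz, contDiffOn_zero.2 fun x hx => (H x hx).1.cont.continuousWithinAt⟩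

theorem weak_deriv (h : Sol U z Z V g) (hV1 : ContDiffOn ℝ 1 V U) (hx0 : x0 ∈ U) :
    ∃ r > 0, ball x0 r ⊆ U ∧ ∀ e, Weak (ball x0 r) (fun x => fd V x e + g x • e) (fun _ => 0) := by
  obtain ⟨R, hR, h1⟩ := ball_small (k := 7) (h.hU.mem_nhds hx0) nz
  have hs : closedBall x0 (3 * (2 * R)) ⊆ U := fun x hx => h1 x (cbsb lz hx)
  obtain ⟨z', Z', V', g', a1, a2, a3, a4, a5, a6⟩ := globalize h.hU h.hz h.hZ h.hV h.hg h.hw (R := 2 * R) (x0 := x0) pz hs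
  let χ : ContDiffBump x0 := ⟨5 * R, 6 * R, pz, lz⟩
  have hχ1 : ∀ x ∈ ball x0 (5 * R), χ x = 1 := fun x hx => χ.one_of_mem_closedBall (bscb hx)
  have hW : ContDiff ℝ 1 (fun x => χ x • V x) := by
    refine contDiff_iff_contDiffAt.2 fun x => ?_
    by_cases hx : x ∈ tsupport χ
    · exact χ.contDiff.contDiffAt.smul (hV1.contDiffAt (h.hU.mem_nhds (hs (by rw [χ.tsupport_eq] at hx; convert hx using 2; simp only [χ]; ring))))
    · refine (contDiffAt_const (c := (0 : E))).congr_of_eventuallyEq ?_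
      filter_upwards [nmt.1 hx] with y hy
      simp [hy]
  set W := fun x => χ x • V x
  rw [show 5 / 2 * (2 * R) = 5 * R by ring] at a5 a6
  have hWw : Weak (ball x0 (5 * R)) W g' := a5.congr fun x hx => ⟨by simp [W, hχ1 x hx, (a6 x hx).2.2.1], rfl⟩
  refine ⟨4 * R, pz, fun x hx => h1 x (bsb lz hx), fun e => ?_⟩
  have key : Weak (ball x0 (4 * R)) (fun x => fd W x e + g' x • e) (fun _ => 0) := by
    intro φ hφ hφc hφs
    simp only [zero_mul, integral_zero]
    let D : E → E := fun x => fd W x e + g' x • e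
    have hW' : Continuous fun x => fd W x e := (hW.continuous_fderiv sz).clm_apply continuous_const
    have hD : Continuous D := fz
    let I : ℝ × E → E := fun q => ∫ t in Icc (0 : ℝ) 1, D (q.2 + (t * q.1) • e)
    have hI : Continuous I := by
      refine cpi (μ := (volume : Measure ℝ)) (f := fun (q : ℝ × E) (t : ℝ) => D (q.2 + (t * q.1) • e)) ?_ isCompact_Icc
      unfold Function.uncurry; fun_prop
    let N : ℝ → ℝ := fun s => ∫ x in tsupport φ, fd φ x (I (s, x))
    have hN : Continuous N := by
      refine cpi (μ := (volume : Measure E)) (f := fun (s : ℝ) (x : E) => fd φ x (I (s, x))) ?_ hφc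
      unfold Function.uncurry
      have := hφ.continuous_fderiv sz
      exact (this.comp continuous_snd).clm_apply hI
    have hN' : ∀ s, N s = ∫ x, fd φ x (I (s, x)) := fun s =>
      sie fun x hx => by simp [fderiv_zero_off hx]
    have hz : ∀ᶠ s in 𝓝[≠] (0 : ℝ), N s = 0 := by
      have h2 : ∀ᶠ s in 𝓝 (0 : ℝ), ‖s • e‖ < R := by
        refine (Continuous.tendsto fz _).eventually (gt_mem_nhds ?_)
        simpa using hR
      filter_upwards [h2.filter_mono nwn, self_mem_nhdsWithin] with s hs hs0
      have h3 := weak_dq hW.continuous a4 hs.le hWw s⁻¹ φ hφ hφc hφs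
      simp only [zero_mul, integral_zero] at h3
      rw [hN', ← h3]
      congr 1; ext x; congr 1
      have c1 : ∀ t : ℝ, HasDerivAt (fun t : ℝ => W (x + (t * s) • e)) (s • fd W (x + (t * s) • e) e) t := by
        intro t
        have h4 : HasDerivAt (fun t : ℝ => x + (t * s) • e) (s • e) t := by
          simpa using (((hasDerivAt_id t).mul_const s).smul_const e).const_add x
        refine ((hW.differentiable sz _).hasFDerivAt.comp_hasDerivAt t h4).congr_deriv ?_
        simp
      have c2 := iisub (a := 0) (b := 1) (fun t _ => c1 t) (Continuous.intervalIntegrable fz _ _)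
      rw [intervalIntegral.integral_of_le zero_le_one, ← integral_Icc_eq_integral_Ioc, integral_smul] at c2
      simp only [one_mul, zero_mul, zero_smul, add_zero] at c2
      simp only [I, D]
      rw [integral_add, integral_smul_const, smul_add, ← c2, smul_smul, inv_mul_cancel₀ hs0, one_smul]
      · simp only [smul_smul, mul_comm, ← mul_assoc]
        rw [mul_inv_cancel₀ hs0, one_mul]
      all_goals exact (Continuous.continuousOn fz).integrableOn_compact isCompact_Icc
    have h0 : N 0 = 0 := tendsto_nhds_unique ((hN.tendsto 0).mono_left nwn) (tendsto_const_nhds.congr' (hz.mono fun _ h => h.symm))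
    rw [hN'] at h0
    simpa [I, D] using h0
  refine key.congr fun x hx => ⟨?_, rfl⟩
  have hx5 : x ∈ ball x0 (5 * R) := bsb lz hx
  rw [(a6 x hx5).2.2.2]
  have : W =ᶠ[𝓝 x] V := by
    filter_upwards [isOpen_ball.mem_nhds hx5] with y hy
    simp [W, hχ1 y hy]
  rw [this.fderiv_eq]
end

section

variable {U : Set E} {z : E → ℝ} {Z V : E → E} {g : E → ℝ} {x0 : E} {F : Type} [NormedAddCommGroup F] [NormedSpace ℝ F]

theorem HC.zero (hU : IsOpen U) {f : E → F} (m : ℕ) (hf : HC U m f) : ∀ x ∈ U, LH f x := by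
  induction m with
  | zero => exact hf
  | succ m ih => exact ih (HC.pred hU m hf)

theorem hc_of_dir (hU : IsOpen U) (m : ℕ) {L : E → E →L[ℝ] F} (h : ∀ e, HC U m fun x => L x e) : HC U m L := by
  let b := stdOrthonormalBasis ℝ E
  have h1 : ∀ s : Finset (Fin (Module.finrank ℝ E)), HC U m fun x => ∑ i ∈ s, ContinuousLinearMap.smulRightL ℝ E F (innerSL ℝ (b i)) (L x (b i)) := by
    intro s
    induction s using Finset.induction_on with
    | empty => simpa using HC.const m (0 : E →L[ℝ] F)
    | insert i s hi ih => simp only [Finset.sum_insert hi]; exact HC.add hU m (HC.clm hU m _ (h (b i))) ih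
  refine HC.congr hU m (h1 Finset.univ) fun x _ => ?_
  ext e
  conv_lhs => rw [← b.sum_repr' e]
  simp [map_sum]

theorem hc_clm (m : ℕ) (L : E →L[ℝ] F) : HC U m fun x => L x := by
  cases m with
  | zero => exact fun x _ => LH.of_contDiffAt L.contDiff.contDiffAt
  | succ m => exact ⟨L.contDiff.contDiffOn, by rw [show fd (fun x => L x) = fun _ => L from funext fun x => L.fderiv]; exact HC.const m L⟩

theorem dqk {k : E → F} (hd : ∀ᶠ x in 𝓝 x0, DifferentiableAt ℝ k x) (hL : LH (fd k) x0) :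
    ∃ ρ > 0, ∃ K > 0, ∀ v : E, ‖v‖ ≤ ρ → ∀ x ∈ ball x0 ρ, ‖k (x + v) - k x‖ ≤ K * ‖v‖ ∧
      ∀ y ∈ ball x0 ρ, ‖(k (x + v) - k x) - (k (y + v) - k y)‖ ≤ K * ‖v‖ * ‖x - y‖ ^ hlf := by
  obtain ⟨K, hK, ρ, hρ, h⟩ := hL.exists
  obtain ⟨R, hR, h1⟩ := ball_small (k := 2) ((hd.and (isOpen_ball.eventually_mem (mem_ball_self hρ))).and (ContinuousAt.bdd hL.cont)) nz
  have hb : ∀ v : E, ‖v‖ ≤ R → ∀ x ∈ ball x0 R, ∀ t ∈ Icc (0 : ℝ) 1, x + t • v ∈ ball x0 (2 * R) := by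
    intro v hv x hx t ht
    have h1 : ‖t • v‖ ≤ R := by
      rw [norm_smul, nnn ht.1]
      exact (mlo nnz ht.2).trans hv
    rw [mem_ball, den] at *
    calc ‖x + t • v - x0‖ = ‖(x - x0) + t • v‖ := by congr 1; abel
      _ ≤ _ := norm_add_le _ _
      _ < _ := lz
  have hder : ∀ v : E, ‖v‖ ≤ R → ∀ x ∈ ball x0 R, ∀ t ∈ Icc (0 : ℝ) 1, HasDerivAt (fun t : ℝ => k (x + t • v)) (fd k (x + t • v) v) t := by
    intro v hv x hx t ht
    have h2 : HasDerivAt (fun t : ℝ => x + t • v) v t := by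
      simpa using ((hasDerivAt_id t).smul_const v).const_add x
    exact (h1 _ (hb v hv x hx t ht)).1.1.hasFDerivAt.comp_hasDerivAt t h2
  have hK0 := norm_nonneg (fd k x0)
  refine ⟨R, hR, K + (‖fd k x0‖ + 1), pz, fun v hv x hx => ⟨?_, fun y hy => ?_⟩⟩
  · have := norm_image_sub_le_of_norm_deriv_le_segment_01' (C := (‖fd k x0‖ + 1) * ‖v‖) (fun t ht => (hder v hv x hx t ht).hasDerivWithinAt) (fun t ht => by
      refine (lop _ _).trans ?_
      gcongr
      exact (h1 _ (hb v hv x hx t (Ico_subset_Icc_self ht))).2)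
    simp only [one_smul, zero_smul, add_zero] at this
    exact this.trans (mlr lz nnz)
  · have := norm_image_sub_le_of_norm_deriv_le_segment_01' (C := K * ‖x - y‖ ^ hlf * ‖v‖) (fun t ht => ((hder v hv x hx t ht).sub (hder v hv y hy t ht)).hasDerivWithinAt) (fun t ht => by
      rw [← _root_.sub_apply]
      refine (lop _ _).trans ?_
      gcongr
      have h3 := h _ (h1 _ (hb v hv x hx t (Ico_subset_Icc_self ht))).1.2 _ (h1 _ (hb v hv y hy t (Ico_subset_Icc_self ht))).1.2
      rwa [add_sub_add_right_eq_sub] at h3)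
    simp only [Pi.sub_apply, one_smul, zero_smul, add_zero] at this
    calc _ = ‖k (x + v) - k (y + v) - (k x - k y)‖ := by congr 1; abel
      _ ≤ _ := this
      _ ≤ (K + (‖fd k x0‖ + 1)) * ‖x - y‖ ^ hlf * ‖v‖ := by gcongr; linarith
      _ = _ := by ring

theorem grad_symm (h : ∀ᶠ x in 𝓝 x0, HasGradientAt z (Z x) x) (hd : DifferentiableAt ℝ Z x0) (v w : E) : ⟪fd Z x0 v, w⟫ = ⟪fd Z x0 w, v⟫ := by
  have := second_derivative_symmetric_of_eventually (f := z) (f' := fun x => tD E (Z x)) (f'' := ((tD E).toContinuousLinearEquiv.toContinuousLinearMap).comp (fd Z x0)) (h.mono fun x hx => hx.hasFDerivAt)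
    (((tD E).toContinuousLinearEquiv.toContinuousLinearMap).hasFDerivAt.comp x0 hd.hasFDerivAt) v w
  simpa using this

theorem sol_deriv (h : Sol U z Z V g) (hZ1 : ContDiffOn ℝ 1 Z U) (hV1 : ContDiffOn ℝ 1 V U) (hx0 : x0 ∈ U) :
    ∃ r > 0, ball x0 r ⊆ U ∧ ∀ (e : E) (V' : E → E), (∀ x ∈ U, V' x = fd V x e + g x • e) →
      Sol (ball x0 r) (fun x => ⟪Z x, e⟫) (fun x => fd Z x e) V' (fun _ => 0) := by
  obtain ⟨r, hr, hrU, hw⟩ := weak_deriv h hV1 hx0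
  refine ⟨r, hr, hrU, fun e V' hV' => ⟨isOpen_ball, ContDiffOn.inner ℝ (hZ1.mono hrU) contDiffOn_const, fun x hx => ?_, ?_, continuousOn_const, (hw e).congr fun x hx => ⟨hV' x (hrU hx), rfl⟩⟩⟩
  · have hd := (hZ1.contDiffAt (h.hU.mem_nhds (hrU hx))).differentiableAt sz
    refine (hd.hasFDerivAt.inner ℝ (hasFDerivAt_const e x)).congr_fderiv ?_
    ext v
    simp only [fderivInnerCLM_apply, ContinuousLinearMap.comp_apply, ContinuousLinearMap.prod_apply, _root_.zero_apply, inner_zero_right, InnerProductSpace.toDual_apply_apply, zero_add]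
    exact grad_symm (by filter_upwards [h.hU.mem_nhds (hrU hx)] with y hy using h.hZ y hy) hd v e
  · refine ContinuousOn.congr ?_ fun x hx => hV' x (hrU hx)
    exact (((hV1.continuousOn_fderiv_of_isOpen h.hU sz).mono hrU).clm_apply continuousOn_const).add ((h.hg.mono hrU).smul continuousOn_const)

theorem lin (m : ℕ) : ∀ {U : Set E} {z : E → ℝ} {Z F : E → E} {a : E → E →L[ℝ] E}, Sol U z Z (fun x => a x (Z x) + F x) (fun _ => 0) → (∀ x ∈ U, SPD (a x)) → HC U m a → HC U m F → HC U m Z := by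
  induction m with
  | zero =>
    intro U z Z F a h hS ha hF x0 hx0
    refine holder_pt h (hS x0 hx0) hx0 fun θ hθ => ?_
    obtain ⟨K1, hK1, ρ1, hρ1, h1⟩ := (ha x0 hx0).exists
    obtain ⟨K2, hK2, ρ2, hρ2, h2⟩ := (hF x0 hx0).exists
    obtain ⟨ρ3, hρ3, h3⟩ := Metric.continuousAt_iff.1 (ha x0 hx0).cont θ hθ
    refine ⟨min ρ1 (min ρ2 ρ3), pz, K1 + K2, pz, univ, isClosed_univ, convex_univ, fun _ _ => mem_univ _, fun q _ x hx => ⟨a x q - a x0 q + F x, fun y hy => ?_⟩⟩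
    simp only [mem_ball, lt_min_iff] at hx hy
    have e : a y (Z y) + F y - a x0 (Z y) - (a x q - a x0 q + F x) = (a y - a x0) (Z y - q) + (a y - a x) q + (F y - F x) := by
      simp only [_root_.sub_apply, map_sub]; abel
    rw [e]
    have n1 : ‖(a y - a x0) (Z y - q)‖ ≤ θ * ‖Z y - q‖ := (lop _ _).trans (by
      gcongr; rw [← den]; exact (h3 hy.2.2).le)
    have n2 : ‖(a y - a x) q‖ ≤ K1 * ‖y - x‖ ^ hlf * ‖q‖ := (lop _ _).trans (by
      gcongr; exact h1 y hy.1 x hx.1)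
    have n3 := h2 y hy.2.1 x hx.2.1
    have n4 : 0 ≤ K2 * ‖y - x‖ ^ hlf * ‖q‖ := pz
    have n5 : 0 ≤ K1 * ‖y - x‖ ^ hlf := pz
    refine norm_add₃_le.trans ?_
    linarith
  | succ m ih =>
    intro U z Z F a h hS ha hF
    have hZm := ih h hS (HC.pred h.hU m ha) (HC.pred h.hU m hF)
    have hZL := HC.zero h.hU m hZm
    have dif : ∀ {G : Type} [NormedAddCommGroup G] [NormedSpace ℝ G] {f : E → G}, HC U (m + 1) f → ∀ x ∈ U, DifferentiableAt ℝ f x := fun hf x hx =>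
      (hf.1.contDiffAt (h.hU.mem_nhds hx)).differentiableAt sz
    have hev : ∀ {P : E → Prop}, (∀ x ∈ U, P x) → ∀ x ∈ U, ∀ᶠ y in 𝓝 x, P y := fun hP x hx => (h.hU.eventually_mem hx).mono hP
    have h1 : HC U 1 Z := by
      refine hc_one h fun x0 hx0 => dq_pt h (hS x0 hx0) hx0 (LH.of_contDiffAt contDiffAt_const) fun θ hθ => ?_
      obtain ⟨ρ1, hρ1, K1, hK1, H1⟩ := dqk (hev (dif ha) x0 hx0) (HC.zero h.hU m ha.2 x0 hx0)
      obtain ⟨ρ2, hρ2, K2, hK2, H2⟩ := dqk (hev (dif hF) x0 hx0) (HC.zero h.hU m hF.2 x0 hx0)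
      obtain ⟨K3, hK3, ρ3, hρ3, H3⟩ := (hZL x0 hx0).exists
      obtain ⟨K4, hK4, ρ4, hρ4, H4⟩ := (HC.zero h.hU _ ha x0 hx0).exists
      obtain ⟨ρ5, hρ5, H5⟩ := Metric.continuousAt_iff.1 (HC.zero h.hU _ ha x0 hx0).cont θ hθ
      obtain ⟨ρ6, hρ6, H6⟩ := Metric.eventually_nhds_iff_ball.1 (ContinuousAt.bdd (hZL x0 hx0).cont)
      set M := ‖Z x0‖ + 1
      have hM : 0 < M := pz
      set ρ := min (min ρ1 ρ2) (min (min ρ3 ρ6) (min ρ4 ρ5 / 2))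
      have hρ : 0 < ρ := pz
      have l1 : ρ ≤ ρ1 := (min_le_left _ _).trans (min_le_left _ _)
      have l2 : ρ ≤ ρ2 := (min_le_left _ _).trans (min_le_right _ _)
      have l3 : ρ ≤ ρ3 := (min_le_right _ _).trans ((min_le_left _ _).trans (min_le_left _ _))
      have l6 : ρ ≤ ρ6 := (min_le_right _ _).trans ((min_le_left _ _).trans (min_le_right _ _))
      have l45 : ρ ≤ min ρ4 ρ5 / 2 := (min_le_right _ _).trans (min_le_right _ _)
      have l4 : 2 * ρ ≤ ρ4 := by linarith [min_le_left ρ4 ρ5]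
      have l5 : 2 * ρ ≤ ρ5 := by linarith [min_le_right ρ4 ρ5]
      refine ⟨ρ, hρ, K1 * M + K1 * K3 + K2 + K4, pz, fun v hv0 hv => ⟨fun x => a (x + v), fun x => ‖v‖⁻¹ • ((a (x + v) - a x) (Z x) + (F (x + v) - F x)), fun x hx => ?_⟩⟩
      have hvp : 0 < ‖v‖ := norm_pos_iff.2 hv0
      have hb : ∀ y ∈ ball x0 ρ, y + v ∈ ball x0 (2 * ρ) := by
        intro y hy
        rw [mem_ball, den] at *
        calc ‖y + v - x0‖ = ‖(y - x0) + v‖ := by congr 1; abel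
          _ ≤ _ := norm_add_le _ _
          _ < _ := lz
      have sb : ∀ {r}, ρ ≤ r → ∀ {y}, y ∈ ball x0 ρ → y ∈ ball x0 r := fun hr _ hy => bsb hr hy
      have hZx := H6 x (sb l6 hx)
      obtain ⟨b1, b2⟩ := H1 v (hv.trans l1) x (sb l1 hx)
      obtain ⟨c1, c2⟩ := H2 v (hv.trans l2) x (sb l2 hx)
      have p1 : 0 < K1 * M := pz
      have p2 : 0 < K1 * K3 := pz
      refine ⟨?_, ?_, ?_, fun y hy => ⟨?_, ?_⟩⟩
      · rw [smul_inv_smul₀ hvp.ne']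
        simp only [_root_.sub_apply, map_sub]; abel
      · rw [← den]; exact (H5 (bsb l5 (hb x hx))).le
      · rw [norm_smul, norm_inv, norm_norm, inv_mul_le_iff₀ hvp]
        have n1 : ‖(a (x + v) - a x) (Z x)‖ ≤ K1 * ‖v‖ * M := (lop _ _).trans (by gcongr)
        have n2 : 0 ≤ (K1 * K3 + K4) * ‖v‖ := pz
        refine (norm_add_le _ _).trans ?_
        linarith
      · have := H4 _ (bsb l4 (hb x hx)) _ (bsb l4 (hb y hy))
        rw [add_sub_add_right_eq_sub] at this
        exact this.trans (by gcongr; linarith)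
      · obtain ⟨b3, -⟩ := H1 v (hv.trans l1) y (sb l1 hy)
        rw [← smul_sub, norm_smul, norm_inv, norm_norm, inv_mul_le_iff₀ hvp]
        have e : (a (x + v) - a x) (Z x) + (F (x + v) - F x) - ((a (y + v) - a y) (Z y) + (F (y + v) - F y)) =
          ((a (x + v) - a x) - (a (y + v) - a y)) (Z x) + (a (y + v) - a y) (Z x - Z y) + ((F (x + v) - F x) - (F (y + v) - F y)) := by
          simp only [_root_.sub_apply, map_sub]; abel
        rw [e]
        set d := ‖x - y‖ ^ hlf
        have hd : 0 ≤ d := pz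
        have n1 : ‖((a (x + v) - a x) - (a (y + v) - a y)) (Z x)‖ ≤ K1 * ‖v‖ * d * M := (lop _ _).trans (by
          gcongr; exact b2 y (sb l1 hy))
        have n2 : ‖(a (y + v) - a y) (Z x - Z y)‖ ≤ K1 * ‖v‖ * (K3 * d) := (lop _ _).trans (by
          gcongr; exact H3 x (sb l3 hx) y (sb l3 hy))
        have n3 := c2 y (sb l2 hy)
        have n4 : 0 ≤ K4 * ‖v‖ * d := pz
        refine norm_add₃_le.trans ?_
        linarith
    refine ⟨h1.1, HC.local m fun x0 hx0 => ?_⟩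
    have hV1 : ContDiffOn ℝ 1 (fun x => a x (Z x) + F x) U := (ha.1.clm_apply h1.1).add hF.1
    obtain ⟨r, hr, hrU, H⟩ := sol_deriv h h1.1 hV1 hx0
    refine ⟨r, hr, hc_of_dir isOpen_ball m fun e => ?_⟩
    have h2 := H e (fun x => a x (fd Z x e) + ((fd a x e) (Z x) + fd F x e)) fun x hx => by
      have d1 := dif ha x hx
      have d2 := (h1.1.contDiffAt (h.hU.mem_nhds hx)).differentiableAt sz
      have hh : HasFDerivAt (fun x => a x (Z x) + F x) _ x := (d1.hasFDerivAt.clm_apply d2.hasFDerivAt).add (dif hF x hx).hasFDerivAt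
      rw [hh.fderiv]
      simp [add_assoc]
    refine ih h2 (fun x hx => hS x (hrU hx)) (HC.mono hrU m (HC.pred h.hU m ha)) (HC.add isOpen_ball m ?_ ?_)
    · exact HC.bilin isOpen_ball m (ContinuousLinearMap.id ℝ (E →L[ℝ] E)) (HC.clm isOpen_ball m (ContinuousLinearMap.apply ℝ (E →L[ℝ] E) e) (HC.mono hrU m ha.2)) (HC.mono hrU m hZm)
    · exact HC.clm isOpen_ball m (ContinuousLinearMap.apply ℝ E e) (HC.mono hrU m hF.2)
end

section

theorem nl_avg {Φ : E → E} (hΦ : ContDiff ℝ 2 Φ) (η0 : E) {θ : ℝ} (hθ : 0 < θ) : ∃ s > 0, ∃ K > 0, ∃ A : E → E → E →L[ℝ] E,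
    (∀ η ξ, Φ ξ - Φ η = A η ξ (ξ - η)) ∧ (∀ η ∈ ball η0 s, ∀ ξ ∈ ball η0 s, ‖A η ξ - fd Φ η0‖ ≤ θ ∧
      ∀ η' ∈ ball η0 s, ∀ ξ' ∈ ball η0 s, ‖A η ξ - A η' ξ'‖ ≤ K * (‖η - η'‖ + ‖ξ - ξ'‖)) := by
  have hD : ContDiff ℝ 1 (fd Φ) := hΦ.fderiv_right nz
  obtain ⟨K, T, hT, hL⟩ := hD.contDiffAt.exists_lipschitzOnWith (x := η0)
  have h1 : ∀ᶠ η in 𝓝 η0, ‖fd Φ η - fd Φ η0‖ < θ := by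
    have := (hD.continuous.sub continuous_const).norm.tendsto η0 (f := fun η => ‖fd Φ η - fd Φ η0‖)
    simp only [sub_self, norm_zero] at this
    exact this.eventually_lt_const hθ
  obtain ⟨s, hs, hb⟩ := Metric.eventually_nhds_iff_ball.1 (h1.and hT)
  have hseg : ∀ η ∈ ball η0 s, ∀ ξ ∈ ball η0 s, ∀ t ∈ Icc (0 : ℝ) 1, η + t • (ξ - η) ∈ ball η0 s := fun η hη ξ hξ t ht =>
    (convex_ball η0 s).add_smul_sub_mem hη hξ ht
  have hc : ∀ η ξ : E, Continuous fun t : ℝ => fd Φ (η + t • (ξ - η)) := fun η ξ => hD.continuous.comp fz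
  have hi : ∀ η ξ : E, IntervalIntegrable (fun t : ℝ => fd Φ (η + t • (ξ - η))) volume 0 1 := fun η ξ => (hc η ξ).intervalIntegrable 0 1
  refine ⟨s, hs, K + 1, pz, fun η ξ => ∫ t in (0:ℝ)..1, fd Φ (η + t • (ξ - η)), fun η ξ => ?_, fun η hη ξ hξ => ⟨?_, fun η' hη' ξ' hξ' => ?_⟩⟩
  · beta_reduce
    rw [ContinuousLinearMap.intervalIntegral_apply (hi η ξ)]
    have := iisub (a := 0) (b := 1) (f := fun t : ℝ => Φ (η + t • (ξ - η))) (f' := fun t => fd Φ (η + t • (ξ - η)) (ξ - η)) (fun t _ => by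
      have h2 : HasDerivAt (fun t : ℝ => η + t • (ξ - η)) (ξ - η) t := by
        simpa using ((hasDerivAt_id t).smul_const (ξ - η)).const_add η
      exact ((hΦ.differentiable nz) _).hasFDerivAt.comp_hasDerivAt t h2) (((hc η ξ).clm_apply continuous_const).intervalIntegrable 0 1)
    rw [this]; simp
  · have : (∫ t in (0:ℝ)..1, fd Φ (η + t • (ξ - η))) - fd Φ η0 = ∫ t in (0:ℝ)..1, (fd Φ (η + t • (ξ - η)) - fd Φ η0) := by
      rw [intervalIntegral.integral_sub (hi η ξ) sz]; simp
    rw [this]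
    refine (intervalIntegral.norm_integral_le_of_norm_le_const (C := θ) fun t ht => ?_).trans sz
    rw [uIoc_of_le zero_le_one] at ht
    exact (hb _ (hseg η hη ξ hξ t (Ioc_subset_Icc_self ht))).1.le
  · rw [← intervalIntegral.integral_sub (hi η ξ) (hi η' ξ')]
    refine (intervalIntegral.norm_integral_le_of_norm_le_const (C := (K + 1) * (‖η - η'‖ + ‖ξ - ξ'‖)) fun t ht => ?_).trans sz
    rw [uIoc_of_le zero_le_one] at ht
    have h3 := hL.dist_le_mul _ (hb _ (hseg η hη ξ hξ t (Ioc_subset_Icc_self ht))).2 _ (hb _ (hseg η' hη' ξ' hξ' t (Ioc_subset_Icc_self ht))).2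
    rw [den, den] at h3
    have h4 : ‖η + t • (ξ - η) - (η' + t • (ξ' - η'))‖ ≤ ‖η - η'‖ + ‖ξ - ξ'‖ := by
      rw [show η + t • (ξ - η) - (η' + t • (ξ' - η')) = (1 - t) • (η - η') + t • (ξ - ξ') by module]
      refine (norm_add_le _ _).trans ?_
      rw [norm_smul, norm_smul, nnn ht.1.le, nnn (by linarith [ht.2])]
      nlinarith [norm_nonneg (η - η'), norm_nonneg (ξ - ξ'), ht.1, ht.2]
    refine h3.trans ?_
    gcongr
    linarith

theorem nonlin {U : Set E} {z : E → ℝ} {Z : E → E} {Φ : E → E} {G : E × E → ℝ} (hΦ : ∀ m : ℕ, ContDiff ℝ m Φ) (hG : ∀ m : ℕ, ContDiff ℝ m G) (hS : ∀ η, SPD (fd Φ η))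
    (h : Sol U z Z (fun x => Φ (Z x)) (fun x => G (x, Z x))) (m : ℕ) : HC U m Z := by
  have hLH : HC U 0 Z := fun x0 hx0 => by
    refine holder_pt h (hS (Z x0)) hx0 fun θ hθ => ?_
    have hst := ((hΦ 1).contDiffAt.hasStrictFDerivAt (x := Z x0) nz).isLittleO
    have h1 := hst.bound hθ
    rw [nhds_prod_eq] at h1
    obtain ⟨P, hP, h2⟩ := Filter.eventually_prod_self_iff'.1 h1
    obtain ⟨s, hs, hb⟩ := Metric.nhds_basis_closedBall.mem_iff.1 hP
    have hcx : ContinuousAt Z x0 := h.cZ.continuousAt (h.hU.mem_nhds hx0)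
    obtain ⟨ρ, hρ, hb2⟩ := Metric.eventually_nhds_iff_ball.1 (hcx.eventually (Metric.closedBall_mem_nhds (Z x0) hs))
    refine ⟨ρ, hρ, 1, one_pos, closedBall (Z x0) s, isClosed_closedBall, convex_closedBall _ _, hb2, fun q hq x hx => ⟨Φ q - fd Φ (Z x0) q, fun y hy => ?_⟩⟩
    have h3 := h2 _ (hb (hb2 y hy)) _ (hb hq)
    simp only [map_sub] at h3
    have h4 : 0 ≤ 1 * ‖y - x‖ ^ hlf * (1 + ‖q‖) := pz
    calc _ = ‖Φ (Z y) - Φ q - (fd Φ (Z x0) (Z y) - fd Φ (Z x0) q)‖ := by congr 1; abel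
      _ ≤ _ := lz
  have hpair : ∀ {U : Set E} (m : ℕ), IsOpen U → HC U m Z → HC U m fun x => (x, Z x) := fun m hU hZ => by
    refine HC.congr hU m (HC.add hU m (hc_clm m (ContinuousLinearMap.inl ℝ E E)) (HC.clm hU m (ContinuousLinearMap.inr ℝ E E) hZ)) fun x _ => ?_
    simp
  have h1 : HC U 1 Z := hc_one h fun x0 hx0 => by
    have hL := hLH x0 hx0
    refine dq_pt h (hS (Z x0)) hx0 (LH.comp (hpair 0 h.hU hLH x0 hx0) (hG 1).contDiffAt) fun θ hθ => ?_
    obtain ⟨s, hs, K, hK, A, hA, hb⟩ := nl_avg (hΦ 2) (Z x0) hθ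
    obtain ⟨K1, hK1, ρ1, hρ1, hl⟩ := hL.exists
    obtain ⟨R, hR, hb2⟩ := ball_small (k := 2) ((hL.cont.eventually (Metric.ball_mem_nhds (Z x0) hs)).and (isOpen_ball.eventually_mem (mem_ball_self hρ1))) nz
    have hx2 : ∀ x ∈ ball x0 R, x ∈ ball x0 (2 * R) := fun x hx => bsb lz hx
    refine ⟨R, hR, K * (K1 + K1), pz, fun v _ hv => ⟨fun x => A (Z x) (Z (x + v)), fun _ => 0, fun x hx => ?_⟩⟩
    have hxv : ∀ x ∈ ball x0 R, x + v ∈ ball x0 (2 * R) := fun x hx => by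
      rw [mem_ball, den] at *
      rw [show x + v - x0 = x - x0 + v by abel]
      linarith [norm_add_le (x - x0) v]
    refine ⟨by simp [hA], (hb _ (hb2 x (hx2 x hx)).1 _ (hb2 _ (hxv x hx)).1).1, by simp; positivity, fun y hy => ⟨?_, by simp; positivity⟩⟩
    refine ((hb _ (hb2 x (hx2 x hx)).1 _ (hb2 _ (hxv x hx)).1).2 _ (hb2 y (hx2 y hy)).1 _ (hb2 _ (hxv y hy)).1).trans ?_
    have e1 := hl x (hb2 x (hx2 x hx)).2 y (hb2 y (hx2 y hy)).2
    have e2 := hl _ (hb2 _ (hxv x hx)).2 _ (hb2 _ (hxv y hy)).2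
    rw [add_sub_add_right_eq_sub] at e2
    rw [mul_assoc, add_mul]
    gcongr
  have hm : ∀ m : ℕ, HC U (m + 1) Z := by
    intro m
    induction m with
    | zero => exact h1
    | succ m ih =>
      refine ⟨h1.1, HC.local (m + 1) fun x0 hx0 => ?_⟩
      have hV1 : ContDiffOn ℝ 1 (fun x => Φ (Z x)) U := (hΦ 1).comp_contDiffOn h1.1
      obtain ⟨r, hr, hrU, H⟩ := sol_deriv h h1.1 hV1 hx0
      refine ⟨r, hr, hc_of_dir isOpen_ball (m + 1) fun e => ?_⟩
      have h2 := H e (fun x => fd Φ (Z x) (fd Z x e) + G (x, Z x) • e) fun x hx => by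
        have d2 := (h1.1.contDiffAt (h.hU.mem_nhds hx)).differentiableAt sz
        have hh : HasFDerivAt (fun x => Φ (Z x)) _ x := (((hΦ 1).differentiable sz) (Z x)).hasFDerivAt.comp x d2.hasFDerivAt
        rw [hh.fderiv]; simp
      have ih' := HC.mono hrU (m + 1) ih
      have hD : ContDiff ℝ ((m + 1 : ℕ) + 1) (fd Φ) := (hΦ (m + 3)).fderiv_right (by norm_cast)
      refine lin (m + 1) h2 (fun x _ => hS _) (HC.comp isOpen_ball (m + 1) hD ih') ?_
      have h5 := HC.comp isOpen_ball (m + 1) (by exact_mod_cast hG (m + 2)) (hpair (m + 1) isOpen_ball ih')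
      exact HC.clm isOpen_ball (m + 1) (ContinuousLinearMap.smulRight (1 : ℝ →L[ℝ] ℝ) e) h5
  exact HC.pred h.hU m (hm m)
end

section

noncomputable def tr (X : E →L[ℝ] E) : ℝ := ∑ i, ⟪X (stdOrthonormalBasis ℝ E i), stdOrthonormalBasis ℝ E i⟫
noncomputable def Rf (p ε : ℝ) (η : E) : ℝ := (ε + ‖η‖ ^ 2) ^ ((p - 2) / 2)
noncomputable def gf (p ε l : ℝ) (q : E × E) : ℝ := l + Rf p ε q.2 * ((p - 1) * ‖q.2‖ ^ 2 - ε - ⟪q.2, q.1⟫)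
noncomputable def opP (p ε : ℝ) (η : E) (X : E →L[ℝ] E) : ℝ := tr X + (p - 2) * ⟪X η, η⟫ / (ε + ‖η‖ ^ 2)

variable {p ε l : ℝ}

theorem Rf_pos (hε : 0 < ε) (η : E) : 0 < Rf p ε η := Real.rpow_pos_of_pos pz _

theorem Rf_contDiff (hε : 0 < ε) (m : ℕ) : ContDiff ℝ m (Rf p ε : E → ℝ) :=
  (contDiff_const.add (contDiff_norm_sq ℝ)).rpow_const_of_ne fun η => pz

theorem gf_contDiff (hε : 0 < ε) (m : ℕ) : ContDiff ℝ m (gf p ε l : E × E → ℝ) :=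
  contDiff_const.add (((Rf_contDiff hε m).comp contDiff_snd).mul (((contDiff_const.mul ((contDiff_norm_sq ℝ).comp contDiff_snd)).sub contDiff_const).sub (contDiff_snd.inner ℝ contDiff_fst)))

theorem V_deriv (hε : 0 < ε) (η ξ : E) : fd (fun η : E => Rf p ε η • η) η ξ = Rf p ε η • (ξ + ((p - 2) * ⟪η, ξ⟫ / (ε + ‖η‖ ^ 2)) • η) := by
  have h0 : 0 < ε + ‖η‖ ^ 2 := pz
  have h1 : HasFDerivAt (fun η : E => ε + ‖η‖ ^ 2) (2 • innerSL ℝ η) η := by simpa using ((hasStrictFDerivAt_norm_sq η).hasFDerivAt).const_add ε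
  have h2 : HasFDerivAt (fun η : E => Rf p ε η • η) _ η := (h1.rpow_const (p := (p - 2) / 2) (Or.inl h0.ne')).smul (hasFDerivAt_id η)
  rw [h2.fderiv]
  have h3 : (ε + ‖η‖ ^ 2) ^ ((p - 2) / 2 - 1) = Rf p ε η / (ε + ‖η‖ ^ 2) := Real.rpow_sub_one h0.ne' _
  simp only [add_apply, smul_apply, ContinuousLinearMap.smulRight_apply, id_eq, h3, ContinuousLinearMap.coe_id', innerSL_apply_apply, smul_add, smul_smul, smul_eq_mul, nsmul_eq_mul, Nat.cast_ofNat]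
  congr 2
  field_simp

theorem mp_le (_hp : 1 < p) {t : ℝ} (h0 : 0 ≤ t) (h1 : t ≤ 1) : min 1 (p - 1) ≤ 1 + (p - 2) * t := by
  rcases le_total 2 p with h | h
  · exact (min_le_left _ _).trans (by nlinarith)
  · exact (min_le_right _ _).trans (by nlinarith)

theorem V_spd (hp : 1 < p) (hε : 0 < ε) (η : E) : SPD (fd (fun η : E => Rf p ε η • η) η) := by
  have hR := Rf_pos (p := p) hε η
  have h0 : 0 < ε + ‖η‖ ^ 2 := pz
  refine ⟨fun x y => ?_, Rf p ε η * min 1 (p - 1), mul_pos hR (lt_min one_pos lz), fun x => ?_⟩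
  · rw [V_deriv hε, V_deriv hε]
    simp only [isml, inner_smul_right, inner_add_left, inner_add_right, cjr]
    rw [real_inner_comm η x]; ring
  · rw [V_deriv hε]
    simp only [isml, inner_add_left, cjr, riq]
    rw [mul_assoc]
    refine mll ?_ hR.le
    rcases eq_or_ne x 0 with rfl | hx
    · simp
    have hx2 : 0 < ‖x‖ ^ 2 := pz
    have hi : ⟪η, x⟫ ^ 2 ≤ ‖η‖ ^ 2 * ‖x‖ ^ 2 := by
      rw [← mul_pow, ← sq_abs]; gcongr; exact ail η x
    have := mp_le hp (t := ⟪η, x⟫ ^ 2 / ((ε + ‖η‖ ^ 2) * ‖x‖ ^ 2)) pz ((div_le_one pz).2 (by nlinarith))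
    calc _ ≤ (1 + (p - 2) * (⟪η, x⟫ ^ 2 / ((ε + ‖η‖ ^ 2) * ‖x‖ ^ 2))) * ‖x‖ ^ 2 := by gcongr
      _ = _ := by field_simp

theorem psd_cs {Y : E →L[ℝ] E} (hs : ∀ x y, ⟪Y x, y⟫ = ⟪Y y, x⟫) (h0 : ∀ x, 0 ≤ ⟪Y x, x⟫) (x y : E) : ⟪Y x, y⟫ ^ 2 ≤ ⟪Y x, x⟫ * ⟪Y y, y⟫ := by
  have h : ∀ t : ℝ, 0 ≤ ⟪Y y, y⟫ * (t * t) + (2 * ⟪Y x, y⟫) * t + ⟪Y x, x⟫ := fun t => by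
    have := h0 (x + t • y)
    simp only [map_add, map_smul, inner_add_left, inner_add_right, isml, inner_smul_right, cjr, hs y x] at this
    linarith
  have := discrim_le_zero h
  rw [discrim] at this; linarith

theorem quad_le_tr {Y : E →L[ℝ] E} (hs : ∀ x y, ⟪Y x, y⟫ = ⟪Y y, x⟫) (h0 : ∀ x, 0 ≤ ⟪Y x, x⟫) (η : E) : ⟪Y η, η⟫ ≤ tr Y * ‖η‖ ^ 2 := by
  set b := stdOrthonormalBasis ℝ E
  have h1 : ⟪Y η, η⟫ = ∑ i, ⟪b i, η⟫ * ⟪Y η, b i⟫ := by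
    conv_lhs => rw [← b.sum_repr' η, inner_sum]
    simp [inner_smul_right, b.sum_repr']
  have h2 : ⟪Y η, η⟫ ^ 2 ≤ ‖η‖ ^ 2 * ∑ i, ⟪Y η, b i⟫ ^ 2 := by
    conv_lhs => rw [h1]
    refine (Finset.sum_mul_sq_le_sq_mul_sq _ _ _).trans (le_of_eq ?_)
    congr 1
    simpa [real_inner_comm] using b.sum_sq_norm_inner_right η
  have h3 : ∑ i, ⟪Y η, b i⟫ ^ 2 ≤ ⟪Y η, η⟫ * tr Y := by
    rw [tr, Finset.mul_sum]
    exact Finset.sum_le_sum fun i _ => psd_cs hs h0 _ _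
  have ht : 0 ≤ tr Y := Finset.sum_nonneg fun i _ => h0 _
  rcases (h0 η).eq_or_lt with h | h
  · rw [← h]; positivity
  · exact le_of_mul_le_mul_left (by nlinarith [sq_nonneg ‖η‖]) h

theorem psd_norm {Y : E →L[ℝ] E} (hs : ∀ x y, ⟪Y x, y⟫ = ⟪Y y, x⟫) (h0 : ∀ x, 0 ≤ ⟪Y x, x⟫) : ‖Y‖ ≤ tr Y := by
  have ht : 0 ≤ tr Y := Finset.sum_nonneg fun i _ => h0 _
  refine Y.opNorm_le_bound ht fun x => ?_
  have h1 := psd_cs hs h0 x (Y x)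
  rw [riq] at h1
  have h2 := quad_le_tr hs h0 x
  have h3 := quad_le_tr hs h0 (Y x)
  have h4 : (‖Y x‖ ^ 2) ^ 2 ≤ (tr Y * ‖x‖ ^ 2) * (tr Y * ‖Y x‖ ^ 2) := h1.trans (mul_le_mul h2 h3 (h0 _) pz)
  rcases eq_or_ne (Y x) 0 with h | h
  · rw [h, norm_zero]; positivity
  have h5 : 0 < ‖Y x‖ ^ 2 := pz
  refine le_of_sq_le_sq ?_ pz
  exact le_of_mul_le_mul_right lz h5

theorem opP_nonneg (hp : 1 < p) (hε : 0 < ε) {Y : E →L[ℝ] E} (hs : ∀ x y, ⟪Y x, y⟫ = ⟪Y y, x⟫) (h0 : ∀ x, 0 ≤ ⟪Y x, x⟫) (η : E) : min 1 (p - 1) * tr Y ≤ opP p ε η Y := by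
  have h1 := quad_le_tr hs h0 η
  have ht : 0 ≤ tr Y := Finset.sum_nonneg fun i _ => h0 _
  have hR : 0 < ε + ‖η‖ ^ 2 := pz
  rcases ht.eq_or_lt with h | h
  · have : ⟪Y η, η⟫ = 0 := le_antisymm (by rw [← h] at h1; linarith) (h0 η)
    simp [opP, ← h, this]
  · have := mp_le hp (t := ⟪Y η, η⟫ / (tr Y * (ε + ‖η‖ ^ 2))) (div_nonneg (h0 η) pz) ((div_le_one pz).2 (by nlinarith))
    calc _ ≤ (1 + (p - 2) * (⟪Y η, η⟫ / (tr Y * (ε + ‖η‖ ^ 2)))) * tr Y := by gcongr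
      _ = _ := by rw [opP]; field_simp

theorem tr_sub (X Y : E →L[ℝ] E) : tr (X - Y) = tr X - tr Y := by simp [tr, inner_sub_left]

theorem opP_sub (η : E) (X Y : E →L[ℝ] E) : opP p ε η (X - Y) = opP p ε η X - opP p ε η Y := by
  simp only [opP, tr_sub, _root_.sub_apply, inner_sub_left]; ring

theorem opP_mono (hp : 1 < p) (hε : 0 < ε) {X Y : E →L[ℝ] E} (hX : ∀ x y, ⟪X x, y⟫ = ⟪X y, x⟫) (hY : ∀ x y, ⟪Y x, y⟫ = ⟪Y y, x⟫) (h0 : ∀ x, ⟪Y x, x⟫ ≤ ⟪X x, x⟫) (η : E) : opP p ε η Y ≤ opP p ε η X := by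
  have h1 : ∀ x, 0 ≤ ⟪(X - Y) x, x⟫ := fun x => by simpa [inner_sub_left] using h0 x
  have := opP_nonneg (p := p) (ε := ε) hp hε (Y := X - Y) (fun x y => by simp [inner_sub_left, hX x y, hY x y]) h1 η
  rw [opP_sub] at this
  have ht : 0 ≤ tr (X - Y) := Finset.sum_nonneg fun i _ => h1 _
  have : 0 ≤ min 1 (p - 1) * tr (X - Y) := mul_nonneg (le_min zero_le_one lz) ht
  linarith

theorem tr_V (hε : 0 < ε) (η : E) {X : E →L[ℝ] E} (hX : ∀ x y, ⟪X x, y⟫ = ⟪X y, x⟫) : tr ((fd (fun η : E => Rf p ε η • η) η).comp X) = Rf p ε η * opP p ε η X := by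
  set b := stdOrthonormalBasis ℝ E with hb
  have h1 : ∑ i, ⟪η, X (b i)⟫ * ⟪η, b i⟫ = ⟪X η, η⟫ := by
    rw [← b.sum_inner_mul_inner (X η) η]
    refine Finset.sum_congr rfl fun i _ => ?_
    rw [real_inner_comm, hX, real_inner_comm η]
  rw [opP, ← h1, tr, tr, ← hb, mul_add, Finset.mul_sum, Finset.mul_sum, Finset.sum_div, Finset.mul_sum, ← Finset.sum_add_distrib]
  refine Finset.sum_congr rfl fun i _ => ?_
  rw [ContinuousLinearMap.comp_apply, V_deriv hε]
  simp only [isml, inner_add_left, cjr]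
  ring

theorem second_order {d : E → ℝ} {D : E → E} {x0 : E} (h : ∀ᶠ x in 𝓝 x0, HasGradientAt d (D x) x) (hm : IsLocalMin d x0) (hd : DifferentiableAt ℝ D x0) :
    D x0 = 0 ∧ ∀ ξ, 0 ≤ ⟪fd D x0 ξ, ξ⟫ := by
  have h0 : D x0 = 0 := by
    have := hm.hasFDerivAt_eq_zero h.self_of_nhds.hasFDerivAt
    simpa using this
  refine ⟨h0, fun ξ => ?_⟩
  by_contra hc
  push Not at hc
  have hl : ∀ t : ℝ, HasDerivAt (fun t : ℝ => x0 + t • ξ) ξ t := fun t => by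
    simpa using ((hasDerivAt_id t).smul_const ξ).const_add x0
  have ht : Filter.Tendsto (fun t : ℝ => x0 + t • ξ) (𝓝 0) (𝓝 x0) := by
    simpa using (hl 0).continuousAt.tendsto
  have h1 : ∀ᶠ t : ℝ in 𝓝 0, HasDerivAt (fun t : ℝ => -d (x0 + t • ξ)) (-⟪D (x0 + t • ξ), ξ⟫) t := (ht.eventually h).mono fun t hh => by
    exact (hh.hasFDerivAt.comp_hasDerivAt t (hl t)).neg.congr_deriv sz
  have h2 : deriv (fun t : ℝ => -d (x0 + t • ξ)) =ᶠ[𝓝 0] fun t => -⟪D (x0 + t • ξ), ξ⟫ := h1.mono fun t hh => hh.deriv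
  have h3 : HasDerivAt (fun t : ℝ => -⟪D (x0 + t • ξ), ξ⟫) (-⟪fd D x0 ξ, ξ⟫) 0 := by
    have h4 : HasDerivAt (fun t : ℝ => D (x0 + t • ξ)) (fd D x0 ξ) 0 := by
      have : HasFDerivAt D (fd D x0) (x0 + (0 : ℝ) • ξ) := by simpa using hd.hasFDerivAt
      exact this.comp_hasDerivAt 0 (hl 0)
    exact (h4.inner ℝ (hasDerivAt_const (0 : ℝ) ξ)).neg.congr_deriv sz
  have h5 : IsLocalMin (fun t : ℝ => -d (x0 + t • ξ)) 0 := isLocalMin_of_deriv_deriv_pos (by rw [h2.deriv_eq, h3.deriv]; linarith)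
    (by rw [h2.self_of_nhds]; simp [h0]) h1.self_of_nhds.continuousAt
  have h6 : (fun t : ℝ => -d (x0 + t • ξ)) =ᶠ[𝓝 0] fun _ => -d x0 := by
    filter_upwards [h5, ht.eventually hm] with t e1 e2
    simp only [zero_smul, add_zero] at e1
    linarith
  have h7 := h2.deriv_eq
  rw [h6.deriv.deriv_eq, h3.deriv] at h7
  simp at h7
  linarith

theorem tr_int_zero {X : E → E} {K : ℝ≥0} (hL : LipschitzWith K X) (hc : HasCompactSupport X) : (Integrable fun x => tr (fd X x)) ∧ ∫ x, tr (fd X x) = 0 := by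
  have h1 : ∀ a : E, Integrable fun x => ⟪fd X x a, a⟫ := fun a => by
    have hm : AEStronglyMeasurable (fun x => ⟪fd X x a, a⟫) := ((measurable_fderiv_apply_const ℝ X a).inner measurable_const).aestronglyMeasurable
    have hs : HasCompactSupport (fun x => ⟪fd X x a, a⟫) := (hc.fderiv (𝕜 := ℝ)).comp_left (g := fun L : E →L[ℝ] E => ⟪L a, a⟫) sz
    rw [← integrableOn_iff_integrable_of_support_subset (subset_tsupport _)]
    refine Measure.integrableOn_of_bounded (M := K * ‖a‖ * ‖a‖) hs.measure_lt_top.ne hm (eof fun x => ?_)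
    refine (norm_inner_le_norm _ _).trans ?_
    gcongr
    refine (lop _ _).trans ?_
    gcongr
    exact norm_fderiv_le_of_lipschitz ℝ hL
  simp only [tr]
  refine ⟨integrable_finsetSum _ fun i _ => h1 _, ?_⟩
  rw [integral_finsetSum _ fun i _ => h1 _]
  refine Finset.sum_eq_zero fun i _ => ?_
  set a := stdOrthonormalBasis ℝ E i
  have hLa : LipschitzWith (‖innerSL ℝ a‖₊ * K) fun x => ⟪a, X x⟫ := (innerSL ℝ a).lipschitz.comp hL
  have h2 := LipschitzWith.integral_lineDeriv_mul_eq (μ := volume) (LipschitzWith.const' (β := ℝ) (K := 0) 1 : LipschitzWith 0 fun _ : E => (1 : ℝ)) hLa (hc.comp_left (g := fun y => ⟪a, y⟫) sz) (-a)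
  simp only [lineDeriv, deriv_const, zero_mul, integral_zero, neg_neg, mul_one] at h2
  rw [h2]
  refine integral_congr_ae ?_
  filter_upwards [hL.ae_differentiableAt (μ := volume)] with x hx
  have h3 : HasFDerivAt (fun x => ⟪a, X x⟫) _ x := (innerSL ℝ a).hasFDerivAt.comp x hx.hasFDerivAt
  have h4 := h3.differentiableAt.lineDeriv_eq_fderiv (v := a)
  rw [lineDeriv] at h4
  rw [h4, h3.fderiv]
  simp [real_inner_comm]
end

section

variable {p ε l : ℝ} {U : Set E}

theorem contDiff_cut {F : Type} [NormedAddCommGroup F] [NormedSpace ℝ F] (hU : IsOpen U) {φ : E → ℝ} {f : E → F} (hφ : ContDiff ℝ 1 φ) (hs : tsupport φ ⊆ U) (hf : ContDiffOn ℝ 1 f U) : ContDiff ℝ 1 fun x => φ x • f x := by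
  rw [contDiff_iff_contDiffAt]
  intro x
  by_cases hx : x ∈ U
  · exact hφ.contDiffAt.smul (hf.contDiffAt (hU.mem_nhds hx))
  · refine (contDiffAt_const (c := (0 : F))).congr_of_eventuallyEq ?_
    filter_upwards [nmt.1 fun h => hx (hs h)] with y hy
    simp [hy]

def LL {F G : Type} [PseudoEMetricSpace F] [PseudoEMetricSpace G] (f : F → G) (x : F) : Prop := ∃ K : ℝ≥0, ∃ t ∈ 𝓝 x, LipschitzOnWith K f t

theorem LL.comp {F G : Type} [NormedAddCommGroup F] [NormedSpace ℝ F] [NormedAddCommGroup G] [NormedSpace ℝ G] {f : E → F} {g : F → G} {x : E} (hg : ContDiffAt ℝ 1 g (f x)) (hf : LL f x) : LL (fun y => g (f y)) x := by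
  obtain ⟨K, t, ht, hK⟩ := hg.exists_lipschitzOnWith
  obtain ⟨K', t', ht', hK'⟩ := hf
  refine ⟨K * K', t' ∩ f ⁻¹' t, Filter.inter_mem ht' ((hK'.continuousOn.continuousAt ht').preimage_mem_nhds ht), hK.comp (hK'.mono inter_subset_left) fun y hy => hy.2⟩

theorem LL.prod {F G : Type} [PseudoEMetricSpace F] [PseudoEMetricSpace G] {f : E → F} {g : E → G} {x : E} (hf : LL f x) (hg : LL g x) : LL (fun y => (f y, g y)) x := by
  obtain ⟨K, t, ht, hK⟩ := hf
  obtain ⟨K', t', ht', hK'⟩ := hg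
  exact ⟨_, t ∩ t', Filter.inter_mem ht ht', (hK.mono inter_subset_left).prodMk (hK'.mono inter_subset_right)⟩

theorem LL_ae {V : E → E} (h : ∀ x ∈ U, LL V x) : ∀ᵐ x, x ∈ U → DifferentiableAt ℝ V x := by
  rw [ae_iff]
  refine measure_null_of_locally_null _ fun x hx => ?_
  simp only [Classical.not_imp] at hx
  obtain ⟨K, t, ht, hK⟩ := h x hx.1
  obtain ⟨s, hst, hs, hxs⟩ := _root_.mem_nhds_iff.1 ht
  have := (hK.mono hst).ae_differentiableWithinAt_of_mem (μ := volume)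
  rw [ae_iff] at this
  refine ⟨_, Filter.inter_mem self_mem_nhdsWithin (mem_nhdsWithin_of_mem_nhds (hs.mem_nhds hxs)), measure_mono_null (fun y hy => ?_) this⟩
  simp only [Classical.not_imp] at hy ⊢
  exact ⟨hy.2, fun hd => hy.1.2 (hd.differentiableAt (hs.mem_nhds hy.2))⟩

theorem ibp_lip (hU : IsOpen U) {V : E → E} (hV : ∀ x ∈ U, LL V x) {φ : E → ℝ} (hφ : ContDiff ℝ 1 φ) (hc : HasCompactSupport φ) (hs : tsupport φ ⊆ U) :
    (Integrable fun x => tr (fd V x) * φ x) ∧ (Integrable fun x => fd φ x (V x)) ∧ ∫ x, fd φ x (V x) = ∫ x, -tr (fd V x) * φ x := by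
  have hz : ∀ x, x ∉ U → φ =ᶠ[𝓝 x] 0 := fun x hx => nmt.1 fun h => hx (hs h)
  have hXc : HasCompactSupport fun x => φ x • V x := hc.smul_right
  have hX : LocallyLipschitz fun x => φ x • V x := fun x => by
    by_cases hx : x ∈ U
    · exact LL.comp (g := fun q : ℝ × E => q.1 • q.2) (f := fun x => (φ x, V x)) fz (LL.prod hφ.contDiffAt.exists_lipschitzOnWith (hV x hx))
    · refine ⟨0, _, (hz x hx), LipschitzOnWith.of_dist_le_mul fun y (hy : φ y = 0) y' (hy' : φ y' = 0) => by simp [hy, hy']⟩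
  obtain ⟨R, hR⟩ := hXc.isCompact.isBounded.subset_closedBall 0
  obtain ⟨K, hK⟩ := (hX.locallyLipschitzOn (s := closedBall 0 (R + 1))).exists_lipschitzOnWith_of_compact (icb _ _)
  obtain ⟨B, hB⟩ := hX.continuous.bounded_above_of_compact_support hXc
  have hB0 : 0 ≤ B := (norm_nonneg _).trans (hB 0)
  have h0' : ∀ y ∉ closedBall 0 R, φ y • V y = 0 := fun y hy => ime (f := fun x => φ x • V x) fun h => hy (hR h)
  have key : ∀ x ∈ closedBall (0 : E) R, ∀ y, ‖φ x • V x - φ y • V y‖ ≤ (K + B) * ‖x - y‖ := fun x hx y => by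
    by_cases hy : y ∈ closedBall (0 : E) (R + 1)
    · have := hK.dist_le_mul x (cbcb lz hx) y hy
      rw [den, den] at this
      nlinarith [norm_nonneg (x - y)]
    · rw [h0' y fun h => hy (cbcb lz h), sub_zero]
      have e1 : 1 ≤ ‖x - y‖ := by
        rw [mcz] at hx hy
        linarith [norm_sub_norm_le y x, norm_sub_rev x y]
      have := hB x
      nlinarith [K.2, mul_nonneg K.2 (norm_nonneg (x - y))]
  have hL : LipschitzWith (K + ⟨B, hB0⟩) fun x => φ x • V x := LipschitzWith.of_dist_le_mul fun x y => by
    rw [den, den]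
    show _ ≤ (K + B) * _
    by_cases hx : x ∈ closedBall (0 : E) R
    · exact key x hx y
    by_cases hy : y ∈ closedBall (0 : E) R
    · rw [norm_sub_rev, norm_sub_rev x]; exact key y hy x
    · rw [h0' x hx, h0' y hy]; simp; positivity
  have h0 := tr_int_zero hL hXc
  have h1 : ∀ᵐ x, tr (fd (fun x => φ x • V x) x) = fd φ x (V x) + tr (fd V x) * φ x := by
    filter_upwards [LL_ae hV] with x hd
    by_cases hx : x ∈ U
    · have hh : HasFDerivAt (fun x => φ x • V x) _ x := ((hφ.differentiable sz) x).hasFDerivAt.smul (hd hx).hasFDerivAt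
      have e1 : fd φ x (V x) = ∑ i, fd φ x (stdOrthonormalBasis ℝ E i) * ⟪V x, stdOrthonormalBasis ℝ E i⟫ := by
        conv_lhs => rw [← (stdOrthonormalBasis ℝ E).sum_repr' (V x), map_sum]
        exact Finset.sum_congr rfl fun i _ => by rw [map_smul, smul_eq_mul, mul_comm, real_inner_comm]
      rw [hh.fderiv, e1, tr, tr, Finset.sum_mul, ← Finset.sum_add_distrib]
      refine Finset.sum_congr rfl fun i _ => ?_
      simp only [add_apply, smul_apply, ContinuousLinearMap.smulRight_apply, inner_add_left, isml, cjr]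
      ring
    · have e1 : (fun x => φ x • V x) =ᶠ[𝓝 x] fun _ => 0 := (hz x hx).mono fun y hy => by simp [hy]
      rw [e1.fderiv_eq, (hz x hx).fderiv_eq, (hz x hx).self_of_nhds]
      simp [tr]
  have i1 := h0.1
  have i2 : Integrable fun x => fd φ x (V x) := by
    have hcs : HasCompactSupport fun x => fd φ x (V x) := hcs_fderiv_ap V hc
    refine Continuous.ics (continuous_of_tsupport fun x hx => ?_) hcs
    have hx' : x ∈ U := by
      by_contra h
      refine (nmt.2 ?_) hx
      filter_upwards [(hz x h).fderiv (𝕜 := ℝ)] with y hy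
      rw [hy]; simp
    obtain ⟨_, t, ht, hL⟩ := hV x hx'
    exact (hφ.continuous_fderiv sz).continuousAt.clm_apply (hL.continuousOn.continuousAt ht)
  have h2 : ∀ᵐ x, -tr (fd V x) * φ x = fd φ x (V x) - tr (fd (fun x => φ x • V x) x) := by
    filter_upwards [h1] with x h1
    rw [h1]; ring
  refine ⟨(i1.sub i2).congr ?_, i2, ?_⟩
  · filter_upwards [h1] with x h1
    rw [Pi.sub_apply, h1]; ring
  · rw [integral_congr_ae h2, integral_sub i2 i1, h0.2, sub_zero]

theorem ibp (hU : IsOpen U) {V : E → E} (hV : ContDiffOn ℝ 1 V U) {φ : E → ℝ} (hφ : ContDiff ℝ 1 φ) (hc : HasCompactSupport φ) (hs : tsupport φ ⊆ U) :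
    ∫ x, fd φ x (V x) = ∫ x, -tr (fd V x) * φ x :=
  (ibp_lip hU (fun _ hx => (hV.contDiffAt (hU.mem_nhds hx)).exists_lipschitzOnWith) hφ hc hs).2.2

variable {w : E → ℝ} {W : E → E}

theorem classical (hp : 1 < p) (hε : 0 < ε) (h : Sol U w W (fun x => Rf p ε (W x) • W x) (fun x => gf p ε l (x, W x))) :
    (∀ m : ℕ, ContDiffOn ℝ m W U) ∧ (∀ x ∈ U, ∀ v y, ⟪fd W x v, y⟫ = ⟪fd W x y, v⟫) ∧
    ∀ x ∈ U, Rf p ε (W x) * opP p ε (W x) (fd W x) + gf p ε l (x, W x) = 0 := by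
  have hΦ : ∀ m : ℕ, ContDiff ℝ m fun η : E => Rf p ε η • η := fun m => (Rf_contDiff hε m).smul contDiff_id
  have hW : ∀ m : ℕ, ContDiffOn ℝ m W U := fun m => HC.contDiffOn h.hU m (nonlin hΦ (gf_contDiff hε) (V_spd hp hε) h m)
  have hd : ∀ x ∈ U, DifferentiableAt ℝ W x := fun x hx => ((hW 1).contDiffAt (h.hU.mem_nhds hx)).differentiableAt sz
  have hs : ∀ x ∈ U, ∀ v y, ⟪fd W x v, y⟫ = ⟪fd W x y, v⟫ := fun x hx => grad_symm ((h.hU.eventually_mem hx).mono fun y hy => h.hZ y hy) (hd x hx)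
  refine ⟨hW, hs, fun x hx => ?_⟩
  have hV : ContDiffOn ℝ 1 (fun x => Rf p ε (W x) • W x) U := (hΦ 1).comp_contDiffOn (by exact_mod_cast hW 1)
  have hct : ContinuousOn (fun x => tr (fd (fun x => Rf p ε (W x) • W x) x) + gf p ε l (x, W x)) U := by
    have := hV.continuousOn_fderiv_of_isOpen h.hU sz
    have h2 := h.hg
    unfold tr; fun_prop
  have h3 := h.hU.ae_eq_zero_of_integral_contDiff_smul_eq_zero (μ := volume) (hct.locallyIntegrableOn h.hU.measurableSet) fun φ hφ hc hsu => by
    have hφ1 : ContDiff ℝ 1 φ := hφ.of_le sz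
    have e1 := h.hw φ hφ1 hc hsu
    rw [ibp h.hU hV hφ1 hc hsu, eq_comm, ← sub_eq_zero, ← integral_sub] at e1
    · rw [← e1]; congr 1; ext x; simp only [smul_eq_mul]; ring
    all_goals
      refine Continuous.ics (continuous_of_tsupport fun x hx => ?_) hc.mul_left
      have hx' : x ∈ U := hsu (tsupport_mul_subset_right hx)
      have := (hV.continuousOn_fderiv_of_isOpen h.hU sz).continuousAt (h.hU.mem_nhds hx')
      have h2 := h.hg.continuousAt (h.hU.mem_nhds hx')
      have h4 := hφ.continuous
      (try unfold tr); fun_prop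
  have h4 := Measure.eqOn_open_of_ae_eq (μ := volume) (f := fun x => tr (fd (fun x => Rf p ε (W x) • W x) x) + gf p ε l (x, W x)) (g := fun _ => 0) ((ae_restrict_iff' h.hU.measurableSet).2 h3) h.hU hct continuousOn_const hx
  have hh : HasFDerivAt (fun x => Rf p ε (W x) • W x) _ x := ((hΦ 1).differentiable sz (W x)).hasFDerivAt.comp x (hd x hx).hasFDerivAt
  simp only at h4
  rwa [hh.fderiv, tr_V hε _ (hs x hx)] at h4
end

section

variable {p ε : ℝ} {U Ω : Set E} {w u : E → ℝ} {W : E → E}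

theorem bar_e (α : ℝ) (a x : E) : HasFDerivAt (fun x : E => exp (-(α * ‖x - a‖ ^ 2))) ((exp (-(α * ‖x - a‖ ^ 2)) * (-(2 * α))) • innerSL ℝ (x - a)) x := by
  have h1 : HasFDerivAt (fun x : E => ‖x - a‖ ^ 2) _ x := ((hasFDerivAt_id x).sub_const a).norm_sq
  refine ((h1.const_mul α).neg.exp).congr_fderiv ?_
  ext ξ
  simp; ring

theorem barrier_pt (hp : 1 < p) (hε : 0 < ε) {x0 a : E} {α k r : ℝ} (hα : 1 ≤ α) (hk : 0 < k) (hr : 0 < r)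
    (hW : ∀ᶠ x in 𝓝 x0, HasGradientAt w (W x) x) (hd : DifferentiableAt ℝ W x0) (hs : ∀ v y, ⟪fd W x0 v, y⟫ = ⟪fd W x0 y, v⟫)
    (hP : opP p ε (W x0) (fd W x0) + (p - 1) * ‖W x0‖ ^ 2 - ε - ⟪W x0, x0⟫ ≤ 0)
    (h0 : k < exp (-(α * ‖x0 - a‖ ^ 2))) (hm : IsLocalMin (fun x => w x - log (exp (-(α * ‖x - a‖ ^ 2)) - k)) x0)
    (hr1 : r / 2 ≤ ‖x0 - a‖) (hr2 : ‖x0 - a‖ ≤ r) : α * (min 1 (p - 1) * r ^ 2 / 2) ≤ Module.finrank ℝ E + |p - 2| + ε + r * (‖a‖ + r) := by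
  set e : E → ℝ := fun x => exp (-(α * ‖x - a‖ ^ 2)) with he
  have hec : Continuous e := fz
  have hpos : ∀ᶠ x in 𝓝 x0, k < e x := hec.continuousAt.eventually_const_lt h0
  set D : E → E := fun x => W x + (2 * α * (e x * (e x - k)⁻¹)) • (x - a) with hD
  have h1 : ∀ᶠ x in 𝓝 x0, HasGradientAt (fun x => w x - log (e x - k)) (D x) x := by
    filter_upwards [hW, hpos] with x hx hx2
    rw [hgfd] at hx ⊢
    refine (hx.sub (((bar_e α a x).sub_const k).log (sub_pos.2 hx2).ne')).congr_fderiv ?_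
    ext ξ
    simp [hD, inner_add_left, isml, he]
    ring
  set y := x0 - a with hy
  set s := 2 * α * (e x0 * (e x0 - k)⁻¹) with hsd
  have hek : 0 < e x0 - k := sub_pos.2 h0
  have h2 : HasFDerivAt (fun x => 2 * α * (e x * (e x - k)⁻¹)) ((s * (s - 2 * α)) • innerSL ℝ y) x0 := by
    refine (((bar_e α a x0).mul ((hasDerivAt_inv hek.ne').comp_hasFDerivAt x0 ((bar_e α a x0).sub_const k))).const_mul (2 * α)).congr_fderiv ?_
    have hek' := hek.ne'
    change (2 * α) • (e x0 • ((-(((e x0 - k) ^ 2)⁻¹)) • ((e x0 * (-(2 * α))) • innerSL ℝ y)) + (e x0 - k)⁻¹ • ((e x0 * (-(2 * α))) • innerSL ℝ y)) = _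
    rw [smul_smul, smul_smul, smul_smul, ← add_smul, smul_smul]
    congr 1
    rw [hsd]
    generalize e x0 = e0 at hek'
    field_simp
    ring
  have h3 : HasFDerivAt D _ x0 := hd.hasFDerivAt.add (h2.smul ((hasFDerivAt_id x0).sub_const a))
  obtain ⟨hD0, hD2⟩ := second_order h1 hm h3.differentiableAt
  rw [h3.fderiv] at hD2
  have hη : W x0 = -(s • y) := eq_neg_of_add_eq_zero_left hD0
  set Y : E →L[ℝ] E := -(s • ContinuousLinearMap.id ℝ E) - (s * (s - 2 * α)) • (innerSL ℝ y).smulRight y with hY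
  have hYi : ∀ v z, ⟪Y v, z⟫ = -(s * ⟪v, z⟫) - s * (s - 2 * α) * (⟪y, v⟫ * ⟪y, z⟫) := fun v z => by simp [hY, inner_sub_left, isml]
  have h4 := opP_mono (p := p) (ε := ε) hp hε hs (Y := Y) (fun v z => by rw [hYi, hYi, real_inner_comm z v]; ring) (fun ξ => by
    have := hD2 ξ
    simp only [add_apply, smul_apply, ContinuousLinearMap.smulRight_apply, inner_add_left, isml, cjr, innerSL_apply_apply, ContinuousLinearMap.coe_id', id_eq, smul_eq_mul] at this
    rw [hYi]; linarith) (W x0)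
  have htr : tr Y = -(s * Module.finrank ℝ E) - s * (s - 2 * α) * ‖y‖ ^ 2 := by
    simp only [tr, hYi, Finset.sum_sub_distrib, Finset.sum_neg_distrib, ← Finset.mul_sum]
    congr 2
    · simp
    · simp_rw [← sq]; simpa [real_inner_comm] using (stdOrthonormalBasis ℝ E).sum_sq_norm_inner_right y
  have hs2 : 2 * α ≤ s := by
    rw [hsd]
    refine le_mul_of_one_le_right lz ?_
    rw [← div_eq_mul_inv, one_le_div hek]; linarith
  have hs0 : 0 < s := lz
  have hWn : ‖W x0‖ ^ 2 = s ^ 2 * ‖y‖ ^ 2 := by rw [hη, norm_neg, norm_smul, mul_pow, nea, sq_abs]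
  have hR : 0 < ε + ‖W x0‖ ^ 2 := pz
  set t := ‖W x0‖ ^ 2 / (ε + ‖W x0‖ ^ 2) with ht
  have ht0 : 0 ≤ t := pz
  have ht1 : t ≤ 1 := (div_le_one hR).2 lz
  have htR : (p - 2) * t * (ε + ‖W x0‖ ^ 2) = (p - 2) * ‖W x0‖ ^ 2 := by rw [ht]; field_simp
  have h5 : opP p ε (W x0) Y = -(s * (Module.finrank ℝ E + (p - 2) * t)) - s * (s - 2 * α) * ‖y‖ ^ 2 * (1 + (p - 2) * t) := by
    have e1 : ⟪Y (W x0), W x0⟫ = (-s - s * (s - 2 * α) * ‖y‖ ^ 2) * ‖W x0‖ ^ 2 := by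
      rw [hYi, hWn, hη]
      simp only [inner_neg_left, inner_neg_right, isml, inner_smul_right, riq, cjr]
      ring
    rw [opP, htr, e1, ht]
    field_simp
    ring
  have h6 : -(‖y‖ * (‖a‖ + r)) ≤ ⟪y, x0⟫ := by
    have e1 : ‖x0‖ ≤ ‖a‖ + r := by
      have := norm_add_le a (x0 - a)
      rw [add_sub_cancel] at this; linarith
    have := ail y x0
    have e3 : ‖y‖ * ‖x0‖ ≤ ‖y‖ * (‖a‖ + r) := by gcongr
    linarith [neg_abs_le ⟪y, x0⟫]
  have h7 : ⟪W x0, x0⟫ = -(s * ⟪y, x0⟫) := by rw [hη]; simp [isml]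
  have hmp := mp_le hp ht0 ht1
  have hm0 : 0 < min 1 (p - 1) := lt_min one_pos lz
  have hpt : (p - 2) * t ≤ |p - 2| := by
    nlinarith only [le_abs_self (p - 2), abs_nonneg (p - 2), ht0, ht1]
  have hpe : -ε ≤ (p - 2) * t * ε := by nlinarith only [mul_pos (sub_pos.2 hp) hε, ht0, ht1, hε]
  rw [h5] at h4
  have h8 : s * (2 * α * ‖y‖ ^ 2 * (1 + (p - 2) * t) - (Module.finrank ℝ E + (p - 2) * t) + ⟪y, x0⟫) ≤ 2 * ε := by
    rw [h7] at hP
    have : -(s * (s - 2 * α) * ‖y‖ ^ 2 * (1 + (p - 2) * t)) + (p - 1) * ‖W x0‖ ^ 2 = 2 * α * s * ‖y‖ ^ 2 * (1 + (p - 2) * t) + (p - 2) * t * ε := by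
      linear_combination (-1) * htR + (1 + (p - 2) * t) * hWn
    linarith
  have h9 : α * (min 1 (p - 1) * r ^ 2 / 2) ≤ 2 * α * ‖y‖ ^ 2 * (1 + (p - 2) * t) := by
    have : (r / 2) ^ 2 ≤ ‖y‖ ^ 2 := by gcongr
    calc _ = 2 * α * (r / 2) ^ 2 * min 1 (p - 1) := by ring
      _ ≤ _ := by gcongr
  have h10 : ‖y‖ * (‖a‖ + r) ≤ r * (‖a‖ + r) := by gcongr
  by_contra hc
  push Not at hc
  have h11 : ε < 2 * α * ‖y‖ ^ 2 * (1 + (p - 2) * t) - (Module.finrank ℝ E + (p - 2) * t) + ⟪y, x0⟫ := lz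
  have h12 := mul_lt_mul_of_pos_left h11 hs0
  have h13 : 2 * ε ≤ s * ε := mlr lz hε.le
  linarith

set_option maxHeartbeats 800000 in
theorem hopf (hp : 1 < p) (hε : 0 < ε) (hΩ : IsOpen Ω) (hΩc : IsPreconnected Ω) (hu : ContDiffOn ℝ 1 u Ω) (hu0 : ∀ x ∈ Ω, 0 ≤ u x) (hne : ∃ x ∈ Ω, 0 < u x)
    (hW : ∀ x ∈ {x ∈ Ω | 0 < u x}, HasGradientAt (fun x => log (u x)) (W x) x) (hd : ∀ x ∈ {x ∈ Ω | 0 < u x}, DifferentiableAt ℝ W x) (hs : ∀ x ∈ {x ∈ Ω | 0 < u x}, ∀ v y, ⟪fd W x v, y⟫ = ⟪fd W x y, v⟫)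
    (hP : ∀ x ∈ {x ∈ Ω | 0 < u x}, opP p ε (W x) (fd W x) + (p - 1) * ‖W x‖ ^ 2 - ε - ⟪W x, x⟫ ≤ 0) : ∀ x ∈ Ω, 0 < u x := by
  set U := {x ∈ Ω | 0 < u x}
  have hUo : IsOpen U := hu.continuousOn.isOpen_inter_preimage hΩ isOpen_Ioi
  by_contra hcon
  push Not at hcon
  obtain ⟨z1, hz1, hz1u⟩ := hcon
  have hex : ∃ z ∈ Ω, z ∈ closure U ∧ z ∉ U := by
    by_contra hno
    push Not at hno
    have h2 := hΩc U (closure U)ᶜ hUo isClosed_closure.isOpen_compl (fun x hx => by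
      by_cases h : x ∈ closure U
      · exact Or.inl (hno x hx h)
      · exact Or.inr h) (by obtain ⟨x, hx, h⟩ := hne; exact ⟨x, hx, hx, h⟩) ⟨z1, hz1, fun h => absurd (hno z1 hz1 h).2 (not_lt.2 hz1u)⟩
    obtain ⟨x, _, h3, h4⟩ := h2
    exact h4 (subset_closure h3)
  obtain ⟨z, hz, hzc, hzn⟩ := hex
  obtain ⟨ρ, hρ, hb⟩ := Metric.isOpen_iff.1 hΩ z hz
  obtain ⟨a, ha, haz⟩ := Metric.mem_closure_iff.1 hzc (ρ / 2) lz
  obtain ⟨z0, hz0, hz0d⟩ := hUo.isClosed_compl.exists_infDist_eq_dist ⟨z, hzn⟩ a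
  set r := dist a z0 with hr
  have hrz : r ≤ dist a z := by rw [← hz0d]; exact Metric.infDist_le_dist_of_mem hzn
  have hz0Ω : z0 ∈ Ω := hb (by
    rw [mem_ball]
    have := dist_triangle z0 a z
    rw [dist_comm z0 a] at this
    rw [dist_comm z a] at haz
    linarith)
  have huz0 : u z0 = 0 := le_antisymm (not_lt.1 fun h => hz0 ⟨hz0Ω, h⟩) (hu0 z0 hz0Ω)
  have hr0 : 0 < r := dist_pos.2 fun h => hz0 (h ▸ ha)
  have hbU : ∀ x, ‖x - a‖ < r → x ∈ U := fun x hx => by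
    by_contra h
    have := Metric.infDist_le_dist_of_mem (x := a) (show x ∈ Uᶜ from h)
    rw [hz0d, dist_comm, den] at this
    linarith
  have hm0 : 0 < min 1 (p - 1) := lt_min one_pos lz
  set N := Module.finrank ℝ E + |p - 2| + ε + r * (‖a‖ + r)
  have hN : 0 ≤ N := pz
  set α := 1 + N / (min 1 (p - 1) * r ^ 2 / 2) with hα
  have hα1 : 1 ≤ α := le_add_of_nonneg_right pz
  have hαN : N < α * (min 1 (p - 1) * r ^ 2 / 2) := by
    rw [hα, add_mul, div_mul_cancel₀ _ pz]
    have : 0 < 1 * (min 1 (p - 1) * r ^ 2 / 2) := pz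
    linarith
  have huc : ContinuousOn u (ball a r) := hu.continuousOn.mono fun x hx => (hbU x (by rwa [mem_ball, den] at hx)).1
  obtain ⟨xm, hxm, hmin⟩ := (icb a (r / 2)).exists_isMinOn ⟨a, by simp; linarith⟩ (huc.mono (cbsb lz))
  have hxmU := hbU xm (by rw [mem_closedBall, den] at hxm; linarith)
  set c := u xm / 2 with hc
  have hc0 : 0 < c := by have := hxmU.2; positivity
  have key : ∀ r', r' < r → ∀ x, r / 2 ≤ ‖x - a‖ → ‖x - a‖ ≤ r' → c * (exp (-(α * ‖x - a‖ ^ 2)) - exp (-(α * r' ^ 2))) ≤ u x := by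
    intro r' hr' x1 h1 h2
    have hr0' : 0 < r' := lz
    set k := exp (-(α * r' ^ 2))
    set A := closedBall a r' ∩ {x | r / 2 ≤ ‖x - a‖}
    have hA : IsCompact A := (icb a r').inter_right (isClosed_le fz fz)
    have hAU : ∀ x ∈ A, x ∈ U := fun x hx => hbU x (by have := hx.1; rw [mem_closedBall, den] at this; linarith)
    obtain ⟨x0, hx0, hmax⟩ := hA.exists_isMaxOn (f := fun x => (exp (-(α * ‖x - a‖ ^ 2)) - k) / u x) ⟨x1, by rwa [mem_closedBall, den], h1⟩
      (ContinuousOn.div fz (huc.mono fun x hx => (cbsb hr') hx.1) fun x hx => (hAU x hx).2.ne')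
    have hx1A : x1 ∈ A := ⟨by rwa [mem_closedBall, den], h1⟩
    have hx1u := (hAU x1 hx1A).2
    by_contra hlt
    push Not at hlt
    have h3 : 1 / c < (exp (-(α * ‖x0 - a‖ ^ 2)) - k) / u x0 := by
      refine lt_of_lt_of_le ?_ (hmax hx1A)
      rw [div_lt_div_iff₀ hc0 hx1u]; linarith
    have hu0' := (hAU x0 hx0).2
    have h4 : k < exp (-(α * ‖x0 - a‖ ^ 2)) := by
      have : 0 < (exp (-(α * ‖x0 - a‖ ^ 2)) - k) / u x0 := lt_trans pz h3
      rw [div_pos_iff_of_pos_right hu0'] at this; linarith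
    have hxr : ‖x0 - a‖ < r' := by
      rw [exp_lt_exp, neg_lt_neg_iff, mul_lt_mul_iff_right₀ lz] at h4
      exact lt_of_pow_lt_pow_left₀ 2 hr0'.le h4
    have hxi : r / 2 < ‖x0 - a‖ := by
      refine lt_of_le_of_ne hx0.2 fun he => ?_
      have e1 : u xm ≤ u x0 := hmin (show x0 ∈ closedBall a (r / 2) by rw [mem_closedBall, den]; exact he.ge)
      rw [div_lt_div_iff₀ hc0 hu0'] at h3
      have e2 : exp (-(α * ‖x0 - a‖ ^ 2)) ≤ 1 := exp_le_one_iff.2 (neg_nonpos.2 pz)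
      have e3 : 0 < k := exp_pos _
      have e4 := mlr (show exp (-(α * ‖x0 - a‖ ^ 2)) - k ≤ 1 by linarith) hc0.le
      linarith
    have hnb : ∀ᶠ x in 𝓝 x0, x ∈ A ∧ x ∈ U ∧ k < exp (-(α * ‖x - a‖ ^ 2)) := by
      have c1 : ContinuousAt (fun x : E => ‖x - a‖) x0 := fz
      have c2 : ContinuousAt (fun x : E => exp (-(α * ‖x - a‖ ^ 2))) x0 := fz
      filter_upwards [c1.eventually_lt_const hxr, c1.eventually_const_lt hxi, hUo.eventually_mem (hAU x0 hx0), c2.eventually_const_lt h4] with x e1 e2 e3 e4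
      exact ⟨⟨by rw [mem_closedBall, den]; exact e1.le, e2.le⟩, e3, e4⟩
    refine absurd (barrier_pt hp hε (w := fun x => log (u x)) hα1 (exp_pos (-(α * r' ^ 2))) hr0 (hnb.mono fun x hx => hW x hx.2.1) (hd x0 (hAU x0 hx0)) (hs x0 (hAU x0 hx0)) (hP x0 (hAU x0 hx0)) h4 ?_ hx0.2 (hxr.le.trans hr'.le)) (not_le.2 hαN)
    refine hnb.mono fun x hx => ?_
    have e1 := hmax hx.1
    have e2 := log_le_log (div_pos (sub_pos.2 hx.2.2) hx.2.1.2) e1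
    rw [log_div (sub_pos.2 hx.2.2).ne' hx.2.1.2.ne', log_div (sub_pos.2 h4).ne' hu0'.ne'] at e2
    simp only
    linarith
  have hgrad : HasFDerivAt u (0 : E →L[ℝ] ℝ) z0 := by
    have h1 := ((hu.contDiffAt (hΩ.mem_nhds hz0Ω)).differentiableAt sz).hasFDerivAt
    have : IsLocalMin u z0 := (hΩ.eventually_mem hz0Ω).mono fun x hx => by rw [huz0]; exact hu0 x hx
    rwa [this.hasFDerivAt_eq_zero h1] at h1
  have hder : HasDerivAt (fun t : ℝ => u (z0 + t • (a - z0))) 0 0 := by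
    have h2 : HasDerivAt (fun t : ℝ => z0 + t • (a - z0)) (a - z0) 0 := by
      simpa using ((hasDerivAt_id (0 : ℝ)).smul_const (a - z0)).const_add z0
    have : HasFDerivAt u (0 : E →L[ℝ] ℝ) (z0 + (0 : ℝ) • (a - z0)) := by simpa using hgrad
    exact (this.comp_hasDerivAt 0 h2).congr_deriv sz
  set κ := c * (exp (-(α * r ^ 2)) * (α * r ^ 2)) with hκ
  have hκ0 : 0 < κ := pz
  have hbd := (hasDerivAt_iff_isLittleO.1 hder).bound (half_pos hκ0)
  have hbd2 : ∀ᶠ t : ℝ in 𝓝[>] 0, u (z0 + t • (a - z0)) ≤ κ / 2 * t := by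
    filter_upwards [hbd.filter_mono nwn, self_mem_nhdsWithin] with t h1 h2
    simp only [zero_smul, add_zero, huz0, sub_zero, smul_zero, nea, abs_of_pos (mem_Ioi.1 h2)] at h1
    exact (le_abs_self _).trans h1
  obtain ⟨t, ht, ht1, ht2⟩ := (hbd2.and ((eventually_mem_nhdsWithin).and (eventually_lt_nhds (show (0 : ℝ) < 1 / 2 by norm_num) |>.filter_mono nwn))).exists
  have ht1 : 0 < t := ht1
  have hxt : ‖z0 + t • (a - z0) - a‖ = (1 - t) * r := by
    rw [show z0 + t • (a - z0) - a = (1 - t) • (z0 - a) by module, norm_smul, nnn lz, hr, dist_comm, den]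
  have hlim : c * (exp (-(α * ((1 - t) * r) ^ 2)) - exp (-(α * r ^ 2))) ≤ u (z0 + t • (a - z0)) := by
    have hcont : Filter.Tendsto (fun r' => c * (exp (-(α * ((1 - t) * r) ^ 2)) - exp (-(α * r' ^ 2)))) (𝓝[<] r) (𝓝 (c * (exp (-(α * ((1 - t) * r) ^ 2)) - exp (-(α * r ^ 2))))) :=
      (Continuous.tendsto fz r).mono_left nwn
    refine le_of_tendsto hcont ?_
    have hlt : (1 - t) * r < r := by nlinarith only [ht1, hr0]
    filter_upwards [self_mem_nhdsWithin, Filter.Eventually.filter_mono nwn (eventually_gt_nhds hlt)] with r' h1 h2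
    have := key r' h1 (z0 + t • (a - z0)) (by rw [hxt]; nlinarith only [ht2, hr0]) (by rw [hxt]; exact h2.le)
    rwa [hxt] at this
  have hex : α * r ^ 2 * t ≤ exp (α * r ^ 2 * (2 * t - t ^ 2)) - 1 := by
    have h1 := add_one_le_exp (α * r ^ 2 * (2 * t - t ^ 2))
    have h2 : α * r ^ 2 * t ≤ α * r ^ 2 * (2 * t - t ^ 2) := by gcongr; nlinarith only [ht1, ht2]
    linarith
  have hmul : exp (-(α * ((1 - t) * r) ^ 2)) = exp (-(α * r ^ 2)) * exp (α * r ^ 2 * (2 * t - t ^ 2)) := by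
    rw [← exp_add]; ring_nf
  have hfin : κ * t ≤ u (z0 + t • (a - z0)) := by
    refine le_trans ?_ hlim
    rw [hmul, hκ]
    have := mll hex (mul_pos hc0 (exp_pos (-(α * r ^ 2)))).le
    linarith
  linarith [mul_pos hκ0 ht1]
end

section

variable {p ε l : ℝ} {U Ω : Set E} {u v : E → ℝ}

noncomputable def gw (x : E) : ℝ := exp (-‖x‖ ^ 2 / 2)
noncomputable def jf (p ε : ℝ) (v : E → ℝ) (x : E) : ℝ := (ε * v x ^ 2 + ‖fd v x‖ ^ 2) ^ (p / 2)
def Ray (p ε l : ℝ) (Ω : Set E) (v : E → ℝ) : Prop := l * ∫ x in Ω, gw x * |v x| ^ p ≤ ∫ x in Ω, gw x * jf p ε v x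

theorem gw_pos (x : E) : 0 < gw x := exp_pos _

theorem gw_contDiff : ContDiff ℝ 1 (gw : E → ℝ) := ((contDiff_norm_sq ℝ).neg.div_const 2).exp

theorem jf_nonneg (hε : 0 < ε) (v : E → ℝ) (x : E) : 0 ≤ jf p ε v x := by unfold jf; positivity

theorem pow_le_jf (hp : 1 < p) (hε : 0 < ε) (v : E → ℝ) (x : E) : gw x * |v x| ^ p ≤ (ε ^ (p / 2))⁻¹ * (gw x * jf p ε v x) := by
  have h1 : ε ^ (p / 2) * |v x| ^ p = (ε * v x ^ 2) ^ (p / 2) := by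
    rw [mul_rpow hε.le (sq_nonneg _), ← sq_abs, ← rpow_natCast, ← rpow_mul (abs_nonneg _)]
    congr 2; push_cast; ring
  have h2 : (ε * v x ^ 2) ^ (p / 2) ≤ jf p ε v x := rpow_le_rpow pz (by nlinarith [sq_nonneg ‖fd v x‖]) lz
  rw [← h1] at h2
  have h3 : 0 < ε ^ (p / 2) := pz
  rw [le_inv_mul_iff₀ h3]
  nlinarith [gw_pos x]

theorem lim_pass (hp : 1 < p) (hε : 0 < ε) (hΩ : IsOpen Ω) {f : ℕ → E → ℝ} (hf : ∀ k, ContDiff ℝ 1 (f k)) (ht : ∀ x ∈ Ω, Filter.Tendsto (fun k => f k x) .atTop (𝓝 (v x)))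
    (hd : ∀ x ∈ Ω, Filter.Tendsto (fun k => fd (f k) x) .atTop (𝓝 (fd v x))) {G : E → ℝ} (hG : IntegrableOn G Ω)
    (hdom : ∀ k, ∀ x ∈ Ω, gw x * jf p ε (f k) x ≤ G x) (h : ∀ k, Ray p ε l Ω (f k)) : Ray p ε l Ω v := by
  have hgc : Continuous (gw : E → ℝ) := gw_contDiff.continuous
  have hjc : ∀ k, Continuous (jf p ε (f k)) := fun k => by
    have := (hf k).continuous; have := (hf k).continuous_fderiv sz
    unfold jf
    exact Continuous.rpow_const fz fun x => Or.inr lz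
  have h1 : Filter.Tendsto (fun k => ∫ x in Ω, gw x * jf p ε (f k) x) .atTop (𝓝 (∫ x in Ω, gw x * jf p ε v x)) := by
    refine tendsto_integral_of_dominated_convergence G (fun k => (hgc.mul (hjc k)).aestronglyMeasurable) hG (fun k => ?_) ?_
    · filter_upwards [smar hΩ.measurableSet] with x hx
      rw [nnn (mul_nonneg (gw_pos x).le (jf_nonneg hε _ _))]
      exact hdom k x hx
    · filter_upwards [smar hΩ.measurableSet] with x hx
      exact (((((ht x hx).pow 2).const_mul ε).add ((hd x hx).norm.pow 2)).rpow_const (Or.inr lz)).const_mul _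
  have h2 : Filter.Tendsto (fun k => ∫ x in Ω, gw x * |f k x| ^ p) .atTop (𝓝 (∫ x in Ω, gw x * |v x| ^ p)) := by
    refine tendsto_integral_of_dominated_convergence _ (fun k => ?_) (hG.const_mul (ε ^ (p / 2))⁻¹) (fun k => ?_) ?_
    · exact (hgc.mul (((hf k).continuous.abs).rpow_const fun x => Or.inr lz)).aestronglyMeasurable
    · filter_upwards [smar hΩ.measurableSet] with x hx
      rw [nnn (mul_nonneg (gw_pos x).le pz)]
      exact (pow_le_jf hp hε _ x).trans (mll (hdom k x hx) pz)
    · filter_upwards [smar hΩ.measurableSet] with x hx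
      exact ((ht x hx).abs.rpow_const (Or.inr lz)).const_mul _
  exact le_of_tendsto_of_tendsto' (h2.const_mul l) h1 h

theorem ray_C1 (hp : 1 < p) (hε : 0 < ε) (hΩ : IsOpen Ω) (hb : IsBounded Ω) (HL : ∀ v, ContDiff ℝ (⊤ : ℕ∞) v → HasCompactSupport v → tsupport v ⊆ Ω → Ray p ε l Ω v)
    (hv : ContDiff ℝ 1 v) (hc : HasCompactSupport v) (hs : tsupport v ⊆ Ω) : Ray p ε l Ω v := by
  obtain ⟨δ, hδ, hδΩ⟩ := hc.isCompact.exists_cthickening_subset_open hΩ hs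
  let φ : ℕ → ContDiffBump (0 : E) := fun k => ⟨δ / (k + 2) / 2, δ / (k + 2), pz, half_lt_self pz⟩
  have hr : Filter.Tendsto (fun k => (φ k).rOut) .atTop (𝓝 0) := by
    have := (tendsto_const_div_atTop_nhds_zero_nat δ).comp (Filter.tendsto_add_atTop_nat 2)
    refine this.congr fun k => by simp [φ]
  have hvf := hv.continuous_fderiv sz
  have hfc := hc.fderiv ℝ
  obtain ⟨M, hM⟩ := hvf.bounded_above_of_compact_support hfc
  obtain ⟨N, hN⟩ := hv.continuous.bounded_above_of_compact_support hc
  set L := ContinuousLinearMap.lsmul ℝ ℝ (E := ℝ)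
  set f : ℕ → E → ℝ := fun k => convolution ((φ k).normed volume) v L volume with hf
  have hfd : ∀ k x, HasFDerivAt (f k) (convolution ((φ k).normed volume) (fd v) (ContinuousLinearMap.lsmul ℝ ℝ) volume x) x := fun k x =>
    hc.hasFDerivAt_convolution_right L (φ k).continuous_normed.locallyIntegrable hv x
  have hcd : ∀ k, ContDiff ℝ (⊤ : ℕ∞) (f k) := fun k => (φ k).hasCompactSupport_normed.contDiff_convolution_left L (φ k).contDiff_normed hv.continuous.locallyIntegrable
  have hbd : ∀ {F : Type} [NormedAddCommGroup F] [NormedSpace ℝ F] [CompleteSpace F] (g : E → F) (B : ℝ), Continuous g → (∀ x, ‖g x‖ ≤ B) → ∀ k x, ‖convolution ((φ k).normed volume) g (ContinuousLinearMap.lsmul ℝ ℝ) volume x‖ ≤ B := by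
    intro F _ _ _ g B hg hB k x
    have := dist_convolution_le (z₀ := 0) (x₀ := x) ((norm_nonneg _).trans (hB x)) (φ k).support_normed_eq.subset (φ k).nonneg_normed ((φ k).integral_normed (μ := volume)) hg.aestronglyMeasurable (fun y _ => by simpa using hB y)
    simpa using this
  have hsup : ∀ k, tsupport (f k) ⊆ cthickening δ (tsupport v) := fun k => by
    refine closure_minimal ((support_convolution_subset L).trans ?_) isClosed_cthickening
    rintro _ ⟨a, ha, b, hb, rfl⟩
    rw [(φ k).support_normed_eq, mem_ball_zero_iff] at ha
    refine mem_cthickening_of_dist_le _ b δ _ (subset_closure hb) ?_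
    simp only [den, add_sub_cancel_right]
    exact ha.le.trans (div_le_self hδ.le (by linarith [k.cast_nonneg (α := ℝ)]))
  refine lim_pass hp hε hΩ (f := f) (fun k => (hcd k).of_le (by exact_mod_cast le_top)) (fun x _ => ContDiffBump.convolution_tendsto_right_of_continuous hr hv.continuous x) (fun x _ => ?_)
    (G := fun _ => (ε * N ^ 2 + M ^ 2) ^ (p / 2)) (integrableOn_const hb.measure_lt_top.ne) (fun k x _ => ?_) (fun k => HL _ (hcd k) (hc.isCompact.cthickening.of_isClosed_subset isClosed_closure (hsup k)) ((hsup k).trans hδΩ))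
  · simp_rw [(hfd _ x).fderiv]
    exact ContDiffBump.convolution_tendsto_right_of_continuous hr hvf x
  · have h1 : gw x ≤ 1 := exp_le_one_iff.2 (by have := sq_nonneg ‖x‖; linarith)
    have h2 := hbd v N hv.continuous hN k x
    have h3 := hbd _ M hvf hM k x
    refine (mlo (jf_nonneg hε _ _) h1).trans ?_
    unfold jf
    rw [(hfd k x).fderiv, ← sq_abs (f k x)]
    gcongr
    exact h2
end

section

variable {p ε l : ℝ} {U Ω : Set E} {u v : E → ℝ}

theorem theta_facts {a : ℝ} (ha : 0 < a) (s : ℝ) : HasDerivAt (fun s => √(a ^ 2 + max (s - a) 0 ^ 2) - a) (max (s - a) 0 / √(a ^ 2 + max (s - a) 0 ^ 2)) s := by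
  have h1 := ((posPow_hasDerivAt 0 (s - a)).comp s ((hasDerivAt_id s).sub_const a)).const_add (a ^ 2)
  refine ((h1.sqrt (by simp only [Function.comp_def]; positivity)).sub_const a).congr_deriv ?_
  simp only [Function.comp_def]
  have : √(a ^ 2 + max (s - a) 0 ^ 2) ≠ 0 := pz
  simp; field_simp

theorem lemA (hp : 1 < p) (hε : 0 < ε) (hΩ : IsOpen Ω) (hb : IsBounded Ω) (HL : ∀ v, ContDiff ℝ (⊤ : ℕ∞) v → HasCompactSupport v → tsupport v ⊆ Ω → Ray p ε l Ω v)
    (hv : ContinuousOn v (closure Ω)) (hv1 : ContDiffOn ℝ 1 v Ω) (h0 : ∀ x ∈ Ω, 0 ≤ v x) (hf : ∀ x ∈ frontier Ω, v x = 0)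
    (hi : IntegrableOn (fun x => gw x * jf p ε v x) Ω) : Ray p ε l Ω v := by
  set θ : ℝ → ℝ → ℝ := fun a s => √(a ^ 2 + max (s - a) 0 ^ 2) - a with hθ
  set f : ℝ → E → ℝ := fun a => Ω.indicator fun x => θ a (v x) with hfd
  have hev : ∀ a, ∀ x ∈ Ω, f a =ᶠ[𝓝 x] fun x => θ a (v x) := fun a x hx => by
    filter_upwards [hΩ.mem_nhds hx] with y hy
    exact indicator_of_mem hy _
  have hdv : ∀ x ∈ Ω, HasFDerivAt v (fd v x) x := fun x hx => ((hv1.contDiffAt (hΩ.mem_nhds hx)).differentiableAt sz).hasFDerivAt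
  have hD : ∀ a, 0 < a → ∀ x ∈ Ω, fd (f a) x = (max (v x - a) 0 / √(a ^ 2 + max (v x - a) 0 ^ 2)) • fd v x := fun a ha x hx => by
    rw [(hev a x hx).fderiv_eq]
    exact ((theta_facts ha (v x)).comp_hasFDerivAt x (hdv x hx)).fderiv
  have hK : ∀ a, 0 < a → ∃ K, IsCompact K ∧ K ⊆ Ω ∧ tsupport (f a) ⊆ K := fun a ha => by
    have hc : IsClosed (closure Ω ∩ v ⁻¹' Ici a) := hv.preimage_isClosed_of_isClosed isClosed_closure isClosed_Ici
    refine ⟨_, hb.closure.isCompact_closure.of_isClosed_subset hc fun x hx => subset_closure hx.1, fun x hx => ?_, closure_minimal (fun x hx => ?_) hc⟩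
    · by_contra hn
      have := hf x (by rw [hΩ.frontier_eq]; exact ⟨hx.1, hn⟩)
      have := hx.2
      simp only [mem_preimage, mem_Ici] at this
      linarith
    · have hxΩ : x ∈ Ω := by by_contra h; exact hx (inm h _)
      refine ⟨subset_closure hxΩ, ?_⟩
      by_contra h
      simp only [mem_preimage, mem_Ici, not_le] at h
      refine hx ?_
      simp only [hfd, indicator_of_mem hxΩ, hθ]
      rw [max_eq_right lz]
      simp [sqrt_sq ha.le]
  have hC : ∀ a, 0 < a → ContDiff ℝ 1 (f a) := fun a ha => by
    obtain ⟨K, -, hKΩ, hsK⟩ := hK a ha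
    refine contDiff_iff_contDiffAt.2 fun x => ?_
    by_cases hx : x ∈ tsupport (f a)
    swap
    · exact contDiffAt_const.congr_of_eventuallyEq (nmt.1 hx)
    have hx := hKΩ (hsK hx)
    refine ContDiffAt.congr_of_eventuallyEq ?_ (hev a x hx)
    have : ContDiff ℝ 1 (θ a) := ((contDiff_const.add ((posPow_contDiff 0).comp (contDiff_id.sub contDiff_const))).sqrt fun s => by simp only [Function.comp_def]; positivity).sub contDiff_const
    exact this.contDiffAt.comp x (hv1.contDiffAt (hΩ.mem_nhds hx))
  have hak : ∀ k : ℕ, (0 : ℝ) < 1 / (k + 1) := fun k => pz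
  have hlim : Filter.Tendsto (fun k : ℕ => (1 : ℝ) / (k + 1)) .atTop (𝓝 0) := tendsto_one_div_add_atTop_nhds_zero_nat
  refine lim_pass hp hε hΩ (f := fun k => f (1 / (k + 1))) (fun k => hC _ (hak k)) (fun x hx => ?_) (fun x hx => ?_) hi (fun k x hx => ?_) (fun k => ?_)
  · simp only [hfd, indicator_of_mem hx]
    have : Continuous fun a => θ a (v x) := by simp only [hθ]; fun_prop
    have h2 := (this.tendsto 0).comp hlim
    simp only [hθ, sub_zero, max_eq_left (h0 x hx), sqrt_sq (h0 x hx), ne_eq, OfNat.ofNat_ne_zero, not_false_eq_true, zero_pow, zero_add] at h2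
    exact h2
  · simp_rw [fun k : ℕ => hD _ (hak k) x hx]
    rcases (h0 x hx).eq_or_lt with h | h
    · have : IsLocalMin v x := (hΩ.eventually_mem hx).mono fun y hy => by rw [← h]; exact h0 y hy
      simp [this.fderiv_eq_zero]
    · have : ContinuousAt (fun a => max (v x - a) 0 / √(a ^ 2 + max (v x - a) 0 ^ 2)) 0 :=
        ContinuousAt.div fz fz (by simp [h.le, sqrt_sq h.le, h.ne'])
      have h2 := (this.tendsto.comp hlim).smul_const (fd v x)
      simp only [sub_zero, max_eq_left h.le, sqrt_sq h.le, ne_eq, OfNat.ofNat_ne_zero, not_false_eq_true, zero_pow, zero_add, div_self h.ne', one_smul] at h2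
      exact h2
  · have ha := hak k
    generalize (1 : ℝ) / (k + 1) = a at ha
    have hvx := h0 x hx
    have hm : 0 ≤ max (v x - a) 0 := le_max_right _ _
    have hmv : max (v x - a) 0 ≤ v x := max_le lz hvx
    refine mll ?_ (gw_pos x).le
    unfold jf
    rw [hD a ha x hx, norm_smul]
    simp only [hfd, indicator_of_mem hx, hθ]
    set m := max (v x - a) 0
    have e1 : a ≤ √(a ^ 2 + m ^ 2) := le_sqrt_of_sq_le (by nlinarith)
    have e2 : √(a ^ 2 + m ^ 2) ≤ a + m := sqrt_le_iff.2 ⟨by positivity, by nlinarith⟩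
    have e3 : m ≤ √(a ^ 2 + m ^ 2) := le_sqrt_of_sq_le (by nlinarith)
    have e4 : ‖m / √(a ^ 2 + m ^ 2)‖ ≤ 1 := by
      rw [nnn pz]
      exact div_le_one_of_le₀ e3 pz
    have e5 : √(a ^ 2 + m ^ 2) - a ≤ v x := lz
    have e6 : 0 ≤ √(a ^ 2 + m ^ 2) - a := lz
    have e7 := mlo (norm_nonneg (fd v x)) e4
    gcongr
  · obtain ⟨K, hKc, hKΩ, hsK⟩ := hK _ (hak k)
    exact ray_C1 hp hε hΩ hb HL (hC _ (hak k)) (hKc.of_isClosed_subset isClosed_closure hsK) (hsK.trans hKΩ)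

theorem deriv_param (hε : 0 < ε) {K : Set E} (hK : IsCompact K) {A φ : E → ℝ} {W Φ : E → E} (hA : ContinuousOn A K) (hφ : ContinuousOn φ K) (hW : ContinuousOn W K) (hΦ : ContinuousOn Φ K) :
    HasDerivAt (fun t : ℝ => ∫ x in K, A x * (exp (p * (t * φ x)) * ((ε + ‖W x + t • Φ x‖ ^ 2) ^ (p / 2) - l)))
      (∫ x in K, A x * (p * (φ x * ((ε + ‖W x‖ ^ 2) ^ (p / 2) - l) + Rf p ε (W x) * ⟪W x, Φ x⟫))) 0 := by
  set F' : ℝ → E → ℝ := fun t x => A x * (exp (p * (t * φ x)) * (p * φ x) * ((ε + ‖W x + t • Φ x‖ ^ 2) ^ (p / 2) - l) + exp (p * (t * φ x)) * (p * Rf p ε (W x + t • Φ x) * ⟪W x + t • Φ x, Φ x⟫)) with hF'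
  have hfst : ContinuousOn (fun q : ℝ × E => q.1) (Icc (-1) 1 ×ˢ K) := continuousOn_fst
  have hm : MapsTo (fun q : ℝ × E => q.2) (Icc (-1) 1 ×ˢ K) K := fun q hq => hq.2
  have a1 := hA.comp continuousOn_snd hm
  have a2 := hφ.comp continuousOn_snd hm
  have a3 := hW.comp continuousOn_snd hm
  have a4 := hΦ.comp continuousOn_snd hm
  simp only [Function.comp_def] at a1 a2 a3 a4
  have hcR : ∀ {c : ℝ}, ContinuousOn (fun q : ℝ × E => (ε + ‖W q.2 + q.1 • Φ q.2‖ ^ 2) ^ c) (Icc (-1) 1 ×ˢ K) := fun {c} =>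
    ContinuousOn.rpow_const fz fun q _ => Or.inl pz
  have hcF : ContinuousOn (fun q : ℝ × E => F' q.1 q.2) (Icc (-1) 1 ×ˢ K) := by
    have r1 := hcR (c := p / 2)
    have r2 := hcR (c := (p - 2) / 2)
    have : ContinuousOn (fun q : ℝ × E => ⟪W q.2 + q.1 • Φ q.2, Φ q.2⟫) (Icc (-1) 1 ×ˢ K) := ContinuousOn.inner (𝕜 := ℝ) fz a4
    simp only [hF', Rf]
    fun_prop
  have hcG : ContinuousOn (fun q : ℝ × E => A q.2 * (exp (p * (q.1 * φ q.2)) * ((ε + ‖W q.2 + q.1 • Φ q.2‖ ^ 2) ^ (p / 2) - l))) (Icc (-1) 1 ×ˢ K) := by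
    have r1 := hcR (c := p / 2)
    fun_prop
  obtain ⟨B, hB⟩ := (isCompact_Icc.prod hK).exists_bound_of_continuousOn hcF
  have hsec : ∀ t ∈ Icc (-1 : ℝ) 1, MapsTo (fun x : E => (t, x)) K (Icc (-1) 1 ×ˢ K) := fun t ht x hx => ⟨ht, hx⟩
  have hn : ball (0 : ℝ) 1 ⊆ Icc (-1) 1 := by rw [Real.ball_eq_Ioo]; norm_num; exact Ioo_subset_Icc_self
  have h00 : (0 : ℝ) ∈ Icc (-1 : ℝ) 1 := sz
  have hsc : ∀ {H : ℝ × E → ℝ}, ContinuousOn H (Icc (-1) 1 ×ˢ K) → ∀ t ∈ Icc (-1 : ℝ) 1, ContinuousOn (fun x => H (t, x)) K := fun h t ht => h.comp fz (hsec t ht)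
  have key := hasDerivAt_integral_of_dominated_loc_of_deriv_le (μ := volume.restrict K) (bound := fun _ => B) (F' := F') (F := fun t x => A x * (exp (p * (t * φ x)) * ((ε + ‖W x + t • Φ x‖ ^ 2) ^ (p / 2) - l))) (x₀ := (0 : ℝ)) (ball_mem_nhds 0 one_pos)
    (Filter.eventually_of_mem (ball_mem_nhds (0 : ℝ) one_pos) fun t ht => (hsc hcG t (hn ht)).aestronglyMeasurable hK.measurableSet)
    ((hsc hcG 0 h00).integrableOn_compact hK) ((hsc hcF 0 h00).aestronglyMeasurable hK.measurableSet)
    (by filter_upwards [smar hK.measurableSet] with x hx t ht using hB (t, x) ⟨hn ht, hx⟩) (integrableOn_const hK.measure_lt_top.ne)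
    (eof fun x t _ => by
      have d1 : HasDerivAt (fun t : ℝ => exp (p * (t * φ x))) (exp (p * (t * φ x)) * (p * φ x)) t := by
        simpa using ((((hasDerivAt_id t).mul_const (φ x)).const_mul p)).exp
      have d2 : HasDerivAt (fun t : ℝ => W x + t • Φ x) (Φ x) t := by simpa using ((hasDerivAt_id t).smul_const (Φ x)).const_add (W x)
      have d3 : HasDerivAt (fun t : ℝ => (ε + ‖W x + t • Φ x‖ ^ 2) ^ (p / 2) - l) (p * Rf p ε (W x + t • Φ x) * ⟪W x + t • Φ x, Φ x⟫) t := by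
        refine (((d2.norm_sq.const_add ε).rpow_const (p := p / 2) (Or.inl pz)).sub_const l).congr_deriv ?_
        rw [Rf, show (p - 2) / 2 = p / 2 - 1 by ring]; ring
      exact (d1.mul d3).const_mul (A x))
  refine key.2.congr_deriv (integral_congr_ae (eof fun x => ?_))
  simp [hF']; ring_nf; simp
end

section

variable {p ε l : ℝ} {U Ω : Set E} {u v : E → ℝ}

theorem jf_eq (hε : 0 < ε) {x y : E} (h0 : 0 < v x) (h : HasFDerivAt v (v x • tD E y) x) : jf p ε v x = v x ^ p * (ε + ‖y‖ ^ 2) ^ (p / 2) := by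
  rw [jf, h.fderiv, norm_smul, LinearIsometryEquiv.norm_map, nnn h0.le, show ε * v x ^ 2 + (v x * ‖y‖) ^ 2 = v x ^ 2 * (ε + ‖y‖ ^ 2) by ring, mul_rpow pz pz, ← rpow_natCast, ← rpow_mul h0.le]
  congr 2; push_cast; ring

theorem jf_contOn (hp : 1 < p) (hΩ : IsOpen Ω) (hv : ContDiffOn ℝ 1 v Ω) : ContinuousOn (fun x => gw x * jf p ε v x) Ω := by
  have h1 := hv.continuousOn
  have h2 := hv.continuousOn_fderiv_of_isOpen hΩ le_rfl
  exact gw_contDiff.continuous.continuousOn.mul (ContinuousOn.rpow_const fz fun x _ => Or.inr lz)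

theorem pw_contOn (hp : 1 < p) (hv : ContinuousOn v Ω) : ContinuousOn (fun x => gw x * |v x| ^ p) Ω :=
  gw_contDiff.continuous.continuousOn.mul (hv.abs.rpow_const fun x _ => Or.inr lz)

theorem pw_int (hp : 1 < p) (hε : 0 < ε) (hΩ : IsOpen Ω) (hv : ContinuousOn v Ω) (hi : IntegrableOn (fun x => gw x * jf p ε v x) Ω) : IntegrableOn (fun x => gw x * |v x| ^ p) Ω :=
  (hi.const_mul (ε ^ (p / 2))⁻¹).mono' ((pw_contOn hp hv).aestronglyMeasurable hΩ.measurableSet) (eof fun x => by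
    rw [nnn (mul_nonneg (gw_pos x).le pz)]; exact pow_le_jf hp hε v x)

noncomputable def Wl (u : E → ℝ) (x : E) : E := (u x)⁻¹ • gradient u x

theorem hasF_Wl {x : E} (h0 : 0 < u x) (h : DifferentiableAt ℝ u x) : HasFDerivAt u (u x • tD E (Wl u x)) x := by
  have := h.hasGradientAt.hasFDerivAt
  rwa [← map_smul, Wl, smul_inv_smul₀ h0.ne']

theorem hasG_log {x y : E} (h0 : 0 < u x) (h : HasFDerivAt u (u x • tD E y) x) : HasGradientAt (fun x => log (u x)) y x := by
  rw [hgfd]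
  refine (h.log h0.ne').congr_fderiv ?_
  rw [inv_smul_smul₀ h0.ne']

theorem EL (hp : 1 < p) (hε : 0 < ε) (hΩ : IsOpen Ω) (hb : IsBounded Ω) (HL : ∀ v, ContDiff ℝ (⊤ : ℕ∞) v → HasCompactSupport v → tsupport v ⊆ Ω → Ray p ε l Ω v)
    (hu : ContinuousOn u (closure Ω)) (hu1 : ContDiffOn ℝ 1 u Ω) (h0 : ∀ x ∈ Ω, 0 ≤ u x) (hf : ∀ x ∈ frontier Ω, u x = 0)
    (hi : IntegrableOn (fun x => gw x * jf p ε u x) Ω) (heq : ∫ x in Ω, gw x * jf p ε u x = l * ∫ x in Ω, gw x * |u x| ^ p) :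
    Sol {x ∈ Ω | 0 < u x} (fun x => log (u x)) (Wl u) (fun x => Rf p ε (Wl u x) • Wl u x) (fun x => gf p ε l (x, Wl u x)) := by
  set U := {x ∈ Ω | 0 < u x}
  have hUΩ : U ⊆ Ω := fun x hx => hx.1
  have hU : IsOpen U := hu1.continuousOn.isOpen_inter_preimage hΩ isOpen_Ioi
  have hdu : ∀ x ∈ Ω, DifferentiableAt ℝ u x := fun x hx => (hu1.contDiffAt (hΩ.mem_nhds hx)).differentiableAt sz
  have hfu := fun x (hx : x ∈ U) => hasF_Wl hx.2 (hdu x hx.1)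
  have hWc : ContinuousOn (Wl u) U := by
    refine ContinuousOn.smul ((hu1.continuousOn.mono hUΩ).inv₀ fun x hx => hx.2.ne') ?_
    exact (tD E).symm.continuous.comp_continuousOn ((hu1.continuousOn_fderiv_of_isOpen hΩ le_rfl).mono hUΩ)
  refine ⟨hU, (hu1.mono hUΩ).log fun x hx => hx.2.ne', fun x hx => hasG_log hx.2 (hfu x hx), ((Rf_contDiff hε 0).continuous.comp_continuousOn hWc).smul hWc,
    (gf_contDiff hε 0).continuous.comp_continuousOn (continuousOn_id.prodMk hWc), fun φ0 hφ0 hc hs => ?_⟩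
  set K := tsupport φ0
  have hKΩ := hs.trans hUΩ
  have hKm : MeasurableSet K := (isClosed_tsupport φ0).measurableSet
  set A : E → ℝ := fun x => gw x * u x ^ p with hA
  have hA0 : ∀ x ∈ U, 0 < A x := fun x hx => mul_pos (gw_pos x) (rpow_pos_of_pos hx.2 p)
  have hAf : ∀ x ∈ U, HasFDerivAt A (A x • tD E (p • Wl u x - x)) x := fun x hx => by
    have e1 : HasFDerivAt (gw : E → ℝ) _ x := ((hasStrictFDerivAt_norm_sq x).hasFDerivAt.neg.mul_const (2⁻¹ : ℝ)).exp
    refine (e1.mul ((hfu x hx).rpow_const (p := p) (Or.inl hx.2.ne'))).congr_fderiv ?_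
    ext ξ
    have e2 : u x ^ (p - 1) * u x = u x ^ p := by rw [rpow_sub_one hx.2.ne']; field_simp [hx.2.ne']
    simp [hA, inner_sub_left, isml, gw, ← e2]
    ring
  have hAc : ContDiffOn ℝ 1 A U := gw_contDiff.contDiffOn.mul ((hu1.mono hUΩ).rpow_const_of_ne fun x hx => hx.2.ne')
  have hφ : ContDiff ℝ 1 fun x => φ0 x • (A x)⁻¹ := contDiff_cut hU hφ0 hs (hAc.inv fun x hx => (hA0 x hx).ne')
  set φ : E → ℝ := fun x => φ0 x • (A x)⁻¹ with hφd
  have hφ00 : ∀ x ∉ K, φ0 x = 0 := fun x hx => ime hx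
  set Φ := gradient φ
  have hφf : ∀ x, HasFDerivAt φ (tD E (Φ x)) x := fun x => ((hφ.differentiable sz) x).hasGradientAt.hasFDerivAt
  have hAΦ : ∀ x ∈ U, ∀ ξ, A x * ⟪Φ x, ξ⟫ = fd φ0 x ξ + φ0 x * ⟪x - p • Wl u x, ξ⟫ := fun x hx ξ => by
    have e1 := (((hφ0.differentiable sz) x).hasFDerivAt.mul ((hasDerivAt_inv (hA0 x hx).ne').comp_hasFDerivAt x (hAf x hx))).unique (hφf x)
    have e2 := DFunLike.congr_fun e1 ξ
    have := (hA0 x hx).ne'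
    simp [inner_sub_left, isml] at e2 ⊢
    rw [← e2]
    field_simp
    ring
  have hΦc : Continuous Φ := (tD E).symm.continuous.comp (hφ.continuous_fderiv sz)
  set v : ℝ → E → ℝ := fun t x => u x * exp (t * φ x) with hv
  have hev : ∀ t, ∀ x ∉ K, v t =ᶠ[𝓝 x] u := fun t x hx => by
    filter_upwards [(isClosed_tsupport φ0).isOpen_compl.mem_nhds hx] with y hy
    simp [hv, hφd, hφ00 y hy]
  have hφU : ∀ x ∈ U, ∀ t, 0 < v t x := fun x hx t => mul_pos hx.2 (exp_pos _)
  have hvf : ∀ t, ∀ x ∈ U, HasFDerivAt (v t) (v t x • tD E (Wl u x + t • Φ x)) x := fun t x hx => by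
    refine ((hfu x hx).mul ((hφf x).const_mul t).exp).congr_fderiv ?_
    ext ξ
    simp [hv, inner_add_left, isml]
    ring
  have hvC : ∀ t, ContDiffOn ℝ 1 (v t) Ω := fun t => hu1.mul (contDiff_const.mul hφ).exp.contDiffOn
  have hvi : ∀ t, IntegrableOn (fun x => gw x * jf p ε (v t) x) Ω := fun t => by
    rw [← union_sdiff_cancel hKΩ]
    refine IntegrableOn.union (((jf_contOn hp hΩ (hvC t)).mono hKΩ).integrableOn_compact hc) ?_
    refine (hi.mono_set sdiff_subset).congr_fun (fun x hx => ?_) (hΩ.measurableSet.diff hKm)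
    simp only [jf, (hev t x hx.2).fderiv_eq, (hev t x hx.2).eq_of_nhds]
  have hvp := fun t => pw_int hp hε hΩ (hvC t).continuousOn (hvi t)
  set Q : ℝ → E → ℝ := fun t x => gw x * jf p ε (v t) x - l * (gw x * |v t x| ^ p)
  have hQi : ∀ t, IntegrableOn (Q t) Ω := fun t => (hvi t).sub ((hvp t).const_mul l)
  have hQ : ∀ t, ∫ x in Ω, Q t x = (∫ x in Ω, gw x * jf p ε (v t) x) - l * ∫ x in Ω, gw x * |v t x| ^ p := fun t => by
    rw [← icm]; exact integral_sub (hvi t) ((hvp t).const_mul l)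
  have hQ0 : ∫ x in Ω, Q 0 x = 0 := by
    rw [hQ, sub_eq_zero]
    simpa [hv] using heq
  have hQt : ∀ t, 0 ≤ ∫ x in Ω, Q t x := fun t => by
    rw [hQ, sub_nonneg]
    refine lemA hp hε hΩ hb HL (hu.mul (by have := hφ.continuous; fun_prop)) (hvC t) (fun x hx => mul_nonneg (h0 x hx) (exp_pos _).le) (fun x hx => by simp [hv, hf x hx]) (hvi t)
  have hQs : ∀ t, ∫ x in Ω, Q t x = (∫ x in K, Q t x) + ∫ x in Ω \ K, Q 0 x := fun t => by
    rw [← scf (f := Q t) (hΩ.measurableSet.diff hKm) fun x hx => ?_, ← setIntegral_union disjoint_sdiff_right (hΩ.measurableSet.diff hKm) ((hQi t).mono_set hKΩ) ((hQi t).mono_set sdiff_subset), union_sdiff_cancel hKΩ]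
    simp only [Q, jf, (hev t x hx.2).fderiv_eq, (hev t x hx.2).eq_of_nhds, (hev 0 x hx.2).fderiv_eq, (hev 0 x hx.2).eq_of_nhds]
  have hQK : ∀ t, ∫ x in K, Q t x = ∫ x in K, A x * (exp (p * (t * φ x)) * ((ε + ‖Wl u x + t • Φ x‖ ^ 2) ^ (p / 2) - l)) := fun t => by
    refine scf hKm fun x hx => ?_
    have hx := hs hx
    simp only [Q, jf_eq hε (hφU x hx t) (hvf t x hx), abs_of_pos (hφU x hx t), hA]
    simp only [hv]
    rw [mul_rpow hx.2.le (exp_pos _).le, ← exp_mul, mul_comm (t * φ x) p]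
    ring
  have hd := deriv_param (p := p) (l := l) hε hc (hAc.continuousOn.mono hs) hφ.continuous.continuousOn (hWc.mono hs) hΦc.continuousOn
  have hz := IsLocalMin.hasDerivAt_eq_zero (eof fun t => by
    rw [← hQK, ← hQK]
    linarith [hQs t, hQs 0, hQt t]) hd
  have hi1 : IntegrableOn (fun x => fd φ0 x (Rf p ε (Wl u x) • Wl u x)) K := ContinuousOn.integrableOn_compact hc (((hφ0.continuous_fderiv sz).continuousOn).clm_apply ((((Rf_contDiff hε 0).continuous.comp_continuousOn hWc).smul hWc).mono hs))
  have hi2 : IntegrableOn (fun x => gf p ε l (x, Wl u x) * φ0 x) K := ContinuousOn.integrableOn_compact hc ((((gf_contDiff hε 0).continuous.comp_continuousOn (continuousOn_id.prodMk hWc)).mono hs).mul hφ0.continuous.continuousOn)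
  rw [← sie (s := K) (fun x hx => ?_), ← sie (s := K) (f := fun x => gf p ε l (x, Wl u x) * φ0 x) (fun x hx => by simp [hφ00 x hx]), ← sub_eq_zero, ← integral_sub hi1 hi2]
  · have : p * ∫ x in K, (fd φ0 x (Rf p ε (Wl u x) • Wl u x) - gf p ε l (x, Wl u x) * φ0 x) = 0 := by
      rw [← icm, ← hz]
      refine scf hKm fun x hx => ?_
      have hx := hs hx
      have e1 := hAΦ x hx (Wl u x)
      have e2 : A x * φ x = φ0 x := by have := (hA0 x hx).ne'; simp only [hφd, smul_eq_mul]; field_simp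
      have hR : (0 : ℝ) < ε + ‖Wl u x‖ ^ 2 := pz
      have e3 : (ε + ‖Wl u x‖ ^ 2) ^ (p / 2) = Rf p ε (Wl u x) * (ε + ‖Wl u x‖ ^ 2) := by
        rw [Rf, ← rpow_add_one hR.ne']; congr 1; ring
      rw [inner_sub_left, isml, riq] at e1
      simp only [map_smul, smul_eq_mul, gf, e3, real_inner_comm x (Wl u x), cjr] at e1 ⊢
      rw [real_inner_comm (Wl u x) (Φ x)] at e1
      linear_combination (-(p * Rf p ε (Wl u x))) * e1 - p * (Rf p ε (Wl u x) * (ε + ‖Wl u x‖ ^ 2) - l) * e2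
    exact (mul_eq_zero.1 this).resolve_left lz
  · rw [show fd φ0 x = 0 from ime fun h => hx (tsupport_fderiv_subset ℝ h)]; simp
end

section

variable {p ε l : ℝ} {U Ω : Set E} {u v : E → ℝ}

theorem main1 (hp : 1 < p) (hε : 0 < ε) (hl : 0 ≤ l) (hΩ : IsOpen Ω) (hb : IsBounded Ω) (hcv : Convex ℝ Ω) (HL : ∀ v, ContDiff ℝ (⊤ : ℕ∞) v → HasCompactSupport v → tsupport v ⊆ Ω → Ray p ε l Ω v)
    (hu : ContinuousOn u (closure Ω)) (hu1 : ContDiffOn ℝ 1 u Ω) (h0 : ∀ x ∈ Ω, 0 ≤ u x) (hf : ∀ x ∈ frontier Ω, u x = 0) (hne : ∃ x ∈ Ω, 0 < u x)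
    (hi : IntegrableOn (fun x => gw x * jf p ε u x) Ω) (heq : ∫ x in Ω, gw x * jf p ε u x = l * ∫ x in Ω, gw x * |u x| ^ p) :
    (∀ x ∈ Ω, 0 < u x) ∧ (∀ x ∈ Ω, HasGradientAt (fun x => log (u x)) (Wl u x) x) ∧ (∀ m : ℕ, ContDiffOn ℝ m (Wl u) Ω) ∧ (∀ x ∈ Ω, ∀ v y, ⟪fd (Wl u) x v, y⟫ = ⟪fd (Wl u) x y, v⟫) ∧
    ∀ x ∈ Ω, Rf p ε (Wl u x) * opP p ε (Wl u x) (fd (Wl u) x) + gf p ε l (x, Wl u x) = 0 := by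
  have hS := EL hp hε hΩ hb HL hu hu1 h0 hf hi heq
  obtain ⟨c1, c2, c3⟩ := classical hp hε hS
  have hpos := hopf hp hε hΩ hcv.isPreconnected hu1 h0 hne hS.hZ (fun x hx => ((c1 1).contDiffAt (hS.hU.mem_nhds hx)).differentiableAt sz) c2 fun x hx => by
    have h1 := c3 x hx
    simp only [gf] at h1
    by_contra hc
    push Not at hc
    nlinarith [mul_pos (Rf_pos (p := p) hε (Wl u x)) hc]
  have hU : {x ∈ Ω | 0 < u x} = Ω := by ext x; exact ⟨fun h => h.1, fun h => ⟨h, hpos x h⟩⟩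
  have hZ := hS.hZ
  rw [hU] at c1 c2 c3 hZ
  exact ⟨hpos, hZ, c1, c2, c3⟩

theorem compact_hull {T : Set E} (hT : IsCompact T) : IsCompact (convexHull ℝ T) := by
  rcases T.eq_empty_or_nonempty with rfl | ⟨t0, ht0⟩
  · simp
  set ι := Fin (Module.finrank ℝ E + 1)
  have h1 : IsCompact ((fun q : (ι → ℝ) × (ι → E) => ∑ i, q.1 i • q.2 i) '' (stdSimplex ℝ ι ×ˢ Set.pi univ fun _ => T)) :=
    ((isCompact_stdSimplex ℝ ι).prod (isCompact_univ_pi fun _ => hT)).image fz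
  convert h1
  ext x
  constructor
  · intro hx
    obtain ⟨κ, _, z, w, hz, hi, hw, hw1, rfl⟩ := eq_pos_convex_span_of_mem_convexHull hx
    have hc : Fintype.card κ ≤ Fintype.card ι := by
      have := hi.card_le_finrank_succ
      have h2 := Submodule.finrank_le (vectorSpan ℝ (range z))
      simp only [ι, Fintype.card_fin]; omega
    obtain ⟨e⟩ := Function.Embedding.nonempty_of_card_le hc
    have e1 : ∀ i, Function.extend e w 0 (e i) = w i := e.injective.extend_apply _ _
    have e2 : ∀ i, Function.extend e z (fun _ => t0) (e i) = z i := e.injective.extend_apply _ _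
    have e3 : ∀ j ∉ range e, Function.extend e w 0 j = 0 := fun j hj => Function.extend_apply' _ _ _ hj
    refine ⟨(Function.extend e w 0, Function.extend e z fun _ => t0), ⟨⟨fun j => ?_, ?_⟩, fun j _ => ?_⟩, ?_⟩
    · by_cases hj : j ∈ range e
      · obtain ⟨i, rfl⟩ := hj; exact ((hw i).le.trans_eq (e1 i).symm)
      · exact (e3 j hj).ge
    · rw [← hw1]; exact (Fintype.sum_of_injective e e.injective _ _ e3 fun i => (e1 i).symm).symm
    · by_cases hj : j ∈ range e
      · obtain ⟨i, rfl⟩ := hj; simp only [e2]; exact hz ⟨i, rfl⟩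
      · simp only [Function.extend_apply' _ _ _ hj]; exact ht0
    · exact (Fintype.sum_of_injective e e.injective _ _ (fun j hj => by simp [e3 j hj]) fun i => by simp only [e1, e2]).symm
  · rintro ⟨q, ⟨⟨h1, h2⟩, h3⟩, rfl⟩
    exact mem_convexHull_of_exists_fintype q.1 q.2 h1 h2 (fun i => h3 i trivial) rfl

/-- optimal affine majorant at `z`. -/
theorem env_pt (hΩ : IsOpen Ω) (hb : IsBounded Ω) (hu : ContinuousOn u (closure Ω)) (hpos : ∀ x ∈ Ω, 0 < u x) (hf : ∀ x ∈ frontier Ω, u x = 0) {z : E} (hz : z ∈ Ω) :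
    ∃ (c : ℝ) (η : E), (∀ y ∈ Ω, log (u y) ≤ c + ⟪η, y - z⟫) ∧ (∀ c' ξ, (∀ y ∈ Ω, log (u y) ≤ c' + ⟪ξ, y - z⟫) → c ≤ c') ∧ z ∈ convexHull ℝ {y ∈ Ω | log (u y) = c + ⟪η, y - z⟫} := by
  have hK := hb.closure.isCompact_closure
  rw [closure_closure] at hK
  obtain ⟨ym, hym, hmax⟩ := hK.exists_isMaxOn ⟨z, subset_closure hz⟩ hu
  have hB : ∀ y ∈ Ω, log (u y) ≤ log (u ym) := fun y hy => log_le_log (hpos y hy) (hmax (subset_closure hy))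
  set B := log (u ym)
  obtain ⟨r, hr, hrΩ⟩ := Metric.nhds_basis_closedBall.mem_iff.1 (hΩ.mem_nhds hz)
  obtain ⟨yr, hyr, hmin⟩ := (icb z r).exists_isMinOn ⟨z, by simp [hr.le]⟩ (hu.mono (hrΩ.trans subset_closure))
  have hm : ∀ y ∈ closedBall z r, log (u yr) ≤ log (u y) := fun y hy => log_le_log (hpos yr (hrΩ hyr)) (hmin hy)
  set m := log (u yr)
  set S : Set (ℝ × E) := {q | ∀ y ∈ Ω, log (u y) ≤ q.1 + ⟪q.2, y - z⟫}
  have hSc : IsClosed S := by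
    have : S = ⋂ y ∈ Ω, {q : ℝ × E | log (u y) ≤ q.1 + ⟪q.2, y - z⟫} := by ext; simp [S]
    rw [this]
    exact isClosed_biInter fun y _ => isClosed_le fz fz
  have hSb : S ∩ {q | q.1 ≤ B} ⊆ Icc m B ×ˢ closedBall (0 : E) ((B - m) / r) := by
    rintro ⟨c, ξ⟩ ⟨h1, h2⟩
    have h2 : c ≤ B := h2
    refine ⟨⟨?_, h2⟩, ?_⟩
    · have := h1 z hz
      simp at this
      exact (hm z (by simp [hr.le])).trans this
    · rw [mcz, le_div_iff₀ hr]
      rcases eq_or_ne ξ 0 with rfl | hξ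
      · have := h1 z hz
        have := hm z (by simp [hr.le])
        simp at *; linarith
      have hξ' : ‖ξ‖ ≠ 0 := norm_ne_zero_iff.2 hξ
      have hy : z - (r / ‖ξ‖) • ξ ∈ closedBall z r := by
        rw [mem_closedBall, den, sub_sub_cancel_left, norm_neg, norm_smul, nnn pz, div_mul_cancel₀ _ hξ']
      have := h1 _ (hrΩ hy)
      have h4 := hm _ hy
      simp only [sub_sub_cancel_left, inner_neg_right, inner_smul_right, riq] at this
      have h5 : r / ‖ξ‖ * ‖ξ‖ ^ 2 = ‖ξ‖ * r := by field_simp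
      linarith
  have hScomp : IsCompact (S ∩ {q | q.1 ≤ B}) := (isCompact_Icc.prod (icb _ _)).of_isClosed_subset (hSc.inter (isClosed_le continuous_fst continuous_const)) hSb
  obtain ⟨⟨c, η⟩, ⟨hq, hqB⟩, hqm⟩ := hScomp.exists_isMinOn ⟨(B, 0), fun y hy => by simpa using hB y hy, (le_refl B : B ≤ B)⟩ continuous_fst.continuousOn
  have hopt : ∀ c' ξ, (∀ y ∈ Ω, log (u y) ≤ c' + ⟪ξ, y - z⟫) → c ≤ c' := fun c' ξ h => by
    by_contra hc
    push Not at hc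
    exact absurd (hqm (show (c', ξ) ∈ S ∩ {q | q.1 ≤ B} from ⟨h, hc.le.trans hqB⟩)) (not_le.2 hc)
  refine ⟨c, η, hq, hopt, ?_⟩
  set F : E → ℝ := fun y => u y * exp (-(c + ⟪η, y - z⟫)) with hF
  have hFc : ContinuousOn F (closure Ω) := hu.mul fz
  have hFl : ∀ y ∈ Ω, F y = exp (log (u y) - (c + ⟪η, y - z⟫)) := fun y hy => by rw [sub_eq_add_neg, exp_add, exp_log (hpos y hy)]
  have hF1 : ∀ y ∈ Ω, (log (u y) = c + ⟪η, y - z⟫ ↔ F y = 1) := fun y hy => by rw [hFl y hy, exp_eq_one_iff, sub_eq_zero]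
  have hbd : ∀ y ∈ closure Ω, y ∉ Ω → F y = 0 := fun y hy hn => by simp [hF, hf y (by rw [hΩ.frontier_eq]; exact ⟨hy, hn⟩)]
  set T := {y ∈ Ω | log (u y) = c + ⟪η, y - z⟫}
  have hT : T = closure Ω ∩ F ⁻¹' {1} := by
    ext y
    constructor
    · exact fun h => ⟨subset_closure h.1, (hF1 y h.1).1 h.2⟩
    · rintro ⟨h1, h2⟩
      have : y ∈ Ω := by by_contra h; have := hbd y h1 h; simp_all
      exact ⟨this, (hF1 y this).2 h2⟩
  have hTc : IsCompact T := hK.of_isClosed_subset (hT ▸ hFc.preimage_isClosed_of_isClosed isClosed_closure isClosed_singleton) fun y hy => subset_closure hy.1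
  by_contra hzn
  obtain ⟨f, s, hfs, hsz⟩ := geometric_hahn_banach_closed_point (convex_convexHull ℝ T) (compact_hull hTc).isClosed hzn
  set f' := (tD E).symm f
  have hf' : ∀ y, ⟪f', y⟫ = f y := fun y => by simp [f']
  set κ := f z - s
  have hκ : 0 < κ := sub_pos.2 hsz
  set N := closure Ω ∩ f ⁻¹' Ici s
  have hN : IsCompact N := hK.inter_right (isClosed_Ici.preimage f.continuous)
  obtain ⟨yN, hyN, hmaxN⟩ := hN.exists_isMaxOn ⟨z, subset_closure hz, hsz.le⟩ (hFc.mono inter_subset_left)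
  have hFN : F yN < 1 := by
    by_cases h : yN ∈ Ω
    · refine lt_of_le_of_ne ?_ fun h1 => absurd (hfs yN (subset_convexHull ℝ T ⟨h, (hF1 yN h).2 h1⟩)) (not_lt.2 hyN.2)
      rw [hFl yN h, exp_le_one_iff]; linarith [hq yN h]
    · rw [hbd yN hyN.1 h]; exact one_pos
  obtain ⟨D, hD⟩ := hb.closure.isCompact_closure.exists_bound_of_continuousOn (f := fun y => f y - f z) fz
  have hFz : 0 < F yN := lt_of_lt_of_le (by rw [hFl z hz]; exact exp_pos _) (hmaxN (show z ∈ N from ⟨subset_closure hz, hsz.le⟩))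
  set μ := -log (F yN)
  have hμ : 0 < μ := neg_pos.2 (log_neg hFz hFN)
  have hD0 : 0 ≤ D := (norm_nonneg _).trans (hD z (subset_closure (subset_closure hz)))
  set τ := μ / (2 * (D + κ + 1))
  have hτ : 0 < τ := pz
  have := hopt (c - τ * κ) (η - τ • f') fun y hy => by
    rw [inner_sub_left, isml, inner_sub_right f', hf', hf']
    simp only [cjr]
    by_cases hs : s ≤ f y
    · have h1 := log_le_log (by rw [hFl y hy]; exact exp_pos _) (hmaxN (show y ∈ N from ⟨subset_closure hy, hs⟩))
      rw [hFl y hy, log_exp] at h1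
      have h2 := (abs_le.1 (hD y (subset_closure (subset_closure hy)))).2
      have h3 : τ * (f y - f z) ≤ τ * D := by gcongr
      have h4 : τ * (D + κ + 1) = μ / 2 := by simp only [τ]; field_simp
      have h5 : log (u y) - (c + ⟪η, y - z⟫) ≤ -μ := by simp only [μ, neg_neg]; exact h1
      linarith
    · have h1 := hq y hy
      simp only at h1
      have h2 : τ * (f y - f z) ≤ τ * (-κ) := by gcongr; simp only [κ]; push Not at hs; linarith
      linarith
  nlinarith
end

section

variable {p ε l : ℝ} {Ω : Set E} {u w c : E → ℝ} {W η : E → E}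

structure IsEnv (Ω : Set E) (w c : E → ℝ) (η : E → E) : Prop where
  maj : ∀ z ∈ Ω, ∀ y ∈ Ω, w y ≤ c z + ⟪η z, y - z⟫
  opt : ∀ z ∈ Ω, ∀ c' ξ, (∀ y ∈ Ω, w y ≤ c' + ⟪ξ, y - z⟫) → c z ≤ c'
  hull : ∀ z ∈ Ω, z ∈ convexHull ℝ {y ∈ Ω | w y = c z + ⟪η z, y - z⟫}

theorem env_ex (hΩ : IsOpen Ω) (hb : IsBounded Ω) (hu : ContinuousOn u (closure Ω)) (hpos : ∀ x ∈ Ω, 0 < u x) (hf : ∀ x ∈ frontier Ω, u x = 0) :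
    ∃ (c : E → ℝ) (η : E → E), IsEnv Ω (fun x => log (u x)) c η := by
  have H : ∀ z, ∃ (c : ℝ) (η : E), z ∈ Ω → (∀ y ∈ Ω, log (u y) ≤ c + ⟪η, y - z⟫) ∧ (∀ c' ξ, (∀ y ∈ Ω, log (u y) ≤ c' + ⟪ξ, y - z⟫) → c ≤ c') ∧ z ∈ convexHull ℝ {y ∈ Ω | log (u y) = c + ⟪η, y - z⟫} := fun z => by
    by_cases hz : z ∈ Ω
    · obtain ⟨c, η, h⟩ := env_pt hΩ hb hu hpos hf hz
      exact ⟨c, η, fun _ => h⟩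
    · exact ⟨0, 0, fun h => absurd h hz⟩
  choose c η h using H
  exact ⟨c, η, fun z hz => (h z hz).1, fun z hz => (h z hz).2.1, fun z hz => (h z hz).2.2⟩

namespace IsEnv

theorem supp (h : IsEnv Ω w c η) {y z : E} (hy : y ∈ Ω) (hz : z ∈ Ω) : c y ≤ c z + ⟪η z, y - z⟫ :=
  h.opt y hy _ (η z) fun x hx => (h.maj z hz x hx).trans_eq (by rw [add_assoc, ← inner_add_right]; congr 2; abel)

theorem le (h : IsEnv Ω w c η) {z : E} (hz : z ∈ Ω) : w z ≤ c z := by simpa using h.maj z hz z hz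

theorem contact (h : IsEnv Ω w c η) (hΩ : IsOpen Ω) (hW : ∀ x ∈ Ω, HasGradientAt w (W x) x) {x z : E} (hz : z ∈ Ω) (hx : x ∈ Ω) (he : w x = c z + ⟪η z, x - z⟫) : W x = η z := by
  have h1 : HasFDerivAt (fun y => w y - ⟪η z, y⟫) (tD E (W x) - tD E (η z)) x :=
    (hW x hx).hasFDerivAt.sub (tD E (η z)).hasFDerivAt
  have h2 : IsLocalMax (fun y => w y - ⟪η z, y⟫) x := by
    filter_upwards [hΩ.mem_nhds hx] with y hy
    have := h.maj z hz y hy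
    rw [inner_sub_right] at this he
    linarith
  have := h2.hasFDerivAt_eq_zero h1
  exact (tD E).injective (sub_eq_zero.1 this)

theorem rep (h : IsEnv Ω w c η) {z : E} (hz : z ∈ Ω) : ∃ (ι : Type) (_ : Fintype ι) (a : ι → ℝ) (x : ι → E), (∀ i, 0 ≤ a i) ∧ ∑ i, a i = 1 ∧ (∀ i, x i ∈ Ω ∧ w (x i) = c z + ⟪η z, x i - z⟫) ∧ ∑ i, a i • x i = z ∧
    ∑ i, a i * w (x i) = c z ∧ ∀ k, z + k ∈ Ω → (∀ i, x i + k ∈ Ω) → ∑ i, a i * w (x i + k) ≤ c (z + k) := by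
  obtain ⟨ι, _, a, x, h1, h2, h3, h4⟩ := mem_convexHull_iff_exists_fintype.1 (h.hull z hz)
  have h5 : ∀ (b : ℝ) (ξ : E), ∑ i, a i * (b + ⟪ξ, x i - z⟫) = b := fun b ξ => by
    have e : ∀ i, a i * (b + ⟪ξ, x i - z⟫) = a i * b + ⟪ξ, a i • x i⟫ - a i * ⟪ξ, z⟫ := fun i => by rw [inner_sub_right, inner_smul_right]; ring
    simp only [e]
    rw [Finset.sum_sub_distrib, Finset.sum_add_distrib, ← Finset.sum_mul, ← Finset.sum_mul, ← inner_sum, h2, h4]; ring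
  refine ⟨ι, _, a, x, h1, h2, h3, h4, ?_, fun k hk hk' => ?_⟩
  · rw [← h5 (c z) (η z)]
    exact Finset.sum_congr rfl fun i _ => by rw [(h3 i).2]
  · rw [← h5 (c (z + k)) (η (z + k))]
    refine Finset.sum_le_sum fun i _ => mll ?_ (h1 i)
    exact (h.maj _ hk _ (hk' i)).trans_eq (by congr 2; abel)

end IsEnv

/-- local semiconvexity of the envelope -/
theorem env_semi (h : IsEnv Ω (fun x => log (u x)) c η) (hΩ : IsOpen Ω) (hb : IsBounded Ω) (hu : ContinuousOn u (closure Ω)) (hpos : ∀ x ∈ Ω, 0 < u x) (hf : ∀ x ∈ frontier Ω, u x = 0)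
    (hW : ∀ x ∈ Ω, HasGradientAt (fun x => log (u x)) (W x) x) (hW1 : ContDiffOn ℝ 1 W Ω) {z0 : E} (hz0 : z0 ∈ Ω) :
    ∃ C r, 0 ≤ C ∧ 0 < r ∧ ball z0 (2 * r) ⊆ Ω ∧ ∀ z ∈ ball z0 r, ∀ k, ‖k‖ ≤ r → c z + ⟪η z, k⟫ - C * ‖k‖ ^ 2 ≤ c (z + k) := by
  have hK := hb.closure.isCompact_closure
  rw [closure_closure] at hK
  obtain ⟨ym, hym, hmax⟩ := hK.exists_isMaxOn ⟨z0, subset_closure hz0⟩ hu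
  have hB : ∀ y ∈ Ω, log (u y) ≤ log (u ym) := fun y hy => log_le_log (hpos y hy) (hmax (subset_closure hy))
  set B := log (u ym)
  obtain ⟨r, hr, hrΩ⟩ := Metric.nhds_basis_closedBall.mem_iff.1 (hΩ.mem_nhds hz0)
  obtain ⟨yr, hyr, hmin⟩ := (icb z0 r).exists_isMinOn ⟨z0, by simp [hr.le]⟩ (hu.mono (hrΩ.trans subset_closure))
  have hm : ∀ y ∈ closedBall z0 r, log (u yr) ≤ log (u y) := fun y hy => log_le_log (hpos yr (hrΩ hyr)) (hmin hy)
  set m := log (u yr)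
  obtain ⟨D, hD⟩ := hb.closure.isCompact_closure.exists_bound_of_continuousOn (f := fun y => y) fz
  have hD' : ∀ y ∈ Ω, ‖y‖ ≤ D := fun y hy => hD y (subset_closure (subset_closure hy))
  have hηb : ∀ z ∈ ball z0 (r / 2), ‖η z‖ * (r / 2) ≤ B - m := fun z hz => by
    have hzr : z ∈ closedBall z0 r := bscb (bsb lz hz)
    have hzΩ := hrΩ hzr
    have hc : c z ≤ B := h.opt z hzΩ B 0 fun y hy => by simpa using hB y hy
    have hmz := (hm z hzr).trans (h.le hzΩ)
    rcases eq_or_ne (η z) 0 with h0 | h0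
    · rw [h0]; simp; linarith
    have h0' := norm_ne_zero_iff.2 h0
    have hy : z - (r / 2 / ‖η z‖) • η z ∈ closedBall z0 r := by
      rw [mem_closedBall, den, sub_right_comm]
      refine (norm_sub_le _ _).trans ?_
      rw [norm_smul, nnn pz, div_mul_cancel₀ _ h0', ← den]
      linarith [mem_ball.1 hz]
    have h3 := h.maj z hzΩ _ (hrΩ hy)
    have h4 := hm _ hy
    simp only [sub_sub_cancel_left, inner_neg_right, inner_smul_right, riq] at h3
    have h5 : r / 2 / ‖η z‖ * ‖η z‖ ^ 2 = ‖η z‖ * (r / 2) := by field_simp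
    linarith
  set M := m - (B - m) / (r / 2) * (2 * D)
  set K := closure Ω ∩ u ⁻¹' Ici (exp M)
  have hKc : IsCompact K := hK.of_isClosed_subset (hu.preimage_isClosed_of_isClosed isClosed_closure isClosed_Ici) inter_subset_left
  have hKΩ : K ⊆ Ω := fun x hx => by
    by_contra hn
    have := hx.2
    rw [mem_preimage, hf x (by rw [hΩ.frontier_eq]; exact ⟨hx.1, hn⟩)] at this
    exact absurd this (not_le.2 (exp_pos _))
  obtain ⟨d, hd, hdΩ⟩ := hKc.exists_cthickening_subset_open hΩ hKΩ
  obtain ⟨C, hC⟩ := (hKc.cthickening (r := d)).exists_bound_of_continuousOn ((hW1.continuousOn_fderiv_of_isOpen hΩ le_rfl).mono hdΩ)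
  refine ⟨|C|, min (r / 2) d, abs_nonneg C, pz, (bsb (by linarith [min_le_left (r / 2) d])).trans (bscb.trans hrΩ), fun z hz k hk => ?_⟩
  have hz' : z ∈ ball z0 (r / 2) := bsb (min_le_left _ _) hz
  have hzr : z ∈ closedBall z0 r := bscb (bsb lz hz')
  have hzΩ := hrΩ hzr
  have hzk : z + k ∈ Ω := hrΩ (by
    rw [mem_closedBall, den, add_sub_right_comm]
    refine (norm_add_le _ _).trans ?_
    rw [← den]
    linarith [mem_ball.1 hz', hk.trans (min_le_left _ _)])
  obtain ⟨ι, _, a, x, h1, h2, h3, h4, h5, h6⟩ := h.rep hzΩ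
  have hxK : ∀ i, x i ∈ K := fun i => by
    refine ⟨subset_closure (h3 i).1, ?_⟩
    rw [mem_preimage, mem_Ici, ← le_log_iff_exp_le (hpos _ (h3 i).1), (h3 i).2]
    have e1 := abs_le.1 (ail (η z) (x i - z))
    have e2 : ‖η z‖ * ‖x i - z‖ ≤ (B - m) / (r / 2) * (2 * D) := by
      have e0 : ‖η z‖ ≤ (B - m) / (r / 2) := by rw [le_div_iff₀ pz]; exact hηb z hz'
      exact mul_le_mul e0 ((norm_sub_le _ _).trans (by linarith [hD' _ (h3 i).1, hD' z hzΩ])) nnz ((norm_nonneg _).trans e0)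
    have e3 := (hm z hzr).trans (h.le hzΩ)
    simp only [M]; linarith [e1.1]
  have hball : ∀ i, closedBall (x i) ‖k‖ ⊆ cthickening d K := fun i => (cbcb (hk.trans (min_le_right _ _))).trans (closedBall_subset_cthickening (hxK i) d)
  have hxk : ∀ i, x i + k ∈ closedBall (x i) ‖k‖ := fun i => sz
  have hT : ∀ i, log (u (x i)) + ⟪η z, k⟫ - |C| * ‖k‖ ^ 2 ≤ log (u (x i + k)) := fun i => by
    have hself : x i ∈ closedBall (x i) ‖k‖ := sz
    have hWx := h.contact hΩ hW hzΩ (h3 i).1 (h3 i).2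
    have t1 : ∀ y ∈ closedBall (x i) ‖k‖, ‖tD E (W y) - tD E (η z)‖ ≤ |C| * ‖k‖ := fun y hy => by
      rw [← map_sub, LinearIsometryEquiv.norm_map, ← hWx]
      refine ((convex_closedBall (x i) ‖k‖).norm_image_sub_le_of_norm_hasFDerivWithin_le (f := W) (f' := fun y => fd W y) (C := |C|) (fun q hq => ?_) (fun q hq => (hC q (hball i hq)).trans (le_abs_self C)) hself hy).trans ?_
      · exact ((hW1.contDiffAt (hΩ.mem_nhds (hdΩ (hball i hq)))).differentiableAt sz).hasFDerivAt.hasFDerivWithinAt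
      · gcongr; rw [← den]; exact hy
    have t2 := (convex_closedBall (x i) ‖k‖).norm_image_sub_le_of_norm_hasFDerivWithin_le' (fun q hq => (hW q (hdΩ (hball i hq))).hasFDerivAt.hasFDerivWithinAt) t1 hself (hxk i)
    rw [ascl] at t2
    have t3 := (abs_le.1 t2).1
    simp only [InnerProductSpace.toDual_apply_apply] at t3
    nlinarith
  have h7 := h6 k hzk fun i => hdΩ (hball i (hxk i))
  refine le_trans ?_ h7
  refine le_trans ?_ (Finset.sum_le_sum fun i _ => mll (hT i) (h1 i))
  refine le_of_eq ?_
  simp only [add_sub_assoc, mul_add, Finset.sum_add_distrib, ← Finset.sum_mul, h2]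
  rw [h5, one_mul]
end

section

variable {p ε l : ℝ} {Ω : Set E} {u w c : E → ℝ} {W η : E → E}

theorem env_loc (h : IsEnv Ω w c η) (hs : ∀ z0 ∈ Ω, ∃ C r, 0 ≤ C ∧ 0 < r ∧ ball z0 (2 * r) ⊆ Ω ∧ ∀ z ∈ ball z0 r, ∀ k, ‖k‖ ≤ r → c z + ⟪η z, k⟫ - C * ‖k‖ ^ 2 ≤ c (z + k)) :
    (∀ z ∈ Ω, HasGradientAt c (η z) z) ∧ ∀ z0 ∈ Ω, ∃ r > 0, ∃ K : ℝ≥0, LipschitzOnWith K η (ball z0 r) := by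
  refine ⟨fun z hz => ?_, fun z0 hz0 => ?_⟩
  · obtain ⟨C, r, hC, hr, hrΩ, hs⟩ := hs z hz
    rw [hgfd, hasFDerivAt_iff_isLittleO]
    have h1 : (fun y => c y - c z - (tD E (η z)) (y - z)) =O[𝓝 z] fun y => ‖y - z‖ ^ 2 := by
      refine Asymptotics.IsBigO.of_bound C ?_
      filter_upwards [ball_mem_nhds z hr] with y hy
      have e1 := hs z (by simpa using hr) (y - z) (by rw [← den]; exact (mem_ball.1 hy).le)
      have e2 := h.supp (hrΩ (bsb lz hy)) hz
      rw [add_sub_cancel] at e1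
      rw [InnerProductSpace.toDual_apply_apply, nea, norm_pow, norm_norm, abs_le]
      constructor <;> nlinarith [sq_nonneg ‖y - z‖]
    exact h1.trans_isLittleO ((Asymptotics.isLittleO_norm_pow_id (by norm_num : 1 < 2)).comp_tendsto (k := fun y : E => y - z) (l' := 𝓝 z) (by simpa using (continuous_sub_right z).tendsto z))
  · obtain ⟨C, r, hC, hr, hrΩ, hs⟩ := hs z0 hz0
    refine ⟨r / 2, pz, ⟨2 * C, pz⟩, LipschitzOnWith.of_dist_le_mul fun y hy z hz => ?_⟩
    rw [den, den]
    show _ ≤ 2 * C * _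
    have hyr := bsb lz hy (ε₂ := r)
    have hzr := bsb lz hz (ε₂ := r)
    have hq : ‖y - z‖ ≤ r := by
      rw [← den]
      linarith [dist_triangle_right y z z0, mem_ball.1 hy, mem_ball.1 hz]
    rcases eq_or_ne (η y) (η z) with h0 | h0
    · rw [h0]; simp; positivity
    have h0' : ‖η y - η z‖ ≠ 0 := norm_ne_zero_iff.2 (sub_ne_zero.2 h0)
    rcases eq_or_ne y z with rfl | hyz
    · exact absurd rfl h0
    have hq0 : 0 < ‖y - z‖ := norm_pos_iff.2 (sub_ne_zero.2 hyz)
    set k := (‖y - z‖ / ‖η y - η z‖) • (η y - η z) with hk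
    have hkn : ‖k‖ = ‖y - z‖ := by rw [hk, norm_smul, nnn pz, div_mul_cancel₀ _ h0']
    have e1 := hs y hyr k (hkn.trans_le hq)
    have e2 := hs z hzr (y - z) hq
    rw [add_sub_cancel] at e2
    have hyk : y + k ∈ Ω := hrΩ (by
      rw [mem_ball, den, add_sub_right_comm]
      refine (norm_add_le _ _).trans_lt ?_
      rw [← den]
      linarith [mem_ball.1 hyr])
    have e3 := h.supp hyk (hrΩ (bsb lz hzr))
    rw [add_sub_right_comm, inner_add_right] at e3
    have e4 : ⟪η y - η z, k⟫ = ‖η y - η z‖ * ‖y - z‖ := by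
      rw [hk, inner_smul_right, riq]; field_simp
    rw [inner_sub_left] at e4
    rw [hkn] at e1
    refine le_of_mul_le_mul_right ?_ hq0
    nlinarith

theorem tr_sum {ι : Type} [Fintype ι] (a : ι → ℝ) (X : ι → E →L[ℝ] E) : tr (∑ i, a i • X i) = ∑ i, a i * tr (X i) := by
  simp only [tr, _root_.sum_apply, _root_.smul_apply, sum_inner, isml, cjr, Finset.mul_sum]
  exact Finset.sum_comm

theorem opP_sum {ι : Type} [Fintype ι] (a : ι → ℝ) (X : ι → E →L[ℝ] E) (η : E) : opP p ε η (∑ i, a i • X i) = ∑ i, a i * opP p ε η (X i) := by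
  simp only [opP, tr_sum, mul_add, Finset.sum_add_distrib, _root_.sum_apply, _root_.smul_apply, sum_inner, isml, cjr, Finset.mul_sum, Finset.sum_div]
  congr 1
  exact Finset.sum_congr rfl fun i _ => by ring

theorem env_pde (hp : 1 < p) (hε : 0 < ε) (hΩ : IsOpen Ω) (h : IsEnv Ω w c η) (hg : ∀ z ∈ Ω, HasGradientAt c (η z) z) (hW : ∀ x ∈ Ω, HasGradientAt w (W x) x) (hW1 : ContDiffOn ℝ 1 W Ω)
    (hsym : ∀ x ∈ Ω, ∀ v y, ⟪fd W x v, y⟫ = ⟪fd W x y, v⟫) (heq : ∀ x ∈ Ω, Rf p ε (W x) * opP p ε (W x) (fd W x) + gf p ε l (x, W x) = 0) {z : E} (hz : z ∈ Ω) (hd : DifferentiableAt ℝ η z) :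
    0 ≤ Rf p ε (η z) * opP p ε (η z) (fd η z) + gf p ε l (z, η z) := by
  obtain ⟨ι, _, a, x, h1, h2, h3, h4, h5, h6⟩ := h.rep hz
  have hx : ∀ᶠ y in 𝓝 z, ∀ i, x i + (y - z) ∈ Ω := Filter.eventually_all.2 fun i =>
    (Continuous.tendsto' fz z (x i) sz).eventually (hΩ.mem_nhds (h3 i).1)
  have hWd : ∀ i, HasFDerivAt (fun y => W (x i + (y - z))) (fd W (x i)) z := fun i => by
    have t : HasFDerivAt W (fd W (x i)) (x i + (z - z)) := by
      simpa using ((hW1.contDiffAt (hΩ.mem_nhds (h3 i).1)).differentiableAt sz).hasFDerivAt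
    simpa [Function.comp_def] using t.comp z (((hasFDerivAt_id z).sub_const z).const_add (x i))
  have hD : HasFDerivAt (fun y => η y - ∑ i, a i • W (x i + (y - z))) (fd η z - ∑ i, a i • fd W (x i)) z :=
    hd.hasFDerivAt.sub (HasFDerivAt.fun_sum fun i _ => (hWd i).const_smul (a i))
  have hmin := second_order (d := fun y => c y - ∑ i, a i * log (exp (w (x i + (y - z))))) (D := fun y => η y - ∑ i, a i • W (x i + (y - z))) (x0 := z) (by
    filter_upwards [hx, hΩ.mem_nhds hz] with y hy hyΩ
    have t : ∀ i, HasFDerivAt (fun y => a i * w (x i + (y - z))) (a i • tD E (W (x i + (y - z)))) y := fun i => by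
      have := (hW _ (hy i)).hasFDerivAt.comp y (((hasFDerivAt_id y).sub_const z).const_add (x i))
      simpa using this.const_mul (a i)
    rw [hgfd]
    simp only [log_exp]
    exact ((hg y hyΩ).hasFDerivAt.sub (HasFDerivAt.fun_sum fun i _ => t i)).congr_fderiv (by simp [map_sub, map_sum])) (by
    filter_upwards [hx, hΩ.mem_nhds hz] with y hy hyΩ
    have := h6 (y - z) (by rwa [add_sub_cancel]) hy
    rw [add_sub_cancel] at this
    simp only [log_exp, sub_self, add_zero, h5]
    linarith) hD.differentiableAt
  rw [hD.fderiv] at hmin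
  have hs : ∀ v y, ⟪fd η z v, y⟫ = ⟪fd η z y, v⟫ := fun v y => grad_symm (by filter_upwards [hΩ.mem_nhds hz] with y hy using hg y hy) hd v y
  have hm := opP_mono hp hε (X := fd η z) (Y := ∑ i, a i • fd W (x i)) hs (fun v y => by
    simp only [_root_.sum_apply, _root_.smul_apply, sum_inner, isml]
    exact Finset.sum_congr rfl fun i _ => by rw [hsym _ (h3 i).1 v y]) (fun v => by
    have := hmin.2 v
    rw [_root_.sub_apply, inner_sub_left] at this; linarith) (η z)
  rw [opP_sum] at hm
  have hgf : ∑ i, a i * gf p ε l (x i, η z) = gf p ε l (z, η z) := by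
    have e : ∀ i, a i * gf p ε l (x i, η z) = a i * (l + Rf p ε (η z) * ((p - 1) * ‖η z‖ ^ 2 - ε)) - Rf p ε (η z) * ⟪η z, a i • x i⟫ := fun i => by
      rw [inner_smul_right]; simp only [gf]; ring
    simp only [e]
    rw [Finset.sum_sub_distrib, ← Finset.sum_mul, ← Finset.mul_sum, ← inner_sum, h2, h4]; simp only [gf]; ring
  have hsum : Rf p ε (η z) * ∑ i, a i * opP p ε (η z) (fd W (x i)) + gf p ε l (z, η z) = 0 := by
    rw [← hgf, Finset.mul_sum, ← Finset.sum_add_distrib]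
    refine Finset.sum_eq_zero fun i _ => ?_
    have := heq _ (h3 i).1
    rw [h.contact hΩ hW hz (h3 i).1 (h3 i).2] at this
    linear_combination a i * this
  have := mll hm (Rf_pos (p := p) hε (η z)).le
  linarith

/-- the envelope of `u` vanishes on the boundary -/
theorem env_bd (h : IsEnv Ω (fun x => log (u x)) c η) (hΩ : IsOpen Ω) (hb : IsBounded Ω) (hcv : Convex ℝ Ω) (hu : ContinuousOn u (closure Ω)) (hpos : ∀ x ∈ Ω, 0 < u x) (hf : ∀ x ∈ frontier Ω, u x = 0) (hc : ContinuousOn c Ω) :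
    ContinuousOn (Ω.indicator (M := ℝ) fun x => exp (c x)) (closure Ω) := by
  classical
  intro b hbΩ
  by_cases hbi : b ∈ Ω
  · refine ContinuousAt.continuousWithinAt ?_
    refine (hc.continuousAt (hΩ.mem_nhds hbi)).rexp.congr ?_
    filter_upwards [hΩ.mem_nhds hbi] with y hy
    rw [indicator_of_mem hy]
  have hK := hb.closure.isCompact_closure
  rw [closure_closure] at hK
  obtain ⟨ym, hym, hmax⟩ := hK.exists_isMaxOn ⟨b, hbΩ⟩ hu
  have hB : ∀ y ∈ Ω, log (u y) ≤ log (u ym) := fun y hy => log_le_log (hpos y hy) (hmax (subset_closure hy))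
  obtain ⟨f, hfb⟩ := geometric_hahn_banach_open_point hcv hΩ hbi
  set f' := (tD E).symm f
  have hf' : ∀ y, ⟪f', y⟫ = f y := fun y => by simp [f']
  rw [ContinuousWithinAt, inm hbi, Metric.tendsto_nhds]
  intro e he
  set M := log (e / 2)
  set K := closure Ω ∩ u ⁻¹' Ici (exp M)
  have hKc : IsCompact K := hK.of_isClosed_subset (hu.preimage_isClosed_of_isClosed isClosed_closure isClosed_Ici) inter_subset_left
  have hKΩ : K ⊆ Ω := fun x hx => by
    by_contra hn
    have := hx.2
    rw [mem_preimage, hf x (by rw [hΩ.frontier_eq]; exact ⟨hx.1, hn⟩)] at this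
    exact absurd this (not_le.2 (exp_pos _))
  obtain ⟨k, hk0, hk⟩ : ∃ k : ℝ, 0 ≤ k ∧ ∀ y ∈ Ω, log (u y) ≤ M + k * (f b - f y) := by
    have hout : ∀ y ∈ Ω, y ∉ K → log (u y) ≤ M := fun y hy hn => by
      have : u y < exp M := by by_contra hc; exact hn ⟨subset_closure hy, not_lt.1 hc⟩
      exact ((log_lt_iff_lt_exp (hpos y hy)).2 this).le
    rcases K.eq_empty_or_nonempty with hKe | hKn
    · exact ⟨0, le_rfl, fun y hy => by simpa using hout y hy (by simp [hKe])⟩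
    obtain ⟨y0, hy0, hmin⟩ := hKc.exists_isMinOn hKn (f := fun y => f b - f y) fz
    have hμ : 0 < f b - f y0 := sub_pos.2 (hfb _ (hKΩ hy0))
    refine ⟨|log (u ym) - M| / (f b - f y0), pz, fun y hy => ?_⟩
    by_cases hyK : y ∈ K
    · have : |log (u ym) - M| ≤ |log (u ym) - M| / (f b - f y0) * (f b - f y) := by
        rw [div_mul_eq_mul_div, le_div_iff₀ hμ]; exact mll (hmin hyK) (abs_nonneg _)
      linarith [hB y hy, le_abs_self (log (u ym) - M)]
    · have : 0 ≤ |log (u ym) - M| / (f b - f y0) * (f b - f y) := mul_nonneg pz (sub_pos.2 (hfb y hy)).le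
      linarith [hout y hy hyK]
  have hT : Filter.Tendsto (fun y => exp (M + k * (f b - f y))) (𝓝[closure Ω] b) (𝓝 (exp M)) :=
    (Continuous.tendsto' fz b _ sz).mono_left nwn
  have hM : exp M < e := by simp only [M]; rw [exp_log pz]; linarith
  filter_upwards [hT.eventually_lt_const hM] with y hy
  rw [Real.dist_eq, sub_zero]
  by_cases hyΩ : y ∈ Ω
  · rw [indicator_of_mem hyΩ, abs_of_pos (exp_pos _)]
    refine lt_of_le_of_lt (exp_le_exp.2 (h.opt y hyΩ _ (-k • f') fun x hx => (hk x hx).trans_eq ?_)) hy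
    rw [isml, inner_sub_right, hf', hf']; simp; ring
  · rw [inm hyΩ]; simpa using he
end

section

variable {p ε l : ℝ} {Ω : Set E} {u w c : E → ℝ} {W η : E → E}

theorem fatou_le (hΩ : MeasurableSet Ω) {f : ℕ → E → ℝ} {g : E → ℝ} {M : ℝ} (hi : ∀ k, IntegrableOn (f k) Ω) (h0 : ∀ k, ∀ x ∈ Ω, 0 ≤ f k x) (ht : ∀ x ∈ Ω, Filter.Tendsto (fun k => f k x) .atTop (𝓝 (g x))) (hM : ∀ k, ∫ x in Ω, f k x ≤ M) :
    IntegrableOn g Ω ∧ ∫ x in Ω, g x ≤ M := by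
  have hg0 : 0 ≤ᵐ[volume.restrict Ω] g := by
    filter_upwards [smar hΩ] with x hx using ge_of_tendsto' (ht x hx) fun k => h0 k x hx
  have h0' : ∀ k, 0 ≤ᵐ[volume.restrict Ω] f k := fun k => by
    filter_upwards [smar hΩ] with x hx using h0 k x hx
  have hM0 : 0 ≤ M := (setIntegral_nonneg hΩ (h0 0)).trans (hM 0)
  have hme : AEStronglyMeasurable g (volume.restrict Ω) := aestronglyMeasurable_of_tendsto_ae .atTop (fun k => (hi k).1) (by
    filter_upwards [smar hΩ] with x hx using ht x hx)
  have h1 : ∫⁻ x in Ω, ENNReal.ofReal (g x) ≤ ENNReal.ofReal M := by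
    calc _ = ∫⁻ x in Ω, Filter.liminf (fun k => ENNReal.ofReal (f k x)) .atTop := lintegral_congr_ae (by
            filter_upwards [smar hΩ] with x hx
            exact ((ENNReal.continuous_ofReal.tendsto _).comp (ht x hx)).liminf_eq.symm)
      _ ≤ _ := lintegral_liminf_le' fun k => (hi k).1.aemeasurable.ennreal_ofReal
      _ ≤ _ := Filter.liminf_le_of_frequently_le' (Filter.Frequently.of_forall fun k => by
            rw [← ofReal_integral_eq_lintegral_ofReal (hi k) (h0' k)]
            exact ENNReal.ofReal_le_ofReal (hM k))
  refine ⟨⟨hme, (hasFiniteIntegral_iff_ofReal hg0).2 (h1.trans_lt ENNReal.ofReal_lt_top)⟩, ?_⟩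
  rw [integral_eq_lintegral_of_nonneg_ae hg0 hme]
  exact ENNReal.toReal_le_of_le_ofReal hM0 h1

theorem grad_c1 (hΩ : IsOpen Ω) (hg : ∀ z ∈ Ω, HasGradientAt c (η z) z) (hη : ContinuousOn η Ω) : ContDiffOn ℝ 1 c Ω := by
  rw [show (1 : WithTop ℕ∞) = 0 + 1 from rfl, cdsucc hΩ]
  refine ⟨fun z hz => (hg z hz).hasFDerivAt.differentiableAt.differentiableWithinAt, sz, contDiffOn_zero.2 (ContinuousOn.congr ((tD E).continuous.comp_continuousOn hη) fun z hz => (hg z hz).hasFDerivAt.fderiv)⟩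

theorem env_energy (hp : 1 < p) (hε : 0 < ε) (hl : 0 ≤ l) (hΩ : IsOpen Ω) (hb : IsBounded Ω) (hg : ∀ z ∈ Ω, HasGradientAt c (η z) z) (hL : ∀ z ∈ Ω, LL η z) (hc : ContinuousOn (Ω.indicator (M := ℝ) fun x => exp (c x)) (closure Ω))
    (hpde : ∀ z ∈ Ω, DifferentiableAt ℝ η z → 0 ≤ Rf p ε (η z) * opP p ε (η z) (fd η z) + gf p ε l (z, η z)) :
    IntegrableOn (fun x => gw x * (exp (p * c x) * (ε + ‖η x‖ ^ 2) ^ (p / 2))) Ω ∧ IntegrableOn (fun x => gw x * exp (p * c x)) Ω ∧ ∫ x in Ω, gw x * (exp (p * c x) * (ε + ‖η x‖ ^ 2) ^ (p / 2)) ≤ l * ∫ x in Ω, gw x * exp (p * c x) := by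
  set û := Ω.indicator (M := ℝ) fun x => exp (c x) with hû
  have hûΩ : ∀ x ∈ Ω, û x = exp (c x) := fun x hx => indicator_of_mem hx _
  have hK := hb.closure.isCompact_closure
  rw [closure_closure] at hK
  have hηc : ContinuousOn η Ω := fun x hx => by
    obtain ⟨_, t, ht, h⟩ := hL x hx
    exact (h.continuousOn.continuousAt ht).continuousWithinAt
  have hcd := grad_c1 hΩ hg hηc
  have hcc := hcd.continuousOn
  have hI : IntegrableOn (fun x => gw x * exp (p * c x)) Ω := by
    obtain ⟨B, hB⟩ := hK.exists_bound_of_continuousOn hc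
    have hme : ContinuousOn (fun x => gw x * exp (p * c x)) Ω := gw_contDiff.continuous.continuousOn.mul (continuousOn_const.mul hcc).rexp
    refine Integrable.mono' (integrableOn_const (C := exp (p * log (B + 1))) hb.measure_lt_top.ne) (hme.aestronglyMeasurable hΩ.measurableSet) ?_
    filter_upwards [smar hΩ.measurableSet] with x hx
    have h1 := hB x (subset_closure hx)
    rw [hûΩ x hx, nnn (exp_pos _).le] at h1
    rw [nnn (mul_nonneg (gw_pos x).le (exp_pos _).le)]
    have h2 : gw x ≤ 1 := exp_le_one_iff.2 (by nlinarith [sq_nonneg ‖x‖])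
    refine (mlo (exp_pos _).le h2).trans (exp_le_exp.2 (mll ?_ lz))
    rw [le_log_iff_exp_le (by linarith [exp_pos (c x)])]; linarith
  set T := Real.smoothTransition
  have hTz : ∀ s ≤ 0, T s = 0 := fun _ h => Real.smoothTransition.zero_of_nonpos h
  have hT1 : ∀ s, 1 ≤ s → T s = 1 := fun _ h => Real.smoothTransition.one_of_one_le h
  have hT0 : ∀ x, 0 ≤ T x := Real.smoothTransition.nonneg
  have hTd : ContDiff ℝ 1 T := Real.smoothTransition.contDiff (n := 1)
  have hRc : ContinuousOn (fun x => (ε + ‖η x‖ ^ 2) ^ (p / 2)) Ω := ContinuousOn.rpow_const fz fun x _ => Or.inr lz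
  have key : ∀ k : ℕ, IntegrableOn (fun x => gw x * (exp (p * c x) * (ε + ‖η x‖ ^ 2) ^ (p / 2)) * T (c x + k)) Ω ∧
      ∫ x in Ω, gw x * (exp (p * c x) * (ε + ‖η x‖ ^ 2) ^ (p / 2)) * T (c x + k) ≤ l * ∫ x in Ω, gw x * exp (p * c x) := fun k => by
    set φ : E → ℝ := Ω.indicator (M := ℝ) fun x => exp (-‖x‖ ^ 2 / 2 + p * c x) * T (c x + k) with hφ
    have hφΩ : ∀ x ∈ Ω, φ x = exp (-‖x‖ ^ 2 / 2 + p * c x) * T (c x + k) := fun x hx => indicator_of_mem hx _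
    set K := closure Ω ∩ û ⁻¹' Ici (exp (-k))
    have hKc : IsCompact K := hK.of_isClosed_subset (hc.preimage_isClosed_of_isClosed isClosed_closure isClosed_Ici) inter_subset_left
    have hKΩ : K ⊆ Ω := fun x hx => by
      by_contra hn
      have := hx.2
      rw [mem_preimage, hû, inm hn] at this
      exact absurd this (not_le.2 (exp_pos _))
    have hφ0 : ∀ x ∉ K, φ x = 0 := fun x hx => by
      by_cases hxΩ : x ∈ Ω
      · rw [hφΩ x hxΩ, hTz, mul_zero]
        by_contra hcon
        exact hx ⟨subset_closure hxΩ, by rw [mem_preimage, hûΩ x hxΩ, mem_Ici, exp_le_exp]; linarith⟩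
      · exact inm hxΩ _
    have hts : tsupport φ ⊆ K := closure_minimal (fun x hx => by by_contra h; exact hx (hφ0 x h)) hKc.isClosed
    have hφc : HasCompactSupport φ := hKc.of_isClosed_subset (isClosed_tsupport φ) hts
    have hφe : ∀ x ∈ Ω, φ =ᶠ[𝓝 x] fun x => exp (-‖x‖ ^ 2 / 2 + p * c x) * T (c x + k) := fun x hx => by
      filter_upwards [hΩ.mem_nhds hx] with y hy using hφΩ y hy
    have hφd : ContDiff ℝ 1 φ := contDiff_iff_contDiffAt.2 fun x => by
      by_cases hx : x ∈ tsupport φ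
      · have hcx := hcd.contDiffAt (hΩ.mem_nhds (hKΩ (hts hx)))
        refine ContDiffAt.congr_of_eventuallyEq ?_ (hφe x (hKΩ (hts hx)))
        exact (((contDiff_norm_sq ℝ).contDiffAt.neg.div_const 2).add (contDiffAt_const.mul hcx)).exp.mul (hTd.contDiffAt.comp x (hcx.add contDiffAt_const))
      · exact contDiffAt_const.congr_of_eventuallyEq (nmt.1 hx)
    have hLV : ∀ x ∈ Ω, LL (fun x => Rf p ε (η x) • η x) x := fun x hx => LL.comp (g := fun η : E => Rf p ε η • η) (((Rf_contDiff hε 1).smul contDiff_id).contDiffAt) (hL x hx)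
    obtain ⟨i1, i2, h3⟩ := ibp_lip hΩ hLV hφd hφc (hts.trans hKΩ)
    have iP : ∀ f : E → ℝ, ContinuousOn f Ω → Integrable fun x => φ x * f x := fun f hf => by
      refine Continuous.ics (continuous_of_tsupport fun x hx => ?_) hφc.mul_right
      have hx' : x ∈ Ω := hKΩ (hts (tsupport_mul_subset_left hx))
      exact hφd.continuous.continuousAt.mul (hf.continuousAt (hΩ.mem_nhds hx'))
    have iR := iP _ hRc
    have iφ : Integrable φ := hφd.continuous.ics hφc
    have h4 : ∀ᵐ x, φ x * (ε + ‖η x‖ ^ 2) ^ (p / 2) - l * φ x ≤ fd φ x (Rf p ε (η x) • η x) + tr (fd (fun x => Rf p ε (η x) • η x) x) * φ x := by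
      filter_upwards [LL_ae hL] with x hd
      by_cases hx : x ∈ Ω
      · have hd := hd hx
        have e1 : fd (fun x => Rf p ε (η x) • η x) x = (fd (fun η : E => Rf p ε η • η) (η x)).comp (fd η x) :=
          fderiv_comp x (g := fun η : E => Rf p ε η • η) (((Rf_contDiff hε 1).smul contDiff_id).differentiable sz _) hd
        rw [e1, tr_V hε _ (grad_symm (by filter_upwards [hΩ.mem_nhds hx] with y hy using hg y hy) hd)]
        have e2 : HasFDerivAt (fun x => exp (-‖x‖ ^ 2 / 2 + p * c x) * T (c x + k)) _ x :=
          ((((hasStrictFDerivAt_norm_sq x).hasFDerivAt.neg.mul_const (1 / 2)).add ((hg x hx).hasFDerivAt.const_mul p)).exp.mul (((hTd.differentiable sz (c x + k)).hasDerivAt).comp_hasFDerivAt x ((hg x hx).hasFDerivAt.add_const (k : ℝ)))).congr_of_eventuallyEq (eof fun y => by simp; left; ring)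
        rw [(hφe x hx).fderiv_eq, e2.fderiv]
        have e3 := mll (hpde x hx hd) (mul_nonneg (exp_pos (-‖x‖ ^ 2 / 2 + p * c x)).le (hT0 (c x + k)))
        have e4 : 0 ≤ exp (-‖x‖ ^ 2 / 2 + p * c x) * deriv T (c x + k) * (Rf p ε (η x) * ‖η x‖ ^ 2) := mul_nonneg (mul_nonneg (exp_pos _).le Real.smoothTransition.monotone.deriv_nonneg) (mul_nonneg (Rf_pos hε _).le (sq_nonneg _))
        have e5 : (ε + ‖η x‖ ^ 2) ^ (p / 2) = Rf p ε (η x) * (ε + ‖η x‖ ^ 2) := by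
          rw [Rf, ← rpow_add_one pz]; congr 1; ring
        rw [hφΩ x hx, e5]
        simp only [gf] at e3
        simp [inner_smul_right, riq]
        rw [show -(‖x‖ ^ 2 * 2⁻¹) = -‖x‖ ^ 2 / 2 by ring, real_inner_comm]
        linarith
      · have e1 : φ =ᶠ[𝓝 x] 0 := nmt.1 fun h => hx (hKΩ (hts h))
        rw [e1.fderiv_eq, e1.self_of_nhds]; simp
    have h5 := integral_mono_ae (iR.sub (iφ.const_mul l)) (i2.add i1) h4
    simp only [Pi.sub_apply, Pi.add_apply] at h5
    rw [integral_add i2 i1, integral_sub iR (iφ.const_mul l), h3, icm] at h5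
    simp only [neg_mul, integral_neg, neg_add_cancel] at h5
    have e6 : ∀ x ∈ Ω, gw x * (exp (p * c x) * (ε + ‖η x‖ ^ 2) ^ (p / 2)) * T (c x + k) = φ x * (ε + ‖η x‖ ^ 2) ^ (p / 2) := fun x hx => by
      rw [hφΩ x hx, exp_add, gw]; ring
    refine ⟨(iR.integrableOn (s := Ω)).congr_fun (fun x hx => (e6 x hx).symm) hΩ.measurableSet, ?_⟩
    rw [scf hΩ.measurableSet e6, sie fun x hx => by rw [hφ, inm hx, zero_mul]]
    refine (sub_nonpos.1 h5).trans (mll ?_ hl)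
    rw [← sie (s := Ω) fun x hx => by rw [hφ, inm hx]]
    refine smo iφ.integrableOn hI hΩ.measurableSet fun x hx => ?_
    rw [hφΩ x hx, exp_add]
    exact mul_le_of_le_one_right pz (Real.smoothTransition.le_one _)
  obtain ⟨h1, h2⟩ := fatou_le hΩ.measurableSet (g := fun x => gw x * (exp (p * c x) * (ε + ‖η x‖ ^ 2) ^ (p / 2))) (fun k => (key k).1) (fun k x _ => mul_nonneg (mul_nonneg (gw_pos x).le pz) (hT0 _)) (fun x _ => by
    refine tendsto_const_nhds.congr' ?_
    obtain ⟨N, hN⟩ := exists_nat_gt (1 - c x)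
    filter_upwards [Filter.eventually_ge_atTop N] with k hk
    have : (N : ℝ) ≤ k := by exact_mod_cast hk
    rw [hT1 _ lz, mul_one]) fun k => (key k).2
  exact ⟨h1, hI, h2⟩
end

section

variable {p ε l : ℝ} {Ω : Set E} {u w c : E → ℝ} {W η : E → E}

theorem phi_tangent (hp : 1 < p) (hε : 0 < ε) {a m : E} (h : a ≠ m) : (ε + ‖m‖ ^ 2) ^ (p / 2) + p * Rf p ε m * ⟪m, a - m⟫ < (ε + ‖a‖ ^ 2) ^ (p / 2) := by
  set s := ε + ‖a‖ ^ 2 with hs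
  set M := ε + ‖m‖ ^ 2 with hM
  have hs0 : 0 < s := pz
  have hM0 : 0 < M := pz
  have h1 : ε + ⟪m, a⟫ < √s * √M := by
    rw [← sqrt_mul hs0.le]
    refine lt_sqrt_of_sq_lt ?_
    have h2 := ail m a
    have h3 : 0 < ‖a - m‖ ^ 2 := by have := norm_pos_iff.2 (sub_ne_zero.2 h); positivity
    rw [norm_sub_sq_real, real_inner_comm] at h3
    have h4 := sq_le_sq' (neg_le_of_abs_le h2) (le_of_abs_le h2)
    nlinarith
  have h5 := one_add_mul_self_le_rpow_one_add (s := √s / √M - 1) (by have : 0 ≤ √s / √M := pz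
                                                                     linarith) hp.le
  have e1 : (1 + (√s / √M - 1)) ^ p = s ^ (p / 2) / M ^ (p / 2) := by
    rw [add_sub_cancel, div_rpow (sqrt_nonneg _) (sqrt_nonneg _), sqrt_eq_rpow, sqrt_eq_rpow, ← rpow_mul hs0.le, ← rpow_mul hM0.le]; congr 2 <;> ring
  have e2 : M ^ (p / 2) = Rf p ε m * M := by rw [Rf, ← hM, ← rpow_add_one hM0.ne']; congr 1; ring
  have hR := Rf_pos (p := p) hε m
  rw [e1, le_div_iff₀ pz, e2] at h5
  rw [e2]
  refine lt_of_lt_of_le ?_ h5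
  have e3 : √s / √M * M = √s * √M := by rw [div_mul_eq_mul_div, div_eq_iff pz, mul_assoc, mul_self_sqrt hM0.le]
  have e4 : ⟪m, a - m⟫ = ε + ⟪m, a⟫ - M := by rw [inner_sub_right, riq]; ring
  have e5 := mul_lt_mul_of_pos_left h1 (show 0 < p * Rf p ε m by positivity)
  rw [e4]
  nlinarith

theorem phi_strict (hp : 1 < p) (hε : 0 < ε) {a b : E} {A B : ℝ} (hA : 0 < A) (hB : 0 < B) :
    let m := (A / (A + B)) • a + (B / (A + B)) • b
    (A + B) * (ε + ‖m‖ ^ 2) ^ (p / 2) ≤ A * (ε + ‖a‖ ^ 2) ^ (p / 2) + B * (ε + ‖b‖ ^ 2) ^ (p / 2) ∧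
    ((A + B) * (ε + ‖m‖ ^ 2) ^ (p / 2) = A * (ε + ‖a‖ ^ 2) ^ (p / 2) + B * (ε + ‖b‖ ^ 2) ^ (p / 2) → a = b) := by
  intro m
  have h1 : ∀ y : E, (ε + ‖m‖ ^ 2) ^ (p / 2) + p * Rf p ε m * ⟪m, y - m⟫ ≤ (ε + ‖y‖ ^ 2) ^ (p / 2) := fun y => by
    by_cases h : y = m
    · simp [h]
    · exact (phi_tangent hp hε h).le
  have h2 : A * ⟪m, a - m⟫ + B * ⟪m, b - m⟫ = 0 := by
    rw [← real_inner_smul_right, ← real_inner_smul_right, ← inner_add_right]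
    have : A • (a - m) + B • (b - m) = 0 := by
      have h : (A + B) • m = A • a + B • b := by
        simp only [m, smul_add, smul_smul]; rw [mul_div_cancel₀ _ pz, mul_div_cancel₀ _ pz]
      rw [smul_sub, smul_sub, ← add_sub_add_comm, ← h, add_smul, sub_self]
    rw [this, inner_zero_right]
  have h3 := mll (h1 a) hA.le
  have h4 := mll (h1 b) hB.le
  have h5 : A * (p * Rf p ε m * ⟪m, a - m⟫) + B * (p * Rf p ε m * ⟪m, b - m⟫) = 0 := by linear_combination (p * Rf p ε m) * h2
  refine ⟨by linarith, fun h => ?_⟩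
  by_contra hab
  have ham : a = m := by
    by_contra hn
    have := mul_lt_mul_of_pos_left (phi_tangent hp hε hn) hA
    linarith
  have hbm : b = m := by
    by_contra hn
    have := mul_lt_mul_of_pos_left (phi_tangent hp hε hn) hB
    linarith
  exact hab (ham.trans hbm.symm)

theorem mix_grad (hp : 1 < p) {x : E} {y z : E} (hw : HasGradientAt w y x) (hc : HasGradientAt c z x) :
    HasGradientAt (fun x => 1 / p * log ((exp (p * w x) + exp (p * c x)) / 2)) ((exp (p * w x) / (exp (p * w x) + exp (p * c x))) • y + (exp (p * c x) / (exp (p * w x) + exp (p * c x))) • z) x := by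
  rw [hgfd] at *
  have h := ((((hw.const_mul p).exp.add (hc.const_mul p).exp).mul_const (1 / 2)).log (by simp only [Pi.add_apply]; positivity)).const_mul (1 / p)
  refine (h.congr_fderiv ?_).congr_of_eventuallyEq (eof fun x => by simp [div_eq_mul_inv])
  have h1 := exp_pos (p * w x)
  have h2 := exp_pos (p * c x)
  ext v
  simp
  field_simp

theorem concave (hp : 1 < p) (hε : 0 < ε) (hl : 0 ≤ l) (hΩ : IsOpen Ω) (hb : IsBounded Ω) (hcv : Convex ℝ Ω) (HL : ∀ v, ContDiff ℝ (⊤ : ℕ∞) v → HasCompactSupport v → tsupport v ⊆ Ω → Ray p ε l Ω v)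
    (hu : ContinuousOn u (closure Ω)) (hu1 : ContDiffOn ℝ 1 u Ω) (h0 : ∀ x ∈ Ω, 0 ≤ u x) (hf : ∀ x ∈ frontier Ω, u x = 0) (hne : ∃ x ∈ Ω, 0 < u x)
    (hi : IntegrableOn (fun x => gw x * jf p ε u x) Ω) (heq : ∫ x in Ω, gw x * jf p ε u x = l * ∫ x in Ω, gw x * |u x| ^ p) :
    ∀ y ∈ Ω, ∀ z ∈ Ω, log (u y) ≤ log (u z) + ⟪Wl u z, y - z⟫ := by
  obtain ⟨hpos, hW, hWd, hsym, hpde⟩ := main1 hp hε hl hΩ hb hcv HL hu hu1 h0 hf hne hi heq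
  obtain ⟨c, η, hE⟩ := env_ex hΩ hb hu hpos hf
  have hW1 : ContDiffOn ℝ 1 (Wl u) Ω := by exact_mod_cast hWd 1
  obtain ⟨hg, hLη⟩ := env_loc hE fun z0 hz0 => env_semi hE hΩ hb hu hpos hf hW hW1 hz0
  have hLL : ∀ z ∈ Ω, LL η z := fun z hz => by
    obtain ⟨r, hr, K, h⟩ := hLη z hz
    exact ⟨K, _, ball_mem_nhds z hr, h⟩
  have hηc : ContinuousOn η Ω := fun x hx => by
    obtain ⟨_, t, ht, h⟩ := hLL x hx
    exact (h.continuousOn.continuousAt ht).continuousWithinAt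
  have hcd := grad_c1 hΩ hg hηc
  have hwd := grad_c1 hΩ hW hW1.continuousOn
  have hcc := hcd.continuousOn
  have hc := env_bd hE hΩ hb hcv hu hpos hf hcc
  obtain ⟨i1, i2, h3⟩ := env_energy hp hε hl hΩ hb hg hLL hc fun z hz hd => env_pde hp hε hΩ hE hg hW hW1 hsym hpde hz hd
  set û := Ω.indicator (M := ℝ) fun x => exp (c x) with hû
  have hûΩ : ∀ x ∈ Ω, û x = exp (c x) := fun x hx => indicator_of_mem hx _
  have hp0 : 0 < p := lz
  set v : E → ℝ := fun x => ((u x ^ p + û x ^ p) / 2) ^ (1 / p) with hv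
  set A : E → ℝ := fun x => exp (p * log (u x)) with hA
  set B : E → ℝ := fun x => exp (p * c x) with hB
  have hA0 : ∀ x, 0 < A x := fun x => exp_pos _
  have hB0 : ∀ x, 0 < B x := fun x => exp_pos _
  have huA : ∀ x ∈ Ω, u x ^ p = A x := fun x hx => by rw [rpow_def_of_pos (hpos x hx), mul_comm]
  have huB : ∀ x ∈ Ω, û x ^ p = B x := fun x hx => by rw [hûΩ x hx, ← exp_mul, mul_comm]
  have hvΩ : ∀ x ∈ Ω, v x = exp (1 / p * log ((A x + B x) / 2)) := fun x hx => by
    simp only [hv]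
    rw [huA x hx, huB x hx, rpow_def_of_pos (by linarith [hA0 x, hB0 x]), mul_comm]
  have hvp : ∀ x ∈ Ω, v x ^ p = (A x + B x) / 2 := fun x hx => by
    simp only [hv]
    rw [huA x hx, huB x hx, ← rpow_mul (by linarith [hA0 x, hB0 x]), one_div_mul_cancel hp0.ne', rpow_one]
  have hv0 : ∀ x ∈ Ω, 0 < v x := fun x hx => by rw [hvΩ x hx]; exact exp_pos _
  set m : E → E := fun x => (A x / (A x + B x)) • Wl u x + (B x / (A x + B x)) • η x with hm
  have hvF : ∀ x ∈ Ω, HasFDerivAt v (v x • tD E (m x)) x := fun x hx => by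
    rw [hvΩ x hx]
    exact (mix_grad hp (hW x hx) (hg x hx)).hasFDerivAt.exp.congr_of_eventuallyEq (by filter_upwards [hΩ.mem_nhds hx] with y hy using hvΩ y hy)
  have hvc : ContinuousOn v (closure Ω) := (((hu.rpow_const fun x _ => Or.inr hp0.le).add (hc.rpow_const fun x _ => Or.inr hp0.le)).div_const 2).rpow_const fun x _ => Or.inr pz
  have hwc := hwd.continuousOn
  have hAd : ContDiffOn ℝ 1 A Ω := (contDiffOn_const.mul hwd).exp
  have hBd : ContDiffOn ℝ 1 B Ω := (contDiffOn_const.mul hcd).exp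
  have hv1 : ContDiffOn ℝ 1 v Ω := ContDiffOn.congr (f := fun x => exp (1 / p * log ((A x + B x) / 2))) ((contDiffOn_const.mul (((hAd.add hBd).div_const 2).log fun x _ => by
    have := hA0 x; have := hB0 x; positivity)).exp) hvΩ
  have hvf : ∀ x ∈ frontier Ω, v x = 0 := fun x hx => by
    have h1 : x ∉ Ω := fun h => by rw [hΩ.frontier_eq] at hx; exact hx.2 h
    simp only [hv]
    rw [hf x hx, hû, inm h1, zero_rpow hp0.ne', add_zero, zero_div, zero_rpow pz]
  have hjv : ∀ x ∈ Ω, gw x * jf p ε v x = gw x * ((A x + B x) / 2 * (ε + ‖m x‖ ^ 2) ^ (p / 2)) := fun x hx => by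
    rw [jf_eq hε (hv0 x hx) (hvF x hx), hvp x hx]
  have hju : ∀ x ∈ Ω, gw x * jf p ε u x = gw x * (A x * (ε + ‖Wl u x‖ ^ 2) ^ (p / 2)) := fun x hx => by
    rw [jf_eq hε (hpos x hx) (hasF_Wl (hpos x hx) (hu1.differentiableOn sz |>.differentiableAt (hΩ.mem_nhds hx))), huA x hx]
  set G : E → ℝ := fun x => (gw x * jf p ε u x + gw x * (B x * (ε + ‖η x‖ ^ 2) ^ (p / 2))) / 2 with hG
  have iG : IntegrableOn G Ω := (hi.add i1).div_const 2
  have hGv : ∀ x ∈ Ω, gw x * jf p ε v x ≤ G x := fun x hx => by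
    have h1 := (phi_strict (p := p) hp hε (a := Wl u x) (b := η x) (hA0 x) (hB0 x)).1
    have h2 := mll h1 (gw_pos x).le
    simp only [hG]
    rw [hjv x hx, hju x hx]
    simp only [hm]
    linarith
  have cv := jf_contOn (ε := ε) hp hΩ hv1
  have iv : IntegrableOn (fun x => gw x * jf p ε v x) Ω := iG.mono' (cv.aestronglyMeasurable hΩ.measurableSet) (by
    filter_upwards [smar hΩ.measurableSet] with x hx
    rw [nnn (mul_nonneg (gw_pos x).le (jf_nonneg hε _ _))]
    exact hGv x hx)
  have hR : l * ∫ x in Ω, gw x * |v x| ^ p ≤ ∫ x in Ω, gw x * jf p ε v x := lemA hp hε hΩ hb HL hvc hv1 (fun x hx => (hv0 x hx).le) hvf iv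
  have iu := pw_int hp hε hΩ hu1.continuousOn hi
  have e1 : ∫ x in Ω, gw x * |v x| ^ p = ((∫ x in Ω, gw x * |u x| ^ p) + ∫ x in Ω, gw x * B x) / 2 := by
    rw [← integral_add iu i2, ← integral_div]
    refine scf hΩ.measurableSet fun x hx => ?_
    rw [abs_of_pos (hv0 x hx), hvp x hx, abs_of_pos (hpos x hx), huA x hx]; ring
  have e2 : ∫ x in Ω, G x = ((∫ x in Ω, gw x * jf p ε u x) + ∫ x in Ω, gw x * (B x * (ε + ‖η x‖ ^ 2) ^ (p / 2))) / 2 := by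
    rw [← integral_add hi i1, ← integral_div]
  have e3 : ∫ x in Ω, (G x - gw x * jf p ε v x) ≤ 0 := by
    rw [integral_sub iG iv, e2]; rw [e1] at hR; linarith
  have e4 : ∀ᵐ x ∂volume.restrict Ω, G x - gw x * jf p ε v x = 0 := by
    have h1 : 0 ≤ᵐ[volume.restrict Ω] fun x => G x - gw x * jf p ε v x := by
      filter_upwards [smar hΩ.measurableSet] with x hx using sub_nonneg.2 (hGv x hx)
    exact (integral_eq_zero_iff_of_nonneg_ae h1 (iG.sub iv)).1 (le_antisymm e3 (integral_nonneg_of_ae h1))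
  have cG : ContinuousOn G Ω := ((jf_contOn (ε := ε) hp hΩ hu1).add (gw_contDiff.continuous.continuousOn.mul (hBd.continuousOn.mul (ContinuousOn.rpow_const fz fun x _ => Or.inr lz)))).div_const 2
  have e5 : EqOn (fun x => G x - gw x * jf p ε v x) (fun _ => 0) Ω := Measure.eqOn_open_of_ae_eq e4 hΩ (cG.sub cv) continuousOn_const
  have hWη : ∀ x ∈ Ω, Wl u x = η x := fun x hx => by
    refine (phi_strict (p := p) hp hε (hA0 x) (hB0 x)).2 ?_
    have h1 := e5 hx
    simp only [hG] at h1
    rw [hjv x hx, hju x hx] at h1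
    have := (gw_pos x).ne'
    refine mul_left_cancel₀ this ?_
    simp only [hm] at h1
    linarith
  intro y hy z hz
  have hconst : ∀ x ∈ Ω, log (u x) - c x = log (u z) - c z := fun x hx => by
    refine hΩ.is_const_of_fderiv_eq_zero (𝕜 := ℝ) hcv.isPreconnected (f := fun x => log (u x) - c x) (fun x hx => ((hW x hx).hasFDerivAt.sub (hg x hx).hasFDerivAt).differentiableAt.differentiableWithinAt) (fun x hx => ?_) hx hz
    have := (hW x hx).hasFDerivAt.sub (hg x hx).hasFDerivAt
    rw [hWη x hx, sub_self] at this
    exact this.fderiv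
  obtain ⟨x, hx, he⟩ := convexHull_nonempty_iff.1 ⟨z, hE.hull z hz⟩
  have h1 := hE.supp hx hz
  have h2 := hE.le hx
  have h3 := hconst x hx
  have h4 := hE.maj z hz y hy
  rw [hWη z hz]
  linarith
end

section

variable {p ε l : ℝ} {Ω : Set E} {u w : E → ℝ} {W : E → E}

theorem grad_bd {a C s : ℝ} (ha : 0 < a) (hs : 0 < s) : ∃ G, 0 ≤ G ∧ ∀ (W : E → E) (x : E), ContDiffOn ℝ 1 W (ball x s) → (∀ y ∈ ball x s, ⟪W y - W x, y - x⟫ ≤ 0) →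
    (∀ y ∈ ball x s, a * ‖W y‖ ^ 2 - C ≤ -tr (fd W y)) → ‖W x‖ ≤ G := by
  obtain ⟨ζ, hζd, hζc, hζ0, hζz, hζ1⟩ : ∃ ζ : E → ℝ, ContDiff ℝ 1 ζ ∧ HasCompactSupport ζ ∧ (∀ y, 0 ≤ ζ y) ∧ (∀ y, s * (3 / 4) ≤ ‖y‖ → ζ y = 0) ∧ ∀ y, ‖y‖ ≤ s / 2 → ζ y = 1 := by
    let ζ : ContDiffBump (0 : E) := ⟨s / 2, s * (3 / 4), pz, lz⟩
    exact ⟨ζ, ζ.contDiff, ζ.hasCompactSupport, fun y => ζ.nonneg, fun y hy => ζ.zero_of_le_dist (by rwa [dist_zero_right]), fun y hy => ζ.one_of_mem_closedBall (by rwa [mem_closedBall, dist_zero_right])⟩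
  set N := volume.real (ball (0 : E) (s / 16)) with hN
  have hN0 : 0 < N := ENNReal.toReal_pos (measure_ball_pos _ _ pz).ne' measure_ball_lt_top.ne
  set H : E → ℝ := fun y => C * ζ y ^ 2 + 2 / a * ‖fd ζ y‖ ^ 2 with hH
  set M := ∫ y, H y with hM
  refine ⟨√(2 / a * M / N) * 2, pz, fun W x hW hm ht => ?_⟩
  have iH : Integrable H := by
    have c0 := hζd.continuous
    have c1 : HasCompactSupport fun y => ζ y ^ 2 := by
      simp only [pow_two]; exact hζc.mul_right
    have h1 : Integrable fun y => ζ y ^ 2 := Continuous.ics fz c1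
    have c2 := hζd.continuous_fderiv sz
    have c3 : HasCompactSupport fun y => ‖fd ζ y‖ ^ 2 := by
      simp only [pow_two]; exact (hζc.fderiv (𝕜 := ℝ)).norm.mul_right
    have h2 : Integrable fun y => ‖fd ζ y‖ ^ 2 := Continuous.ics fz c3
    exact (h1.const_mul C).add (h2.const_mul _)
  set z : E → ℝ := fun y => ζ (y - x) with hz
  have hzd : ContDiff ℝ 1 z := hζd.comp (contDiff_id.sub contDiff_const)
  set φ : E → ℝ := fun y => z y ^ 2 with hφ
  have hφd : ContDiff ℝ 1 φ := hzd.pow 2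
  have hts : tsupport φ ⊆ closedBall x (s * (3 / 4)) := closure_minimal (fun y hy => by
    by_contra h
    refine hy ?_
    have h1 : ζ (y - x) = 0 := hζz _ (by rw [← den]; rw [mem_closedBall, not_le] at h; exact h.le)
    simp [hφ, hz, h1]) isClosed_closedBall
  have htb : tsupport φ ⊆ ball x s := hts.trans (cbsb lz)
  have hφc : HasCompactSupport φ := (icb _ _).of_isClosed_subset (isClosed_tsupport _) hts
  obtain ⟨j1, j2, h3⟩ := ibp_lip isOpen_ball (fun _ hx => (hW.contDiffAt (isOpen_ball.mem_nhds hx)).exists_lipschitzOnWith) hφd hφc htb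
  have iW : Integrable fun y => φ y * ‖W y‖ ^ 2 := by
    refine Continuous.ics (continuous_of_tsupport fun y hy => ?_) hφc.mul_right
    have hy' := htb (tsupport_mul_subset_left hy)
    exact hφd.continuous.continuousAt.mul ((hW.continuousOn.continuousAt (isOpen_ball.mem_nhds hy')).norm.pow 2)
  have h4 : ∀ y, a / 2 * (φ y * ‖W y‖ ^ 2) ≤ H (y - x) + (-tr (fd W y) * φ y - fd φ y (W y)) := fun y => by
    have e1 : fd φ y (W y) = 2 * z y * fd ζ (y - x) (W y) := by
      have h1 : HasFDerivAt z (fd ζ (y - x)) y := by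
        simpa [Function.comp_def] using (hζd.differentiable sz (y - x)).hasFDerivAt.comp y ((hasFDerivAt_id y).sub_const x)
      have h2 : HasFDerivAt φ _ y := h1.pow 2
      rw [h2.fderiv]; simp
    have e2 := (fd ζ (y - x)).le_opNorm (W y)
    have e3 : a * ‖W y‖ ^ 2 * φ y - C * φ y ≤ -tr (fd W y) * φ y := by
      by_cases hy : y ∈ ball x s
      · have := mlr (ht y hy) (sq_nonneg (z y)); simp only [hφ]; linarith
      · have : φ y = 0 := by by_contra h; exact hy (htb (subset_tsupport _ h))
        simp [this]
    have e4 : 2 * z y * fd ζ (y - x) (W y) ≤ a / 2 * (φ y * ‖W y‖ ^ 2) + 2 / a * ‖fd ζ (y - x)‖ ^ 2 := by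
      have hz0 : 0 ≤ z y := hζ0 _
      have := mll ((le_abs_self _).trans e2) (show 0 ≤ 2 * z y by positivity)
      have e5 : a / 2 * (φ y * ‖W y‖ ^ 2) + 2 / a * ‖fd ζ (y - x)‖ ^ 2 - 2 * z y * (‖fd ζ (y - x)‖ * ‖W y‖) = a / 2 * (z y * ‖W y‖ - 2 / a * ‖fd ζ (y - x)‖) ^ 2 := by
        simp only [hφ]; field_simp; ring
      have : 0 ≤ a / 2 * (z y * ‖W y‖ - 2 / a * ‖fd ζ (y - x)‖) ^ 2 := pz
      linarith
    rw [e1]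
    have e6 : H (y - x) = C * φ y + 2 / a * ‖fd ζ (y - x)‖ ^ 2 := rfl
    linarith
  have iHx : Integrable fun y => H (y - x) := iH.comp_sub_right x
  have j1' : Integrable fun y => -tr (fd W y) * φ y := j1.neg.congr (eof fun y => sz)
  have jj : Integrable fun y => -tr (fd W y) * φ y - fd φ y (W y) := j1'.sub j2
  have h5 := integral_mono (iW.const_mul (a / 2)) (iHx.add jj) h4
  simp only [Pi.add_apply, Pi.sub_apply] at h5
  rw [icm, integral_add iHx jj, integral_sub j1' j2, h3, sub_self, add_zero, integral_sub_right_eq_self H x] at h5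
  set n := ‖W x‖ with hn
  rcases eq_or_ne n 0 with h0 | h0
  · rw [h0]; positivity
  have hn0 : 0 < n := lt_of_le_of_ne nnz h0.symm
  set x' := x - (s / (4 * n)) • W x with hx'
  have hd : ‖(s / (4 * n)) • W x‖ = s / 4 := by rw [norm_smul, nnn pz, ← hn]; field_simp
  have h6 : ∀ y ∈ ball x' (s / 16), (1 / 4) * n ^ 2 ≤ φ y * ‖W y‖ ^ 2 := fun y hy => by
    rw [mem_ball, den] at hy
    set e := y - x' with he
    have hyx : y - x = e - (s / (4 * n)) • W x := by rw [he, hx']; abel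
    have h7 : ‖y - x‖ ≤ 5 * s / 16 := by rw [hyx]; exact (norm_sub_le _ _).trans (by rw [hd]; linarith)
    have hyb : y ∈ ball x s := by rw [mem_ball, den]; linarith
    have h8 : φ y = 1 := by
      have : ζ (y - x) = 1 := hζ1 _ lz
      simp [hφ, hz, this]
    have h9 := hm y hyb
    have h10 : ⟪W x, y - x⟫ ≤ -(3 * s / 16) * n := by
      rw [hyx, inner_sub_right, real_inner_smul_right, riq, ← hn]
      have := (real_inner_le_norm (W x) e).trans (mll hy.le hn0.le)
      have h11 : s / (4 * n) * n ^ 2 = s / 4 * n := by field_simp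
      rw [h11]; linarith
    rw [inner_sub_left] at h9
    have h12 := neg_le_of_abs_le (ail (W y) (y - x))
    have h13 := mll h7 (norm_nonneg (W y))
    have h14 : s * (3 * n) ≤ s * (5 * ‖W y‖) := lz
    have h15 := le_of_mul_le_mul_left h14 hs
    rw [h8, one_mul]
    nlinarith
  have h16 : (1 / 4) * n ^ 2 * N ≤ ∫ y, φ y * ‖W y‖ ^ 2 := by
    calc _ = ∫ y in ball x' (s / 16), (1 / 4) * n ^ 2 := by
            rw [setIntegral_const, smul_eq_mul, mul_comm, hN, Measure.real, Measure.real, Measure.addHaar_ball_center _ x']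
      _ ≤ ∫ y in ball x' (s / 16), φ y * ‖W y‖ ^ 2 := smo (integrableOn_const measure_ball_lt_top.ne) iW.integrableOn mb_ h6
      _ ≤ _ := setIntegral_le_integral iW (eof fun y => pz)
  have h17 : (n / 2) ^ 2 ≤ 2 / a * M / N := by
    rw [le_div_iff₀ hN0, div_mul_eq_mul_div, le_div_iff₀ ha]
    nlinarith
  linarith [le_sqrt_of_sq_le h17]

structure Nice (p ε l : ℝ) (Ω : Set E) (w : E → ℝ) (W : E → E) : Prop where
  hΩ : IsOpen Ω
  hg : ∀ x ∈ Ω, HasGradientAt w (W x) x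
  hd : ContDiffOn ℝ 1 W Ω
  hc : ∀ y ∈ Ω, ∀ z ∈ Ω, w y ≤ w z + ⟪W z, y - z⟫
  pde : ∀ x ∈ Ω, Rf p ε (W x) * opP p ε (W x) (fd W x) + gf p ε l (x, W x) = 0

theorem Nice.psd (h : Nice p ε l Ω w W) {x : E} (hx : x ∈ Ω) : (∀ v y, ⟪(-fd W x) v, y⟫ = ⟪(-fd W x) y, v⟫) ∧ ∀ v, 0 ≤ ⟪(-fd W x) v, v⟫ := by
  have hd := (h.hd.contDiffAt (h.hΩ.mem_nhds hx)).differentiableAt sz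
  have hn := h.hΩ.mem_nhds hx
  refine ⟨fun v y => ?_, ?_⟩
  · simp only [_root_.neg_apply, inner_neg_left]
    rw [grad_symm (by filter_upwards [hn] with y hy using h.hg y hy) hd]
  · have := (second_order (d := fun y => ⟪W x, y⟫ - w y) (D := fun y => W x - W y) (x0 := x) (by
      filter_upwards [hn] with y hy
      rw [hgfd, map_sub]
      exact (tD E (W x)).hasFDerivAt.sub (h.hg y hy).hasFDerivAt) (by
      filter_upwards [hn] with y hy
      have := h.hc y hy x hx
      rw [inner_sub_right] at this; linarith) (hd.const_sub _)).2
    simpa [fderiv_const_sub] using this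

theorem Nice.mono (h : Nice p ε l Ω w W) {x y : E} (hx : x ∈ Ω) (hy : y ∈ Ω) : ⟪W y - W x, y - x⟫ ≤ 0 := by
  have h1 := h.hc y hy x hx
  have h2 := h.hc x hx y hy
  rw [← neg_sub y x, inner_neg_right] at h2
  rw [inner_sub_left]; linarith

theorem Nice.opP (h : Nice p ε l Ω w W) (hε : 0 < ε) {x : E} (hx : x ∈ Ω) : opP p ε (W x) (-fd W x) = l / Rf p ε (W x) + ((p - 1) * ‖W x‖ ^ 2 - ε - ⟪W x, x⟫) := by
  have h1 := h.pde x hx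
  have hR := Rf_pos (p := p) hε (W x)
  rw [← zero_sub, opP_sub, show _root_.opP p ε (W x) 0 = 0 by simp [_root_.opP, tr]]
  rw [gf] at h1
  field_simp
  linarith

theorem opP_le (hp : 1 < p) (hε : 0 < ε) {Y : E →L[ℝ] E} (hs : ∀ x y, ⟪Y x, y⟫ = ⟪Y y, x⟫) (h0 : ∀ x, 0 ≤ ⟪Y x, x⟫) (η : E) : opP p ε η Y ≤ p * tr Y := by
  have h1 := quad_le_tr hs h0 η
  have ht : 0 ≤ tr Y := Finset.sum_nonneg fun i _ => h0 _
  have hR : 0 < ε + ‖η‖ ^ 2 := pz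
  have h2 : ⟪Y η, η⟫ / (ε + ‖η‖ ^ 2) ≤ tr Y := by rw [div_le_iff₀ hR]; nlinarith
  have h3 : 0 ≤ ⟪Y η, η⟫ / (ε + ‖η‖ ^ 2) := div_nonneg (h0 _) hR.le
  rw [opP, mul_div_assoc]
  nlinarith

theorem unif_grad (hp : 1 < p) {s D : ℝ} (hs : 0 < s) : ∃ G, 0 ≤ G ∧ ∀ (ε l : ℝ) (Ω : Set E) (w : E → ℝ) (W : E → E), 0 < ε → ε < 1 → 0 ≤ l → Ω ⊆ closedBall 0 D → Nice p ε l Ω w W →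
    ∀ x, ball x s ⊆ Ω → ‖W x‖ ≤ G := by
  obtain ⟨G, hG, h⟩ := grad_bd (E := E) (a := (p - 1) / (2 * p)) (C := (1 + D ^ 2 / (2 * (p - 1))) / p) (s := s) (div_pos lz lz) hs
  refine ⟨G, hG, fun ε l Ω w W hε hε1 hl hD' hN x hx => h W x (hN.hd.mono hx) (fun y hy => hN.mono (hx (mem_ball_self hs)) (hx hy)) fun y hy => ?_⟩
  obtain ⟨h1, h2⟩ := hN.psd (hx hy)
  have h3 := opP_le hp hε h1 h2 (W y)
  rw [hN.opP hε (hx hy), ← zero_sub, tr_sub] at h3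
  have h4 : 0 ≤ l / Rf p ε (W y) := div_nonneg hl (Rf_pos hε _).le
  have h5 : ⟪W y, y⟫ ≤ ‖W y‖ * D := (real_inner_le_norm _ _).trans (mll (by simpa using hD' (hx hy)) nnz)
  have hp1 : 0 < p - 1 := lz
  have h6 : ‖W y‖ * D ≤ (p - 1) / 2 * ‖W y‖ ^ 2 + D ^ 2 / (2 * (p - 1)) := by
    have e : (p - 1) / 2 * ‖W y‖ ^ 2 + D ^ 2 / (2 * (p - 1)) - ‖W y‖ * D = (p - 1) / 2 * (‖W y‖ - D / (p - 1)) ^ 2 := by field_simp; ring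
    have : 0 ≤ (p - 1) / 2 * (‖W y‖ - D / (p - 1)) ^ 2 := pz
    linarith
  have h0 : tr (0 : E →L[ℝ] E) = 0 := by simp [tr]
  rw [h0] at h3
  rw [show (p - 1) / (2 * p) * ‖W y‖ ^ 2 - (1 + D ^ 2 / (2 * (p - 1))) / p = ((p - 1) / 2 * ‖W y‖ ^ 2 - (1 + D ^ 2 / (2 * (p - 1)))) / p by field_simp, div_le_iff₀ lz]
  linarith
end

section

variable {p ε l : ℝ} {Ω : Set E} {u w : E → ℝ} {W : E → E}

theorem inner_cvx {s : ℝ} (hcv : Convex ℝ Ω) : Convex ℝ {x : E | ball x s ⊆ Ω} := by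
  intro x hx y hy a b ha hb hab z hz
  have h : ∀ q : E, ball q s ⊆ Ω → q + (z - (a • x + b • y)) ∈ Ω := fun q hq => hq (by rwa [mem_ball, den, ascl, ← den])
  have := hcv (h x hx) (h y hy) ha hb hab
  convert this using 1
  rw [smul_add, smul_add, add_add_add_comm, ← add_smul, hab, one_smul, add_sub_cancel]

theorem V_norm (hp : 2 ≤ p) (hε : 0 < ε) (η : E) : ‖fd (fun η : E => Rf p ε η • η) η‖ ≤ (p - 1) * Rf p ε η := by
  have hR := Rf_pos (p := p) hε η
  have h0 : 0 < ε + ‖η‖ ^ 2 := pz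
  refine ContinuousLinearMap.opNorm_le_bound _ (mul_nonneg lz hR.le) fun ξ => ?_
  rw [V_deriv hε, norm_smul, nnn hR.le, mul_comm (p - 1), mul_assoc]
  refine mll ((norm_add_le _ _).trans ?_) hR.le
  have h1 : ‖((p - 2) * ⟪η, ξ⟫ / (ε + ‖η‖ ^ 2)) • η‖ ≤ (p - 2) * ‖ξ‖ := by
    rw [norm_smul, norm_div, norm_mul, nnn (sub_nonneg.2 hp), nnn h0.le, div_mul_eq_mul_div, div_le_iff₀ h0, mul_assoc, mul_assoc]
    refine mll ?_ (sub_nonneg.2 hp)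
    have := mlr (norm_inner_le_norm (𝕜 := ℝ) η ξ) (norm_nonneg η)
    nlinarith [norm_nonneg ξ]
  linarith

theorem V_mono (hp : 2 ≤ p) (hε : 0 < ε) (η ζ : E) : (1 / 2) ^ (p - 1) * ‖η - ζ‖ ^ p ≤ ⟪Rf p ε η • η - Rf p ε ζ • ζ, η - ζ⟫ := by
  have hq : 0 ≤ (p - 2) / 2 := lz
  have e1 : ⟪Rf p ε η • η - Rf p ε ζ • ζ, η - ζ⟫ = 1 / 2 * (Rf p ε η + Rf p ε ζ) * ‖η - ζ‖ ^ 2 + 1 / 2 * ((Rf p ε η - Rf p ε ζ) * (‖η‖ ^ 2 - ‖ζ‖ ^ 2)) := by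
    rw [norm_sub_sq_real]
    simp only [inner_sub_left, inner_sub_right, real_inner_smul_left, riq, real_inner_comm η ζ]
    ring
  have h2 : 0 ≤ (Rf p ε η - Rf p ε ζ) * (‖η‖ ^ 2 - ‖ζ‖ ^ 2) := by
    rcases le_total (‖η‖ ^ 2) (‖ζ‖ ^ 2) with h | h
    · exact mul_nonneg_of_nonpos_of_nonpos (sub_nonpos.2 (rpow_le_rpow pz lz hq)) lz
    · exact mul_nonneg (sub_nonneg.2 (rpow_le_rpow pz lz hq)) lz
  have h3 : ∀ ξ : E, ‖ξ‖ ^ (p - 2) ≤ Rf p ε ξ := fun ξ => by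
    have : ‖ξ‖ ^ (p - 2) = (‖ξ‖ ^ 2) ^ ((p - 2) / 2) := by rw [← rpow_natCast, ← rpow_mul nnz]; congr 1; push_cast; ring
    rw [this]; exact rpow_le_rpow pz lz hq
  have h4 : (‖η - ζ‖ / 2) ^ (p - 2) ≤ Rf p ε η + Rf p ε ζ := by
    have h := norm_sub_le η ζ
    have a1 := (Rf_pos (p := p) hε η).le
    have a2 := (Rf_pos (p := p) hε ζ).le
    rcases le_total ‖η‖ ‖ζ‖ with h' | h'
    · have := (rpow_le_rpow pz (by linarith : ‖η - ζ‖ / 2 ≤ ‖ζ‖) (by linarith : 0 ≤ p - 2)).trans (h3 ζ); linarith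
    · have := (rpow_le_rpow pz (by linarith : ‖η - ζ‖ / 2 ≤ ‖η‖) (by linarith : 0 ≤ p - 2)).trans (h3 η); linarith
  have h5 : (1 / 2) ^ (p - 1) * ‖η - ζ‖ ^ p = 1 / 2 * (‖η - ζ‖ / 2) ^ (p - 2) * ‖η - ζ‖ ^ 2 := by
    rcases (norm_nonneg (η - ζ)).eq_or_lt with h | h
    · rw [← h, zero_rpow lz]; simp
    rw [div_eq_mul_one_div ‖η - ζ‖ 2, mul_rpow h.le nz, show p - 1 = p - 2 + 1 by ring, rpow_add_one nz, ← rpow_natCast, show ‖η - ζ‖ ^ p = ‖η - ζ‖ ^ (p - 2) * ‖η - ζ‖ ^ ((2 : ℕ) : ℝ) by rw [← rpow_add h]; congr 1; push_cast; ring]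
    ring
  rw [h5, e1]
  have := mlr h4 (sq_nonneg ‖η - ζ‖)
  linarith

theorem unif_holder (hp : 1 < p) {s D Λ : ℝ} (hs : 0 < s) (hD : 0 ≤ D) : ∃ β ∈ Ioo (0 : ℝ) 1, ∃ C, 0 ≤ C ∧ ∀ (ε l : ℝ) (Ω : Set E) (w : E → ℝ) (W : E → E), 0 < ε → ε < 1 → 0 ≤ l → l ≤ Λ → Ω ⊆ closedBall 0 D → Convex ℝ Ω → Nice p ε l Ω w W →
    ∀ x y, ball x s ⊆ Ω → ball y s ⊆ Ω → ‖W x - W y‖ ≤ C * ‖x - y‖ ^ β := by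
  obtain ⟨G, hG, hGb⟩ := unif_grad (E := E) hp (D := D) hs
  set M := (p - 1) * G ^ 2 + G * D with hM
  set T := min 1 (p - 1) with hT
  have hT0 : 0 < T := lt_min one_pos lz
  have hM0 : 0 ≤ M := add_nonneg (mul_nonneg lz (sq_nonneg _)) (mul_nonneg hG hD)
  have key : ∀ (ε l : ℝ) (Ω : Set E) (w : E → ℝ) (W : E → E), 0 < ε → ε < 1 → 0 ≤ l → l ≤ Λ → Ω ⊆ closedBall 0 D → Nice p ε l Ω w W →
    ∀ x, ball x s ⊆ Ω → ‖W x‖ ≤ G ∧ Rf p ε (W x) * (T * ‖fd W x‖) ≤ Λ + Rf p ε (W x) * M := fun ε l Ω w W hε hε1 hl hlΛ hDb hN x hx => by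
    have hxΩ := hx (mem_ball_self hs)
    obtain ⟨h1, h2⟩ := hN.psd hxΩ
    have hg := hGb ε l Ω w W hε hε1 hl hDb hN x hx
    refine ⟨hg, ?_⟩
    have h3 := opP_nonneg hp hε h1 h2 (W x)
    rw [hN.opP hε hxΩ] at h3
    have h4 := psd_norm h1 h2
    rw [norm_neg] at h4
    have h5 : -⟪W x, x⟫ ≤ G * D := by
      have := neg_le_of_abs_le (ail (W x) x)
      have := mul_le_mul hg (by simpa using hDb hxΩ : ‖x‖ ≤ D) nnz hG
      linarith
    have h6 : ‖W x‖ ^ 2 ≤ G ^ 2 := pow_le_pow_left₀ nnz hg 2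
    have hR := Rf_pos (p := p) hε (W x)
    have h7 := mll h6 (show 0 ≤ p - 1 by linarith)
    have h8 : T * ‖fd W x‖ ≤ l / Rf p ε (W x) + M := by
      have := mll h4 hT0.le
      linarith
    have h9 := mll h8 hR.le
    rw [mul_add, mul_div_cancel₀ _ hR.ne'] at h9
    linarith
  rcases le_or_gt p 2 with hp2 | hp3
  · set Q := (1 + G ^ 2) ^ ((2 - p) / 2) with hQ
    have hQ0 : 0 < Q := pz
    refine ⟨1 / 2, nz, |(Λ * Q + M) / T| * (2 * D) ^ hlf, pz, fun ε l Ω w W hε hε1 hl hlΛ hDb hcv hN x y hx hy => ?_⟩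
    have hb : ∀ z ∈ {z : E | ball z s ⊆ Ω}, ‖fd W z‖ ≤ |(Λ * Q + M) / T| := fun z hz => by
      obtain ⟨h1, h2⟩ := key ε l Ω w W hε hε1 hl hlΛ hDb hN z hz
      have hR := Rf_pos (p := p) hε (W z)
      refine le_trans ?_ (le_abs_self _)
      rw [le_div_iff₀ hT0, mul_comm _ T]
      refine le_of_mul_le_mul_left (h2.trans ?_) hR
      rw [mul_add]
      have h3 : 1 ≤ Rf p ε (W z) * Q := by
        have h4 : Q⁻¹ ≤ Rf p ε (W z) := by
          rw [hQ, ← rpow_neg pz, Rf, show -((2 - p) / 2) = (p - 2) / 2 by ring]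
          exact rpow_le_rpow_of_nonpos pz (add_le_add hε1.le (pow_le_pow_left₀ nnz h1 2)) lz
        rw [inv_le_iff_one_le_mul₀ hQ0] at h4; linarith
      nlinarith [mll h3 (hl.trans hlΛ)]
    have h1 := (inner_cvx (s := s) hcv).norm_image_sub_le_of_norm_fderiv_le (𝕜 := ℝ) (fun z (hz : ball z s ⊆ Ω) => (hN.hd.contDiffAt (hN.hΩ.mem_nhds (hz (mem_ball_self hs)))).differentiableAt sz) hb hy hx
    refine h1.trans ?_
    rw [mul_assoc]
    refine mll ?_ (abs_nonneg _)
    have h2 : ‖x - y‖ ≤ 2 * D := (norm_sub_le _ _).trans (by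
      have a := hDb (hx (mem_ball_self hs)); have b := hDb (hy (mem_ball_self hs)); rw [mcz] at a b; linarith)
    calc ‖x - y‖ = ‖x - y‖ ^ hlf * ‖x - y‖ ^ hlf := by rw [← sqrt_eq_rpow, mul_self_sqrt nnz]
      _ ≤ _ := mlr (rpow_le_rpow nnz h2 nz) pz
  · have hp2 := hp3.le
    set Q := (1 + G ^ 2) ^ ((p - 2) / 2) with hQ
    set L := |(p - 1) * (Λ + Q * M) / T| with hL
    refine ⟨1 / (p - 1), ⟨by apply one_div_pos.2; linarith, by rw [div_lt_one lz]; linarith⟩, (2 ^ (p - 1) * L) ^ (1 / (p - 1)), pz, fun ε l Ω w W hε hε1 hl hlΛ hDb hcv hN x y hx hy => ?_⟩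
    have hVd : ∀ η : E, DifferentiableAt ℝ (fun η : E => Rf p ε η • η) η := fun η => ((Rf_contDiff hε 1).smul contDiff_id).differentiable sz η
    have hWd : ∀ z ∈ {z : E | ball z s ⊆ Ω}, DifferentiableAt ℝ W z := fun z hz => (hN.hd.contDiffAt (hN.hΩ.mem_nhds (hz (mem_ball_self hs)))).differentiableAt sz
    have hb : ∀ z ∈ {z : E | ball z s ⊆ Ω}, ‖fd (fun x => Rf p ε (W x) • W x) z‖ ≤ L := fun z hz => by
      obtain ⟨h1, h2⟩ := key ε l Ω w W hε hε1 hl hlΛ hDb hN z hz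
      have hR := Rf_pos (p := p) hε (W z)
      have e1 : fd (fun x => Rf p ε (W x) • W x) z = (fd (fun η : E => Rf p ε η • η) (W z)).comp (fd W z) :=
        fderiv_comp z (g := fun η : E => Rf p ε η • η) (hVd _) (hWd z hz)
      rw [e1]
      refine (ContinuousLinearMap.opNorm_comp_le _ _).trans ((mlr (V_norm hp2 hε _) nnz).trans (le_trans ?_ (le_abs_self _)))
      rw [le_div_iff₀ hT0]
      have h3 : Rf p ε (W z) ≤ Q := rpow_le_rpow pz (add_le_add hε1.le (pow_le_pow_left₀ nnz h1 2)) lz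
      have h4 := mlr h3 hM0
      have h5 := mll (h2.trans (add_le_add_right h4 Λ)) (show 0 ≤ p - 1 by linarith)
      linarith
    have h1 := (inner_cvx (s := s) hcv).norm_image_sub_le_of_norm_fderiv_le (𝕜 := ℝ) (f := fun x => Rf p ε (W x) • W x) (fun z hz => (hVd (W z)).comp z (hWd z hz)) hb hy hx
    have h2 := (V_mono hp2 hε (W x) (W y)).trans ((real_inner_le_norm _ _).trans (mlr h1 nnz))
    set d := ‖W x - W y‖ with hd
    rcases (norm_nonneg (W x - W y)).eq_or_lt with h | h
    · rw [← hd] at h; rw [← h]; positivity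
    rw [← hd] at h
    have h3 : d ^ (p - 1) ≤ 2 ^ (p - 1) * L * ‖x - y‖ := by
      rw [show d ^ p = d ^ (p - 1) * d by rw [← rpow_add_one h.ne']; congr 1; ring, ← mul_assoc] at h2
      have h4 := le_of_mul_le_mul_right h2 h
      rw [one_div, inv_rpow nz, inv_mul_le_iff₀ pz] at h4
      linarith
    calc d = (d ^ (p - 1)) ^ (1 / (p - 1)) := by rw [← rpow_mul h.le, mul_one_div_cancel lz, rpow_one]
      _ ≤ (2 ^ (p - 1) * L * ‖x - y‖) ^ (1 / (p - 1)) := rpow_le_rpow pz h3 (by apply one_div_nonneg.2; linarith)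
      _ = _ := mul_rpow pz nnz
end

section

theorem unif_u {p : ℝ} (hp : 1 < p) {s D Λ κ : ℝ} (hs : 0 < s) (hD : 0 ≤ D) (hκ : 0 ≤ κ) : ∃ β ∈ Ioo (0 : ℝ) 1, ∃ C, 0 < C ∧ ∀ (ε l : ℝ) (Ω : Set E) (u : E → ℝ), 0 < ε → ε < 1 → 0 ≤ l → l ≤ Λ → Ω ⊆ closedBall 0 D → Convex ℝ Ω → Nice p ε l Ω (fun x => log (u x)) (Wl u) →
    (∀ x ∈ Ω, 0 < u x) → (∀ x ∈ Ω, DifferentiableAt ℝ u x) → IntegrableOn (fun x => gw x * |u x| ^ p) Ω → ∫ x in Ω, gw x * |u x| ^ p ≤ κ →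
    ∀ x y, ball x s ⊆ Ω → ball y s ⊆ Ω → |u x| + ‖gradient u y‖ ≤ C ∧ ‖gradient u x - gradient u y‖ ≤ C * ‖x - y‖ ^ β := by
  obtain ⟨G, hG, hGb⟩ := unif_grad (E := E) hp (D := D) (half_pos hs)
  obtain ⟨β, hβ, C1, hC1, hH⟩ := unif_holder (E := E) hp (Λ := Λ) hs hD
  set N := volume.real (ball (0 : E) (s / 2)) with hN
  have hN0 : 0 < N := ENNReal.toReal_pos (measure_ball_pos _ _ pz).ne' measure_ball_lt_top.ne
  set A := κ * exp (D ^ 2 / 2 + p * (G * s)) / N with hA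
  have hA0 : 0 ≤ A := pz
  set U := 1 + A with hU
  set Q := (2 * D) ^ (1 - β) with hQ
  have hQ0 : 0 ≤ Q := pz
  refine ⟨β, hβ, U + U * G + U * C1 + U * G * Q * G, pz, fun ε l Ω u hε hε1 hl hlΛ hDb hcv hNi hpos hd hi hκ => ?_⟩
  have hW : ∀ x, ball x s ⊆ Ω → ∀ y ∈ ball x (s / 2), ‖Wl u y‖ ≤ G := fun x hx y hy => hGb ε l Ω _ _ hε hε1 hl hDb hNi y fun z hz => hx (by
    rw [mem_ball] at *; linarith [dist_triangle z y x])
  have hself : ∀ x, ball x s ⊆ Ω → x ∈ Ω := fun x hx => hx (mem_ball_self hs)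
  have hub : ∀ x, ball x s ⊆ Ω → u x ≤ U := fun x hx => by
    have h1 : ∀ y ∈ ball x (s / 2), u x ^ p * exp (-(D ^ 2 / 2 + p * (G * s))) ≤ gw y * |u y| ^ p := fun y hy => by
      have hyΩ : y ∈ Ω := hx (bsb lz hy)
      have h2 := hNi.hc x (hself x hx) y hyΩ
      have h3 : ⟪Wl u y, x - y⟫ ≤ G * s := (real_inner_le_norm _ _).trans (mul_le_mul (hW x hx y hy) (by
        rw [mem_ball, dist_comm, den] at hy; linarith) nnz hG)
      have h4 : p * log (u x) ≤ p * (log (u y) + G * s) := mll lz lz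
      have h5 : ‖y‖ ^ 2 ≤ D ^ 2 := pow_le_pow_left₀ nnz (by simpa using hDb hyΩ) 2
      rw [abs_of_pos (hpos y hyΩ), rpow_def_of_pos (hpos y hyΩ), rpow_def_of_pos (hpos x (hself x hx)), gw, ← exp_add, ← exp_add, exp_le_exp]
      linarith
    have hbΩ : ball x (s / 2) ⊆ Ω := (bsb lz).trans hx
    have h6 : u x ^ p * exp (-(D ^ 2 / 2 + p * (G * s))) * N ≤ κ := by
      calc _ = ∫ y in ball x (s / 2), u x ^ p * exp (-(D ^ 2 / 2 + p * (G * s))) := by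
              rw [setIntegral_const, smul_eq_mul, mul_comm, hN, Measure.real, Measure.real, Measure.addHaar_ball_center _ x]
        _ ≤ ∫ y in ball x (s / 2), gw y * |u y| ^ p := smo (integrableOn_const measure_ball_lt_top.ne) (hi.mono_set hbΩ) mb_ h1
        _ ≤ ∫ y in Ω, gw y * |u y| ^ p := setIntegral_mono_set hi (eof fun y => mul_nonneg (gw_pos y).le pz) (HasSubset.Subset.eventuallyLE hbΩ)
        _ ≤ κ := hκ
    have h7 : u x ^ p ≤ A := by
      rw [hA, le_div_iff₀ hN0]
      rw [exp_neg] at h6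
      have := mlr h6 (exp_pos (D ^ 2 / 2 + p * (G * s))).le
      have e := (exp_pos (D ^ 2 / 2 + p * (G * s))).ne'
      rw [show u x ^ p * (exp (D ^ 2 / 2 + p * (G * s)))⁻¹ * N * exp (D ^ 2 / 2 + p * (G * s)) = u x ^ p * N by field_simp] at this
      exact this
    rcases le_total (u x) 1 with h | h
    · linarith
    · have := self_le_rpow_of_one_le h hp.le; linarith
  have hgr : ∀ x ∈ Ω, gradient u x = u x • Wl u x := fun x hx => by rw [Wl, smul_inv_smul₀ (hpos x hx).ne']
  have hWx : ∀ x, ball x s ⊆ Ω → ‖Wl u x‖ ≤ G := fun x hx => hW x hx x (mem_ball_self lz)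
  have hgb : ∀ x, ball x s ⊆ Ω → ‖gradient u x‖ ≤ U * G := fun x hx => by
    have := hpos x (hself x hx)
    rw [hgr x (hself x hx), norm_smul, nnn this.le]
    exact mul_le_mul (hub x hx) (hWx x hx) nnz pz
  intro x y hx hy
  have hx0 := hpos x (hself x hx)
  refine ⟨?_, ?_⟩
  · have h1 := hub x hx
    have h2 := hgb y hy
    rw [abs_of_pos hx0]
    have : 0 ≤ U * C1 := pz
    have : 0 ≤ U * G * Q * G := pz
    linarith
  · have h1 : ‖u x - u y‖ ≤ U * G * ‖x - y‖ := (inner_cvx (s := s) hcv).norm_image_sub_le_of_norm_fderiv_le (𝕜 := ℝ) (fun z (hz : ball z s ⊆ Ω) => hd z (hself z hz)) (fun z (hz : ball z s ⊆ Ω) => by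
      have := hgb z hz; rwa [gradient, LinearIsometryEquiv.norm_map] at this) hy hx
    have h2 := hH ε l Ω _ _ hε hε1 hl hlΛ hDb hcv hNi x y hx hy
    have h3 : ‖x - y‖ ≤ Q * ‖x - y‖ ^ β := by
      have h4 : ‖x - y‖ ≤ 2 * D := (norm_sub_le _ _).trans (by
        have a := hDb (hself x hx); have b := hDb (hself y hy); rw [mcz] at a b; linarith)
      rcases (norm_nonneg (x - y)).eq_or_lt with h | h
      · rw [← h]; positivity
      calc ‖x - y‖ = ‖x - y‖ ^ (1 - β) * ‖x - y‖ ^ β := by rw [← rpow_add h, sub_add_cancel, rpow_one]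
        _ ≤ _ := mlr (rpow_le_rpow nnz h4 (by linarith [hβ.2])) pz
    rw [hgr x (hself x hx), hgr y (hself y hy), show u x • Wl u x - u y • Wl u y = u x • (Wl u x - Wl u y) + (u x - u y) • Wl u y by rw [smul_sub, sub_smul]; abel]
    refine (norm_add_le _ _).trans ?_
    rw [norm_smul, norm_smul, nnn hx0.le]
    have h5 : u x * ‖Wl u x - Wl u y‖ ≤ U * (C1 * ‖x - y‖ ^ β) := mul_le_mul (hub x hx) h2 nnz pz
    have h6 : ‖u x - u y‖ * ‖Wl u y‖ ≤ U * G * (Q * ‖x - y‖ ^ β) * G := mul_le_mul (h1.trans (mll h3 pz)) (hWx y hy) nnz pz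
    have h7 : 0 ≤ U * ‖x - y‖ ^ β := pz
    have h8 : 0 ≤ U * G * ‖x - y‖ ^ β := pz
    linarith
end

section

theorem ball_sub_of_infDist {Ω : Set E} (hΩ : IsOpen Ω) {δ : ℝ} (hδ : 0 < δ) {x : E} (hx : x ∈ closure {x ∈ Ω | 2 * δ < infDist x (frontier Ω)}) : ball x δ ⊆ Ω := by
  have h1 : 2 * δ ≤ infDist x (frontier Ω) := closure_minimal (fun y hy => (hy.2.le : 2 * δ ≤ infDist y (frontier Ω))) (isClosed_le continuous_const (continuous_infDist_pt _)) hx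
  have h2 : x ∈ closure Ω := closure_mono (fun y hy => hy.1) hx
  have h3 : ∀ z ∈ ball x δ, z ∉ frontier Ω := fun z hz hf => by
    have := infDist_le_dist_of_mem (x := x) hf
    rw [mem_ball'] at hz; linarith
  have hxΩ : x ∈ Ω := by
    by_contra h
    exact h3 x (mem_ball_self hδ) (by rw [hΩ.frontier_eq]; exact ⟨h2, h⟩)
  have hc : IsPreconnected (ball x δ) := (convex_ball x δ).isPreconnected
  refine hc.subset_left_of_subset_union hΩ isClosed_closure.isOpen_compl (disjoint_compl_right.mono_left subset_closure) (fun z hz => ?_) ⟨x, mem_ball_self hδ, hxΩ⟩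
  by_contra h
  simp only [mem_union, mem_compl_iff, not_or, not_not] at h
  exact h3 z hz (by rw [hΩ.frontier_eq]; exact ⟨h.2, h.1⟩)

theorem smooth_of_W {Ω : Set E} (hΩ : IsOpen Ω) {u : E → ℝ} {W : E → E} (hpos : ∀ x ∈ Ω, 0 < u x) (hg : ∀ x ∈ Ω, HasGradientAt (fun x => log (u x)) (W x) x) (hW : ∀ m : ℕ, ContDiffOn ℝ m W Ω) : ContDiffOn ℝ (⊤ : ℕ∞) u Ω := by
  have hl : ∀ m : ℕ, ContDiffOn ℝ m (fun x => log (u x)) Ω := fun m => by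
    have : ContDiffOn ℝ ((m : ℕ∞) + 1 : WithTop ℕ∞) (fun x => log (u x)) Ω := by
      rw [cdsucc hΩ]
      refine ⟨fun x hx => (hg x hx).hasFDerivAt.differentiableAt.differentiableWithinAt, fun h => absurd h sz, ?_⟩
      refine ContDiffOn.congr (f := fun x => tD E (W x)) ?_ fun x hx => (hg x hx).hasFDerivAt.fderiv
      exact (tD E).toContinuousLinearEquiv.toContinuousLinearMap.contDiff.comp_contDiffOn (hW m)
    exact this.of_le le_self_add
  refine ContDiffOn.congr (f := fun x => exp (log (u x))) (contDiffOn_infty.2 hl).exp fun x hx => (exp_log (hpos x hx)).symm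

theorem jf_smul {p ε t : ℝ} (hε : 0 ≤ ε) (ht : 0 ≤ t) (v : E → ℝ) (x : E) : jf p ε (fun y => t * v y) x = t ^ p * jf p ε v x := by
  have h : ‖fd (fun y => t * v y) x‖ = t * ‖fd v x‖ := by
    rw [show (fun y => t * v y) = t • v from rfl, fderiv_const_smul_field]
    simp [norm_smul, abs_of_nonneg ht]
  simp only [jf]
  rw [h, show ε * (t * v x) ^ 2 + (t * ‖fd v x‖) ^ 2 = t ^ 2 * (ε * v x ^ 2 + ‖fd v x‖ ^ 2) by ring, mul_rpow pz pz, ← rpow_natCast, ← rpow_mul ht]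
  congr 2; push_cast; ring

theorem jf_mono {p ε : ℝ} (hp : 1 < p) (hε : 0 ≤ ε) (h1 : ε ≤ 1) (v : E → ℝ) (x : E) : jf p ε v x ≤ jf p 1 v x :=
  rpow_le_rpow pz (by gcongr) lz

theorem test_int {p ε : ℝ} (hp : 1 < p) {Ω : Set E} (hb : IsBounded Ω) {v : E → ℝ} (hv : ContDiff ℝ (⊤ : ℕ∞) v) : IntegrableOn (fun x => gw x * jf p ε v x) Ω :=
  ((continuousOn_univ.1 (jf_contOn hp isOpen_univ (hv.of_le sz).contDiffOn)).continuousOn.integrableOn_compact hb.isCompact_closure).mono_set subset_closure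

theorem gauss_int {n : ℕ} {Ω : Set (EuclideanSpace ℝ (Fin n))} (hΩ : IsOpen Ω) (f : EuclideanSpace ℝ (Fin n) → ℝ) : ∫ x in Ω, f x ∂(gaussianMeasure n) = (2 * π) ^ (-(n : ℝ) / 2) * ∫ x in Ω, gw x * f x := by
  unfold gaussianMeasure
  rw [setIntegral_withDensity_eq_setIntegral_toReal_smul fz sz f hΩ.measurableSet, ← icm]
  refine integral_congr_ae (eof fun x => ?_)
  simp only [smul_eq_mul]
  rw [ENNReal.toReal_ofReal pz, mul_assoc]; rfl

theorem Jeps_eq {n : ℕ} {p ε : ℝ} {Ω : Set (EuclideanSpace ℝ (Fin n))} (hΩ : IsOpen Ω) (v : EuclideanSpace ℝ (Fin n) → ℝ) : Jeps n p ε Ω v = (2 * π) ^ (-(n : ℝ) / 2) * ∫ x in Ω, gw x * jf p ε v x := by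
  unfold Jeps
  rw [gauss_int hΩ]
  simp only [jf, gradient, LinearIsometryEquiv.norm_map]

end

end

theorem lam_facts {n : ℕ} {p : ℝ} (hp : 1 < p) {Ω : Set (EuclideanSpace ℝ (Fin n))} (hΩ : IsOpen Ω) (hb : IsBounded Ω) (hne : Ω.Nonempty) : ∃ Λ, ∀ ε, 0 < ε → ε < 1 → 0 < lambdaEps n p ε Ω ∧ lambdaEps n p ε Ω ≤ Λ ∧
    ∀ v, ContDiff ℝ (⊤ : ℕ∞) v → HasCompactSupport v → tsupport v ⊆ Ω → Ray p ε (lambdaEps n p ε Ω) Ω v := by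
  set c0 : ℝ := (2 * π) ^ (-(n : ℝ) / 2) with hc0
  have hc : 0 < c0 := pz
  have hbd : ∀ ε, 0 < ε → BddBelow { r : ℝ | ∃ v : EuclideanSpace ℝ (Fin n) → ℝ, IsTestFun n Ω v ∧ (∫ x in Ω, |v x| ^ p ∂(gaussianMeasure n)) = 1 ∧ r = Jeps n p ε Ω v } := fun ε hε => by
    refine ⟨0, ?_⟩
    rintro r ⟨v, -, -, rfl⟩
    rw [Jeps_eq hΩ]
    exact mul_nonneg hc.le (integral_nonneg fun x => mul_nonneg (gw_pos x).le (jf_nonneg hε v x))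
  have hsc : ∀ v, ContDiff ℝ (⊤ : ℕ∞) v → HasCompactSupport v → tsupport v ⊆ Ω → 0 < ∫ x in Ω, gw x * |v x| ^ p → ∃ t, 0 < t ∧ t ^ p * (c0 * ∫ x in Ω, gw x * |v x| ^ p) = 1 ∧ IsTestFun n Ω (fun x => t * v x) ∧ (∫ x in Ω, |t * v x| ^ p ∂(gaussianMeasure n)) = 1 := by
    intro v h1 h2 h3 h4
    set I := ∫ x in Ω, gw x * |v x| ^ p
    have hcI : 0 < c0 * I := mul_pos hc h4
    have ht : 0 < (c0 * I) ^ (-1 / p) := pz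
    have htp : ((c0 * I) ^ (-1 / p)) ^ p * (c0 * I) = 1 := by
      rw [← rpow_mul hcI.le, div_mul_cancel₀ _ lz, rpow_neg_one, inv_mul_cancel₀ hcI.ne']
    generalize (c0 * I) ^ (-1 / p) = t at ht htp
    refine ⟨t, ht, htp, ⟨contDiff_const.mul h1, h2.mul_left, (tsupport_mul_subset_right).trans h3⟩, ?_⟩
    rw [gauss_int hΩ, ← htp]
    have : ∀ x, gw x * |t * v x| ^ p = t ^ p * (gw x * |v x| ^ p) := fun x => by
      rw [abs_mul, abs_of_pos ht, mul_rpow ht.le (abs_nonneg _)]; ring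
    simp only [this]
    rw [icm, ← hc0]
    ring
  obtain ⟨z, hz⟩ := hne
  obtain ⟨v0, hv0, hv1⟩ : ∃ v : EuclideanSpace ℝ (Fin n) → ℝ, IsTestFun n Ω v ∧ (∫ x in Ω, |v x| ^ p ∂(gaussianMeasure n)) = 1 := by
    obtain ⟨f, hf1, hf2, hf3, -, hf4⟩ := exists_contDiff_tsupport_subset (n := ⊤) (hΩ.mem_nhds hz)
    have hpc : ContinuousOn (fun x => gw x * |f x| ^ p) (closure Ω) := pw_contOn hp hf3.continuous.continuousOn
    have hpi : IntegrableOn (fun x => gw x * |f x| ^ p) Ω := (hpc.integrableOn_compact hb.isCompact_closure).mono_set subset_closure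
    have : 0 < ∫ x in Ω, gw x * |f x| ^ p := by
      rw [setIntegral_pos_iff_support_of_nonneg_ae (eof fun x => mul_nonneg (gw_pos x).le pz) hpi]
      have ho : IsOpen (Function.support (fun x => gw x * |f x| ^ p) ∩ Ω) := by
        have hcf : Continuous (fun x => gw x * |f x| ^ p) := continuousOn_univ.1 (pw_contOn hp hf3.continuous.continuousOn)
        exact hcf.isOpen_support.inter hΩ
      exact ho.measure_pos _ ⟨z, by simp [Function.mem_support, hf4, (gw_pos z).ne'], hz⟩
    obtain ⟨t, -, -, h1, h2⟩ := hsc f hf3 hf2 hf1 this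
    exact ⟨_, h1, h2⟩
  refine ⟨Jeps n p 1 Ω v0, fun ε hε hε1 => ⟨?_, ?_, ?_⟩⟩
  · refine lt_of_lt_of_le (rpow_pos_of_pos hε (p / 2)) (le_csInf ⟨_, v0, hv0, hv1, rfl⟩ ?_)
    rintro r ⟨v, hv, h1, rfl⟩
    rw [gauss_int hΩ] at h1
    rw [Jeps_eq hΩ]
    have hi := test_int (ε := ε) hp hb hv.1
    have hm : ∫ x in Ω, gw x * |v x| ^ p ≤ (ε ^ (p / 2))⁻¹ * ∫ x in Ω, gw x * jf p ε v x := by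
      rw [← icm]
      exact setIntegral_mono (pw_int hp hε hΩ hv.1.continuous.continuousOn hi) (hi.const_mul _) fun x => pow_le_jf hp hε v x
    have he := rpow_pos_of_pos hε (p / 2)
    have := mll hm (mul_nonneg he.le hc.le)
    calc ε ^ (p / 2) = ε ^ (p / 2) * c0 * ∫ x in Ω, gw x * |v x| ^ p := by rw [mul_assoc, h1, mul_one]
      _ ≤ _ := this
      _ = _ := by rw [← hc0, mul_comm (ε ^ (p / 2)), mul_assoc, mul_inv_cancel_left₀ he.ne']
  · refine (csInf_le (hbd ε hε) ⟨v0, hv0, hv1, rfl⟩).trans ?_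
    rw [Jeps_eq hΩ, Jeps_eq hΩ]
    exact mll (setIntegral_mono (test_int hp hb hv0.1) (test_int hp hb hv0.1) fun x => mll (jf_mono hp hε.le hε1.le v0 x) (gw_pos x).le) hc.le
  · intro v h1 h2 h3
    unfold Ray
    have hJ : 0 ≤ ∫ x in Ω, gw x * jf p ε v x := integral_nonneg fun x => mul_nonneg (gw_pos x).le (jf_nonneg hε v x)
    rcases (show 0 ≤ ∫ x in Ω, gw x * |v x| ^ p from integral_nonneg fun x => mul_nonneg (gw_pos x).le pz).eq_or_lt with h | h
    · rw [← h, mul_zero]; exact hJ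
    · obtain ⟨t, ht, ht1, ht2, ht3⟩ := hsc v h1 h2 h3 h
      have := csInf_le (hbd ε hε) ⟨_, ht2, ht3, rfl⟩
      rw [Jeps_eq hΩ] at this
      have e : ∀ x, gw x * jf p ε (fun y => t * v y) x = t ^ p * (gw x * jf p ε v x) := fun x => by rw [jf_smul hε.le ht.le]; ring
      simp only [e] at this
      rw [icm] at this
      have htp : 0 < t ^ p * c0 := pz
      change lambdaEps n p ε Ω ≤ _ at this
      refine le_of_mul_le_mul_left ?_ htp
      calc t ^ p * c0 * (lambdaEps n p ε Ω * ∫ x in Ω, gw x * |v x| ^ p) = lambdaEps n p ε Ω * (t ^ p * (c0 * ∫ x in Ω, gw x * |v x| ^ p)) := by ring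
        _ ≤ _ := by rw [ht1, mul_one]; refine this.trans (le_of_eq ?_); ring

theorem regularized_minimizers_interior_C1beta
    (n : ℕ) (hn : 2 ≤ n) (p : ℝ) (hp : 1 < p)
    (Ω : Set (EuclideanSpace ℝ (Fin n)))
    (hΩo : IsOpen Ω) (hΩb : IsBounded Ω) (hΩconv : Convex ℝ Ω) (hΩ2 : HasC2Boundary n Ω)
    (hsc : ∃ R : ℝ, 0 < R ∧ ∀ x ∈ frontier Ω, ∃ y : EuclideanSpace ℝ (Fin n),
      dist x y = R ∧ closure Ω ⊆ Metric.closedBall y R) :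
    ∀ δ : ℝ, 0 < δ → ∃ (ε₀ C β : ℝ), 0 < ε₀ ∧ 0 < C ∧ β ∈ Set.Ioo (0 : ℝ) 1 ∧
      ∀ ε : ℝ, 0 < ε → ε < ε₀ →
        ∀ uε : EuclideanSpace ℝ (Fin n) → ℝ, IsNormalizedMinimizer n p ε Ω uε →
          ContDiffOn ℝ (⊤ : ℕ∞) uε {x ∈ Ω | δ < Metric.infDist x (frontier Ω)} ∧
          (∀ x ∈ closure {x ∈ Ω | 2 * δ < Metric.infDist x (frontier Ω)},
           ∀ y ∈ closure {x ∈ Ω | 2 * δ < Metric.infDist x (frontier Ω)},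
            |uε x| + ‖gradient uε y‖ ≤ C ∧
            ‖gradient uε x - gradient uε y‖ ≤ C * ‖x - y‖ ^ β) := by
  intro δ hδ
  rcases Ω.eq_empty_or_nonempty with rfl | hΩne
  · refine ⟨1, 1, 1 / 2, one_pos, one_pos, ⟨by norm_num, nz⟩, fun ε _ _ u hu => ?_⟩
    have := hu.2.2.2.2.1
    simp at this
  obtain ⟨Λ, hΛ⟩ := lam_facts hp hΩo hΩb hΩne
  obtain ⟨D, hD⟩ := hΩb.subset_closedBall 0
  have hD' : Ω ⊆ closedBall 0 (max D 0) := hD.trans (cbcb (le_max_left _ _))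
  set c0 : ℝ := (2 * π) ^ (-(n : ℝ) / 2) with hc0
  have hc : 0 < c0 := pz
  obtain ⟨β, hβ, C, hC, H⟩ := unif_u (E := EuclideanSpace ℝ (Fin n)) hp (Λ := Λ) (κ := 1 / c0) hδ (le_max_right D 0) pz
  refine ⟨1, C, β, one_pos, hC, hβ, fun ε hε hε1 u hu => ?_⟩
  obtain ⟨hl, hlΛ, HL⟩ := hΛ ε hε hε1
  obtain ⟨h1, h2, h3, h4, h5, h6⟩ := hu
  have h0 : ∀ x ∈ Ω, 0 ≤ u x := fun x hx => h3 x (subset_closure hx)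
  have hI : c0 * ∫ x in Ω, gw x * |u x| ^ p = 1 := by
    rw [gauss_int hΩo] at h5
    rw [← h5, scf hΩo.measurableSet fun x hx => ?_]
    simp only [abs_of_nonneg (h0 x hx)]
  rw [Jeps_eq hΩo] at h6
  have hi : IntegrableOn (fun x => gw x * jf p ε u x) Ω := by
    by_contra h
    rw [integral_undef h, mul_zero] at h6
    exact hl.ne h6
  have hne : ∃ x ∈ Ω, 0 < u x := by
    by_contra h
    push Not at h
    rw [scf (g := fun _ => (0 : ℝ)) hΩo.measurableSet fun x hx => ?_] at hI
    · simp at hI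
    · simp only [le_antisymm (h x hx) (h0 x hx), abs_zero]
      rw [zero_rpow lz, mul_zero]
  have heq : ∫ x in Ω, gw x * jf p ε u x = lambdaEps n p ε Ω * ∫ x in Ω, gw x * |u x| ^ p := by
    refine mul_left_cancel₀ hc.ne' ?_
    rw [h6, mul_left_comm, hI, mul_one]
  obtain ⟨hpos, hg, hW, hsym, hpde⟩ := main1 hp hε hl.le hΩo hΩb hΩconv HL h1 h2 h0 h4 hne hi heq
  have hcc := concave hp hε hl.le hΩo hΩb hΩconv HL h1 h2 h0 h4 hne hi heq
  refine ⟨(smooth_of_W hΩo hpos hg hW).mono fun x hx => hx.1, fun x hx y hy => ?_⟩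
  exact H ε _ Ω u hε hε1 hl.le hlΛ hD' hΩconv ⟨hΩo, hg, by exact_mod_cast hW 1, hcc, hpde⟩ hpos
    (fun x hx => (h2.contDiffAt (hΩo.mem_nhds hx)).differentiableAt sz)
    (pw_int hp hε hΩo h2.continuousOn hi) (by rw [le_div_iff₀ hc, mul_comm, hI]) x y
    (ball_sub_of_infDist hΩo hδ hx) (ball_sub_of_infDist hΩo hδ hy)
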